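/- Let X and Y be finite T0-spaces, R₁ ⊆ X × Y a relation, and U = {U_i}_{i∈I} an open cover of X. Let N₀(U) be the subspace of the non-Hausdorff nerve N(U) consisting of those nonempty finite J ⊆ I for which ⋂_{i∈J} U_i is homotopically trivial. Assume: (1) for every x ∈ X the subspace I_x = {J ∈ N₀(U) : x ∈ ⋂_{i∈J} U_i} of N₀(U) is homotopically trivial; (2) for every y ∈ Y the open hull of R₁⁻¹(U_y) in X is homotopically trivial; (3) for every x ∈ X the closure of R₁(F_x) in Y is homotopically trivial. Then X, Y, and N₀(U) are pairwise simple homotopy equivalent. -/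

import Mathlib

/-! ## Finite T₀-spaces as finite posets with the Alexandrov (down-set) topology -/

universe u v w

/-- The Alexandrov topology on a preorder: the open sets are the down-sets. -/
def alexTop (P : Type u) [Preorder P] : TopologicalSpace P where
  IsOpen s := IsLowerSet s
  isOpen_univ := isLowerSet_univ
  isOpen_inter _ _ hs ht := hs.inter ht
  isOpen_sUnion _ hS := isLowerSet_sUnion hS

/-- A subset of a poset is contractible if, endowed with the Alexandrov topology of its
induced order, it is a contractible space. -/
def ContractibleSet {P : Type u} [Preorder P] (A : Set P) : Prop :=
  @ContractibleSpace A (alexTop A)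

/-- A topological space is homotopically trivial if it is weak homotopy equivalent to a
point: nonempty, path-connected, and all homotopy groups `π_n`, `n ≥ 1`, are trivial at
every basepoint. -/
def HTrivial (T : Type u) [TopologicalSpace T] : Prop :=
  Nonempty T ∧ PathConnectedSpace T ∧
    ∀ (n : ℕ) (x : T), Subsingleton (HomotopyGroup (Fin (n + 1)) T x)

/-- A subset of a poset is homotopically trivial if, with the Alexandrov topology of its
induced order, it is homotopically trivial as a space. -/
def HTrivialSet {P : Type u} [Preorder P] (A : Set P) : Prop :=
  @HTrivial A (alexTop A)

/-- `Û_x` relative to the subspace `A`: the points of `A` strictly below `x`. -/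
def hatDown {P : Type u} [Preorder P] (A : Set P) (x : P) : Set P := {y ∈ A | y < x}

/-- `F̂_x` relative to the subspace `A`: the points of `A` strictly above `x`. -/
def hatUp {P : Type u} [Preorder P] (A : Set P) (x : P) : Set P := {y ∈ A | x < y}

/-- One elementary collapse of finite spaces: remove from the subspace `A` a weak point,
i.e. a point `x ∈ A` such that `Û_x` or `F̂_x` (computed in `A`) is contractible. -/
def CollapseStep {P : Type u} [Preorder P] (A B : Set P) : Prop :=
  ∃ x ∈ A, (ContractibleSet (hatDown A x) ∨ ContractibleSet (hatUp A x)) ∧ B = A \ {x}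

/-- The subspace `A` collapses to the subspace `B` (`A ↘ B`): `B` is obtained from `A` by
successively removing weak points. -/
def CollapsesToSet {P : Type u} [Preorder P] (A B : Set P) : Prop :=
  Relation.ReflTransGen CollapseStep A B

/-- A subspace of a finite space is collapsible if it collapses to a single point. -/
def CollapsibleSet {P : Type u} [Preorder P] (A : Set P) : Prop :=
  ∃ x : P, CollapsesToSet A ({x} : Set P)

/-- A bundled finite poset, i.e. a finite T₀-space. -/
structure FinPoset : Type (u + 1) where
  carrier : Type u
  [po : PartialOrder carrier]
  [fin : Finite carrier]

attribute [instance] FinPoset.po FinPoset.fin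

/-- The finite space `P` collapses to (a subspace order-isomorphic to) the finite
space `Q`. -/
def FinPoset.CollapsesTo (P Q : FinPoset.{u}) : Prop :=
  ∃ A : Set P.carrier, CollapsesToSet (Set.univ : Set P.carrier) A ∧
    Nonempty (Q.carrier ≃o A)

/-- Two finite T₀-spaces have the same simple homotopy type (`X ⧸↘ Y`) if they are related
by the equivalence relation generated by collapses. -/
def SHE (P Q : FinPoset.{u}) : Prop := Relation.EqvGen FinPoset.CollapsesTo P Q

/-! ## Relations, hulls, relation cylinders -/

/-- The open hull of a subset: `{x : x ≤ a for some a ∈ A}`. -/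
def openHull {P : Type u} [Preorder P] (A : Set P) : Set P := {x | ∃ a ∈ A, x ≤ a}

/-- The closure of a subset of a finite space: `{x : x ≥ a for some a ∈ A}`. -/
def cloHull {P : Type u} [Preorder P] (A : Set P) : Set P := {x | ∃ a ∈ A, a ≤ x}

/-- `R⁻¹(B) = {x : x R y for some y ∈ B}`. -/
def relPre {X : Type u} {Y : Type v} (R : Set (X × Y)) (B : Set Y) : Set X :=
  {x | ∃ y ∈ B, (x, y) ∈ R}

/-- `R(A) = {y : x R y for some x ∈ A}`. -/
def relIm {X : Type u} {Y : Type v} (R : Set (X × Y)) (A : Set X) : Set Y :=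
  {y | ∃ x ∈ A, (x, y) ∈ R}

/-- The composite `R₂ ∘ R₁ = {(x,z) : ∃ y, x R₁ y and y R₂ z}`. -/
def relComp {X : Type u} {Y : Type v} {Z : Type w} (R₁ : Set (X × Y)) (R₂ : Set (Y × Z)) :
    Set (X × Z) :=
  {p | ∃ y : Y, (p.1, y) ∈ R₁ ∧ (y, p.2) ∈ R₂}

/-- The relation cylinder `B(R)` of a relation `R ⊆ X × Z`: the underlying set is the
disjoint union `X ⊔ Z`. -/
def RelCyl (X : Type u) (Z : Type u) [PartialOrder X] [PartialOrder Z]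
    (R : Set (X × Z)) : Type u := X ⊕ Z

/-- The order of the relation cylinder: keep the given orders on `X` and `Z`, and set
`x ≤ z` for `x ∈ X`, `z ∈ Z` iff there are `x' ∈ X`, `z' ∈ Z` with `x ≤ x'`, `z' ≤ z` and
`x' R z'`. -/
def RelCyl.le {X Z : Type u} [PartialOrder X] [PartialOrder Z] (R : Set (X × Z)) :
    X ⊕ Z → X ⊕ Z → Prop
  | .inl x, .inl x' => x ≤ x'
  | .inr z, .inr z' => z ≤ z'
  | .inl x, .inr z => ∃ (x' : X) (z' : Z), x ≤ x' ∧ z' ≤ z ∧ (x', z') ∈ R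
  | .inr _, .inl _ => False

instance RelCyl.instPartialOrder {X Z : Type u} [PartialOrder X] [PartialOrder Z]
    (R : Set (X × Z)) : PartialOrder (RelCyl X Z R) where
  le := RelCyl.le R
  le_refl a := by cases a <;> exact _root_.le_refl _
  le_trans a b c hab hbc := by
    cases a with
    | inl x =>
      cases b with
      | inl x' =>
        cases c with
        | inl x'' => exact _root_.le_trans (α := X) hab hbc
        | inr z =>
          obtain ⟨x1, z1, h1, h2, h3⟩ := hbc
          exact ⟨x1, z1, _root_.le_trans (α := X) hab h1, h2, h3⟩
      | inr z =>
        cases c with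
        | inl x'' => exact (hbc : False).elim
        | inr z' =>
          obtain ⟨x1, z1, h1, h2, h3⟩ := hab
          exact ⟨x1, z1, h1, _root_.le_trans (α := Z) h2 hbc, h3⟩
    | inr z =>
      cases b with
      | inl x => exact (hab : False).elim
      | inr z' =>
        cases c with
        | inl x => exact (hbc : False).elim
        | inr z'' => exact _root_.le_trans (α := Z) hab hbc
  le_antisymm a b hab hba := by
    cases a with
    | inl x =>
      cases b with
      | inl x' => exact congrArg Sum.inl (_root_.le_antisymm (α := X) hab hba)
      | inr z => exact (hba : False).elim
    | inr z =>
      cases b with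
      | inl x => exact (hab : False).elim
      | inr z' => exact congrArg Sum.inr (_root_.le_antisymm (α := Z) hab hba)

instance RelCyl.instFinite {X Z : Type u} [PartialOrder X] [PartialOrder Z]
    [Finite X] [Finite Z] (R : Set (X × Z)) : Finite (RelCyl X Z R) :=
  inferInstanceAs (Finite (X ⊕ Z))

/-! ## Finite abstract simplicial complexes and collapses -/

/-- A set of finite nonempty sets is an abstract simplicial complex if it is closed under
passing to nonempty subsets. -/
def IsComplex {V : Type u} (K : Set (Finset V)) : Prop :=
  ∀ s ∈ K, s.Nonempty ∧ ∀ t : Finset V, t ⊆ s → t.Nonempty → t ∈ K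

/-- `s` is a free face of `K` with unique proper coface `t`. -/
def FreeFace {V : Type u} (K : Set (Finset V)) (s t : Finset V) : Prop :=
  s ∈ K ∧ t ∈ K ∧ s ⊂ t ∧ ∀ u ∈ K, s ⊂ u → u = t

/-- An elementary collapse of simplicial complexes: remove a free face together with the
unique simplex properly containing it. -/
def CxStep {V : Type u} (K L : Set (Finset V)) : Prop :=
  ∃ s t : Finset V, FreeFace K s t ∧ L = K \ {s, t}

/-- `K` collapses to the subcomplex `L`. -/
def CxCollapsesTo {V : Type u} (K L : Set (Finset V)) : Prop :=
  Relation.ReflTransGen CxStep K L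

/-- A simplicial complex is collapsible if it collapses to a single vertex. -/
def CxCollapsible {V : Type u} (K : Set (Finset V)) : Prop :=
  ∃ v : V, CxCollapsesTo K {({v} : Finset V)}

/-- A bundled simplicial complex: a vertex type together with a set of faces. -/
structure SCx : Type (u + 1) where
  V : Type u
  faces : Set (Finset V)

/-- Generators of simple homotopy equivalence of complexes: elementary collapses and
simplicial isomorphisms. -/
inductive SCxRel : SCx.{u} → SCx.{u} → Prop
  | collapse (V : Type u) (K L : Set (Finset V)) : CxStep K L → SCxRel ⟨V, K⟩ ⟨V, L⟩
  | iso (K L : SCx.{u}) (e : K.V ≃ L.V) :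
      (∀ s : Finset K.V, s ∈ K.faces ↔ s.map e.toEmbedding ∈ L.faces) → SCxRel K L

/-- Two simplicial complexes are simple homotopy equivalent if they are related by the
equivalence relation generated by elementary collapses (and isomorphism). -/
def SCxSHE : SCx.{u} → SCx.{u} → Prop := Relation.EqvGen SCxRel

/-- The order complex `K(X)` of a poset: faces are the nonempty finite chains. -/
def orderComplex (X : Type u) [Preorder X] : Set (Finset X) :=
  {s | s.Nonempty ∧ IsChain (· ≤ ·) (↑s : Set X)}

/-- The nerve of a family of complexes (or of sets): faces are the nonempty finite
subsets of the index set whose members have nonempty intersection. -/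
def nerveCx {I : Type u} {α : Type v} (L : I → Set α) : Set (Finset I) :=
  {J | J.Nonempty ∧ (⋂ i ∈ J, L i).Nonempty}

instance Finset.instFiniteOfFinite {I : Type u} [Finite I] : Finite (Finset I) :=
  Finite.of_injective (fun s : Finset I => (s : Set I)) Finset.coe_injective

/-- `N₀(U)`: the subspace of the non-Hausdorff nerve consisting of the nonempty finite
index sets whose intersection is homotopically trivial, ordered by inclusion. -/
abbrev NerveHT {I : Type u} {X : Type v} [Preorder X] (U : I → Set X) : Type u :=
  {J : Finset I // J.Nonempty ∧ HTrivialSet (⋂ i ∈ J, U i)}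

open Set

section Alexandrov

theorem alexTop_continuous {P : Type u} {Q : Type v} [Preorder P] [Preorder Q] {f : P → Q}
    (hf : Monotone f) : @Continuous P Q (alexTop P) (alexTop Q) f := by
  let _ := alexTop P
  let _ := alexTop Q
  refine ⟨fun s hs => ?_⟩
  have hs' : IsLowerSet s := hs
  exact (fun a b hba ha => hs' (hf hba) ha : IsLowerSet (f ⁻¹' s))

theorem alexTop_homotopic {P : Type u} {Q : Type v} [Preorder P] [Preorder Q] {f g : P → Q}
    (hf : Monotone f) (hg : Monotone g) (h : ∀ x, f x ≤ g x) :
    @ContinuousMap.Homotopic P Q (alexTop P) (alexTop Q)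
      (@ContinuousMap.mk P Q (alexTop P) (alexTop Q) f (alexTop_continuous hf))
      (@ContinuousMap.mk P Q (alexTop P) (alexTop Q) g (alexTop_continuous hg)) := by
  let _ := alexTop P
  let _ := alexTop Q
  classical
  have hfc : Continuous f := alexTop_continuous hf
  have hgc : Continuous g := alexTop_continuous hg
  refine ⟨⟨⟨fun p => if p.1 < 1 then f p.2 else g p.2, ⟨fun s hs => ?_⟩⟩, ?_, ?_⟩⟩
  · have hs' : IsLowerSet s := hs
    have : (fun p : unitInterval × P => if p.1 < 1 then f p.2 else g p.2) ⁻¹' s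
        = (Iio 1 ×ˢ (f ⁻¹' s)) ∪ (univ ×ˢ (g ⁻¹' s)) := by
      ext ⟨t, x⟩
      by_cases ht : t < 1
      · simp only [mem_preimage, ht, if_true, mem_union, mem_prod, mem_Iio, true_and, mem_univ]
        exact ⟨Or.inl, fun h' => h'.elim id fun h' => hs' (h x) h'⟩
      · simp [ht]
    rw [this]
    exact (isOpen_Iio.prod (hs.preimage hfc)).union (isOpen_univ.prod (hs.preimage hgc))
  · intro x; simp
  · intro x; simp

theorem contractibleSpace_of_top {P : Type u} [Preorder P] (m : P) (hm : ∀ x, x ≤ m) :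
    @ContractibleSpace P (alexTop P) := by
  let _ := alexTop P
  rw [contractible_iff_id_nullhomotopic]
  exact ⟨m, alexTop_homotopic monotone_id monotone_const hm⟩

theorem contractibleSpace_of_bot {P : Type u} [Preorder P] (m : P) (hm : ∀ x, m ≤ x) :
    @ContractibleSpace P (alexTop P) := by
  let _ := alexTop P
  rw [contractible_iff_id_nullhomotopic]
  exact ⟨m, (alexTop_homotopic monotone_const monotone_id hm).symm⟩

theorem contractibleSpace_of_retract {P : Type u} {Q : Type v} [Preorder P] [Preorder Q]
    (i : P → Q) (r : Q → P) (hi : Monotone i) (hr : Monotone r) (hri : ∀ x, r (i x) = x)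
    (h : (∀ y, y ≤ i (r y)) ∨ ∀ y, i (r y) ≤ y)
    (hP : @ContractibleSpace P (alexTop P)) : @ContractibleSpace Q (alexTop Q) := by
  let _ := alexTop P
  let _ := alexTop Q
  have : ContinuousMap.HomotopyEquiv Q P :=
    { toFun := ⟨r, alexTop_continuous hr⟩
      invFun := ⟨i, alexTop_continuous hi⟩
      left_inv := by
        rcases h with h | h
        · exact (alexTop_homotopic monotone_id (hi.comp hr) h).symm
        · exact alexTop_homotopic (hi.comp hr) monotone_id h
      right_inv := by
        have : (ContinuousMap.comp ⟨r, alexTop_continuous hr⟩ ⟨i, alexTop_continuous hi⟩ :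
          C(P, P)) = ContinuousMap.id P := by ext x; exact hri x
        rw [this] }
  exact this.contractibleSpace

theorem contractibleSpace_orderIso {P : Type u} {Q : Type v} [Preorder P] [Preorder Q]
    (e : P ≃o Q) (hP : @ContractibleSpace P (alexTop P)) :
    @ContractibleSpace Q (alexTop Q) :=
  contractibleSpace_of_retract e e.symm e.monotone e.symm.monotone (by simp) (by simp) hP

/-- Finite spaces which reduce to a cone by removing beat points. -/
inductive Dism {Q : Type u} [PartialOrder Q] : Set Q → Prop
  | top (A : Set Q) (m : Q) : m ∈ A → (∀ a ∈ A, a ≤ m) → Dism A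
  | bot (A : Set Q) (m : Q) : m ∈ A → (∀ a ∈ A, m ≤ a) → Dism A
  | up (A : Set Q) (x m : Q) : m ∈ A → x < m → (∀ y ∈ A, x < y → m ≤ y) →
      Dism (A \ {x}) → Dism A
  | down (A : Set Q) (x m : Q) : m ∈ A → m < x → (∀ y ∈ A, y < x → y ≤ m) →
      Dism (A \ {x}) → Dism A

theorem Dism.contractible {Q : Type u} [PartialOrder Q] {A : Set Q} (h : Dism A) :
    ContractibleSet A := by
  classical
  induction h with
  | top A m hm h => exact contractibleSpace_of_top ⟨m, hm⟩ fun x => h x x.2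
  | bot A m hm h => exact contractibleSpace_of_bot ⟨m, hm⟩ fun x => h x x.2
  | up A x m hm hxm h _ ih =>
    refine contractibleSpace_of_retract (P := ↥(A \ {x})) (Q := A) (fun y => ⟨y, y.2.1⟩)
      (fun y => if hy : y.1 = x then ⟨m, hm, hxm.ne'⟩ else ⟨y, y.2, hy⟩) (fun a b hab => hab) ?_ ?_
      (Or.inl ?_) ih
    · intro a b hab
      have hab' : a.1 ≤ b.1 := hab
      by_cases ha : a.1 = x <;> by_cases hb : b.1 = x <;> simp only [ha, hb, dite_true, dite_false]
      · exact le_rfl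
      · exact h b b.2 (lt_of_le_of_ne (ha ▸ hab') (Ne.symm hb))
      · exact (hb ▸ hab').trans hxm.le
      · exact hab'
    · intro y
      have : y.1 ≠ x := y.2.2
      simp [this]
    · intro y
      by_cases hy : y.1 = x
      · simp only [hy, dite_true]; exact (show y.1 ≤ m from hy ▸ hxm.le)
      · simp only [hy, dite_false]; exact le_rfl
  | down A x m hm hxm h _ ih =>
    refine contractibleSpace_of_retract (P := ↥(A \ {x})) (Q := A) (fun y => ⟨y, y.2.1⟩)
      (fun y => if hy : y.1 = x then ⟨m, hm, hxm.ne⟩ else ⟨y, y.2, hy⟩) (fun a b hab => hab) ?_ ?_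
      (Or.inr ?_) ih
    · intro a b hab
      have hab' : a.1 ≤ b.1 := hab
      by_cases ha : a.1 = x <;> by_cases hb : b.1 = x <;> simp only [ha, hb, dite_true, dite_false]
      · exact le_rfl
      · exact hxm.le.trans (ha ▸ hab')
      · exact h a a.2 (lt_of_le_of_ne (hb ▸ hab') ha)
      · exact hab'
    · intro y
      have : y.1 ≠ x := y.2.2
      simp [this]
    · intro y
      by_cases hy : y.1 = x
      · simp only [hy, dite_true]; exact (show m ≤ y.1 from hy ▸ hxm.le)
      · simp only [hy, dite_false]; exact le_rfl

end Alexandrov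

section Cyl

/-- Data for gluing a poset `L` below a poset `P`. -/
structure LRel (L : Type u) (P : Type v) [Preorder L] [Preorder P] where
  rel : L → P → Prop
  up : ∀ l p p', rel l p → p ≤ p' → rel l p'
  anti : ∀ l l' p, l ≤ l' → rel l' p → rel l p

/-- The poset obtained by gluing `L` below `P` along `R`. -/
inductive Cyl {L : Type u} {P : Type v} [Preorder L] [Preorder P] (R : LRel L P) : Type (max u v)
  | lo (l : L) : Cyl R
  | hi (p : P) : Cyl R

namespace Cyl
variable {L : Type u} {P : Type v} [PartialOrder L] [PartialOrder P] {R : LRel L P}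

/-- The order of the glued poset. -/
def le : Cyl R → Cyl R → Prop
  | lo l, lo l' => l ≤ l'
  | lo l, hi p => R.rel l p
  | hi p, hi p' => p ≤ p'
  | hi _, lo _ => False

instance : PartialOrder (Cyl R) where
  le := le
  le_refl a := by cases a <;> exact _root_.le_refl _
  le_trans a b c hab hbc := by
    rcases a with a | a <;> rcases b with b | b <;> rcases c with c | c <;>
      simp only [le] at hab hbc ⊢
    · exact _root_.le_trans hab hbc
    · exact R.anti _ _ _ hab hbc
    · exact R.up _ _ _ hab hbc
    · exact _root_.le_trans hab hbc
  le_antisymm a b hab hba := by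
    rcases a with a | a <;> rcases b with b | b
    · exact congrArg lo (_root_.le_antisymm (α := L) hab hba)
    · exact (hba : False).elim
    · exact (hab : False).elim
    · exact congrArg hi (_root_.le_antisymm (α := P) hab hba)

instance [Finite L] [Finite P] : Finite (Cyl R) :=
  Finite.of_injective (β := L ⊕ P) (fun | lo l => Sum.inl l | hi p => Sum.inr p) (by
    rintro (a | a) (b | b) h <;> simp_all)

@[simp] theorem lo_le_lo {l l' : L} : (lo l : Cyl R) ≤ lo l' ↔ l ≤ l' := Iff.rfl
@[simp] theorem lo_le_hi {l : L} {p : P} : (lo l : Cyl R) ≤ hi p ↔ R.rel l p := Iff.rfl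
@[simp] theorem hi_le_hi {p p' : P} : (hi p : Cyl R) ≤ hi p' ↔ p ≤ p' := Iff.rfl
@[simp] theorem not_hi_le_lo {l : L} {p : P} : ¬ (hi p : Cyl R) ≤ lo l := fun h => h
@[simp] theorem lo_lt_lo {l l' : L} : (lo l : Cyl R) < lo l' ↔ l < l' := by
  simp [lt_iff_le_not_ge]
@[simp] theorem hi_lt_hi {l l' : P} : (hi l : Cyl R) < hi l' ↔ l < l' := by
  simp [lt_iff_le_not_ge]
@[simp] theorem lo_lt_hi {l : L} {p : P} : (lo l : Cyl R) < hi p ↔ R.rel l p := by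
  simp [lt_iff_le_not_ge]
@[simp] theorem not_hi_lt_lo {l : L} {p : P} : ¬ (hi p : Cyl R) < lo l := by
  simp [lt_iff_le_not_ge]
@[simp] theorem lo_inj {l l' : L} : (lo l : Cyl R) = lo l' ↔ l = l' := by
  constructor
  · rintro ⟨⟩; rfl
  · rintro rfl; rfl
@[simp] theorem hi_inj {l l' : P} : (hi l : Cyl R) = hi l' ↔ l = l' := by
  constructor
  · rintro ⟨⟩; rfl
  · rintro rfl; rfl
@[simp] theorem lo_ne_hi {l : L} {p : P} : (lo l : Cyl R) ≠ hi p := nofun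
@[simp] theorem hi_ne_lo {l : L} {p : P} : (hi p : Cyl R) ≠ lo l := nofun
end Cyl

end Cyl

section SimpleEquivalence

theorem SHE.refl (P : FinPoset.{u}) : SHE P P := Relation.EqvGen.refl _
theorem SHE.symm {P Q : FinPoset.{u}} (h : SHE P Q) : SHE Q P := Relation.EqvGen.symm _ _ h
theorem SHE.trans {P Q R : FinPoset.{u}} (h : SHE P Q) (h' : SHE Q R) : SHE P R :=
  Relation.EqvGen.trans _ _ _ h h'

theorem SHE.of_orderIso {P Q : Type u} [PartialOrder P] [Finite P] [PartialOrder Q] [Finite Q]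
    (e : P ≃o Q) : SHE ⟨P⟩ ⟨Q⟩ :=
  Relation.EqvGen.rel _ _ ⟨Set.univ, Relation.ReflTransGen.refl, ⟨e.symm.trans OrderIso.Set.univ.symm⟩⟩

/-- The order isomorphism between a subset of a subset and its image. -/
def subSubIso {E : Type u} [PartialOrder E] (A : Set E) (p : A → Prop) (q : Set E)
    (h : ∀ y, y ∈ q ↔ ∃ hy : y ∈ A, p ⟨y, hy⟩) : {y : A // p y} ≃o q where
  toFun y := ⟨y.1.1, (h _).2 ⟨y.1.2, y.2⟩⟩
  invFun y := ⟨⟨y.1, ((h _).1 y.2).1⟩, ((h _).1 y.2).2⟩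
  left_inv _ := rfl
  right_inv _ := rfl
  map_rel_iff' := Iff.rfl

theorem SHE.remove {E : Type u} [PartialOrder E] [Finite E] {A : Set E} {x : E} (hx : x ∈ A)
    (h : Dism {y | y ∈ A ∧ y < x} ∨ Dism {y | y ∈ A ∧ x < y}) :
    SHE ⟨A⟩ ⟨↥(A \ {x})⟩ := by
  refine Relation.EqvGen.rel _ _ ⟨Set.univ \ {⟨x, hx⟩}, Relation.ReflTransGen.single
    ⟨⟨x, hx⟩, Set.mem_univ _, ?_, rfl⟩, ⟨?_⟩⟩
  · rcases h with h | h
    · left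
      refine contractibleSpace_orderIso
        (subSubIso A (fun y => y ∈ hatDown Set.univ (⟨x, hx⟩ : A)) _ ?_).symm h.contractible
      intro y
      exact ⟨fun h => ⟨h.1, trivial, h.2⟩, fun h => ⟨h.1, h.2.2⟩⟩
    · right
      refine contractibleSpace_orderIso
        (subSubIso A (fun y => y ∈ hatUp Set.univ (⟨x, hx⟩ : A)) _ ?_).symm h.contractible
      intro y
      exact ⟨fun h => ⟨h.1, trivial, h.2⟩, fun h => ⟨h.1, h.2.2⟩⟩
  · refine (subSubIso A (fun y => y ∈ Set.univ \ {(⟨x, hx⟩ : A)}) (A \ {x}) ?_).symm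
    intro y
    exact ⟨fun h => ⟨h.1, trivial, fun h' => h.2 (congrArg Subtype.val h')⟩,
      fun h => ⟨h.1, fun h' => h.2.2 (Subtype.ext h')⟩⟩

theorem removal_aux {E : Type u} [Finite E] (r : E → E → Prop)
    (hr : ∀ S : Set E, S.Nonempty → ∃ d ∈ S, ∀ y ∈ S, ¬ r d y)
    (rel : Set E → Set E → Prop) (hrefl : ∀ A, rel A A)
    (htrans : ∀ A B C, rel A B → rel B C → rel A C) (A D : Set E) (hD : D ⊆ A)
    (step : ∀ d ∈ D, ∀ B, A \ D ⊆ B → B ⊆ A → d ∈ B → (∀ y ∈ B, r d y → y ∉ D) →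
      rel B (B \ {d})) : rel A (A \ D) := by
  have key : ∀ (n : ℕ) (D' : Set E), D' ⊆ D → D'.ncard = n → rel (A \ D ∪ D') (A \ D) := by
    intro n
    induction n with
    | zero =>
      intro D' _ h
      rw [Set.ncard_eq_zero (Set.toFinite _)] at h
      rw [h, Set.union_empty]; exact hrefl _
    | succ n ih =>
      intro D' hD' hn
      have hne : D'.Nonempty := by
        rw [← Set.ncard_pos (Set.toFinite _)]; omega
      obtain ⟨d, hd, hmax⟩ := hr D' hne
      have hn' : (D' \ {d}).ncard = n := by
        rw [Set.ncard_sdiff_singleton_of_mem hd]; omega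
      have h1 := ih (D' \ {d}) (Set.sdiff_subset.trans hD') hn'
      refine htrans _ _ _ (step d (hD' hd) _ Set.subset_union_left ?_ (Or.inr hd) ?_) ?_
      · rintro y (hy | hy)
        · exact hy.1
        · exact hD (hD' hy)
      · rintro y (hy | hy) hr' hyD
        · exact hy.2 hyD
        · exact hmax y hy hr'
      · have : (A \ D ∪ D') \ {d} = A \ D ∪ D' \ {d} := by
          ext y
          simp only [Set.mem_sdiff, Set.mem_union, Set.mem_singleton_iff]
          have : y = d → y ∈ D := fun h => h ▸ hD' hd
          tauto
        rw [this]; exact h1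
  have := key _ D subset_rfl rfl
  rwa [Set.sdiff_union_of_subset hD] at this

theorem removal_up {E : Type u} [Finite E] [PartialOrder E]
    (rel : Set E → Set E → Prop) (hrefl : ∀ A, rel A A)
    (htrans : ∀ A B C, rel A B → rel B C → rel A C) (A D : Set E) (hD : D ⊆ A)
    (step : ∀ d ∈ D, ∀ B, d ∈ B → {y | y ∈ B ∧ d < y} = {y | y ∈ A ∧ y ∉ D ∧ d < y} →
      rel B (B \ {d})) : rel A (A \ D) := by
  refine removal_aux (· < ·) (fun S hS => ?_) rel hrefl htrans A D hD ?_
  · obtain ⟨d, hd⟩ := (Set.toFinite S).exists_maximal hS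
    exact ⟨d, hd.1, fun y hy h => h.not_ge (hd.2 hy h.le)⟩
  · intro d hd B h1 h2 h3 h4
    refine step d hd B h3 (Set.ext fun y => ?_)
    exact ⟨fun h => ⟨h2 h.1, h4 y h.1 h.2, h.2⟩, fun h => ⟨h1 ⟨h.1, h.2.1⟩, h.2.2⟩⟩

theorem removal_down {E : Type u} [Finite E] [PartialOrder E]
    (rel : Set E → Set E → Prop) (hrefl : ∀ A, rel A A)
    (htrans : ∀ A B C, rel A B → rel B C → rel A C) (A D : Set E) (hD : D ⊆ A)
    (step : ∀ d ∈ D, ∀ B, d ∈ B → {y | y ∈ B ∧ y < d} = {y | y ∈ A ∧ y ∉ D ∧ y < d} →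
      rel B (B \ {d})) : rel A (A \ D) := by
  refine removal_aux (· > ·) (fun S hS => ?_) rel hrefl htrans A D hD ?_
  · obtain ⟨d, hd⟩ := (Set.toFinite S).exists_minimal hS
    exact ⟨d, hd.1, fun y hy h => h.not_ge (hd.2 hy h.le)⟩
  · intro d hd B h1 h2 h3 h4
    refine step d hd B h3 (Set.ext fun y => ?_)
    exact ⟨fun h => ⟨h2 h.1, h4 y h.1 h.2, h.2⟩, fun h => ⟨h1 ⟨h.1, h.2.1⟩, h.2.2⟩⟩

/-- Removing points which have a unique minimal element above them outside the removed set. -/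
theorem SHE.removeBeat {E : Type u} [PartialOrder E] [Finite E] (A D : Set E) (hD : D ⊆ A)
    (h : ∀ d ∈ D, ∃ m ∈ A, m ∉ D ∧ d < m ∧ ∀ y ∈ A, y ∉ D → d < y → m ≤ y) :
    SHE ⟨A⟩ ⟨↥(A \ D)⟩ := by
  refine removal_up (fun A B => SHE ⟨A⟩ ⟨B⟩) (fun _ => SHE.refl _)
    (fun _ _ _ => SHE.trans) A D hD fun d hd B hdB hB => SHE.remove hdB (Or.inr ?_)
  rw [hB]
  obtain ⟨m, hmA, hmD, hm, hmin⟩ := h d hd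
  exact Dism.bot _ m ⟨hmA, hmD, hm⟩ fun y hy => hmin y hy.1 hy.2.1 hy.2.2

theorem Dism.removeBeatDown {E : Type u} [PartialOrder E] [Finite E] (A D : Set E) (hD : D ⊆ A)
    (h : ∀ d ∈ D, ∃ m ∈ A, m ∉ D ∧ m < d ∧ ∀ y ∈ A, y ∉ D → y < d → y ≤ m)
    (hAD : Dism (A \ D)) : Dism A := by
  have := removal_down (fun A B => Dism B → Dism A) (fun _ => id)
    (fun _ _ _ h h' => h ∘ h') A D hD fun d hd B hdB hB => ?_
  · exact this hAD
  · obtain ⟨m, hmA, hmD, hm, hmin⟩ := h d hd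
    intro hB'
    have hm' : m ∈ {y | y ∈ B ∧ y < d} := by rw [hB]; exact ⟨hmA, hmD, hm⟩
    refine Dism.down B d m hm'.1 hm (fun y hy hyd => ?_) hB'
    have : y ∈ {y | y ∈ B ∧ y < d} := ⟨hy, hyd⟩
    rw [hB] at this
    exact hmin y this.1 this.2.1 hyd

end SimpleEquivalence

section Gamma

/-- The equivalence relation generated by order isomorphisms, removal of points `x` such that
`Û_x` is equivalent to a point, and removal of points covered by a single element. -/
inductive Eqv : FinPoset.{0} → FinPoset.{0} → Prop
  | iso {P Q : Type} [PartialOrder P] [Finite P] [PartialOrder Q] [Finite Q] :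
      (P ≃o Q) → Eqv ⟨P⟩ ⟨Q⟩
  | symm {P Q : FinPoset.{0}} : Eqv P Q → Eqv Q P
  | trans {P Q R : FinPoset.{0}} : Eqv P Q → Eqv Q R → Eqv P R
  | up {P : Type} [PartialOrder P] [Finite P] (x : P) :
      Eqv ⟨{y // y < x}⟩ ⟨PUnit⟩ → Eqv ⟨P⟩ ⟨{y // y ≠ x}⟩
  | beat {P : Type} [PartialOrder P] [Finite P] (x m : P) : x < m → (∀ y, x < y → m ≤ y) →
      Eqv ⟨P⟩ ⟨{y // y ≠ x}⟩

/-- Every point whose punctured minimal neighbourhood is isomorphic to `A` can be removed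
without changing the simple homotopy type. -/
def Removable (A : FinPoset.{0}) : Prop :=
  ∀ (E : Type u) [PartialOrder E] [Finite E] (S : Set E) (c : E), c ∈ S →
    Nonempty ({y // y ∈ S ∧ y < c} ≃o A.carrier) → SHE.{u} ⟨S⟩ ⟨↥(S \ {c})⟩

theorem Removable.of_type {A : FinPoset.{0}}
    (h : ∀ (E : Type u) [PartialOrder E] [Finite E] (c : E),
      Nonempty ({y // y < c} ≃o A.carrier) → SHE.{u} ⟨E⟩ ⟨{y // y ≠ c}⟩) :
    Removable.{u} A := by
  intro E _ _ S c hc ⟨e⟩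
  refine (h S ⟨c, hc⟩ ⟨(subSubIso S (fun y => y < ⟨c, hc⟩) {y | y ∈ S ∧ y < c} ?_).trans e⟩).trans
    (SHE.of_orderIso (subSubIso S (fun y => y ≠ ⟨c, hc⟩) (S \ {c}) ?_))
  · intro y
    exact ⟨fun h => ⟨h.1, h.2⟩, fun h => ⟨h.1, h.2⟩⟩
  · intro y
    exact ⟨fun h => ⟨h.1, fun h' => h.2 (congrArg Subtype.val h')⟩,
      fun h => ⟨h.1, fun h' => h.2 (Subtype.ext h')⟩⟩

theorem Removable.iso {A B : FinPoset.{0}} (e : A.carrier ≃o B.carrier)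
    (h : Removable.{u} A) : Removable.{u} B :=
  fun E _ _ S c hc ⟨f⟩ => h E S c hc ⟨f.trans e.symm⟩

theorem Removable.punit : Removable.{u} ⟨PUnit⟩ := by
  intro E _ _ S c hc ⟨e⟩
  refine SHE.remove hc (Or.inl ?_)
  refine Dism.top _ (e.symm PUnit.unit).1 (e.symm PUnit.unit).2 fun a ha => ?_
  have : (⟨a, ha⟩ : {y // y ∈ S ∧ y < c}) = e.symm PUnit.unit := by
    apply e.injective; rfl
  rw [← this]

variable {P : Type} [PartialOrder P] {E : Type u} [PartialOrder E]

/-- Extension of a gluing relation by a top element glued below `c`. -/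
def LRel.withTop (R : LRel P E) (c : E) (h : ∀ l e, c ≤ e → R.rel l e) :
    LRel (WithTop P) E where
  rel l e := WithTop.recTopCoe (C := fun _ => Prop) (c ≤ e) (fun l => R.rel l e) l
  up l p p' := by
    induction l using WithTop.recTopCoe with
    | top => exact fun h h' => h.trans h'
    | coe l => exact R.up _ _ _
  anti l l' p := by
    induction l using WithTop.recTopCoe with
    | top =>
      induction l' using WithTop.recTopCoe with
      | top => exact fun _ h => h
      | coe l' => exact fun h => absurd h (by simp)
    | coe l =>
      induction l' using WithTop.recTopCoe with
      | top => exact fun _ h' => h _ _ h'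
      | coe l' => exact fun h h' => R.anti _ _ _ (WithTop.coe_le_coe.1 h) h'

@[simp] theorem LRel.withTop_top {R : LRel P E} {c : E} {h : ∀ l e, c ≤ e → R.rel l e} {e : E} :
    (R.withTop c h).rel ⊤ e ↔ c ≤ e := Iff.rfl
@[simp] theorem LRel.withTop_coe {R : LRel P E} {c : E} {h : ∀ l e, c ≤ e → R.rel l e} {e : E}
    {l : P} : (R.withTop c h).rel l e ↔ R.rel l e := Iff.rfl

namespace Gam
variable {R : LRel (WithTop P) E}

/-- The subset of a glued poset consisting of `L`, of the top point if `t`, and of `B`. -/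
def part (R : LRel (WithTop P) E) (L : Set P) (t : Prop) (B : Set E) : Set (Cyl R)
  | .lo l => WithTop.recTopCoe (C := fun _ => Prop) t (fun l => l ∈ L) l
  | .hi e => e ∈ B

variable {L : Set P} {t : Prop} {B : Set E}
@[simp] theorem mem_top : (Cyl.lo ⊤ : Cyl R) ∈ part R L t B ↔ t := Iff.rfl
@[simp] theorem mem_coe {l : P} : (Cyl.lo (l : WithTop P) : Cyl R) ∈ part R L t B ↔ l ∈ L := Iff.rfl
@[simp] theorem mem_hi {e : E} : (Cyl.hi e : Cyl R) ∈ part R L t B ↔ e ∈ B := Iff.rfl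

theorem cases {p : Cyl R → Prop} (h1 : p (.lo ⊤)) (h2 : ∀ l : P, p (.lo l)) (h3 : ∀ e, p (.hi e)) :
    ∀ w, p w
  | .hi e => h3 e
  | .lo l => by
    induction l using WithTop.recTopCoe with
    | top => exact h1
    | coe l => exact h2 l

variable [Finite P] [Finite E]

theorem diff_top : part R L True B \ {Cyl.lo ⊤} = part R L False B := by
  ext w; induction w using cases <;> simp

theorem diff_coe {x : P} : part R univ t B \ {Cyl.lo (x : WithTop P)} = part R {y | y ≠ x} t B := by
  ext w; induction w using cases <;> simp

theorem diff_hi {c : E} : part R L t univ \ {Cyl.hi c} = part R L t {y | y ≠ c} := by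
  ext w; induction w using cases <;> simp

theorem lower_top : {w | w ∈ part R L True B ∧ w < Cyl.lo ⊤} = {w | ∃ l ∈ L, w = Cyl.lo (l : WithTop P)} := by
  ext w
  induction w using cases <;> simp

theorem lower_coe {x : P} : {w | w ∈ part R univ t B ∧ w < Cyl.lo (x : WithTop P)} =
    {w | ∃ l ∈ {y | y < x}, w = Cyl.lo (l : WithTop P)} := by
  ext w
  induction w using cases <;> simp

/-- The embedding of the lower layer. -/
noncomputable def layerIso (L : Set P) :
    {w : Cyl R | ∃ l ∈ L, w = Cyl.lo (l : WithTop P)} ≃o L :=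
  (RelIso.ofSurjective (show L ↪o {w : Cyl R | ∃ l ∈ L, w = Cyl.lo (l : WithTop P)} from
    ⟨⟨fun l => ⟨Cyl.lo (l.1 : WithTop P), l.1, l.2, rfl⟩, fun a b h => by
      simpa [Subtype.ext_iff] using h⟩, by
        rintro ⟨a, ha⟩ ⟨b, hb⟩
        exact Cyl.lo_le_lo.trans WithTop.coe_le_coe⟩)
    (by rintro ⟨_, l, hl, rfl⟩; exact ⟨⟨l, hl⟩, rfl⟩)).symm

/-- The top point of the lower layer can be removed when the layer is removable. -/
theorem remove_top (h : Removable.{u} ⟨L⟩) :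
    SHE ⟨part R L True B⟩ ⟨part R L False B⟩ := by
  rw [← diff_top]
  exact h (Cyl R) (part R L True B) (Cyl.lo ⊤) trivial ⟨(OrderIso.setCongr _ _ (lower_top (R := R) (B := B))).trans (layerIso L)⟩

theorem remove_coe {x : P} (h : Removable.{u} ⟨{y // y < x}⟩) :
    SHE ⟨part R univ t B⟩ ⟨part R {y | y ≠ x} t B⟩ := by
  rw [← diff_coe]
  exact h (Cyl R) (part R univ t B) (Cyl.lo x) trivial ⟨(OrderIso.setCongr _ _ (lower_coe (R := R) (t := t) (B := B))).trans (layerIso _)⟩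

theorem remove_beat {x m : P} (hm : x < m) (hmin : ∀ y, x < y → m ≤ y)
    (hR : ∀ e ∈ B, R.rel x e → R.rel m e) :
    SHE ⟨part R univ t B⟩ ⟨part R {y | y ≠ x} t B⟩ := by
  rw [← diff_coe]
  refine SHE.remove trivial (Or.inr (Dism.bot _ (.lo (m : WithTop P)) ⟨trivial, by simpa using hm⟩ ?_))
  rintro w ⟨hw, hw'⟩
  induction w using cases with
  | h1 => simp
  | h2 l => simpa using hmin l (by simpa using hw')
  | h3 e => simpa using hR e hw (by simpa using hw')

theorem layer (i : P → E) (hi : ∀ l ∈ L, i l ∈ B ∧ ∀ e ∈ B, R.rel l e ↔ i l ≤ e)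
    (ht : t → ∃ c ∈ B, ∀ e ∈ B, R.rel ⊤ e ↔ c ≤ e) : SHE ⟨part R L t B⟩ ⟨B⟩ := by
  have := SHE.removeBeat (part R L t B) {w | w ∈ part R L t B ∧ ∃ l, w = .lo l} (fun w h => h.1) ?_
  · refine this.trans (SHE.of_orderIso ?_)
    refine OrderIso.symm ?_
    refine ⟨⟨fun b => ⟨.hi b.1, by simp⟩, fun w => ?_, ?_, ?_⟩, ?_⟩
    · rcases w with ⟨w, hw⟩
      rcases w with w | w
      · exact absurd ⟨hw.1, w, rfl⟩ hw.2
      · exact ⟨w, hw.1⟩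
    · intro b; rfl
    · rintro ⟨w, hw⟩
      rcases w with w | w
      · exact absurd ⟨hw.1, w, rfl⟩ hw.2
      · rfl
    · intro a b; simp
  · rintro d ⟨hd, l, rfl⟩
    induction l using WithTop.recTopCoe with
    | top =>
      obtain ⟨c, hc, h⟩ := ht hd
      refine ⟨.hi c, hc, by simp, by simpa using (h c hc).2 le_rfl, fun y hy hy' hy'' => ?_⟩
      rcases y with y | y
      · exact absurd ⟨hy, y, rfl⟩ hy'
      · simpa using (h y hy).1 (by simpa using hy'')
    | coe l =>
      obtain ⟨hc, h⟩ := hi l hd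
      refine ⟨.hi (i l), hc, by simp, by simpa using (h _ hc).2 le_rfl, fun y hy hy' hy'' => ?_⟩
      rcases y with y | y
      · exact absurd ⟨hy, y, rfl⟩ hy'
      · simpa using (h y hy).1 (by simpa using hy'')

theorem dism {c : E} (htop : ∀ e, R.rel ⊤ e ↔ c ≤ e) (i : P → E)
    (hi : ∀ l ∈ L, ∀ e, R.rel l e ↔ i l ≤ e) (hmono : ∀ l ∈ L, ∀ l' ∈ L, i l ≤ i l' → l ≤ l')
    (hB : ∀ a ∈ B, a < c ∧ ∃ l ∈ L, i l = a) : Dism (part R L True B) := by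
  refine Dism.removeBeatDown _ {w | w ∈ part R L True B ∧ ∃ e, w = .hi e} (fun w h => h.1) ?_ ?_
  · rintro d ⟨hd, e, rfl⟩
    obtain ⟨hlt, l, hl, rfl⟩ := hB e hd
    refine ⟨.lo (l : WithTop P), hl, by simp, by simp [hi l hl], fun w hw hw' hw'' => ?_⟩
    induction w using cases with
    | h1 => exact absurd ((htop _).1 (by simpa using hw'')) hlt.not_ge
    | h2 l' => simpa using hmono l' hw l hl ((hi l' hw _).1 (by simpa using hw''))
    | h3 e => exact absurd ⟨hw, e, rfl⟩ hw'
  · refine Dism.top _ (.lo ⊤) ⟨trivial, by simp⟩ ?_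
    rintro (w | w) hw
    · simp
    · exact absurd ⟨hw.1, w, rfl⟩ hw.2

theorem decouple {c : E} (htop : ∀ e, R.rel ⊤ e ↔ c ≤ e) (i : P → E)
    (hi : ∀ l ∈ L, i l < c ∧ ∀ e, R.rel l e ↔ i l ≤ e) (hd : Dism (part R L True {a | a < c})) :
    SHE ⟨E⟩ ⟨part R L True {e | e ≠ c}⟩ := by
  refine (SHE.of_orderIso OrderIso.Set.univ).symm.trans
    ((layer (R := R) (L := L) (t := True) (B := univ) i (fun l hl => ⟨trivial, fun e _ => (hi l hl).2 e⟩)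
    fun _ => ⟨c, trivial, fun e _ => htop e⟩).symm.trans ?_)
  rw [← diff_hi]
  refine SHE.remove trivial (Or.inl ?_)
  convert hd using 1
  ext w
  induction w using cases with
  | h1 => simp [htop]
  | h2 l => 
    simp only [mem_setOf_eq, mem_coe, Cyl.lo_lt_hi, and_iff_left_iff_imp]
    exact fun h => ((hi l h).2 c).2 (hi l h).1.le
  | h3 e => simp

theorem layer_ne {c : E} (i : P → E) (hi : ∀ l ∈ L, i l < c ∧ ∀ e, R.rel l e ↔ i l ≤ e) :
    SHE ⟨part R L False {e | e ≠ c}⟩ ⟨{e // e ≠ c}⟩ :=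
  layer i (fun l hl => ⟨(hi l hl).1.ne, fun e _ => (hi l hl).2 e⟩) False.elim

end Gam

theorem Removable.of_univ [Finite P] (h : Removable.{u} ⟨P⟩) : Removable.{u} ⟨(univ : Set P)⟩ :=
  h.iso OrderIso.Set.univ.symm

open Gam

variable [Finite P]

open Classical in
theorem Removable.up {x : P} (hx : Removable.{u} ⟨{y // y < x}⟩) :
    Removable.{u} ⟨P⟩ ↔ Removable.{u} ⟨{y // y ≠ x}⟩ := by
  constructor <;> refine fun h => Removable.of_type fun E _ _ c ⟨e⟩ => ?_
  · let i : P → E := fun y => if hy : y ≠ x then (e.symm ⟨y, hy⟩).1 else c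
    have hic : ∀ y, y ≠ x → i y < c := fun y hy => by
      simp only [i, dif_pos hy]; exact (e.symm ⟨y, hy⟩).2
    have hle : ∀ y, y ≠ x → ∀ y', y' ≠ x → (i y ≤ i y' ↔ y ≤ y') := fun y hy y' hy' => by
      simp only [i, dif_pos hy, dif_pos hy']
      exact e.symm.le_iff_le
    let R₀ : LRel P E := ⟨fun l a => (∃ y, y ≠ x ∧ l ≤ y ∧ i y ≤ a) ∨ c ≤ a, ?_, ?_⟩
    let R := R₀.withTop c fun l a h => Or.inr h
    have hi : ∀ l ∈ {y | y ≠ x}, i l < c ∧ ∀ a, R.rel l a ↔ i l ≤ a := by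
      refine fun l hl => ⟨hic l hl, fun a => ⟨?_, fun h => Or.inl ⟨l, hl, le_rfl, h⟩⟩⟩
      rintro (⟨y, hy, h1, h2⟩ | h)
      · exact ((hle l hl y hy).2 h1).trans h2
      · exact (hic l hl).le.trans h
    refine (decouple (R := R) (L := {y | y ≠ x}) (fun _ => Iff.rfl) i hi ?_).trans ?_
    · refine dism (c := c) (fun _ => Iff.rfl) i (fun l hl => (hi l hl).2)
        (fun l hl l' hl' => (hle l hl l' hl').1) fun a ha => ⟨ha, (e ⟨a, ha⟩).1, (e ⟨a, ha⟩).2, ?_⟩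
      simp only [i, dif_pos (e ⟨a, ha⟩).2, Subtype.coe_eta, OrderIso.symm_apply_apply]
    · refine (remove_coe hx).symm.trans ((remove_top h.of_univ).trans ((remove_coe hx).trans
        (layer_ne i hi)))
    · rintro l a a' (⟨y, hy, h1, h2⟩ | h) h'
      · exact Or.inl ⟨y, hy, h1, h2.trans h'⟩
      · exact Or.inr (h.trans h')
    · rintro l l' a hl (⟨y, hy, h1, h2⟩ | h)
      · exact Or.inl ⟨y, hy, hl.trans h1, h2⟩
      · exact Or.inr h
  · let i : P → E := fun y => (e.symm y).1
    have hic : ∀ y, i y < c := fun y => (e.symm y).2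
    have hle : ∀ y y', i y ≤ i y' ↔ y ≤ y' := fun y y' => e.symm.le_iff_le
    let R₀ : LRel P E := ⟨fun l a => i l ≤ a, fun _ _ _ => le_trans,
      fun _ _ _ h => ((hle _ _).2 h).trans⟩
    let R := R₀.withTop c fun l a h => (hic l).le.trans h
    have hi : ∀ l, i l < c ∧ ∀ a, R.rel l a ↔ i l ≤ a := fun l => ⟨hic l, fun a => Iff.rfl⟩
    refine (decouple (R := R) (L := univ) (fun _ => Iff.rfl) i (fun l _ => hi l) ?_).trans ?_
    · refine dism (c := c) (fun _ => Iff.rfl) i (fun l hl => (hi l).2)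
        (fun l hl l' hl' => (hle l l').1) fun a ha => ⟨ha, (e ⟨a, ha⟩), trivial, ?_⟩
      simp [i]
    · exact (remove_coe hx).trans ((remove_top h).trans (layer_ne i fun l _ => hi l))

open Classical in
theorem Removable.beat {x m : P} (hm : x < m) (hmin : ∀ y, x < y → m ≤ y) :
    Removable.{u} ⟨P⟩ ↔ Removable.{u} ⟨{y // y ≠ x}⟩ := by
  constructor <;> refine fun h => Removable.of_type fun E _ _ c ⟨e⟩ => ?_
  · let ρ : P → {y // y ≠ x} := fun y => if hy : y ≠ x then ⟨y, hy⟩ else ⟨m, hm.ne'⟩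
    have hρ : ∀ y (hy : y ≠ x), ρ y = ⟨y, hy⟩ := fun y hy => dif_pos hy
    have hρx : ρ x = ⟨m, hm.ne'⟩ := dif_neg (by simp)
    have hρm : ∀ y y', y ≤ y' → ρ y ≤ ρ y' := by
      intro y y' h
      by_cases hy : y = x <;> by_cases hy' : y' = x
      · rw [hy, hy']
      · subst hy
        rw [hρ y' hy', hρx]
        exact hmin y' (lt_of_le_of_ne h (Ne.symm hy'))
      · subst hy'
        rw [hρ y hy, hρx]
        exact h.trans hm.le
      · rw [hρ y hy, hρ y' hy']; exact h
    let i : P → E := fun y => (e.symm (ρ y)).1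
    have hic : ∀ y, i y < c := fun y => (e.symm _).2
    have hle : ∀ y, y ≠ x → ∀ y', y' ≠ x → (i y ≤ i y' ↔ y ≤ y') := fun y hy y' hy' => by
      simp only [i, hρ y hy, hρ y' hy']
      exact e.symm.le_iff_le
    let R₀ : LRel P E := ⟨fun l a => i l ≤ a, fun _ _ _ => le_trans,
      fun _ _ _ h => le_trans (e.symm.le_iff_le.2 (hρm _ _ h))⟩
    let R := R₀.withTop c fun l a h => (hic l).le.trans h
    have hi : ∀ l ∈ {y | y ≠ x}, i l < c ∧ ∀ a, R.rel l a ↔ i l ≤ a :=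
      fun l _ => ⟨hic l, fun a => Iff.rfl⟩
    have hx : ∀ t B, SHE ⟨part R univ t B⟩ ⟨part R {y | y ≠ x} t B⟩ := fun t B =>
      remove_beat hm hmin fun e _ he => by
        have : i m = i x := by simp only [i, hρx, hρ m hm.ne']
        exact this.le.trans he
    refine (decouple (R := R) (L := {y | y ≠ x}) (fun _ => Iff.rfl) i hi ?_).trans ?_
    · refine dism (c := c) (fun _ => Iff.rfl) i (fun l hl => (hi l hl).2)
        (fun l hl l' hl' => (hle l hl l' hl').1) fun a ha => ⟨ha, (e ⟨a, ha⟩).1, (e ⟨a, ha⟩).2, ?_⟩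
      simp only [i, hρ _ (e ⟨a, ha⟩).2, Subtype.coe_eta, OrderIso.symm_apply_apply]
    · exact (hx _ _).symm.trans ((remove_top h.of_univ).trans ((hx _ _).trans (layer_ne i hi)))
  · let i : P → E := fun y => (e.symm y).1
    have hic : ∀ y, i y < c := fun y => (e.symm y).2
    have hle : ∀ y y', i y ≤ i y' ↔ y ≤ y' := fun y y' => e.symm.le_iff_le
    let R₀ : LRel P E := ⟨fun l a => i l ≤ a, fun _ _ _ => le_trans,
      fun _ _ _ h => ((hle _ _).2 h).trans⟩
    let R := R₀.withTop c fun l a h => (hic l).le.trans h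
    have hi : ∀ l ∈ {y | y ≠ x}, i l < c ∧ ∀ a, R.rel l a ↔ i l ≤ a :=
      fun l _ => ⟨hic l, fun a => Iff.rfl⟩
    refine (decouple (R := R) (L := {y | y ≠ x}) (fun _ => Iff.rfl) i hi ?_).trans ?_
    · have hsurj : ∀ a, a < c → ∃ l, i l = a := fun a ha => ⟨e ⟨a, ha⟩, by simp [i]⟩
      refine Dism.up _ (.hi (i x)) (.hi (i m)) (hic m)
        (by simpa using lt_of_le_not_ge ((hle _ _).2 hm.le) fun h => hm.not_ge ((hle _ _).1 h)) ?_ ?_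
      · rintro (w | w) hw hw'
        · exact absurd hw' (by simp)
        · obtain ⟨l, rfl⟩ := hsurj w hw
          have hw' : i x < i l := by simpa using hw'
          simpa using (hle _ _).2 (hmin l (lt_of_le_not_ge ((hle _ _).1 hw'.le)
            fun h => hw'.not_ge ((hle _ _).2 h)))
      · have : part R {y | y ≠ x} True {a | a < c} \ {.hi (i x)} =
            part R {y | y ≠ x} True {a | a < c ∧ a ≠ i x} := by
          ext w; induction w using cases <;> simp
        rw [this]
        refine dism (c := c) (fun _ => Iff.rfl) i (fun l hl => (hi l hl).2)
          (fun l hl l' hl' => (hle l l').1) fun a ha => ⟨ha.1, ?_⟩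
        obtain ⟨l, rfl⟩ := hsurj a ha.1
        exact ⟨l, fun h => ha.2 (h ▸ rfl), rfl⟩
    · exact (remove_top h).trans (layer_ne i hi)

theorem Eqv.removable_iff {A B : FinPoset.{0}} (h : Eqv A B) :
    Removable.{u} A ↔ Removable.{u} B := by
  induction h with
  | iso e => exact ⟨Removable.iso e, Removable.iso e.symm⟩
  | symm _ ih => exact ih.symm
  | trans _ _ ih ih' => exact ih.trans ih'
  | up x _ ih => exact Removable.up (ih.2 Removable.punit)
  | beat x m hm hmin => exact Removable.beat hm hmin

/-- A copy of a poset in an arbitrary universe. -/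
theorem Eqv.she {A B : FinPoset.{0}} (h : Eqv A B) :
    SHE.{u} ⟨ULift.{u} A.carrier⟩ ⟨ULift.{u} B.carrier⟩ := by
  have hl : ∀ {P Q : Type} [PartialOrder P] [PartialOrder Q] (e : P ≃o Q),
      Nonempty (ULift.{u} P ≃o ULift.{u} Q) := fun e =>
    ⟨⟨⟨fun a => ⟨e a.1⟩, fun a => ⟨e.symm a.1⟩, fun a => by simp, fun a => by simp⟩,
      fun {a b} => e.le_iff_le⟩⟩
  have hx : ∀ {P : Type} [PartialOrder P] (x : P),
      Nonempty (↥((univ : Set (ULift.{u} P)) \ {⟨x⟩}) ≃o ULift.{u} {y // y ≠ x}) := fun x =>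
    ⟨⟨⟨fun a => ⟨a.1.1, fun h => a.2.2 (ULift.ext _ _ h)⟩, fun a => ⟨⟨a.1.1⟩, trivial, fun h =>
      a.1.2 (congrArg ULift.down h)⟩, fun a => rfl, fun a => rfl⟩, Iff.rfl⟩⟩
  induction h with
  | iso e => exact SHE.of_orderIso (hl e).some
  | symm _ ih => exact ih.symm
  | trans _ _ ih ih' => exact ih.trans ih'
  | up x hU _ =>
    refine (SHE.of_orderIso OrderIso.Set.univ).symm.trans (SHE.trans ?_ (SHE.of_orderIso (hx x).some))
    refine (hU.removable_iff.2 Removable.punit) _ _ _ trivial ⟨⟨⟨fun a => ⟨a.1.1, a.2.2⟩,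
      fun a => ⟨⟨a.1⟩, trivial, a.2⟩, fun a => rfl, fun a => rfl⟩, Iff.rfl⟩⟩
  | beat x m hm hmin =>
    refine (SHE.of_orderIso OrderIso.Set.univ).symm.trans (SHE.trans ?_ (SHE.of_orderIso (hx x).some))
    exact SHE.remove trivial (Or.inr (Dism.bot _ ⟨m⟩ ⟨trivial, hm⟩ fun y hy => hmin _ hy.2))

end Gamma

section Calculus

theorem Eqv.refl (P : FinPoset.{0}) : Eqv P P := Eqv.iso (OrderIso.refl P.carrier)

/-- Equivalence of subsets of finite posets. -/
def EqS {E F : Type} [PartialOrder E] [Finite E] [PartialOrder F] [Finite F]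
    (A : Set E) (B : Set F) : Prop := Eqv ⟨A⟩ ⟨B⟩

/-- A subset which is equivalent to a point. -/
def Triv {E : Type} [PartialOrder E] [Finite E] (A : Set E) : Prop := Eqv ⟨A⟩ ⟨PUnit⟩

variable {E F G : Type} [PartialOrder E] [Finite E] [PartialOrder F] [Finite F]
  [PartialOrder G] [Finite G] {A : Set E} {B : Set F} {C : Set G}

theorem EqS.refl (A : Set E) : EqS A A := Eqv.refl _
theorem EqS.symm (h : EqS A B) : EqS B A := Eqv.symm h
theorem EqS.trans (h : EqS A B) (h' : EqS B C) : EqS A C := Eqv.trans h h'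
theorem EqS.iso (e : A ≃o B) : EqS A B := Eqv.iso e
theorem EqS.triv (h : EqS A B) (hB : Triv B) : Triv A := Eqv.trans h hB
theorem Triv.eqS (h : Triv A) (hB : Triv B) : EqS A B := Eqv.trans h (Eqv.symm hB)
theorem Eqv.ofUniv : Eqv ⟨E⟩ ⟨(Set.univ : Set E)⟩ := Eqv.iso OrderIso.Set.univ.symm

theorem EqS.image (f : E → F) (h : ∀ a ∈ A, ∀ b ∈ A, f a ≤ f b ↔ a ≤ b) (hB : f '' A = B) :
    EqS A B := by
  subst hB
  refine EqS.iso (RelIso.ofSurjective (show A ↪o ↥(f '' A) from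
    ⟨⟨fun a => ⟨f a, mem_image_of_mem f a.2⟩, fun a b hab => ?_⟩, fun {a b} => h a a.2 b b.2⟩) ?_)
  · have := congrArg Subtype.val hab
    exact Subtype.ext (le_antisymm ((h a a.2 b b.2).1 (le_of_eq this))
      ((h b b.2 a a.2).1 (le_of_eq this.symm)))
  · rintro ⟨_, a, ha, rfl⟩; exact ⟨⟨a, ha⟩, rfl⟩

theorem EqS.remove_aux {x : E} (hx : x ∈ A) :
    Nonempty ({y : A // y ≠ ⟨x, hx⟩} ≃o ↥(A \ {x})) :=
  ⟨subSubIso A (fun y => y ≠ ⟨x, hx⟩) (A \ {x}) fun y =>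
    ⟨fun h => ⟨h.1, fun h' => h.2 (congrArg Subtype.val h')⟩,
      fun h => ⟨h.1, fun h' => h.2 (Subtype.ext h')⟩⟩⟩

theorem EqS.removeUp {x : E} (hx : x ∈ A) (h : Triv {y | y ∈ A ∧ y < x}) :
    EqS A (A \ {x}) := by
  refine (Eqv.up (⟨x, hx⟩ : A) (Eqv.trans (Eqv.iso (subSubIso A _ {y | y ∈ A ∧ y < x} ?_)) h)).trans
    (Eqv.iso (remove_aux hx).some)
  exact fun y => ⟨fun h => ⟨h.1, h.2⟩, fun h => ⟨h.1, h.2⟩⟩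

theorem EqS.removeBeat {x m : E} (hx : x ∈ A) (hm : m ∈ A) (hxm : x < m)
    (h : ∀ y ∈ A, x < y → m ≤ y) : EqS A (A \ {x}) :=
  (Eqv.beat (⟨x, hx⟩ : A) ⟨m, hm⟩ hxm fun y hy => h y y.2 hy).trans
    (Eqv.iso (remove_aux hx).some)

/-- Removal of a set of points whose lower links outside the set are trivial. -/
theorem EqS.removeLower (D : Set E) (hD : D ⊆ A)
    (h : ∀ d ∈ D, Triv {y | y ∈ A ∧ y ∉ D ∧ y < d}) : EqS A (A \ D) :=
  removal_down (fun A B => EqS A B) EqS.refl (fun _ _ _ => EqS.trans) A D hD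
    fun d hd B hdB hB => EqS.removeUp hdB (hB ▸ h d hd)

theorem EqS.removeBeats (D : Set E) (hD : D ⊆ A)
    (h : ∀ d ∈ D, ∃ m ∈ A, m ∉ D ∧ d < m ∧ ∀ y ∈ A, y ∉ D → d < y → m ≤ y) :
    EqS A (A \ D) := by
  refine removal_up (fun A B => EqS A B) EqS.refl
    (fun _ _ _ => EqS.trans) A D hD fun d hd B hdB hB => ?_
  obtain ⟨m, hmA, hmD, hm, hmin⟩ := h d hd
  have hm' : m ∈ {y | y ∈ B ∧ d < y} := by rw [hB]; exact ⟨hmA, hmD, hm⟩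
  refine EqS.removeBeat hdB hm'.1 hm fun y hy hdy => ?_
  have : y ∈ {y | y ∈ B ∧ d < y} := ⟨hy, hdy⟩
  rw [hB] at this
  exact hmin y this.1 this.2.1 hdy

theorem Triv.singleton (x : E) : Triv ({x} : Set E) :=
  Eqv.iso ⟨Equiv.ofUnique _ _, fun {a b} => by
    simp [Subsingleton.elim a b]⟩

theorem Triv.top {m : E} (hm : m ∈ A) (h : ∀ a ∈ A, a ≤ m) : Triv A := by
  have := EqS.removeBeats (A := A) (A \ {m}) sdiff_subset fun d hd =>
    ⟨m, hm, fun h => h.2 rfl, lt_of_le_of_ne (h d hd.1) hd.2, fun y hy hy' _ => ?_⟩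
  · rw [sdiff_sdiff_cancel_left (by simpa using hm)] at this
    exact this.triv (Triv.singleton m)
  · by_contra hc
    exact hy' ⟨hy, fun h => hc (h ▸ le_rfl)⟩

theorem Triv.bot {m : E} (hm : m ∈ A) (h : ∀ a ∈ A, m ≤ a) : Triv A := by
  have := EqS.removeLower (A := A) (A \ {m}) sdiff_subset fun d hd => ?_
  · rw [sdiff_sdiff_cancel_left (by simpa using hm)] at this
    exact this.triv (Triv.singleton m)
  · convert Triv.singleton m using 1
    ext y
    constructor
    · rintro ⟨h1, h2, -⟩
      by_contra hc
      exact h2 ⟨h1, hc⟩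
    · rintro rfl
      exact ⟨hm, fun h => h.2 rfl, lt_of_le_of_ne (h d hd.1) (Ne.symm hd.2)⟩

/-- A finite poset is equivalent to its opposite. -/
theorem Eqv.dual (P : Type) [PartialOrder P] [Finite P] : Eqv ⟨P⟩ ⟨Pᵒᵈ⟩ := by
  have aux : ∀ (P : Type) [PartialOrder P] [Finite P] (p : P),
      Triv {q : Pᵒᵈ × P | OrderDual.ofDual q.1 ≤ q.2 ∧ q.2 ≤ p} := by
    intro P _ _ p
    have h := EqS.removeBeats (A := {q : Pᵒᵈ × P | OrderDual.ofDual q.1 ≤ q.2 ∧ q.2 ≤ p})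
      {q | OrderDual.ofDual q.1 ≤ q.2 ∧ q.2 < p} (fun q hq => ⟨hq.1, hq.2.le⟩) fun q hq =>
      ⟨(q.1, p), ⟨hq.1.trans hq.2.le, le_rfl⟩, fun h => h.2.false,
        Prod.mk_lt_mk_iff_right.2 hq.2, fun y hy hy' hqy => ⟨hqy.le.1, ?_⟩⟩
    · refine h.triv (Triv.bot (m := (OrderDual.toDual p, p)) ⟨⟨le_rfl, le_rfl⟩, fun h => h.2.false⟩ ?_)
      intro y hy
      have : y.2 = p := by
        by_contra hc; exact hy.2 ⟨hy.1.1, lt_of_le_of_ne hy.1.2 hc⟩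
      exact ⟨this ▸ hy.1.1, this.ge⟩
    · by_contra hc
      exact hy' ⟨hy.1, lt_of_le_of_ne hy.2 fun h => hc h.ge⟩
  have key : ∀ (P : Type) [PartialOrder P] [Finite P],
      Eqv ⟨P⟩ ⟨({q | OrderDual.ofDual q.1 ≤ q.2} : Set (Pᵒᵈ × P))⟩ := by
    intro P _ _
    let R : LRel ({q | OrderDual.ofDual q.1 ≤ q.2} : Set (Pᵒᵈ × P)) P :=
      ⟨fun q p => q.1.2 ≤ p, fun _ _ _ => le_trans, fun l l' p h => h.2.trans⟩
    have h1 := EqS.removeBeats (A := (univ : Set (Cyl R))) {w | ∃ l, w = .lo l} (subset_univ _) ?_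
    have h2 := EqS.removeLower (A := (univ : Set (Cyl R))) {w | ∃ l, w = .hi l} (subset_univ _) ?_
    · refine Eqv.trans (Eqv.trans Eqv.ofUniv ?_) (Eqv.trans (h1.symm.trans h2) (Eqv.symm (Eqv.trans Eqv.ofUniv ?_)))
      · refine EqS.image (.hi : P → Cyl R) (by simp) ?_
        ext w; rcases w with w | w
        · exact ⟨by simp, fun h => absurd ⟨w, rfl⟩ h.2⟩
        · simp
      · refine EqS.image (.lo : _ → Cyl R) (by simp) ?_
        ext w; rcases w with w | w
        · exact ⟨fun _ => ⟨trivial, by simp⟩, fun _ => ⟨w, trivial, rfl⟩⟩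
        · simp
    · rintro _ ⟨p, rfl⟩
      refine EqS.triv (EqS.symm ?_) (aux P p)
      refine EqS.trans (B := {l : ({q | OrderDual.ofDual q.1 ≤ q.2} : Set (Pᵒᵈ × P)) | l.1.2 ≤ p})
        (EqS.symm (EqS.image Subtype.val (fun _ _ _ _ => Iff.rfl) ?_)) (EqS.image .lo (by simp) ?_)
      · ext q; simp [and_comm]
      · ext w; rcases w with w | w <;> simp [R, -Subtype.exists]
    · rintro _ ⟨l, rfl⟩
      refine ⟨.hi l.1.2, trivial, by simp, by simp [R], ?_⟩
      rintro (y | y) _ h h'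
      · exact absurd ⟨y, rfl⟩ h
      · simpa [R] using h'
  refine (key P).trans (Eqv.trans (Eqv.iso ?_) (Eqv.symm (key Pᵒᵈ)))
  exact ⟨⟨fun q => ⟨(q.1.2, q.1.1), q.2⟩, fun q => ⟨(q.1.2, q.1.1), q.2⟩, fun _ => rfl, fun _ => rfl⟩,
    and_comm⟩

/-- The same subset of the opposite poset. -/
def dualSet (A : Set E) : Set Eᵒᵈ := {x | OrderDual.ofDual x ∈ A}

theorem EqS.dual (A : Set E) : EqS A (dualSet A) :=
  (Eqv.dual A).trans (Eqv.iso ⟨⟨fun a => ⟨OrderDual.toDual a.1, a.2⟩,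
    fun a => ⟨OrderDual.ofDual a.1, a.2⟩, fun _ => rfl, fun _ => rfl⟩, Iff.rfl⟩)

/-- Removal of a set of points whose upper links outside the set are trivial. -/
theorem EqS.removeUpper (D : Set E) (hD : D ⊆ A)
    (h : ∀ d ∈ D, Triv {y | y ∈ A ∧ y ∉ D ∧ d < y}) : EqS A (A \ D) :=
  ((EqS.dual A).trans (EqS.removeLower (A := dualSet A) (dualSet D) (fun _ h => hD h)
    fun d hd => (EqS.dual _).symm.triv (h _ hd))).trans (EqS.dual (A \ D)).symm

/-- A monotone retraction onto `B` with trivial upper fibres is an equivalence. -/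
theorem EqS.of_upper_fibers (f : E → F) (hf : ∀ a ∈ A, ∀ b ∈ A, a ≤ b → f a ≤ f b)
    (hAB : ∀ a ∈ A, f a ∈ B) (h : ∀ b ∈ B, Triv {a | a ∈ A ∧ b ≤ f a}) : EqS A B := by
  let R : LRel B A := ⟨fun b a => b.1 ≤ f a, fun l a a' h h' => h.trans (hf _ a.2 _ a'.2 h'),
    fun l l' p h h' => le_trans (show l.1 ≤ l'.1 from h) h'⟩
  have h1 := EqS.removeUpper (A := (univ : Set (Cyl R))) {w | ∃ l, w = .lo l} (subset_univ _) ?_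
  have h2 := EqS.removeLower (A := (univ : Set (Cyl R))) {w | ∃ l, w = .hi l} (subset_univ _) ?_
  · refine Eqv.trans (Eqv.trans Eqv.ofUniv ?_) (Eqv.trans (h1.symm.trans h2)
      (Eqv.symm (Eqv.trans Eqv.ofUniv ?_)))
    · refine EqS.image (.hi : A → Cyl R) (by simp) ?_
      ext w; rcases w with w | w <;> simp [-Subtype.exists]
    · refine EqS.image (.lo : B → Cyl R) (by simp) ?_
      ext w; rcases w with w | w <;> simp [-Subtype.exists]
  · rintro _ ⟨a, rfl⟩
    refine Triv.top (m := .lo ⟨f a, hAB a a.2⟩) ⟨trivial, by simp, by simp [R]⟩ ?_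
    rintro (y | y) ⟨_, h, h'⟩
    · exact (Cyl.lo_le_hi.1 h'.le : _)
    · exact absurd ⟨y, rfl⟩ h
  · rintro _ ⟨b, rfl⟩
    refine EqS.triv (EqS.symm ?_) (h b b.2)
    refine EqS.trans (B := {a : A | b.1 ≤ f a})
      (EqS.symm (EqS.image Subtype.val (fun _ _ _ _ => Iff.rfl) ?_)) (EqS.image .hi (by simp) ?_)
    · ext q; simp; tauto
    · ext w; rcases w with w | w <;> simp [R, -Subtype.exists]

/-! ### Contractibility through fences -/

/-- Monotone maps which are connected by a fence. -/
def Fence {P Q : Type*} [Preorder P] [Preorder Q] (f g : P →o Q) : Prop :=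
  Relation.EqvGen (· ≤ ·) f g

namespace Fence
variable {P Q S : Type*} [Preorder P] [Preorder Q] [Preorder S] {f g h : P →o Q}
theorem refl (f : P →o Q) : Fence f f := Relation.EqvGen.refl _
theorem symm (h : Fence f g) : Fence g f := Relation.EqvGen.symm _ _ h
theorem trans (h1 : Fence f g) (h2 : Fence g h) : Fence f h := Relation.EqvGen.trans _ _ _ h1 h2
theorem of_le (h : f ≤ g) : Fence f g := Relation.EqvGen.rel _ _ h
theorem of_ge (h : g ≤ f) : Fence f g := (of_le h).symm
theorem comp_left (k : Q →o S) (h : Fence f g) : Fence (k.comp f) (k.comp g) := by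
  induction h with
  | rel _ _ h => exact of_le fun x => k.monotone (h x)
  | refl => exact refl _
  | symm _ _ _ ih => exact ih.symm
  | trans _ _ _ _ _ ih ih' => exact ih.trans ih'
theorem comp_right (k : S →o P) (h : Fence f g) : Fence (f.comp k) (g.comp k) := by
  induction h with
  | rel _ _ h => exact of_le fun x => h (k x)
  | refl => exact refl _
  | symm _ _ _ ih => exact ih.symm
  | trans _ _ _ _ _ ih ih' => exact ih.trans ih'
end Fence

/-- A finite poset whose identity is connected to a constant map by a fence is trivial. -/
theorem Eqv.of_fence {P : Type} [PartialOrder P] [Finite P] (c : P)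
    (h : Fence OrderHom.id (OrderHom.const P c)) : Eqv ⟨P⟩ ⟨PUnit⟩ := by
  induction hn : Nat.card P using Nat.strong_induction_on generalizing P with
  | _ n ih =>
  have red : ∀ x m : P, x ≠ m → (∀ f : P →o P, (∀ y, y ≠ x → f y = y) → f x = m → 
      Eqv ⟨{y // y ≠ x}⟩ ⟨PUnit⟩) := by
    intro x m hxm f hf hfx
    let r : P →o {y // y ≠ x} := ⟨fun y => ⟨f y, by
      by_cases hy : y = x
      · rw [hy, hfx]; exact hxm.symm
      · rw [hf y hy]; exact hy⟩, fun a b hab => f.monotone hab⟩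
    let i : {y // y ≠ x} →o P := ⟨Subtype.val, fun a b hab => hab⟩
    refine ih (Nat.card {y // y ≠ x}) ?_ (r c) ?_ rfl
    · rw [← hn]
      exact Finite.card_subtype_lt (x := x) (by simp)
    · have := (h.comp_left r).comp_right i
      rwa [show (r.comp OrderHom.id).comp i = OrderHom.id from
        OrderHom.ext _ _ (funext fun y => Subtype.ext (hf y y.2))] at this
  by_cases hup : ∃ x m : P, x < m ∧ ∀ y, x < y → m ≤ y
  · obtain ⟨x, m, hxm, hmin⟩ := hup
    classical
    refine (Eqv.beat x m hxm hmin).trans (red x m hxm.ne ⟨fun y => if y = x then m else y, ?_⟩ ?_ ?_)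
    · intro a b hab
      dsimp only
      split_ifs with h1 h2 h2
      · exact le_rfl
      · exact hmin b (lt_of_le_of_ne (h1 ▸ hab) (Ne.symm h2))
      · exact (h2 ▸ hab).trans hxm.le
      · exact hab
    · intro y hy; exact if_neg hy
    · exact if_pos rfl
  by_cases hdn : ∃ x m : P, m < x ∧ ∀ y, y < x → y ≤ m
  · obtain ⟨x, m, hxm, hmin⟩ := hdn
    classical
    refine (Eqv.up x ?_).trans (red x m hxm.ne' ⟨fun y => if y = x then m else y, ?_⟩ ?_ ?_)
    · exact Triv.top (A := {y | y < x}) (m := m) hxm hmin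
    · intro a b hab
      dsimp only
      split_ifs with h1 h2 h2
      · exact le_rfl
      · exact hxm.le.trans (h1 ▸ hab)
      · exact hmin a (lt_of_le_of_ne (h2 ▸ hab) h1)
      · exact hab
    · intro y hy; exact if_neg hy
    · exact if_pos rfl
  have rig : ∀ f : P →o P, (OrderHom.id ≤ f ∨ f ≤ OrderHom.id) → f = OrderHom.id := by
    rintro f (hf | hf)
    · by_contra hne
      have : {y | f y ≠ y}.Nonempty := by
        by_contra hc
        rw [not_nonempty_iff_eq_empty] at hc
        refine hne (OrderHom.ext _ _ (funext fun y => ?_))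
        by_contra hy
        exact (hc.subset hy : y ∈ (∅ : Set P))
      obtain ⟨x, hx, hmax⟩ := (toFinite {y | f y ≠ y}).exists_maximal this
      refine hup ⟨x, f x, lt_of_le_of_ne (hf x) (Ne.symm hx), fun y hxy => ?_⟩
      have : f y = y := by
        by_contra hy
        exact hxy.not_ge (hmax hy hxy.le)
      rw [← this]; exact f.monotone hxy.le
    · by_contra hne
      have : {y | f y ≠ y}.Nonempty := by
        by_contra hc
        rw [not_nonempty_iff_eq_empty] at hc
        refine hne (OrderHom.ext _ _ (funext fun y => ?_))
        by_contra hy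
        exact (hc.subset hy : y ∈ (∅ : Set P))
      obtain ⟨x, hx, hmin⟩ := (toFinite {y | f y ≠ y}).exists_minimal this
      refine hdn ⟨x, f x, lt_of_le_of_ne (hf x) hx, fun y hxy => ?_⟩
      have : f y = y := by
        by_contra hy
        exact hxy.not_ge (hmin hy hxy.le)
      rw [← this]; exact f.monotone hxy.le
  have key : ∀ f g : P →o P, Fence f g → (f = OrderHom.id ↔ g = OrderHom.id) := by
    intro f g hfg
    induction hfg with
    | rel f g h => exact ⟨fun hf => rig g (Or.inl (hf ▸ h)), fun hg => rig f (Or.inr (hg ▸ h))⟩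
    | refl => exact Iff.rfl
    | symm _ _ _ ih => exact ih.symm
    | trans _ _ _ _ _ ih ih' => exact ih.trans ih'
  have hc := (key _ _ h).1 rfl
  have hs : ∀ y : P, y = c := fun y => (DFunLike.congr_fun hc y).symm
  exact (Eqv.ofUniv (E := P)).trans (Triv.top (m := c) trivial fun a _ => (hs a).le)

/-- Two monotone self-maps of a subset related by a chain of comparisons. -/
theorem Triv.of_fence (c : A) (h : Fence OrderHom.id (OrderHom.const A c)) : Triv A :=
  Eqv.of_fence c h

/-- Conical contractibility. -/
theorem Triv.of_cone (f : E → E) (hf : ∀ a ∈ A, ∀ b ∈ A, a ≤ b → f a ≤ f b)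
    (hA : ∀ a ∈ A, f a ∈ A) (c : E) (hc : c ∈ A)
    (h : (∀ a ∈ A, f a ≤ a) ∨ ∀ a ∈ A, a ≤ f a)
    (h' : (∀ a ∈ A, f a ≤ c) ∨ ∀ a ∈ A, c ≤ f a) : Triv A := by
  let F : A →o A := ⟨fun a => ⟨f a, hA a a.2⟩, fun a b hab => hf a a.2 b b.2 hab⟩
  have h1 : Fence OrderHom.id F := by
    rcases h with h | h
    · exact Fence.of_ge fun a => h a a.2
    · exact Fence.of_le fun a => h a a.2
  have h2 : Fence F (OrderHom.const A ⟨c, hc⟩) := by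
    rcases h' with h' | h'
    · exact Fence.of_le fun a => h' a a.2
    · exact Fence.of_ge fun a => h' a a.2
  exact Triv.of_fence ⟨c, hc⟩ (h1.trans h2)

end Calculus

/-- The subdivision of an interval into `N` open edges (odd values) and `N + 1` vertices (even
values), ordered so that vertices are maximal. -/
@[ext] structure Fen (N : ℕ) where
  val : ℕ
  le_two_mul : val ≤ 2 * N

namespace Fen
variable {N M : ℕ}

instance : PartialOrder (Fen N) where
  le a b := a.val = b.val ∨ (a.val % 2 = 1 ∧ (b.val = a.val + 1 ∨ b.val + 1 = a.val))
  le_refl _ := Or.inl rfl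
  le_trans a b c h h' := by omega
  le_antisymm a b h h' := Fen.ext (by omega)

theorem le_def {a b : Fen N} : a ≤ b ↔
    a.val = b.val ∨ (a.val % 2 = 1 ∧ (b.val = a.val + 1 ∨ b.val + 1 = a.val)) := Iff.rfl

instance : Finite (Fen N) :=
  Finite.of_injective (fun a : Fen N => (⟨a.val, by have := a.2; omega⟩ : Fin (2 * N + 1)))
    fun a b h => Fen.ext (congrArg Fin.val h)

/-- Truncation to a cell. -/
def mk' (N k : ℕ) : Fen N := ⟨min k (2 * N), by omega⟩
@[simp] theorem mk'_val (N k : ℕ) : (mk' N k).val = min k (2 * N) := rfl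

theorem mk'_of_val (a : Fen N) : mk' N a.val = a := Fen.ext (by have := a.2; simp [this])

/-- The coarsening from `N * c` edges to `N` edges. -/
def coarse (c : ℕ) (a : Fen M) : Fen N := mk' N (a.val / (2 * c) + (a.val + (2 * c - 1)) / (2 * c))

end Fen

section Clamp
variable {ι : Type} {N : ℕ}

open Classical in
/-- Raise the coordinates in `W` to at least `j`. -/
noncomputable def raise (W : Set ι) (j : ℕ) (κ : ι → Fen N) : ι → Fen N :=
  fun i => if i ∈ W then Fen.mk' N (max (κ i).val j) else κ i

open Classical in
/-- Lower the coordinates in `W` to at most `j`. -/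
noncomputable def lower (W : Set ι) (j : ℕ) (κ : ι → Fen N) : ι → Fen N :=
  fun i => if i ∈ W then Fen.mk' N (min (κ i).val j) else κ i

theorem raise_mono (W : Set ι) (j : ℕ) : Monotone (raise W j : (ι → Fen N) → ι → Fen N) := by
  intro a b h i
  have := h i
  have ha := (a i).2
  have hb := (b i).2
  simp only [raise]
  split_ifs <;> simp only [Fen.le_def, Fen.mk'_val] at this ⊢ <;> omega

theorem lower_mono (W : Set ι) (j : ℕ) : Monotone (lower W j : (ι → Fen N) → ι → Fen N) := by
  intro a b h i
  have := h i
  have ha := (a i).2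
  have hb := (b i).2
  simp only [lower]
  split_ifs <;> simp only [Fen.le_def, Fen.mk'_val] at this ⊢ <;> omega

theorem raise_zero (W : Set ι) (κ : ι → Fen N) : raise W 0 κ = κ := by
  funext i; simp [raise, Fen.mk'_of_val]

theorem lower_top (W : Set ι) (κ : ι → Fen N) : lower W (2 * N) κ = κ := by
  funext i; simp [lower, (κ i).2, Fen.mk'_of_val]

theorem raise_step (W : Set ι) (j : ℕ) (κ : ι → Fen N) :
    (j % 2 = 1 → raise W j κ ≤ raise W (j + 1) κ) ∧
      (j % 2 = 0 → raise W (j + 1) κ ≤ raise W j κ) := by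
  refine ⟨fun hj i => ?_, fun hj i => ?_⟩ <;>
  · have ha := (κ i).2
    simp only [raise]
    split_ifs
    · simp only [Fen.le_def, Fen.mk'_val]; omega
    · exact le_rfl

theorem lower_step (W : Set ι) (j : ℕ) (κ : ι → Fen N) :
    (j % 2 = 1 → lower W j κ ≤ lower W (j + 1) κ) ∧
      (j % 2 = 0 → lower W (j + 1) κ ≤ lower W j κ) := by
  refine ⟨fun hj i => ?_, fun hj i => ?_⟩ <;>
  · have ha := (κ i).2
    simp only [lower]
    split_ifs
    · simp only [Fen.le_def, Fen.mk'_val]; omega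
    · exact le_rfl

/-- The restriction of a monotone map to an invariant subset. -/
def restr {P : Type*} [PartialOrder P] (f : P → P) (hf : Monotone f) (A : Set P)
    (h : ∀ a ∈ A, f a ∈ A) : A →o A := ⟨fun a => ⟨f a, h a a.2⟩, fun _ _ hab => hf hab⟩

theorem Fence.of_steps {P : Type*} [PartialOrder P] (A : Set P) (f : ℕ → P → P)
    (hf : ∀ j, Monotone (f j)) (h : ∀ j, ∀ a ∈ A, f j a ∈ A)
    (hs : ∀ j x, (j % 2 = 1 → f j x ≤ f (j + 1) x) ∧ (j % 2 = 0 → f (j + 1) x ≤ f j x)) (n : ℕ) :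
    Fence (restr (f 0) (hf 0) A (h 0)) (restr (f n) (hf n) A (h n)) := by
  induction n with
  | zero => exact Fence.refl _
  | succ n ih =>
    rcases Nat.mod_two_eq_zero_or_one n with hn | hn
    · exact ih.trans (Fence.of_ge fun x => (hs n x).2 hn)
    · exact ih.trans (Fence.of_le fun x => (hs n x).1 hn)

theorem Fence.raise (W : Set ι) (A : Set (ι → Fen N)) (h : ∀ j, ∀ a ∈ A, raise W j a ∈ A) :
    Fence OrderHom.id (restr (raise W (2 * N)) (raise_mono _ _) A (h _)) := by
  convert Fence.of_steps A (fun j => _root_.raise W j) (raise_mono W) h (raise_step W) (2 * N)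
  ext x
  simp [restr, raise_zero]

theorem Fence.lower (W : Set ι) (A : Set (ι → Fen N)) (h : ∀ j, ∀ a ∈ A, lower W j a ∈ A) :
    Fence OrderHom.id (restr (lower W 0) (lower_mono _ _) A (h _)) := by
  convert (Fence.of_steps A (fun j => _root_.lower W j) (lower_mono W) h (lower_step W) (2 * N)).symm
  ext x
  simp [restr, lower_top]

/-- A composite of self-maps each connected to the identity. -/
theorem Fence.comp_id {P : Type*} [PartialOrder P] {f g : P →o P} (hf : Fence OrderHom.id f)
    (hg : Fence OrderHom.id g) : Fence OrderHom.id (g.comp f) :=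
  hf.trans (hg.comp_right f)

theorem Triv.of_fence_const {P : Type} [PartialOrder P] {A : Set P} [Finite A] {f : A →o A}
    (hf : Fence OrderHom.id f) (c : A) (hc : ∀ a, f a = c) : Eqv ⟨A⟩ ⟨PUnit⟩ :=
  Eqv.of_fence c (hf.trans (by
    rw [show f = OrderHom.const A c from OrderHom.ext _ _ (funext hc)]; exact Fence.refl _))

variable [Finite ι]

/-- Sub-boxes are trivial. -/
theorem Triv.box (lo hi : ι → ℕ) (h : ∀ i, lo i ≤ hi i) (hN : ∀ i, hi i ≤ 2 * N) :
    Triv {κ : ι → Fen N | ∀ i, lo i ≤ (κ i).val ∧ (κ i).val ≤ hi i} := by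
  classical
  set A := {κ : ι → Fen N | ∀ i, lo i ≤ (κ i).val ∧ (κ i).val ≤ hi i}
  have key : ∀ s : Finset ι, ∃ f : A →o A, Fence OrderHom.id f ∧
      ∀ a, ∀ i ∈ s, ((f a).1 i).val = lo i := by
    intro s
    induction s using Finset.induction_on with
    | empty => exact ⟨_, Fence.refl _, by simp⟩
    | insert i s hi ih =>
      obtain ⟨f, hf, hfs⟩ := ih
      let g : ℕ → (ι → Fen N) → ι → Fen N := fun j =>
        if lo i ≤ j then lower {i} j else lower {i} (lo i)
      have hg : ∀ j, Monotone (g j) := fun j => by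
        dsimp only [g]; split_ifs <;> exact lower_mono _ _
      have hgA : ∀ j, ∀ a ∈ A, g j a ∈ A := fun j a ha i' => by
        have := ha i'
        have := hN i'
        dsimp only [g]
        split_ifs <;> simp only [lower, mem_singleton_iff] <;> split_ifs <;> try assumption
        all_goals subst i'; simp only [Fen.mk'_val]; omega
      have hgs : ∀ j x, (j % 2 = 1 → g j x ≤ g (j + 1) x) ∧ (j % 2 = 0 → g (j + 1) x ≤ g j x) := by
        intro j x
        dsimp only [g]
        split_ifs with h1 h2 h2
        · exact lower_step _ _ _
        · omega
        · rw [show j + 1 = lo i by omega]; simp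
        · simp
      refine ⟨(restr (g 0) (hg 0) A (hgA 0)).comp f, hf.comp_id ?_, ?_⟩
      · refine Fence.trans (g := restr (g (2 * N)) (hg _) A (hgA _)) (Fence.of_le fun x => ?_)
          (Fence.of_steps A g hg hgA hgs (2 * N)).symm
        have hx : g (2 * N) x = x := by
          dsimp only [g]; rw [if_pos ((h i).trans (hN i)), lower_top]
        exact (Subtype.ext hx.symm : x = ⟨g (2 * N) x, _⟩).le
      · intro a i' hi'
        have h0 : g 0 = lower {i} (lo i) := by
          dsimp only [g]; split_ifs with h0
          · rw [Nat.le_zero.1 h0]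
          · rfl
        simp only [restr, OrderHom.comp_coe, Function.comp, OrderHom.coe_mk, h0, lower,
          mem_singleton_iff]
        have h1 := (f a).2 i'
        have h2 := hN i'
        split_ifs with hii
        · subst hii; simp only [Fen.mk'_val]; omega
        · exact hfs a i' (Finset.mem_of_mem_insert_of_ne hi' hii)
  have := Fintype.ofFinite ι
  obtain ⟨f, hf, hfs⟩ := key Finset.univ
  refine Triv.of_fence_const hf ⟨fun i => Fen.mk' N (lo i), fun i => ?_⟩ fun a => ?_
  · have := h i; have := hN i; simp; omega
  · ext i
    have := h i; have := hN i
    simp [hfs a i]; omega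

end Clamp

section Att
variable {Λ S S' P Q : Type} [PartialOrder S] [PartialOrder S'] [PartialOrder P] [PartialOrder Q]

/-- The poset obtained from `P` by attaching, for each index `l`, a cone over `S` along `ψ l`. -/
inductive Att (ψ : Λ → S →o P) : Type
  | base (p : P) : Att ψ
  | cyl (l : Λ) (s : S) : Att ψ
  | apex (l : Λ) : Att ψ

namespace Att
variable {ψ : Λ → S →o P}

/-- The order of `Att ψ`. -/
def le : Att ψ → Att ψ → Prop
  | base p, base q => p ≤ q
  | cyl l s, base p => ψ l s ≤ p
  | cyl l s, cyl l' s' => l = l' ∧ s ≤ s'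
  | cyl l _, apex l' => l = l'
  | apex l, apex l' => l = l'
  | _, _ => False

instance : PartialOrder (Att ψ) where
  le := le
  le_refl a := by cases a <;> simp [le]
  le_trans a b c h h' := by
    cases a <;> cases b <;> cases c <;> simp only [le] at h h' ⊢
    · exact h.trans h'
    · exact h.trans h'
    · obtain ⟨rfl, h⟩ := h; exact ((ψ _).monotone h).trans h'
    · exact ⟨h.1.trans h'.1, h.2.trans h'.2⟩
    · exact h.1.trans h'
    · exact h.trans h'
    · exact h.trans h'
  le_antisymm a b h h' := by
    cases a <;> cases b <;> simp only [le] at h h'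
    · exact congrArg _ (le_antisymm h h')
    · obtain ⟨rfl, h⟩ := h; rw [le_antisymm h h'.2]
    · rw [h]

@[simp] theorem base_le_base {p q : P} : (base p : Att ψ) ≤ base q ↔ p ≤ q := Iff.rfl
@[simp] theorem cyl_le_base {l : Λ} {s : S} {p : P} : (cyl l s : Att ψ) ≤ base p ↔ ψ l s ≤ p := Iff.rfl
@[simp] theorem cyl_le_cyl {l l' : Λ} {s s' : S} :
    (cyl l s : Att ψ) ≤ cyl l' s' ↔ l = l' ∧ s ≤ s' := Iff.rfl
@[simp] theorem cyl_le_apex {l l' : Λ} {s : S} : (cyl l s : Att ψ) ≤ apex l' ↔ l = l' := Iff.rfl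
@[simp] theorem apex_le_apex {l l' : Λ} : (apex l : Att ψ) ≤ apex l' ↔ l = l' := Iff.rfl
@[simp] theorem not_base_le_cyl {l : Λ} {s : S} {p : P} : ¬ (base p : Att ψ) ≤ cyl l s := id
@[simp] theorem not_base_le_apex {l : Λ} {p : P} : ¬ (base p : Att ψ) ≤ apex l := id
@[simp] theorem not_apex_le_cyl {l l' : Λ} {s : S} : ¬ (apex l : Att ψ) ≤ cyl l' s := id
@[simp] theorem not_apex_le_base {l : Λ} {p : P} : ¬ (apex l : Att ψ) ≤ base p := id

theorem lt_iff {a b : Att ψ} : a < b ↔ a ≤ b ∧ a ≠ b := lt_iff_le_and_ne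

instance [Finite Λ] [Finite S] [Finite P] : Finite (Att ψ) :=
  Finite.of_surjective (fun x : P ⊕ (Λ × S) ⊕ Λ => match x with
    | .inl p => base p | .inr (.inl x) => cyl x.1 x.2 | .inr (.inr l) => apex l) fun x => by
    cases x with
    | base p => exact ⟨.inl p, rfl⟩
    | cyl l s => exact ⟨.inr (.inl (l, s)), rfl⟩
    | apex l => exact ⟨.inr (.inr l), rfl⟩

theorem baseTriv [Finite Λ] [Finite S] [Finite P] (p : P) :
    Triv {x : Att ψ | ∃ q, x = base q ∧ p ≤ q} :=
  Triv.bot (m := base p) ⟨p, rfl, le_rfl⟩ (by rintro _ ⟨q, rfl, h⟩; exact h)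

variable [Finite Λ] [Finite S] [Finite S'] [Finite P] [Finite Q]

/-- Attaching cones along comparable maps from spheres which are related by a map with trivial
upper fibres. -/
theorem reindex (φ : S' →o S) (hφ : ∀ s, Triv {s' | s ≤ φ s'}) (ψ : Λ → S →o P)
    (ψ' : Λ → S' →o P) (h : ∀ l s', ψ l (φ s') ≤ ψ' l s') : Eqv ⟨Att ψ⟩ ⟨Att ψ'⟩ := by
  let R : LRel S S' := ⟨fun s s' => s ≤ φ s', fun _ _ _ h h' => h.trans (φ.monotone h'),
    fun _ _ _ h h' => le_trans h h'⟩
  let χ : Λ → Cyl R →o P := fun l => ⟨fun x => match x with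
    | .lo s => ψ l s | .hi s' => ψ' l s', by
      rintro (x | x) (y | y) hxy
      · exact (ψ l).monotone hxy
      · exact ((ψ l).monotone hxy).trans (h l y)
      · exact hxy.elim
      · exact (ψ' l).monotone hxy⟩
  have χlo : ∀ l s, χ l (.lo s) = ψ l s := fun _ _ => rfl
  have χhi : ∀ l s, χ l (.hi s) = ψ' l s := fun _ _ => rfl
  have h1 := EqS.removeLower (A := (univ : Set (Att χ))) {w | ∃ l s, w = .cyl l (.hi s)}
    (subset_univ _) ?_
  have h2 := EqS.removeUpper (A := (univ : Set (Att χ))) {w | ∃ l s, w = .cyl l (.lo s)}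
    (subset_univ _) ?_
  · refine Eqv.trans (Eqv.trans Eqv.ofUniv ?_) (Eqv.trans (h1.symm.trans h2)
      (Eqv.symm (Eqv.trans Eqv.ofUniv ?_)))
    · refine EqS.image (A := univ) (fun x => match x with
        | .base p => .base p | .cyl l s => .cyl l (.lo s) | .apex l => .apex l) ?_ ?_
      · rintro (a | a | a) - (b | b | b) - <;> simp [χlo]
      · ext w
        constructor
        · rintro ⟨a | a | a, -, rfl⟩ <;> simp
        · rcases w with p | ⟨l, s | s⟩ | l
          · exact fun _ => ⟨.base p, trivial, rfl⟩
          · exact fun _ => ⟨.cyl l s, trivial, rfl⟩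
          · exact fun h => absurd ⟨l, s, rfl⟩ h.2
          · exact fun _ => ⟨.apex l, trivial, rfl⟩
    · refine EqS.image (A := univ) (fun x => match x with
        | .base p => .base p | .cyl l s => .cyl l (.hi s) | .apex l => .apex l) ?_ ?_
      · rintro (a | a | a) - (b | b | b) - <;> simp [χhi]
      · ext w
        constructor
        · rintro ⟨a | a | a, -, rfl⟩ <;> simp
        · rcases w with p | ⟨l, s | s⟩ | l
          · exact fun _ => ⟨.base p, trivial, rfl⟩
          · exact fun h => absurd ⟨l, s, rfl⟩ h.2
          · exact fun _ => ⟨.cyl l s, trivial, rfl⟩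
          · exact fun _ => ⟨.apex l, trivial, rfl⟩
  · rintro _ ⟨l, s, rfl⟩
    have hZ : EqS {s' | s ≤ φ s'} {x : Att χ | ∃ s', x = .cyl l (.hi s') ∧ s ≤ φ s'} := by
      refine EqS.image (fun s' => .cyl l (.hi s')) (by simp) ?_
      ext w; simp only [mem_image, mem_setOf_eq]
      exact ⟨fun ⟨a, h, e⟩ => ⟨a, e.symm, h⟩, fun ⟨a, h, e⟩ => ⟨a, e, h.symm⟩⟩
    have e1 := EqS.removeUp (x := (.apex l : Att χ)) (A := {y | y ∈ univ ∧
      y ∉ {w | ∃ l s, w = .cyl l (.lo s)} ∧ .cyl l (.lo s) < y}) ?_ ?_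
    have e2 := EqS.removeUpper (A := {y | y ∈ univ ∧
      y ∉ {w : Att χ | ∃ l s, w = .cyl l (.lo s)} ∧ .cyl l (.lo s) < y} \ {.apex l})
      {x : Att χ | ∃ s', x = .cyl l (.hi s') ∧ s ≤ φ s'} ?_ ?_
    · refine (e1.trans e2).triv ?_
      convert baseTriv (ψ := χ) (ψ l s) using 1
      ext (p | ⟨l', s' | s'⟩ | l') <;> simp [lt_iff, χlo, R] <;> tauto
    · rintro _ ⟨s', rfl, hs⟩
      simp [lt_iff, R, hs]
    · rintro _ ⟨s', rfl, hs⟩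
      convert baseTriv (ψ := χ) (ψ' l s') using 1
      ext (p | ⟨l', t | t⟩ | l')
      · simp only [lt_iff, χlo, χhi, R, mem_setOf_eq, mem_diff, cyl_le_base]
        simp only [true_and, reduceCtorEq, base.injEq]
        simp
        exact fun hp => (((ψ l).monotone hs).trans (h l s')).trans hp
      · simp
      · simp only [lt_iff, R, mem_setOf_eq, mem_diff]; simp; tauto
      · simp [lt_iff]; tauto
    · simp [lt_iff]
    · convert hZ.symm.triv (hφ s) using 1
      ext (p | ⟨l', t | t⟩ | l') <;> simp [lt_iff, R] <;> tauto
  · rintro _ ⟨l, s, rfl⟩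
    refine Triv.top (m := .cyl l (.lo (φ s))) ⟨trivial, by simp, by simp [lt_iff, R]⟩ ?_
    rintro (p | ⟨l', t | t⟩ | l') ⟨-, h, h'⟩
    · simp [lt_iff] at h'
    · simpa [lt_iff, R] using h'
    · exact absurd ⟨l', t, rfl⟩ h
    · simp [lt_iff] at h'

end Att
end Att

namespace Fen
variable {N M c : ℕ}

theorem coarse_eq (hc : 0 < c) (hM : M = N * c) (a : Fen M) {q r : ℕ} (h : a.val = 2 * c * q + r)
    (hr : r < 2 * c) : (coarse c a : Fen N).val = if r = 0 then 2 * q else 2 * q + 1 := by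
  have ha := a.2
  have h1 : a.val / (2 * c) = q := by
    rw [h, Nat.mul_add_div (by omega), Nat.div_eq_of_lt hr, add_zero]
  have h2 : (a.val + (2 * c - 1)) / (2 * c) = if r = 0 then q else q + 1 := by
    rw [h, add_assoc, Nat.mul_add_div (by omega)]
    split_ifs with h0
    · rw [Nat.div_eq_of_lt (by omega), add_zero]
    · rw [Nat.div_eq_of_lt_le (k := 1)] <;> omega
  have h3 : r = 0 → q ≤ N := by
    intro h0
    have : c * q ≤ c * N := by subst hM; nlinarith
    exact Nat.le_of_mul_le_mul_left this hc
  have h4 : r ≠ 0 → q < N := by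
    intro h0
    have : c * q < c * N := by
      subst hM
      have : 2 * (c * q) < 2 * (c * N) := by
        have : 0 < r := Nat.pos_of_ne_zero h0
        nlinarith
      omega
    exact Nat.lt_of_mul_lt_mul_left this
  simp only [coarse, mk'_val, h1, h2]
  split_ifs with h0
  · have := h3 h0; omega
  · have := h4 h0; omega

theorem exists_div (hc : 0 < c) (n : ℕ) : ∃ q r, n = 2 * c * q + r ∧ r < 2 * c :=
  ⟨n / (2 * c), n % (2 * c), (Nat.div_add_mod _ _).symm, Nat.mod_lt _ (by omega)⟩

theorem coarse_mono (hc : 0 < c) (hM : M = N * c) : Monotone (coarse c : Fen M → Fen N) := by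
  intro a b h
  rw [le_def] at h
  rcases h with h | ⟨h, h'⟩
  · rw [show a = b from Fen.ext h]
  obtain ⟨q, r, e, hr⟩ := exists_div hc a.val
  have hodd : r % 2 = 1 := by
    have : (2 * c * q + r) % 2 = r % 2 := by rw [mul_assoc]; omega
    omega
  have ha := coarse_eq hc hM a e hr
  rw [if_neg (by omega)] at ha
  rcases h' with h' | h'
  · rcases Nat.lt_or_ge (r + 1) (2 * c) with h1 | h1
    · have hb := coarse_eq hc hM b (q := q) (r := r + 1) (by omega) h1
      rw [if_neg (by omega)] at hb
      rw [le_def]; omega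
    · have hb := coarse_eq hc hM b (q := q + 1) (r := 0) (by rw [mul_add]; omega) (by omega)
      rw [if_pos rfl] at hb
      rw [le_def]; omega
  · have hb := coarse_eq hc hM b (q := q) (r := r - 1) (by omega) (by omega)
    rw [le_def, hb]; split_ifs <;> omega

theorem coarse_fiber (hc : 0 < c) (hM : M = N * c) (a : Fen N) : ∃ lo hi : ℕ, lo ≤ hi ∧ hi ≤ 2 * M ∧
    (∀ b : Fen M, a ≤ coarse c b ↔ lo ≤ b.val ∧ b.val ≤ hi) ∧ (a.val = 0 → hi = 0) ∧
    (a.val = 2 * N → lo = 2 * M) := by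
  have ha := a.2
  obtain ⟨v, hv⟩ : ∃ v, a.val = 2 * v ∨ a.val = 2 * v + 1 := ⟨a.val / 2, by omega⟩
  rcases hv with hv | hv
  · refine ⟨2 * c * v, 2 * c * v, le_rfl, ?_, fun b => ?_, ?_, ?_⟩
    · have : v ≤ N := by omega
      subst hM; nlinarith
    · obtain ⟨q, r, e, hr⟩ := exists_div hc b.val
      have hb := coarse_eq hc hM b e hr
      rw [le_def, hb, hv, e]
      split_ifs with h0
      · subst h0
        constructor
        · intro h
          have : q = v := by omega
          subst this; omega
        · intro h
          have h1 : 2 * c * v = 2 * c * q := by omega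
          have := Nat.eq_of_mul_eq_mul_left (by omega) h1
          omega
      · constructor
        · intro h; omega
        · intro h
          exfalso
          rcases Nat.lt_trichotomy q v with h1 | rfl | h1
          · have : 2 * c * (q + 1) ≤ 2 * c * v := Nat.mul_le_mul_left _ h1
            rw [mul_add] at this; omega
          · omega
          · have : 2 * c * (v + 1) ≤ 2 * c * q := Nat.mul_le_mul_left _ h1
            rw [mul_add] at this; omega
    · intro h; have : v = 0 := by omega
      subst this; simp
    · intro h
      have : v = N := by omega
      subst this; subst hM; ring
  · refine ⟨2 * c * v, 2 * c * (v + 1), Nat.mul_le_mul_left _ (by omega), ?_, fun b => ?_, ?_, ?_⟩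
    · have : v + 1 ≤ N := by omega
      subst hM; nlinarith
    · obtain ⟨q, r, e, hr⟩ := exists_div hc b.val
      have hb := coarse_eq hc hM b e hr
      rw [le_def, hb, hv, e, mul_add]
      have key : ∀ x y : ℕ, x < y → 2 * c * x + 2 * c ≤ 2 * c * y := fun x y h => by
        have : 2 * c * (x + 1) ≤ 2 * c * y := Nat.mul_le_mul_left _ h
        rwa [mul_add, mul_one] at this
      split_ifs with h0
      · subst h0
        constructor
        · intro h
          have : q = v ∨ q = v + 1 := by omega
          rcases this with rfl | rfl
          · omega
          · rw [mul_add]; omega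
        · intro h
          rcases Nat.lt_trichotomy q v with h1 | rfl | h1
          · have := key _ _ h1; omega
          · omega
          · rcases Nat.lt_trichotomy q (v + 1) with h2 | rfl | h2
            · omega
            · omega
            · have h3 := key _ _ h2; rw [mul_add] at h3; omega
      · constructor
        · intro h
          have : q = v := by omega
          subst this; omega
        · intro h
          rcases Nat.lt_trichotomy q v with h1 | rfl | h1
          · have := key _ _ h1; omega
          · omega
          · have := key _ _ h1; omega
    · omega
    · omega

end Fen

/-- The boundary of a subdivided cube. -/
def Sph (ι : Type) (N : ℕ) : Set (ι → Fen N) := {κ | ∃ i, (κ i).val = 0 ∨ (κ i).val = 2 * N}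

instance {ι : Type} [Finite ι] {N : ℕ} : Finite (Sph ι N) := inferInstance

/-- Coarsening of the boundary of a subdivided cube. -/
def Sph.coarse {ι : Type} {N c M : ℕ} (hc : 0 < c) (hM : M = N * c) : Sph ι M →o Sph ι N where
  toFun κ := ⟨fun i => (κ.1 i).coarse c, by
    obtain ⟨κ, i, h⟩ := κ
    refine ⟨i, ?_⟩
    rcases h with h | h
    · left; rw [Fen.coarse_eq hc hM _ (q := 0) (r := 0) (by simp [h]) (by omega)]; simp
    · right; rw [Fen.coarse_eq hc hM _ (q := N) (r := 0) (by rw [h, hM]; ring) (by omega)]; simp⟩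
  monotone' _ _ h i := Fen.coarse_mono hc hM (h i)

theorem Sph.coarse_fiber {ι : Type} [Finite ι] {N c M : ℕ} (hc : 0 < c) (hM : M = N * c)
    (s : Sph ι N) : Triv {s' : Sph ι M | s ≤ Sph.coarse hc hM s'} := by
  choose lo hi h1 h2 h3 h4 h5 using fun i => Fen.coarse_fiber hc hM (s.1 i)
  refine EqS.triv (EqS.image (fun s' : Sph ι M => s'.1) (fun _ _ _ _ => Iff.rfl) ?_)
    (Triv.box lo hi h1 h2)
  ext κ
  constructor
  · rintro ⟨κ, h, rfl⟩ i
    exact (h3 i _).1 (h i)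
  · intro h
    obtain ⟨i, hi⟩ := s.2
    refine ⟨⟨κ, i, ?_⟩, fun j => (h3 j _).2 (h j), rfl⟩
    rcases hi with hi | hi
    · have := h i; have := h4 i hi; omega
    · have := h i; have := h5 i hi; have := h2 i; omega

section
open scoped unitInterval Topology

/-- A poset with its Alexandrov topology. -/
def Al (P : Type u) : Type u := P

instance {P : Type u} [PartialOrder P] : PartialOrder (Al P) := inferInstanceAs (PartialOrder P)
instance {P : Type u} [PartialOrder P] : TopologicalSpace (Al P) := alexTop P
instance {P : Type u} [Finite P] : Finite (Al P) := inferInstanceAs (Finite P)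

section Al
variable {P : Type*} [PartialOrder P] {T : Type*} [TopologicalSpace T]

theorem Al.isOpen_iff {s : Set (Al P)} : IsOpen s ↔ IsLowerSet s := Iff.rfl

theorem Al.tendsto_iff {f : T → Al P} {l : Filter T} {a : Al P} :
    Filter.Tendsto f l (𝓝 a) ↔ ∀ᶠ t in l, f t ≤ a := by
  have : 𝓝 a = Filter.principal (Iic a) := by
    refine le_antisymm (Filter.le_principal_iff.2 ?_) ?_
    · exact IsOpen.mem_nhds (Al.isOpen_iff.2 (isLowerSet_Iic a)) le_rfl
    · intro s hs
      obtain ⟨u, hus, hu, ha⟩ := mem_nhds_iff.1 hs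
      exact fun x hx => hus (Al.isOpen_iff.1 hu hx ha)
  rw [this, Filter.tendsto_principal]; rfl

theorem Al.continuous_iff {f : T → Al P} : Continuous f ↔ ∀ t, ∀ᶠ t' in 𝓝 t, f t' ≤ f t := by
  simp only [continuous_iff_continuousAt, ContinuousAt, Al.tendsto_iff]

theorem Al.continuous_of_monotone {Q : Type*} [PartialOrder Q] {f : Al P → Al Q}
    (hf : Monotone f) : Continuous f :=
  continuous_def.2 fun s hs => Al.isOpen_iff.2 fun _ _ h ha => Al.isOpen_iff.1 hs (hf h) ha

theorem Al.continuousOn_iff {f : T → Al P} {K : Set T} :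
    ContinuousOn f K ↔ ∀ t ∈ K, ∀ᶠ t' in 𝓝[K] t, f t' ≤ f t := by
  simp only [ContinuousOn, ContinuousWithinAt, Al.tendsto_iff]

end Al

/-- The cell containing a point of the subdivided interval. -/
noncomputable def cell (N : ℕ) (t : I) : Fen N :=
  Fen.mk' N (⌊(N * t : ℝ)⌋₊ + ⌈(N * t : ℝ)⌉₊)

theorem cell_val (N : ℕ) (t : I) : (cell N t).val = ⌊(N * t : ℝ)⌋₊ + ⌈(N * t : ℝ)⌉₊ := by
  have h : (N * t : ℝ) ≤ N := mul_le_of_le_one_right (by positivity) t.2.2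
  have h1 : ⌊(N * t : ℝ)⌋₊ ≤ N := Nat.floor_le_of_le h
  have h2 : ⌈(N * t : ℝ)⌉₊ ≤ N := Nat.ceil_le.2 h
  have : (cell N t).val = min (⌊(N * t : ℝ)⌋₊ + ⌈(N * t : ℝ)⌉₊) (2 * N) := rfl
  rw [this]; omega

theorem cell_cases (N : ℕ) (t : I) : (∃ n : ℕ, (N * t : ℝ) = n ∧ (cell N t).val = 2 * n) ∨
    ∃ n : ℕ, (n : ℝ) < N * t ∧ (N * t : ℝ) < n + 1 ∧ (cell N t).val = 2 * n + 1 := by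
  have h0 : (0 : ℝ) ≤ N * t := mul_nonneg (by positivity) t.2.1
  rw [cell_val]
  rcases (Nat.floor_le h0).eq_or_lt with h | h
  · left
    refine ⟨_, h.symm, ?_⟩
    rw [← h]; simp; omega
  · right
    refine ⟨_, h, Nat.lt_floor_add_one _, ?_⟩
    have : ⌈(N * t : ℝ)⌉₊ = ⌊(N * t : ℝ)⌋₊ + 1 := by
      rw [Nat.ceil_eq_iff (by omega)]
      exact ⟨by simpa using h, by push_cast; exact (Nat.lt_floor_add_one _).le⟩
    omega

theorem cell_eq_even {N : ℕ} {t : I} {n : ℕ} (h : (N * t : ℝ) = n) : (cell N t).val = 2 * n := by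
  rw [cell_val, h]; simp; omega

theorem cell_eq_odd {N : ℕ} {t : I} {n : ℕ} (h : (n : ℝ) < N * t) (h' : (N * t : ℝ) < n + 1) :
    (cell N t).val = 2 * n + 1 := by
  rcases cell_cases N t with ⟨m, h1, -⟩ | ⟨m, h1, h2, h3⟩
  · rw [h1] at h h'
    have h1 : n < m := by exact_mod_cast h
    have h2 : m < n + 1 := by exact_mod_cast h'
    omega
  · have e1 : n < m + 1 := by exact_mod_cast h.trans h2
    have e2 : m < n + 1 := by exact_mod_cast h1.trans h'
    omega

theorem cell_eventually_le (N : ℕ) (t : I) : ∀ᶠ t' in 𝓝 t, cell N t' ≤ cell N t := by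
  have hc : Continuous fun t : I => (N * t : ℝ) := by fun_prop
  rcases cell_cases N t with ⟨n, h, h'⟩ | ⟨n, h1, h2, h3⟩
  · filter_upwards [hc.continuousAt.eventually (Ioo_mem_nhds (a := (n : ℝ) - 1) (b := n + 1)
      (by simp [h]) (by simp [h]))] with s hs
    refine Fen.le_def.2 ?_
    rw [h']
    rcases cell_cases N s with ⟨m, e, e'⟩ | ⟨m, e1, e2, e3⟩
    · rw [e] at hs
      have h1 : n < m + 1 := by have := hs.1; exact_mod_cast (by linarith : (n : ℝ) < m + 1)
      have h2 : m < n + 1 := by exact_mod_cast hs.2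
      omega
    · have h1 : m < n + 1 := by exact_mod_cast e1.trans hs.2
      have h2 : n < m + 2 := by
        have := hs.1; exact_mod_cast (by linarith : (n : ℝ) < m + 2)
      omega
  · filter_upwards [hc.continuousAt.eventually (Ioo_mem_nhds h1 h2)] with s hs
    refine Fen.le_def.2 ?_
    rw [h3, cell_eq_odd hs.1 hs.2]
    exact Or.inl rfl

theorem coarse_cell {N c M : ℕ} (hc : 0 < c) (hM : M = N * c) (t : I) :
    (Fen.coarse c (cell M t : Fen M) : Fen N) = cell N t := by
  have hx : (M * t : ℝ) = c * (N * t) := by rw [hM]; push_cast; ring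
  have hc' : (0 : ℝ) < c := by exact_mod_cast hc
  apply Fen.ext
  rcases cell_cases N t with ⟨n, h, h'⟩ | ⟨n, h1, h2, h3⟩
  · have := cell_eq_even (N := M) (t := t) (n := c * n) (by rw [hx, h]; push_cast; ring)
    rw [Fen.coarse_eq hc hM _ (q := n) (r := 0) (by rw [this]; ring) (by omega), h']
    simp
  · rw [h3]
    have l1 : ((c * n : ℕ) : ℝ) < M * t := by rw [hx]; push_cast; exact mul_lt_mul_of_pos_left h1 hc'
    have l2 : (M * t : ℝ) < ((c * (n + 1) : ℕ) : ℝ) := by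
      rw [hx]; push_cast; exact mul_lt_mul_of_pos_left h2 hc'
    have key : ∀ v, (cell M t).val = v → 2 * (c * n) < v → v < 2 * (c * (n + 1)) →
        (Fen.coarse c (cell M t : Fen M) : Fen N).val = 2 * n + 1 := by
      intro v hv hv1 hv2
      rw [Fen.coarse_eq hc hM _ (q := n) (r := v - 2 * (c * n)) (by rw [hv, mul_assoc]; omega)
        (by rw [mul_add] at hv2; omega), if_neg (by omega)]
    rcases cell_cases M t with ⟨m, e, e'⟩ | ⟨m, e1, e2, e3⟩
    · rw [e] at l1 l2
      have l1' : c * n < m := by exact_mod_cast l1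
      have l2' : m < c * (n + 1) := by exact_mod_cast l2
      exact key _ e' (by omega) (by omega)
    · have l1' : c * n < m + 1 := by exact_mod_cast l1.trans e2
      have l2' : m < c * (n + 1) := by exact_mod_cast e1.trans l2
      exact key _ e3 (by omega) (by omega)

theorem cell_surjective {N : ℕ} (hN : 0 < N) (a : Fen N) : ∃ t, cell N t = a := by
  have ha := a.2
  have hN' : (0 : ℝ) < N := by exact_mod_cast hN
  have hle : (a.val : ℝ) ≤ 2 * N := by exact_mod_cast ha
  refine ⟨⟨a.val / (2 * N), by positivity, (div_le_one (by positivity)).2 hle⟩, Fen.ext ?_⟩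
  have hx : (N * (a.val / (2 * N) : ℝ)) = a.val / 2 := by field_simp
  rcases Nat.even_or_odd' a.val with ⟨n, h | h⟩
  · exact (cell_eq_even (n := n) (by rw [hx, h]; push_cast; ring)).trans h.symm
  · exact (cell_eq_odd (n := n) (by rw [hx, h]; push_cast; linarith)
      (by rw [hx, h]; push_cast; linarith)).trans h.symm

theorem dist_le_of_cell_le {N : ℕ} (hN : 0 < N) {s t : I} (h : cell N s ≤ cell N t) :
    dist s t ≤ 2 / N := by
  have hN' : (0 : ℝ) < N := by exact_mod_cast hN
  have h := Fen.le_def.1 h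
  rw [Subtype.dist_eq, Real.dist_eq, abs_le', le_div_iff₀ hN', le_div_iff₀ hN']
  have key : ∀ t : I, (cell N t).val - 1 ≤ 2 * (N * t : ℝ) ∧ 2 * (N * t : ℝ) ≤ (cell N t).val + 1 := by
    intro t
    rcases cell_cases N t with ⟨n, h, h'⟩ | ⟨n, h1, h2, h3⟩
    · rw [h, h']; push_cast; constructor <;> linarith
    · rw [h3]; push_cast; constructor <;> linarith
  have a1 : ((cell N s).val : ℝ) ≤ (cell N t).val + 1 := by
    have : (cell N s).val ≤ (cell N t).val + 1 := by omega
    exact_mod_cast this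
  have a2 : ((cell N t).val : ℝ) ≤ (cell N s).val + 1 := by
    have : (cell N t).val ≤ (cell N s).val + 1 := by omega
    exact_mod_cast this
  have := key s
  have := key t
  constructor <;> linarith

section Approx
variable {ι : Type} {P : Type} [PartialOrder P]

/-- The cell containing a point of the subdivided cube. -/
noncomputable def cells (N : ℕ) (t : ι → I) : ι → Fen N := fun i => cell N (t i)

theorem cells_surjective {N : ℕ} (hN : 0 < N) (a : ι → Fen N) : ∃ t, cells N t = a := by
  choose t ht using fun i => cell_surjective hN (a i)
  exact ⟨t, funext ht⟩

theorem cells_eventually_le [Finite ι] (N : ℕ) (t : ι → I) : ∀ᶠ t' in 𝓝 t, cells N t' ≤ cells N t := by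
  simp only [Pi.le_def, Filter.eventually_all]
  intro i
  exact (continuous_apply i).continuousAt.eventually (cell_eventually_le N (t i))

/-- Simplicial approximation for maps into finite spaces. -/
theorem exists_approx [Fintype ι] [Finite P] (K : Set (ι → I)) (hK : IsClosed K)
    (f : (ι → I) → Al P) (hf : ContinuousOn f K) (ε : ℝ) (hε : 0 < ε) :
    ∃ N₀, ∀ N ≥ N₀, ∃ g : (ι → Fen N) → P, MonotoneOn g (cells N '' K) ∧
      ∀ t ∈ K, f t ≤ g (cells N t) ∧ ∃ t' ∈ K, dist t t' < ε ∧ g (cells N t) = f t' := by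
  classical
  induction hn : (f '' K).ncard using Nat.strong_induction_on generalizing K ε with
  | _ n ih =>
  have hfin : (f '' K).Finite := Set.toFinite _
  rcases K.eq_empty_or_nonempty with rfl | hne
  · exact ⟨0, fun N _ => ⟨fun _ => f 0, fun _ _ _ _ _ => le_rfl, by simp⟩⟩
  obtain ⟨m, hm⟩ := hfin.exists_maximal (hne.image f)
  set C := {t ∈ K | f t = m} with hC
  have hCK : C ⊆ K := fun t h => h.1
  have hCclosed : IsClosed C := by
    have : C = K \ {t ∈ K | f t ≠ m} := by ext t; simp [hC]
    have hop : ∃ U, IsOpen U ∧ f ⁻¹' {x | x ≠ m ∧ ∃ y ∈ f '' K, x ≤ y ∧ y ≠ m} ∩ K = U ∩ K := by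
      refine continuousOn_iff'.1 hf _ (Al.isOpen_iff.2 ?_)
      rintro x y hyx ⟨hx, z, hz, hxz, hzm⟩
      refine ⟨?_, z, hz, hyx.trans hxz, hzm⟩
      rintro rfl
      exact hzm (le_antisymm (hm.2 hz (hyx.trans hxz)) (hyx.trans hxz))
    obtain ⟨U, hU, hUK⟩ := hop
    have : C = K \ U := by
      ext t
      constructor
      · rintro ⟨h, h'⟩
        refine ⟨h, fun hu => ?_⟩
        have : t ∈ f ⁻¹' {x | x ≠ m ∧ ∃ y ∈ f '' K, x ≤ y ∧ y ≠ m} ∩ K := hUK ▸ ⟨hu, h⟩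
        exact this.1.1 h'
      · rintro ⟨h, h'⟩
        refine ⟨h, by_contra fun hu => h' ?_⟩
        have : t ∈ U ∩ K := hUK ▸ ⟨⟨hu, f t, ⟨t, h, rfl⟩, le_rfl, hu⟩, h⟩
        exact this.1
    rw [this]; exact hK.sdiff hU
  obtain ⟨V, hV, hVK⟩ := continuousOn_iff'.1 hf (Iic m) (Al.isOpen_iff.2 (isLowerSet_Iic m))
  have hCV : C ⊆ V := fun t h => by
    have : t ∈ V ∩ K := hVK ▸ ⟨h.2.le, h.1⟩
    exact this.1
  obtain ⟨δ, hδ, hδV⟩ := hCclosed.isCompact.exists_thickening_subset_open hV hCV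
  have hδm : ∀ t ∈ K, ∀ c ∈ C, dist t c < δ → f t ≤ m := fun t ht c hc h => by
    have : t ∈ f ⁻¹' (Iic m) ∩ K := hVK ▸ ⟨hδV (Metric.mem_thickening_iff.2 ⟨c, hc, h⟩), ht⟩
    exact this.1
  set η := min δ ε / 4 with hη
  have hη0 : 0 < η := by positivity
  have hηδ : 4 * η ≤ δ := by rw [hη]; linarith [min_le_left δ ε]
  have hηε : 4 * η ≤ ε := by rw [hη]; linarith [min_le_right δ ε]
  have hlt : (f '' (K \ Metric.thickening η C)).ncard < n := by
    rw [← hn]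
    refine Set.ncard_lt_ncard (ssubset_iff_subset_ne.2 ⟨image_mono sdiff_subset, fun h => ?_⟩) hfin
    have : m ∈ f '' (K \ Metric.thickening η C) := h ▸ hm.1
    obtain ⟨t, ht, htm⟩ := this
    exact ht.2 (Metric.self_subset_thickening hη0 C ⟨ht.1, htm⟩)
  obtain ⟨N₀, hN₀⟩ := ih _ hlt (K \ Metric.thickening η C)
    (hK.sdiff Metric.isOpen_thickening) (hf.mono sdiff_subset) η hη0 rfl
  refine ⟨max N₀ (⌈2 / η⌉₊ + 1), fun N hN => ?_⟩
  obtain ⟨g, hg, hg'⟩ := hN₀ N (le_of_max_le_left hN)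
  have hNpos : 0 < N := by have := le_of_max_le_right hN; omega
  have hN2 : (2 : ℝ) / N < η := by
    rw [div_lt_comm₀ (by exact_mod_cast hNpos) hη0]
    have h1 := Nat.le_ceil (2 / η)
    have h2 : ((⌈2 / η⌉₊ + 1 : ℕ) : ℝ) ≤ N := by exact_mod_cast le_of_max_le_right hN
    push_cast at h2; linarith
  have hd : ∀ s t : ι → I, cells N s ≤ cells N t → dist s t < η := fun s t h =>
    ((dist_pi_le_iff (by positivity)).2 fun i => dist_le_of_cell_le hNpos (h i)).trans_lt hN2
  set 𝓒 := {κ : ι → Fen N | ∃ s ∈ K, s ∈ Metric.thickening η C ∧ cells N s ≤ κ} with h𝓒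
  have h𝓒1 : ∀ t, cells N t ∈ 𝓒 → ∃ c ∈ C, dist t c < 2 * η := by
    rintro t ⟨s, -, hs, hst⟩
    obtain ⟨c, hc, hsc⟩ := Metric.mem_thickening_iff.1 hs
    refine ⟨c, hc, (dist_triangle _ s _).trans_lt ?_⟩
    have := hd _ _ hst
    rw [dist_comm] at this; linarith
  have h𝓒2 : ∀ t ∈ K, cells N t ∉ 𝓒 → t ∈ K \ Metric.thickening η C := fun t ht h =>
    ⟨ht, fun h' => h ⟨t, ht, h', le_rfl⟩⟩
  refine ⟨fun κ => if κ ∈ 𝓒 then m else g κ, ?_, fun t ht => ?_⟩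
  · rintro _ ⟨s, hs, rfl⟩ _ ⟨t, ht, rfl⟩ hst
    by_cases h1 : cells N s ∈ 𝓒
    · have h2 : cells N t ∈ 𝓒 := by
        obtain ⟨r, hr, hr', hrs⟩ := h1
        exact ⟨r, hr, hr', hrs.trans hst⟩
      simp only [h1, h2, if_true]
      exact le_refl (α := P) m
    · obtain ⟨-, s', hs', hss', e⟩ := hg' s (h𝓒2 s hs h1)
      by_cases h2 : cells N t ∈ 𝓒
      · simp only [h1, h2, if_true, if_false, e]
        obtain ⟨c, hc, htc⟩ := h𝓒1 t h2
        refine hδm s' hs'.1 c hc ?_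
        have t1 := dist_triangle s' s c
        have t2 := dist_triangle s t c
        have t3 := hd _ _ hst
        rw [dist_comm] at hss'
        linarith
      · simp only [h1, h2, if_false]
        exact hg ⟨s, h𝓒2 s hs h1, rfl⟩ ⟨t, h𝓒2 t ht h2, rfl⟩ hst
  · by_cases h1 : cells N t ∈ 𝓒
    · obtain ⟨c, hc, htc⟩ := h𝓒1 t h1
      simp only [h1, if_true]
      exact ⟨hδm t ht c hc (by linarith), c, hc.1, by linarith, hc.2.symm⟩
    · simp only [h1, if_false]
      obtain ⟨h2, t', ht', h3, h4⟩ := hg' t (h𝓒2 t ht h1)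
      exact ⟨h2, t', ht'.1, by linarith, h4⟩

end Approx

end

section
open scoped unitInterval Topology

theorem cell_zero (N : ℕ) : (cell N 0).val = 0 := cell_eq_even (n := 0) (by simp)
theorem cell_one (N : ℕ) : (cell N 1).val = 2 * N := cell_eq_even (n := N) (by simp)

theorem cell_eq_zero {N : ℕ} (hN : 0 < N) {t : I} : (cell N t).val = 0 ↔ t = 0 := by
  constructor
  · intro h
    rcases cell_cases N t with ⟨n, h1, h2⟩ | ⟨n, h1, h2, h3⟩
    · obtain rfl : n = 0 := by omega
      rw [Nat.cast_zero, mul_eq_zero] at h1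
      rcases h1 with h1 | h1
      · simp at h1; omega
      · exact Subtype.ext h1
    · omega
  · rintro rfl; exact cell_zero N

theorem cell_eq_two_mul {N : ℕ} (hN : 0 < N) {t : I} : (cell N t).val = 2 * N ↔ t = 1 := by
  constructor
  · intro h
    have hN' : (0 : ℝ) < N := by exact_mod_cast hN
    rcases cell_cases N t with ⟨n, h1, h2⟩ | ⟨n, h1, h2, h3⟩
    · obtain rfl : n = N := by omega
      exact Subtype.ext (by simpa [hN'.ne'] using h1)
    · omega
  · rintro rfl; exact cell_one N

theorem Al.homotopic_of_le {T P : Type*} [TopologicalSpace T] [PartialOrder P] {f g : C(T, Al P)}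
    (h : ∀ t, f t ≤ g t) : f.Homotopic g := by
  classical
  refine ⟨⟨⟨fun x => if x.1 = 1 then g x.2 else f x.2, ?_⟩, ?_, ?_⟩⟩
  · rw [Al.continuous_iff]
    rintro ⟨s, t⟩
    by_cases hs : s = 1
    · filter_upwards [continuous_snd.continuousAt.eventually
        (Al.continuous_iff.1 g.continuous t)] with x hx
      simp only [hs, if_true]
      split_ifs
      · exact hx
      · exact (h _).trans hx
    · filter_upwards [continuous_snd.continuousAt.eventually
        (Al.continuous_iff.1 f.continuous t), continuous_fst.continuousAt.eventually
          (isOpen_compl_singleton.mem_nhds hs)] with x hx hx'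
      simp only [hs, if_false]
      rwa [if_neg (show ¬ x.1 = 1 from hx')]
  · intro t; simp
  · intro t; simp

section
variable {ι Λ P : Type} [PartialOrder P]

/-- The cell containing a point of the boundary of the cube. -/
noncomputable def cellS (N : ℕ) (t : Cube.boundary ι) : Sph ι N :=
  ⟨cells N t, t.2.imp fun i h => h.imp (fun h => by simp [cells, h, cell_zero])
    fun h => by simp [cells, h, cell_one]⟩

theorem cells_mem_Sph {N : ℕ} (hN : 0 < N) {t : ι → I} :
    cells N t ∈ Sph ι N ↔ t ∈ Cube.boundary ι :=
  exists_congr fun _ => or_congr (cell_eq_zero hN) (cell_eq_two_mul hN)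

theorem cellS_surjective {N : ℕ} (hN : 0 < N) (s : Sph ι N) : ∃ t, cellS N t = s := by
  obtain ⟨t, ht⟩ := cells_surjective hN s.1
  exact ⟨⟨t, (cells_mem_Sph hN).1 (ht ▸ s.2)⟩, Subtype.ext ht⟩

theorem coarse_cellS {N c M : ℕ} (hc : 0 < c) (hM : M = N * c) (t : Cube.boundary ι) :
    Sph.coarse hc hM (cellS M t) = cellS N t :=
  Subtype.ext (funext fun _ => coarse_cell hc hM _)

/-- The continuous map on the boundary of the cube defined by a monotone map on cells. -/
noncomputable def realize [Finite ι] {N : ℕ} (ψ : Sph ι N →o P) : C(Cube.boundary ι, Al P) where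
  toFun t := ψ (cellS N t)
  continuous_toFun := Al.continuous_iff.2 fun t => by
    filter_upwards [continuous_subtype_val.continuousAt.eventually (cells_eventually_le N t.1)]
      with t' h
    exact ψ.monotone h

theorem realize_apply [Finite ι] {N : ℕ} (ψ : Sph ι N →o P) (t : Cube.boundary ι) :
    realize ψ t = ψ (cellS N t) := rfl

theorem exists_approx_subtype [Fintype ι] [Finite P] [Nonempty P] {K : Set (ι → I)}
    (hK : IsClosed K) (f : C(K, Al P)) : ∀ᶠ N in Filter.atTop, ∃ g : (ι → Fen N) → P,
      MonotoneOn g (cells N '' K) ∧ ∀ t : K, f t ≤ g (cells N t) := by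
  classical
  rcases K.eq_empty_or_nonempty with rfl | ⟨t₀, ht₀⟩
  · exact Filter.Eventually.of_forall fun N =>
      ⟨fun _ => Classical.arbitrary P, fun _ _ _ _ _ => le_rfl, fun t => t.2.elim⟩
  · have hf : ContinuousOn (fun t => if h : t ∈ K then f ⟨t, h⟩ else f ⟨t₀, ht₀⟩) K := by
      rw [continuousOn_iff_continuous_restrict]
      convert f.continuous using 1
      ext t; simp
    obtain ⟨N₀, h⟩ := exists_approx K hK _ hf 1 one_pos
    filter_upwards [Filter.eventually_ge_atTop N₀] with N hN
    obtain ⟨g, hg, hg'⟩ := h N hN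
    exact ⟨g, hg, fun t => by simpa using (hg' t t.2).1⟩

theorem isClosed_boundary [Finite ι] : IsClosed (Cube.boundary ι) := by
  have : Cube.boundary ι = ⋃ i, {t : ι → I | t i = 0} ∪ {t | t i = 1} := by
    ext t; simp [Cube.boundary]
  rw [this]
  exact isClosed_iUnion_of_finite fun i =>
    (isClosed_eq (continuous_apply i) continuous_const).union
      (isClosed_eq (continuous_apply i) continuous_const)

/-- Approximation of maps on the boundary of the cube. -/
theorem exists_realize_le [Fintype ι] [Finite P] [Nonempty P] (f : C(Cube.boundary ι, Al P)) :
    ∀ᶠ N in Filter.atTop, ∃ ψ : Sph ι N →o P, ∀ t, f t ≤ realize ψ t := by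
  filter_upwards [exists_approx_subtype isClosed_boundary f, Filter.eventually_gt_atTop 0]
    with N ⟨g, hg, hg'⟩ hN
  refine ⟨⟨fun s => g s.1, fun s s' h => ?_⟩, hg'⟩
  obtain ⟨t, rfl⟩ := cellS_surjective hN s
  obtain ⟨t', rfl⟩ := cellS_surjective hN s'
  exact hg ⟨t, t.2, rfl⟩ ⟨t', t'.2, rfl⟩ h

theorem exists_realize [Fintype ι] [Finite P] [Nonempty P] [Finite Λ]
    (f : Λ → C(Cube.boundary ι, Al P)) : ∃ N > 0, ∃ ψ : Λ → Sph ι N →o P,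
      ∀ l, (realize (ψ l)).Homotopic (f l) := by
  have h := (Filter.eventually_all.2 fun l => exists_realize_le (f l)).and
    (Filter.eventually_gt_atTop 0)
  obtain ⟨N, h, hN⟩ := h.exists
  choose ψ hψ using h
  exact ⟨N, hN, ψ, fun l => (Al.homotopic_of_le (hψ l)).symm⟩

/-- Homotopic maps on the boundary of the cube are connected by fences after subdivision. -/
theorem exists_fence_of_homotopic [Fintype ι] [Finite P] {N N' : ℕ}
    {ψ : Sph ι N →o P} {ψ' : Sph ι N' →o P} (h : (realize ψ).Homotopic (realize ψ')) :
    ∀ᶠ M in Filter.atTop, ∀ (c c' : ℕ) (hc : 0 < c) (hc' : 0 < c') (hM : M = N * c)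
      (hM' : M = N' * c'), ∃ g : ℕ → Sph ι M →o P, ψ.comp (Sph.coarse hc hM) ≤ g 0 ∧
        ψ'.comp (Sph.coarse hc' hM') ≤ g (2 * M) ∧
        ∀ j, (j % 2 = 1 → g j ≤ g (j + 1)) ∧ (j % 2 = 0 → g (j + 1) ≤ g j) := by
  classical
  obtain ⟨H⟩ := h
  rcases isEmpty_or_nonempty P with hP | hP
  · filter_upwards [Filter.eventually_gt_atTop 0] with M hM0 c c' hc hc' hM hM'
    have : IsEmpty (Sph ι M) := ⟨fun s => hP.elim (ψ (Sph.coarse hc hM s))⟩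
    exact ⟨fun _ => ⟨fun s => isEmptyElim s, fun s => isEmptyElim s⟩, fun s => isEmptyElim s,
      fun s => isEmptyElim s, fun _ => ⟨fun _ s => isEmptyElim s, fun _ s => isEmptyElim s⟩⟩
  let K : Set (Option ι → I) := (fun t i => t (some i)) ⁻¹' Cube.boundary ι
  have hK : IsClosed K := isClosed_boundary.preimage (by fun_prop)
  have hr : Continuous fun (t : K) (i : ι) => t.1 (some i) :=
    continuous_pi fun i => (continuous_apply (some i)).comp continuous_subtype_val
  let f : C(K, Al P) := ⟨fun t => H (t.1 none, ⟨fun i => t.1 (some i), t.2⟩),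
    H.continuous.comp (((continuous_apply none).comp continuous_subtype_val).prodMk
      (hr.subtype_mk fun t => t.2))⟩
  filter_upwards [exists_approx_subtype hK f, Filter.eventually_gt_atTop 0]
    with M ⟨g, hg, hg'⟩ hM0 c c' hc hc' hM hM'
  have hmem : ∀ κ : Option ι → Fen M, (fun i => κ (some i)) ∈ Sph ι M → κ ∈ cells M '' K := by
    intro κ hκ
    obtain ⟨t, rfl⟩ := cells_surjective hM0 κ
    exact ⟨t, (cells_mem_Sph hM0).1 hκ, rfl⟩
  let e : Fen M → (ι → Fen M) → Option ι → Fen M := fun a κ i => i.elim a κ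
  have he : ∀ {a b κ κ'}, a ≤ b → κ ≤ κ' → e a κ ≤ e b κ' := by
    rintro a b κ κ' h h' (_ | i)
    · exact h
    · exact h' i
  refine ⟨fun j => ⟨fun s => g (e (Fen.mk' M j) s.1), fun s s' h =>
    hg (hmem _ s.2) (hmem _ s'.2) (he le_rfl h)⟩, fun s => ?_, fun s => ?_, fun j => ⟨?_, ?_⟩⟩
  · obtain ⟨t, rfl⟩ := cellS_surjective hM0 s
    have h1 := hg' ⟨fun i => i.elim 0 t.1, t.2⟩
    have h2 : f ⟨fun i => i.elim 0 t.1, t.2⟩ = realize ψ t := H.apply_zero t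
    rw [h2, realize_apply, ← coarse_cellS hc hM] at h1
    refine h1.trans (le_of_eq (congrArg g (funext ?_)))
    rintro (_ | i)
    · exact Fen.ext (by simp [e, cells, cell_zero])
    · rfl
  · obtain ⟨t, rfl⟩ := cellS_surjective hM0 s
    have h1 := hg' ⟨fun i => i.elim 1 t.1, t.2⟩
    have h2 : f ⟨fun i => i.elim 1 t.1, t.2⟩ = realize ψ' t := H.apply_one t
    rw [h2, realize_apply, ← coarse_cellS hc' hM'] at h1
    refine h1.trans (le_of_eq (congrArg g (funext ?_)))
    rintro (_ | i)
    · exact Fen.ext (by simp [e, cells, cell_one])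
    · rfl
  · intro hj s
    exact hg (hmem _ s.2) (hmem _ s.2) (he (by rw [Fen.le_def]; simp; omega) le_rfl)
  · intro hj s
    exact hg (hmem _ s.2) (hmem _ s.2) (he (by rw [Fen.le_def]; simp; omega) le_rfl)

theorem Att.of_le [Finite Λ] [Finite P] {S : Type} [PartialOrder S] [Finite S]
    {ψ ψ' : Λ → S →o P} (h : ∀ l, ψ l ≤ ψ' l) : Eqv ⟨Att ψ⟩ ⟨Att ψ'⟩ :=
  Att.reindex OrderHom.id (fun s => Triv.bot (m := s) le_rfl fun _ h => h) ψ ψ' fun l s => h l s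

/-- Attaching cones along homotopic maps gives equivalent posets. -/
theorem Att.of_homotopic [Finite ι] [Finite P] [Finite Λ] {N N' : ℕ} (hN : 0 < N) (hN' : 0 < N')
    {ψ : Λ → Sph ι N →o P} {ψ' : Λ → Sph ι N' →o P}
    (h : ∀ l, (realize (ψ l)).Homotopic (realize (ψ' l))) : Eqv ⟨Att ψ⟩ ⟨Att ψ'⟩ := by
  have := Fintype.ofFinite ι
  obtain ⟨M₀, hM₀⟩ := Filter.eventually_atTop.1
    (Filter.eventually_all.2 fun l => exists_fence_of_homotopic (h l))
  choose g hg0 hg1 hg using fun l => hM₀ (N * N' * (M₀ + 1)) (by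
    have : 1 * (M₀ + 1) ≤ N * N' * (M₀ + 1) := Nat.mul_le_mul_right _ (Nat.mul_pos hN hN')
    omega) l (N' * (M₀ + 1)) (N * (M₀ + 1)) (by positivity) (by positivity) (by ring) (by ring)
  have key : ∀ j, Eqv ⟨Att fun l => g l 0⟩ ⟨Att fun l => g l j⟩ := by
    intro j
    induction j with
    | zero => exact Eqv.refl _
    | succ j ih =>
      rcases Nat.mod_two_eq_zero_or_one j with hj | hj
      · exact ih.trans (Att.of_le fun l => (hg l j).2 hj).symm
      · exact ih.trans (Att.of_le fun l => (hg l j).1 hj)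
  exact ((Att.reindex _ (Sph.coarse_fiber _ _) ψ _ fun l => hg0 l).trans (key _)).trans
    (Att.reindex _ (Sph.coarse_fiber _ _) ψ' _ fun l => hg1 l).symm

end

end

section
open scoped unitInterval Topology Topology.Homotopy

open Classical in
theorem continuous_glue {X T : Type*} [TopologicalSpace X] [TopologicalSpace T] {f g : X → T}
    {A B : Set X} (hA : IsClosed A) (hB : IsClosed B) (hAB : ∀ x, x ∉ A → x ∈ B)
    (hf : ContinuousOn f A) (hg : ContinuousOn g B) (h : ∀ x ∈ A, x ∈ B → f x = g x) :
    Continuous fun x => if x ∈ A then f x else g x := by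
  rw [← continuousOn_univ, show univ = A ∪ B from
    (eq_univ_of_forall fun x => or_iff_not_imp_left.2 (hAB x)).symm]
  refine ContinuousOn.union_of_isClosed (hf.congr fun x hx => if_pos hx) (hg.congr fun x hx => ?_)
    hA hB
  by_cases hx' : x ∈ A
  · simp [hx', h x hx' hx]
  · simp [hx']

theorem HTrivial.genLoop_homotopic {T : Type*} [TopologicalSpace T] (hT : HTrivial T) {m : ℕ} {x : T}
    (γ : Ω^ (Fin m) T x) : GenLoop.Homotopic γ GenLoop.const := by
  obtain ⟨_, hp, hπ⟩ := hT
  cases m with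
  | zero =>
    obtain ⟨p⟩ := hp.joined (γ 0) x
    refine ⟨⟨⟨⟨fun y => p y.1, by fun_prop⟩, fun y => ?_, fun y => ?_⟩, fun s y hy => ?_⟩⟩
    · rw [Subsingleton.elim y 0]; simp
    · simp
    · obtain ⟨i, -⟩ := hy; exact i.elim0
  | succ m => exact Quotient.exact (@Subsingleton.elim _ (hπ m x) ⟦γ⟧ ⟦GenLoop.const⟧)

section
variable {m : ℕ}

/-- The unit sphere of the maximum norm. -/
abbrev MaxSphere (m : ℕ) : Type := Metric.sphere (0 : (Fin m → ℝ) × ℝ) 1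

theorem MaxSphere.cases (x : MaxSphere m) :
    ‖x.1.1‖ ≤ 1 ∧ |x.1.2| ≤ 1 ∧ (‖x.1.1‖ = 1 ∨ x.1.2 = 1 ∨ x.1.2 = -1) := by
  have h : max ‖x.1.1‖ ‖x.1.2‖ = 1 := mem_sphere_zero_iff_norm.1 x.2
  rw [Real.norm_eq_abs] at h
  refine ⟨(le_max_left _ _).trans h.le, (le_max_right _ _).trans h.le, ?_⟩
  rcases max_choice ‖x.1.1‖ |x.1.2| with h' | h' <;> rw [h'] at h
  · exact Or.inl h
  · exact Or.inr (eq_or_eq_neg_of_abs_eq h)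

/-- The complement of the open top face. -/
def MaxSphere.J (m : ℕ) : Set (MaxSphere m) := {x | ‖x.1.1‖ = 1 ∨ x.1.2 = -1}

/-- Concentrates the sphere on its top face. -/
noncomputable def MaxSphere.target (x : MaxSphere m) : (Fin m → ℝ) × ℝ :=
  if x ∈ {x : MaxSphere m | x.1.2 = 1} then ((1 - ‖x.1.1‖) • x.1.1, 1 - 2 * ‖x.1.1‖) else (0, -1)

theorem MaxSphere.isClosed_J : IsClosed (J m) :=
  (isClosed_eq (by fun_prop) continuous_const).union (isClosed_eq (by fun_prop) continuous_const)

theorem MaxSphere.isClosed_top : IsClosed {x : MaxSphere m | x.1.2 = 1} :=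
  isClosed_eq (by fun_prop) continuous_const

theorem MaxSphere.mem_J {x : MaxSphere m} (h : x ∉ {x : MaxSphere m | x.1.2 = 1}) : x ∈ J m := by
  obtain ⟨-, -, h1 | h1 | h1⟩ := x.cases
  · exact Or.inl h1
  · exact (h h1).elim
  · exact Or.inr h1

theorem MaxSphere.norm_eq_one {x : MaxSphere m} (h : x.1.2 = 1) (h' : x ∈ J m) : ‖x.1.1‖ = 1 := by
  rcases h' with h' | h'
  · exact h'
  · linarith

theorem MaxSphere.continuous_target : Continuous (target (m := m)) := by
  classical
  convert continuous_glue (isClosed_top (m := m)) (isClosed_J (m := m)) (fun x => mem_J)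
    (f := fun x : MaxSphere m => ((1 - ‖x.1.1‖) • x.1.1, 1 - 2 * ‖x.1.1‖))
    (g := fun _ => ((0 : Fin m → ℝ), (-1 : ℝ))) (Continuous.continuousOn (by fun_prop))
    continuousOn_const ?_ using 2
  · exact if_congr Iff.rfl rfl rfl
  · intro x hx hx'
    rw [norm_eq_one hx hx']; norm_num

theorem MaxSphere.target_of_mem {x : MaxSphere m} (h : x ∈ J m) : target x = (0, -1) := by
  unfold target
  split_ifs with h'
  · rw [norm_eq_one h' h]; norm_num
  · rfl

theorem MaxSphere.segment_ne_zero (x : MaxSphere m) (s : I) :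
    (1 - s : ℝ) • x.1 + (s : ℝ) • target x ≠ 0 := by
  intro h
  have h1 := congrArg Prod.fst h
  have h2 := congrArg Prod.snd h
  simp only [Prod.fst_add, Prod.snd_add, Prod.smul_fst, Prod.smul_snd, Prod.fst_zero,
    Prod.snd_zero, smul_eq_mul] at h1 h2
  have hs := s.2.1
  have hs' := s.2.2
  by_cases hx : x.1.2 = 1
  · have e : target x = ((1 - ‖x.1.1‖) • x.1.1, 1 - 2 * ‖x.1.1‖) := if_pos hx
    rw [e, hx] at h2
    rw [e] at h1
    simp only at h1 h2
    rw [smul_smul, ← add_smul, smul_eq_zero] at h1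
    have hn := x.cases.1
    have hn0 := norm_nonneg x.1.1
    rcases h1 with h1 | h1
    · have : (s : ℝ) * ‖x.1.1‖ = 1 := by linarith
      nlinarith
    · rw [h1, norm_zero] at h2; nlinarith
  · have hJ := mem_J (x := x) hx
    rw [target_of_mem hJ] at h1 h2
    simp only [smul_zero, add_zero] at h1 h2
    rcases smul_eq_zero.1 h1 with h3 | h3
    · rw [h3] at h2; nlinarith
    · rcases hJ with h4 | h4
      · rw [h3, norm_zero] at h4; norm_num at h4
      · rw [h4] at h2; nlinarith

/-- Radial projection. -/
noncomputable def MaxSphere.proj (x : {x : (Fin m → ℝ) × ℝ // x ≠ 0}) : MaxSphere m :=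
  ⟨‖x.1‖⁻¹ • x.1, by
    have := norm_ne_zero_iff.2 x.2
    rw [mem_sphere_zero_iff_norm, norm_smul, norm_inv, norm_norm, inv_mul_cancel₀ this]⟩

theorem MaxSphere.continuous_proj : Continuous (proj (m := m)) :=
  Continuous.subtype_mk (((continuous_norm.comp continuous_subtype_val).inv₀
    fun x => norm_ne_zero_iff.2 x.2).smul continuous_subtype_val) _

theorem MaxSphere.proj_self (x : MaxSphere m) (h) : proj ⟨x.1, h⟩ = x :=
  Subtype.ext (by
    have : ‖x.1‖ = 1 := by simpa using x.2
    simp [proj, this])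

theorem MaxSphere.nullhomotopic {T : Type*} [TopologicalSpace T] (hT : HTrivial T)
    (f : C(MaxSphere m, T)) : f.Nullhomotopic := by
  classical
  let S : C(I × MaxSphere m, MaxSphere m) := ⟨fun y => MaxSphere.proj
    ⟨(1 - y.1 : ℝ) • y.2.1 + (y.1 : ℝ) • target y.2, segment_ne_zero y.2 y.1⟩,
    continuous_proj.comp (Continuous.subtype_mk (by
      have := continuous_target (m := m)
      fun_prop) _)⟩
  let ρ : C(MaxSphere m, MaxSphere m) := ⟨fun x => S (1, x), by fun_prop⟩
  have h1 : f.Homotopic (f.comp ρ) := by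
    refine ⟨⟨⟨fun y => f (S y), by fun_prop⟩, fun x => ?_, fun x => rfl⟩⟩
    simp only
    congr 1
    simp only [S, ContinuousMap.coe_mk]
    convert proj_self x (by
      intro h; have := x.2; rw [h] at this; simp at this) using 2
    simp
  set c := f (ρ ⟨(0, -1), by simp⟩) with hc
  have hρJ : ∀ x ∈ J m, f (ρ x) = c := by
    intro x hx
    simp only [c, ρ, S, ContinuousMap.coe_mk]
    congr 3
    rw [target_of_mem hx, target_of_mem (Or.inr rfl)]
    simp
  let top : C(Fin m → I, MaxSphere m) := ⟨fun v => ⟨(fun i => 2 * (v i : ℝ) - 1, 1), by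
      have : ‖fun i => 2 * (v i : ℝ) - 1‖ ≤ 1 := by
        rw [pi_norm_le_iff_of_nonneg zero_le_one]
        intro i
        have := (v i).2.1
        have := (v i).2.2
        rw [Real.norm_eq_abs, abs_le]; constructor <;> linarith
      simp [Prod.norm_def, this]⟩, by
    refine Continuous.subtype_mk (Continuous.prodMk (continuous_pi fun i => ?_) continuous_const) _
    have := continuous_apply (A := fun _ : Fin m => I) i
    fun_prop⟩
  let γ : Ω^ (Fin m) T c := ⟨(f.comp ρ).comp top, by
    rintro v ⟨i, hi⟩
    refine hρJ _ (Or.inl (le_antisymm (top v).cases.1 ?_))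
    refine le_trans ?_ (norm_le_pi_norm _ i)
    rcases hi with hi | hi <;> simp [top, hi] <;> norm_num⟩
  obtain ⟨H⟩ := hT.genLoop_homotopic γ
  refine ⟨c, h1.trans ?_⟩
  let q : MaxSphere m → Fin m → I := fun x i =>
    projIcc 0 1 zero_le_one ((x.1.1 i + 1) / 2)
  have hq : Continuous q := continuous_pi fun i => continuous_projIcc.comp (by fun_prop)
  have hqtop : ∀ x : MaxSphere m, x.1.2 = 1 → top (q x) = x := by
    intro x hx
    refine Subtype.ext (Prod.ext (funext fun i => ?_) hx.symm)
    have h1 : |x.1.1 i| ≤ 1 := (norm_le_pi_norm x.1.1 i).trans x.cases.1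
    rw [abs_le] at h1
    simp only [top, q, ContinuousMap.coe_mk]
    rw [projIcc_of_mem zero_le_one (show (x.1.1 i + 1) / 2 ∈ Icc (0 : ℝ) 1 from
      ⟨by linarith, by linarith⟩)]
    ring
  have hqb : ∀ x : MaxSphere m, ‖x.1.1‖ = 1 → q x ∈ Cube.boundary (Fin m) := by
    intro x hx
    by_contra hb
    have : ‖x.1.1‖ < 1 := by
      rw [pi_norm_lt_iff zero_lt_one]
      intro i
      have h1 : |x.1.1 i| ≤ 1 := (norm_le_pi_norm x.1.1 i).trans x.cases.1
      refine lt_of_le_of_ne h1 fun h2 => hb ⟨i, ?_⟩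
      simp only [q]
      rcases eq_or_eq_neg_of_abs_eq h2 with h | h <;> rw [h]
      · right; norm_num
      · left; norm_num
    linarith
  have hK := continuous_glue (A := {y : I × MaxSphere m | y.2.1.2 = 1}) (B := {y | y.2 ∈ J m})
    (isClosed_top.preimage continuous_snd) (isClosed_J.preimage continuous_snd)
    (fun x hx => mem_J (x := x.2) hx)
    (f := fun y => H (y.1, q y.2)) (g := fun _ => c) (Continuous.continuousOn (by fun_prop))
    continuousOn_const (fun y hy hy' =>
      (H.eq_fst y.1 (hqb _ (norm_eq_one hy hy'))).trans
        (γ.2 _ (hqb _ (norm_eq_one hy hy'))))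
  refine ⟨⟨⟨_, hK⟩, fun x => ?_, fun x => ?_⟩⟩
  · simp only [mem_setOf_eq]
    split_ifs with h
    · rw [H.apply_zero]; exact congrArg (fun x => f (ρ x)) (hqtop x h)
    · exact (hρJ x (mem_J h)).symm
  · simp only [mem_setOf_eq]
    split_ifs with h
    · rw [H.apply_one]; rfl
    · rfl

/-- Nullhomotopic maps extend over the ball. -/
theorem MaxSphere.exists_extend {T : Type*} [TopologicalSpace T] (f : C(MaxSphere m, T))
    (hf : f.Nullhomotopic) : ∃ F : (Fin m → ℝ) × ℝ → T, Continuous F ∧ ∀ x : MaxSphere m, F x = f x := by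
  classical
  obtain ⟨c, ⟨H⟩⟩ := hf
  let x₀ : MaxSphere m := ⟨(0, -1), by simp⟩
  have hK := continuous_glue (A := {x : (Fin m → ℝ) × ℝ | ‖x‖ ≤ 1 / 2}) (B := {x | 1 / 2 ≤ ‖x‖})
    (f := fun _ => c) (g := fun x => H (projIcc 0 1 zero_le_one (2 - 2 * ‖x‖),
      if h : x ≠ 0 then proj ⟨x, h⟩ else x₀)) (isClosed_le (by fun_prop) continuous_const)
    (isClosed_le continuous_const (by fun_prop)) (fun x hx => (not_le.1 (show ¬ ‖x‖ ≤ 1 / 2 from hx)).le) continuousOn_const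
    ?_ ?_
  · refine ⟨_, hK, fun x => ?_⟩
    have hx : ‖x.1‖ = 1 := by simpa using x.2
    have h0 : x.1 ≠ 0 := by intro h; rw [h, norm_zero] at hx; norm_num at hx
    have h2 : ¬ ‖x.1‖ ≤ 1 / 2 := by rw [hx]; norm_num
    simp only [mem_setOf_eq, h2, if_false, h0, ne_eq, not_false_eq_true, dif_pos, proj_self]
    rw [hx, show (2 - 2 * 1 : ℝ) = 0 by norm_num, projIcc_left]
    exact H.apply_zero x
  · refine H.continuous.comp_continuousOn (ContinuousOn.prodMk
      (Continuous.continuousOn (continuous_projIcc.comp (by fun_prop))) ?_)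
    rw [continuousOn_iff_continuous_restrict]
    have h0 : ∀ x : {x : (Fin m → ℝ) × ℝ | 1 / 2 ≤ ‖x‖}, x.1 ≠ 0 := by
      rintro ⟨x, hx⟩ (rfl : x = 0)
      norm_num at hx
    convert (continuous_proj (m := m)).comp (Continuous.subtype_mk continuous_subtype_val h0) using 1
    ext1 x
    simp [restrict, h0 x]
  · intro x (hx : ‖x‖ ≤ 1 / 2) (hx' : 1 / 2 ≤ ‖x‖)
    have : ‖x‖ = 1 / 2 := le_antisymm hx hx'
    rw [this, show (2 - 2 * (1 / 2) : ℝ) = 1 by norm_num, projIcc_right]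
    exact (H.apply_one _).symm

end

end

section
open scoped unitInterval Topology Topology.Homotopy

section Extend
variable {T : Type*} [TopologicalSpace T]

/-- The affine map from the unit cube to the cube of side two. -/
noncomputable def toBall {m : ℕ} {ι : Type} (τ : Option (Fin m) ≃ ι) (t : ι → I) :
    (Fin m → ℝ) × ℝ :=
  (fun i => 2 * (t (τ (some i)) : ℝ) - 1, 2 * (t (τ none) : ℝ) - 1)

/-- The inverse of `toBall` on the cube of side two. -/
noncomputable def ofBall {m : ℕ} {ι : Type} (τ : Option (Fin m) ≃ ι) (x : (Fin m → ℝ) × ℝ)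
    (i : ι) : I :=
  projIcc 0 1 zero_le_one (((τ.symm i).elim x.2 x.1 + 1) / 2)

variable {m : ℕ} {ι : Type} (τ : Option (Fin m) ≃ ι)

theorem continuous_toBall : Continuous (toBall τ) := by
  unfold toBall
  have : ∀ i, Continuous fun t : ι → I => (t i : ℝ) := fun i =>
    continuous_subtype_val.comp (continuous_apply i)
  refine Continuous.prodMk (continuous_pi fun i => ?_) ?_
  · have := this (τ (some i)); fun_prop
  · have := this (τ none); fun_prop

theorem continuous_ofBall : Continuous (ofBall τ) := by
  refine continuous_pi fun i => continuous_projIcc.comp ?_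
  rcases h : τ.symm i with _ | j <;> simp only [Option.elim] <;> fun_prop

theorem ofBall_toBall (t : ι → I) : ofBall τ (toBall τ t) = t := by
  funext i
  obtain ⟨j, rfl⟩ := τ.surjective i
  have : ((τ.symm (τ j)).elim (toBall τ t).2 (toBall τ t).1 + 1) / 2 = (t (τ j) : ℝ) := by
    rw [τ.symm_apply_apply]
    rcases j with _ | j <;> simp [toBall]
  simp only [ofBall, this, projIcc_val]

theorem abs_two_mul_sub_one_le (t : I) : |2 * (t : ℝ) - 1| ≤ 1 := by
  have := t.2.1
  have := t.2.2
  rw [abs_le]; constructor <;> linarith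

theorem norm_toBall {t : ι → I} (ht : t ∈ Cube.boundary ι) : ‖toBall τ t‖ = 1 := by
  refine le_antisymm ?_ ?_
  · rw [Prod.norm_def, max_le_iff, pi_norm_le_iff_of_nonneg zero_le_one]
    exact ⟨fun i => abs_two_mul_sub_one_le _, abs_two_mul_sub_one_le _⟩
  · obtain ⟨i, hi⟩ := ht
    obtain ⟨j, rfl⟩ := τ.surjective i
    have h : |2 * (t (τ j) : ℝ) - 1| = 1 := by
      rcases hi with hi | hi <;> rw [hi] <;> norm_num
    rw [Prod.norm_def, le_max_iff]
    rcases j with _ | j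
    · exact Or.inr h.ge
    · exact Or.inl (h.ge.trans (norm_le_pi_norm (toBall τ t).1 j))

theorem ofBall_mem {x : (Fin m → ℝ) × ℝ} (hx : ‖x‖ = 1) : ofBall τ x ∈ Cube.boundary ι := by
  obtain ⟨-, -, h⟩ := MaxSphere.cases ⟨x, mem_sphere_zero_iff_norm.2 hx⟩
  have key : ∀ j : Option (Fin m), |j.elim x.2 x.1| = 1 → ofBall τ x ∈ Cube.boundary ι := by
    intro j hj
    refine ⟨τ j, ?_⟩
    simp only [ofBall, τ.symm_apply_apply]
    rcases eq_or_eq_neg_of_abs_eq hj with h | h <;> rw [h]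
    · right; norm_num
    · left; norm_num
  by_cases h2 : |x.2| = 1
  · exact key none h2
  · have h1 : ‖x.1‖ = 1 := by
      rcases h with h | h | h
      · exact h
      · exact (h2 (by rw [show x.2 = 1 from h]; norm_num)).elim
      · exact (h2 (by rw [show x.2 = -1 from h]; norm_num)).elim
    by_contra hb
    have : ‖x.1‖ < 1 := by
      rw [pi_norm_lt_iff zero_lt_one]
      intro i
      exact lt_of_le_of_ne ((norm_le_pi_norm x.1 i).trans h1.le) fun h3 => hb (key (some i) h3)
    linarith

theorem Cube.exists_sphere [Finite ι] [Nonempty ι] : ∃ m, Nonempty (Option (Fin m) ≃ ι) := by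
  obtain ⟨n, ⟨e⟩⟩ := Finite.exists_equiv_fin ι
  cases n with
  | zero => exact ((e (Classical.arbitrary ι)).elim0)
  | succ n => exact ⟨n, ⟨(finSuccEquiv n).symm.trans e.symm⟩⟩

/-- Nullhomotopic maps on the boundary of a cube extend over the cube. -/
theorem exists_extend [Finite ι] [Nonempty ι] (f : C(Cube.boundary ι, T)) (hf : f.Nullhomotopic) :
    ∃ F : C(ι → I, T), ∀ t : Cube.boundary ι, F t = f t := by
  obtain ⟨m, ⟨τ⟩⟩ := Cube.exists_sphere (ι := ι)
  let p : C(MaxSphere m, Cube.boundary ι) :=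
    ⟨fun x => ⟨ofBall τ x.1, ofBall_mem τ (mem_sphere_zero_iff_norm.1 x.2)⟩,
      Continuous.subtype_mk ((continuous_ofBall τ).comp continuous_subtype_val) _⟩
  obtain ⟨F, hF, hF'⟩ := MaxSphere.exists_extend (f.comp p) (hf.comp_left p)
  refine ⟨⟨fun t => F (toBall τ t), hF.comp (continuous_toBall τ)⟩, fun t => ?_⟩
  have := hF' ⟨toBall τ t, mem_sphere_zero_iff_norm.2 (norm_toBall τ t.2)⟩
  refine this.trans (congrArg f (Subtype.ext (ofBall_toBall τ t)))

theorem HTrivial.exists_extend [Finite ι] (hT : HTrivial T) (f : C(Cube.boundary ι, T)) :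
    ∃ F : C(ι → I, T), ∀ t : Cube.boundary ι, F t = f t := by
  rcases isEmpty_or_nonempty ι with h | h
  · obtain ⟨c⟩ := hT.1
    exact ⟨ContinuousMap.const _ c, fun t => (h.false t.2.choose).elim⟩
  · obtain ⟨m, ⟨τ⟩⟩ := Cube.exists_sphere (ι := ι)
    refine _root_.exists_extend f ?_
    let p : C(MaxSphere m, Cube.boundary ι) :=
      ⟨fun x => ⟨ofBall τ x.1, ofBall_mem τ (mem_sphere_zero_iff_norm.1 x.2)⟩,
        Continuous.subtype_mk ((continuous_ofBall τ).comp continuous_subtype_val) _⟩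
    let q : C(Cube.boundary ι, MaxSphere m) :=
      ⟨fun t => ⟨toBall τ t, mem_sphere_zero_iff_norm.2 (norm_toBall τ t.2)⟩,
        Continuous.subtype_mk ((continuous_toBall τ).comp continuous_subtype_val) _⟩
    have : f = (f.comp p).comp q := by
      ext t
      exact congrArg f (Subtype.ext (ofBall_toBall τ t).symm)
    rw [this]
    exact (MaxSphere.nullhomotopic hT _).comp_left q
end Extend

end

section
open scoped unitInterval Topology Topology.Homotopy

section
variable {X : Type} [PartialOrder X]

/-- Points of the unit cube over `X` whose support is a chain. -/
def ChainSupp (t : X → I) : Prop := ∀ x y, (x ≤ y ∨ y ≤ x) ∨ t x = 0 ∨ t y = 0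

/-- The realization of the order complex, as points of the unit cube. -/
def Real1 (X : Type) [PartialOrder X] : Set (X → I) := {t | ChainSupp t ∧ ∃ x, t x = 1}

variable [Finite X]

theorem isClosed_chainSupp : IsClosed {t : X → I | ChainSupp t} := by
  simp only [ChainSupp, setOf_forall]
  refine isClosed_iInter fun x => isClosed_iInter fun y => ?_
  by_cases h : x ≤ y ∨ y ≤ x
  · simp [h]
  · simp only [h, false_or]
    exact (isClosed_eq (continuous_apply x) continuous_const).union
      (isClosed_eq (continuous_apply y) continuous_const)

theorem isClosed_real1 : IsClosed (Real1 X) := by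
  refine isClosed_chainSupp.inter (s₂ := {t : X → I | ∃ x, t x = 1}) ?_
  rw [setOf_exists]
  exact isClosed_iUnion_of_finite fun x => isClosed_eq (continuous_apply x) continuous_const

/-- The points whose support belongs to the family `𝓢`. -/
def suppIn (𝓢 : Finset (Set X)) : Set (X → I) := {t | {x | t x ≠ 0} ∈ 𝓢}

theorem isClosed_suppLe (e : Set X) : IsClosed {t : X → I | {x | t x ≠ 0} ⊆ e} := by
  have : {t : X → I | {x | t x ≠ 0} ⊆ e} = ⋂ x ∈ eᶜ, {t | t x = 0} := by
    ext t
    simp only [mem_setOf_eq, mem_iInter, mem_compl_iff]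
    exact ⟨fun h x hx => by_contra fun h' => hx (h h'), fun h x hx => by_contra fun h' => hx (h x h')⟩
  rw [this]
  exact isClosed_biInter fun x _ => isClosed_eq (continuous_apply x) continuous_const

theorem isClosed_suppIn (𝓢 : Finset (Set X)) (h : ∀ e ∈ 𝓢, ∀ e' ⊆ e, e' ∈ 𝓢) :
    IsClosed (suppIn 𝓢) := by
  have : suppIn 𝓢 = ⋃ e ∈ 𝓢, {t : X → I | {x | t x ≠ 0} ⊆ e} := by
    ext t
    simp only [suppIn, mem_setOf_eq, mem_iUnion]
    exact ⟨fun h => ⟨_, h, subset_rfl⟩, fun ⟨e, he, h'⟩ => h e he _ h'⟩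
  rw [this]
  exact Set.Finite.isClosed_biUnion 𝓢.finite_toSet fun e _ => isClosed_suppLe e

/-- Extension from the realization of the order complex over its cone. -/
theorem HTrivial.exists_cone_extend {T : Type*} [TopologicalSpace T] (hT : HTrivial T)
    (f : (X → I) → T) (hf : ContinuousOn f (Real1 X)) (𝓢 : Finset (Set X))
    (h𝓢 : ∀ e ∈ 𝓢, ∀ e' ⊆ e, e' ∈ 𝓢) (hc : ∀ e ∈ 𝓢, ∀ x ∈ e, ∀ y ∈ e, x ≤ y ∨ y ≤ x) :
    ∃ F : (X → I) → T, ContinuousOn F (Real1 X ∪ suppIn 𝓢) ∧ ∀ t ∈ Real1 X, F t = f t := by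
  classical
  induction h : 𝓢.card generalizing 𝓢 with
  | zero =>
    obtain rfl := Finset.card_eq_zero.1 h
    exact ⟨f, by simpa [suppIn] using hf, fun _ _ => rfl⟩
  | succ n ih =>
    have hne : 𝓢.Nonempty := Finset.card_pos.1 (by omega)
    obtain ⟨e, he⟩ := 𝓢.exists_maximal hne
    have hmax : ∀ e' ∈ 𝓢, e ⊆ e' → e' = e := fun e' he' hle =>
      subset_antisymm (he.2 he' hle) hle
    have hd : ∀ e' ∈ 𝓢.erase e, ∀ e'' ⊆ e', e'' ∈ 𝓢.erase e := by
      intro e' he' e'' hle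
      rw [Finset.mem_erase] at he' ⊢
      exact ⟨fun h => he'.1 (hmax e' he'.2 (h ▸ hle)), h𝓢 _ he'.2 _ hle⟩
    obtain ⟨F, hF, hFf⟩ := ih (𝓢.erase e) hd (fun e' h' => hc e' (Finset.mem_of_mem_erase h'))
      (by rw [Finset.card_erase_of_mem he.1, h]; rfl)
    let ext0 : (e → I) → X → I := fun s x => if h : x ∈ e then s ⟨x, h⟩ else 0
    have hext : Continuous ext0 := by
      refine continuous_pi fun x => ?_
      by_cases h : x ∈ e
      · simpa [ext0, h] using continuous_apply _
      · simpa [ext0, h] using continuous_const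
    have hsupp : ∀ s, {x | ext0 s x ≠ 0} ⊆ e := by
      intro s x hx
      by_contra h'
      exact hx (by simp [ext0, h'])
    have hmem : ∀ s ∈ Cube.boundary e, ext0 s ∈ Real1 X ∪ suppIn (𝓢.erase e) := by
      rintro s ⟨i, hi | hi⟩
      · right
        refine Finset.mem_erase.2 ⟨fun h' => ?_, h𝓢 e he.1 _ (hsupp s)⟩
        have : (i : X) ∈ {x | ext0 s x ≠ 0} := by rw [h']; exact i.2
        exact this (by simp [ext0, hi])
      · left
        refine ⟨fun x y => ?_, i, by simp [ext0, hi]⟩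
        by_cases hx : x ∈ e
        · by_cases hy : y ∈ e
          · exact Or.inl (hc e he.1 x hx y hy)
          · simp [ext0, hy]
        · simp [ext0, hx]
    have hcont : Continuous fun s : Cube.boundary e => F (ext0 s) :=
      hF.comp_continuous (hext.comp continuous_subtype_val) fun s => hmem s s.2
    obtain ⟨G, hG⟩ := hT.exists_extend (ι := e) ⟨_, hcont⟩
    have hrestr : ∀ t : X → I, {x | t x ≠ 0} ⊆ e → ext0 (fun i => t i) = t := by
      intro t ht
      funext x
      by_cases h : x ∈ e
      · simp [ext0, h]
      · simp only [ext0, h, dif_neg, not_false_eq_true]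
        by_contra h'
        exact h (ht (Ne.symm h'))
    have hbd : ∀ t : X → I, {x | t x ≠ 0} ⊆ e → t ∈ Real1 X ∪ suppIn (𝓢.erase e) →
        (fun i : e => t i) ∈ Cube.boundary e := by
      rintro t hte (⟨-, x, hx⟩ | ht')
      · exact ⟨⟨x, hte (by simp [hx])⟩, Or.inr hx⟩
      · by_contra hb
        refine (Finset.mem_erase.1 ht').1 (subset_antisymm hte fun x hx h0 => hb ⟨⟨x, hx⟩, Or.inl h0⟩)
    have hglue : ∀ t : X → I, {x | t x ≠ 0} ⊆ e → t ∈ Real1 X ∪ suppIn (𝓢.erase e) →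
        G (fun i : e => t i) = F t := by
      intro t hte ht
      refine (hG ⟨_, hbd t hte ht⟩).trans (congrArg F (hrestr t hte))
    refine ⟨fun t => if {x | t x ≠ 0} ⊆ e then G (fun i : e => t i) else F t, ?_, ?_⟩
    · have hsub : Real1 X ∪ suppIn 𝓢 ⊆ {t | {x | t x ≠ 0} ⊆ e} ∪ (Real1 X ∪ suppIn (𝓢.erase e)) := by
        rintro t (ht | ht)
        · exact Or.inr (Or.inl ht)
        · by_cases h' : {x | t x ≠ 0} = e
          · exact Or.inl h'.le
          · exact Or.inr (Or.inr (Finset.mem_erase.2 ⟨h', ht⟩))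
      refine ContinuousOn.mono (ContinuousOn.union_of_isClosed ?_ ?_ (isClosed_suppLe e)
        (isClosed_real1.union (isClosed_suppIn _ hd))) hsub
      · refine ContinuousOn.congr (f := fun t : X → I => G fun i : e => t i)
          (Continuous.continuousOn (G.continuous.comp
            (continuous_pi fun i => continuous_apply (i : X)))) fun t (ht : {x | t x ≠ 0} ⊆ e) => if_pos ht
      · refine hF.congr fun t ht => ?_
        by_cases hte : {x | t x ≠ 0} ⊆ e
        · simp only [hte, if_true]; exact hglue t hte ht
        · simp only [hte, if_false]
    · intro t ht
      rw [← hFf t ht]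
      by_cases hte : {x | t x ≠ 0} ⊆ e
      · simp only [hte, if_true]; exact hglue t hte (Or.inl ht)
      · simp only [hte, if_false]
end

end

section
open scoped unitInterval Topology Topology.Homotopy

/-- A finite poset is null if a map to it with upper fibres contractible by fences is connected to
a constant map by a fence. -/
def Null (X : Type) [PartialOrder X] : Prop :=
  ∃ (S : Type) (_ : PartialOrder S) (_ : Finite S) (φ : S →o X),
    (∀ x, ∃ c, Fence (OrderHom.id : {s // x ≤ φ s} →o {s // x ≤ φ s}) (OrderHom.const _ c)) ∧
      ∃ c, Fence φ (OrderHom.const S c)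

section
variable {X : Type} [PartialOrder X]

open Classical in
/-- The greatest element of a set, if there is one. -/
noncomputable def greatest [Nonempty X] (s : Set X) : X :=
  if h : ∃ x, IsGreatest s x then h.choose else Classical.arbitrary X

theorem greatest_eq [Nonempty X] {s : Set X} {x : X} (h : IsGreatest s x) : greatest s = x := by
  have h' : ∃ x, IsGreatest s x := ⟨x, h⟩
  rw [greatest, dif_pos h']
  exact h'.choose_spec.unique h

theorem exists_greatest [Finite X] {s : Set X} (hs : s.Nonempty)
    (h : ∀ x ∈ s, ∀ y ∈ s, x ≤ y ∨ y ≤ x) : ∃ x, IsGreatest s x := by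
  obtain ⟨x, hx⟩ := (toFinite s).exists_maximal hs
  exact ⟨x, hx.1, fun y hy => (h y hy x hx.1).elim id fun h => hx.2 hy h⟩

theorem isGreatest_greatest [Finite X] [Nonempty X] {s : Set X} (hs : s.Nonempty)
    (h : ∀ x ∈ s, ∀ y ∈ s, x ≤ y ∨ y ≤ x) : IsGreatest s (greatest s) := by
  obtain ⟨x, hx⟩ := exists_greatest hs h
  rwa [greatest_eq hx]

/-- The combinatorial analogue of `Real1`. -/
def Grid1 (X : Type) [PartialOrder X] (N : ℕ) : Set (X → Fen N) :=
  {κ | (∀ x y, (x ≤ y ∨ y ≤ x) ∨ (κ x).val = 0 ∨ (κ y).val = 0) ∧ ∃ x, (κ x).val = 2 * N}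

theorem Fen.eq_of_le_of_even {N : ℕ} {a b : Fen N} (h : a ≤ b) {k : ℕ} (ha : a.val = 2 * k) :
    b.val = 2 * k := by
  rcases Fen.le_def.1 h with h | ⟨h, -⟩ <;> omega

theorem Grid1.isGreatest [Finite X] [Nonempty X] {N : ℕ} (hN : 0 < N) {κ : X → Fen N}
    (h : κ ∈ Grid1 X N) : IsGreatest {x | (κ x).val = 2 * N} (greatest {x | (κ x).val = 2 * N}) :=
  isGreatest_greatest h.2 fun x hx y hy => by
    rcases h.1 x y with h | h | h
    · exact h
    · rw [mem_setOf_eq] at hx; omega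
    · rw [mem_setOf_eq] at hy; omega

/-- The greatest element of the top level. -/
noncomputable def Grid1.top [Finite X] [Nonempty X] {N : ℕ} (hN : 0 < N) : Grid1 X N →o X where
  toFun κ := greatest {x | (κ.1 x).val = 2 * N}
  monotone' κ κ' h := (isGreatest hN κ'.2).2 (Fen.eq_of_le_of_even (h _) (isGreatest hN κ.2).1)

theorem raise_val {ι : Type} {N j : ℕ} (hj : j ≤ 2 * N) (W : Set ι) (κ : ι → Fen N) (i : ι)
    [Decidable (i ∈ W)] :
    (raise W j κ i).val = if i ∈ W then max (κ i).val j else (κ i).val := by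
  have := (κ i).2
  unfold raise
  split_ifs
  · simp only [Fen.mk'_val]; omega
  · rfl

theorem lower_val {ι : Type} {N j : ℕ} (W : Set ι) (κ : ι → Fen N) (i : ι) [Decidable (i ∈ W)] :
    (lower W j κ i).val = if i ∈ W then min (κ i).val j else (κ i).val := by
  have := (κ i).2
  unfold lower
  split_ifs
  · simp only [Fen.mk'_val]; omega
  · rfl

theorem lower_val_le {ι : Type} {N j : ℕ} (W : Set ι) (κ : ι → Fen N) (i : ι) :
    (lower W j κ i).val ≤ (κ i).val := by
  classical
  rw [lower_val]; split_ifs <;> omega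

theorem raise_of_le {ι : Type} {N j : ℕ} (hj : 2 * N ≤ j) (W : Set ι) :
    (raise W j : (ι → Fen N) → ι → Fen N) = raise W (2 * N) := by
  funext κ i
  have := (κ i).2
  unfold raise
  split_ifs
  · ext; simp only [Fen.mk'_val]; omega
  · rfl

theorem lower_of_le {ι : Type} {N j : ℕ} (hj : 2 * N ≤ j) (W : Set ι) (κ : ι → Fen N) :
    lower W j κ = κ := by
  classical
  funext i
  have := (κ i).2
  ext
  rw [lower_val]
  split_ifs <;> omega

/-- The self-map `f` of `A` is connected to the identity by a fence. -/
def Slides {P : Type*} [PartialOrder P] (A : Set P) (f : P → P) : Prop :=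
  ∃ (hf : Monotone f) (h : ∀ a ∈ A, f a ∈ A), Fence OrderHom.id (restr f hf A h)

namespace Slides
variable {P : Type*} [PartialOrder P] {A : Set P} {f : P → P} {ι : Type} {N : ℕ}

theorem id (A : Set P) : Slides A id := ⟨monotone_id, fun _ => _root_.id, Fence.refl _⟩

theorem of_steps (hf : Slides A f) (g : ℕ → P → P) (hg : ∀ j, Monotone (g j))
    (hs : ∀ j x, (j % 2 = 1 → g j x ≤ g (j + 1) x) ∧ (j % 2 = 0 → g (j + 1) x ≤ g j x))
    (h : ∀ j, ∀ a ∈ A, g j (f a) ∈ A) (n m : ℕ) (hn : ∀ x, g n x = x) : Slides A (g m ∘ f) := by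
  obtain ⟨hm, hA, hF⟩ := hf
  have key := fun n => Fence.of_steps A (fun j => g j ∘ f) (fun j => (hg j).comp hm) h
    (fun j x => hs j (f x)) n
  refine ⟨(hg m).comp hm, h m, hF.trans ?_⟩
  have h1 := (key n).symm.trans (key m)
  convert h1 using 1
  ext x
  exact (hn _).symm

theorem raise {A : Set (ι → Fen N)} {f : (ι → Fen N) → ι → Fen N} (hf : Slides A f) (W : Set ι)
    (m : ℕ) (h : ∀ j ≤ 2 * N, ∀ a ∈ A, raise W j (f a) ∈ A) : Slides A (_root_.raise W m ∘ f) := by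
  refine hf.of_steps (fun j => _root_.raise W j) (raise_mono W) (raise_step W) (fun j a ha => ?_) 0 m
    (raise_zero W)
  rcases le_total j (2 * N) with hj | hj
  · exact h j hj a ha
  · simp only [raise_of_le hj]; exact h _ le_rfl a ha

theorem lower {A : Set (ι → Fen N)} {f : (ι → Fen N) → ι → Fen N} (hf : Slides A f) (W : Set ι)
    (m : ℕ) (h : ∀ j ≤ 2 * N, ∀ a ∈ A, lower W j (f a) ∈ A) : Slides A (_root_.lower W m ∘ f) := by
  refine hf.of_steps (fun j => _root_.lower W j) (lower_mono W) (lower_step W) (fun j a ha => ?_)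
    (2 * N) m (lower_top W)
  rcases le_total j (2 * N) with hj | hj
  · exact h j hj a ha
  · simp only [lower_of_le hj]; exact hf.2.1 a ha

theorem fence (hf : Slides A f) (c : A) (hc : ∀ a ∈ A, f a = c) :
    Fence OrderHom.id (OrderHom.const A c) := by
  obtain ⟨hm, hA, hF⟩ := hf
  convert hF
  ext a
  exact (hc a a.2).symm

theorem triv {P : Type} [PartialOrder P] [Finite P] {A : Set P} {f : P → P} (hf : Slides A f)
    {c : P} (hcA : c ∈ A) (hc : ∀ a ∈ A, f a = c) : Triv A :=
  Triv.of_fence ⟨c, hcA⟩ (hf.fence ⟨c, hcA⟩ hc)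

end Slides

/-- The vertex of the grid at `x`. -/
def Grid1.vertex (N : ℕ) (x : X) [DecidableEq X] : X → Fen N := fun y =>
  if y = x then ⟨2 * N, le_rfl⟩ else ⟨0, by omega⟩

theorem Grid1.fiber [Finite X] {N : ℕ} (hN : 0 < N) (x : X) :
    ∃ (c : X → Fen N) (f : (X → Fen N) → X → Fen N),
    let A := {κ | κ ∈ Grid1 X N ∧ ∃ y, x ≤ y ∧ (κ y).val = 2 * N}
    c ∈ A ∧ Slides A f ∧ ∀ a ∈ A, f a = c := by
  classical
  refine ⟨Grid1.vertex N x, lower {x}ᶜ 0 ∘ raise {x} (2 * N) ∘ lower (Ici x)ᶜ 0 ∘ id, ?_⟩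
  intro A
  have h1 : ∀ j ≤ 2 * N, ∀ a ∈ A, lower (Ici x)ᶜ j a ∈ A := by
    rintro j - a ⟨⟨ha, -⟩, y, hy, hy'⟩
    have e : (lower (Ici x)ᶜ j a y).val = 2 * N := by simp [lower_val, hy, hy']
    refine ⟨⟨fun z w => ?_, y, e⟩, y, hy, e⟩
    refine (ha z w).imp_right (Or.imp (fun h => ?_) fun h => ?_) <;>
      exact Nat.le_zero.1 ((lower_val_le _ _ _).trans h.le)
  have h2 : ∀ j ≤ 2 * N, ∀ a ∈ A, raise {x} j (lower (Ici x)ᶜ 0 a) ∈ A := by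
    intro j hj a ha
    obtain ⟨⟨ha', -⟩, y, hy, hy'⟩ := h1 0 (by omega) a ha
    have e : (raise {x} j (lower (Ici x)ᶜ 0 a) y).val = 2 * N := by
      rw [raise_val hj, hy']; split_ifs <;> omega
    refine ⟨⟨fun z w => ?_, y, e⟩, y, hy, e⟩
    have := ha' z w
    have hz : ∀ z, x ≤ z ∨ (lower (Ici x)ᶜ 0 a z).val = 0 := fun z => by
      rw [lower_val]; by_cases hz : x ≤ z <;> simp [hz]
    simp only [raise_val hj, mem_singleton_iff]
    by_cases hzx : z = x
    · by_cases hwx : w = x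
      · subst hzx hwx; simp
      · subst hzx
        rcases hz w with h | h
        · exact Or.inl (Or.inl h)
        · simp [hwx, h]
    · by_cases hwx : w = x
      · subst hwx
        rcases hz z with h | h
        · exact Or.inl (Or.inr h)
        · simp [hzx, h]
      · simpa [hzx, hwx] using this
  have h3 : ∀ j ≤ 2 * N, ∀ a ∈ A, lower {x}ᶜ j (raise {x} (2 * N) (lower (Ici x)ᶜ 0 a)) ∈ A := by
    intro j hj a ha
    obtain ⟨⟨ha', -⟩, -⟩ := h2 _ le_rfl a ha
    have e : (lower {x}ᶜ j (raise {x} (2 * N) (lower (Ici x)ᶜ 0 a)) x).val = 2 * N := by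
      have := (lower (Ici x)ᶜ 0 a x).2
      rw [lower_val, if_neg (by simp), raise_val le_rfl, if_pos (mem_singleton x)]; omega
    refine ⟨⟨fun z w => ?_, x, e⟩, x, le_rfl, e⟩
    refine (ha' z w).imp_right (Or.imp (fun h => ?_) fun h => ?_) <;>
      exact Nat.le_zero.1 ((lower_val_le _ _ _).trans h.le)
  refine ⟨⟨⟨fun z w => ?_, x, ?_⟩, x, le_rfl, ?_⟩,
    (((Slides.id A).lower _ 0 h1).raise _ _ h2).lower _ 0 h3, fun a _ => funext fun i => Fen.ext ?_⟩
  · by_cases hz : z = x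
    · by_cases hw : w = x
      · simp [hz, hw]
      · simp [vertex, hw]
    · simp [vertex, hz]
  · simp [vertex]
  · simp [vertex]
  · by_cases hi : i = x
    · subst hi
      have := (lower (Ici i)ᶜ 0 a i).2
      simp only [Function.comp, vertex, _root_.id, if_true]
      rw [lower_val, if_neg (by simp), raise_val le_rfl, if_pos (mem_singleton i)]
      omega
    · simp [lower_val, vertex, hi]

theorem Fence.of_iso {A B : Type*} [Preorder A] [Preorder B] (e : A ≃o B) {c : B}
    (h : Fence (OrderHom.id : B →o B) (OrderHom.const B c)) :
    ∃ c, Fence (OrderHom.id : A →o A) (OrderHom.const A c) := by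
  refine ⟨e.symm c, ?_⟩
  have := (h.comp_left (e.symm : B →o A)).comp_right (e : A →o B)
  convert this using 1
  · ext a
    exact (e.symm_apply_apply a).symm
  · rfl

theorem HTrivial.null [Finite X] (h : HTrivial (Al X)) : Null X := by
  classical
  have : Fintype X := Fintype.ofFinite X
  have hne : Nonempty X := h.1
  let f : (X → I) → Al X := fun t => greatest (X := X) {x | t x = 1}
  have hgr : ∀ t ∈ Real1 X, IsGreatest {x | t x = 1} (greatest (X := X) {x | t x = 1}) := by
    intro t ht
    refine isGreatest_greatest ht.2 fun x (hx : t x = 1) y (hy : t y = 1) => ?_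
    rcases ht.1 x y with h | h | h
    · exact h
    · exact (zero_ne_one (h.symm.trans hx)).elim
    · exact (zero_ne_one (h.symm.trans hy)).elim
  have hf : ContinuousOn f (Real1 X) := by
    rw [Al.continuousOn_iff]
    intro t ht
    have : ∀ᶠ t' in 𝓝[Real1 X] t, ∀ x, t x ≠ 1 → t' x ≠ 1 := by
      rw [Filter.eventually_all]
      intro x
      by_cases hx : t x = 1
      · simp [hx]
      · exact (((continuous_apply x).continuousAt.eventually_ne hx).filter_mono
          nhdsWithin_le_nhds).mono fun _ h _ => h
    filter_upwards [this, self_mem_nhdsWithin] with t' h' ht'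
    exact (hgr t ht).2 (by_contra fun hc => h' _ hc (hgr t' ht').1)
  let 𝓢 : Finset (Set X) := Finset.univ.filter fun e => ∀ x ∈ e, ∀ y ∈ e, x ≤ y ∨ y ≤ x
  obtain ⟨F, hF, hFf⟩ := h.exists_cone_extend f hf 𝓢
    (fun e he e' h' => by
      simp only [𝓢, Finset.mem_filter, Finset.mem_univ, true_and] at he ⊢
      exact fun x hx y hy => he x (h' hx) y (h' hy))
    (fun e he => (Finset.mem_filter.1 he).2)
  let K : Set (Option X → I) := {w | (fun x => w (some x)) ∈ Real1 X}
  have hK : IsClosed K := isClosed_real1.preimage (by fun_prop)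
  have hcont : Continuous fun w : K => F fun x => w.1 none * w.1 (some x) := by
    refine hF.comp_continuous (continuous_pi fun x =>
      ((continuous_apply none).comp continuous_subtype_val).mul
        ((continuous_apply (some x)).comp continuous_subtype_val)) fun w => Or.inr ?_
    simp only [suppIn, 𝓢, Finset.mem_filter, Finset.mem_univ, true_and, mem_setOf_eq]
    intro x hx y hy
    refine (w.2.1 x y).resolve_right ?_
    rintro (h | h)
    · exact hx (by rw [show w.1 (some x) = 0 from h, mul_zero])
    · exact hy (by rw [show w.1 (some y) = 0 from h, mul_zero])
  have hne' : Nonempty (Al X) := h.1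
  obtain ⟨N, hN, g, hg, hg'⟩ := ((Filter.eventually_gt_atTop 0).and
    (exists_approx_subtype (P := X) hK ⟨_, hcont⟩)).exists
  let κj : ℕ → (X → Fen N) → Option X → Fen N := fun j κ o => o.elim (Fen.mk' N j) κ
  have hlift : ∀ j, ∀ κ ∈ Grid1 X N, ∃ w : K, cells N w.1 = κj j κ := by
    intro j κ hκ
    obtain ⟨w, hw⟩ := cells_surjective hN (κj j κ)
    have hw' : ∀ x, cell N (w (some x)) = κ x := fun x => congrFun hw (some x)
    refine ⟨⟨w, fun x y => (hκ.1 x y).imp_right (Or.imp (fun h => ?_) fun h => ?_), ?_⟩, hw⟩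
    · rw [← hw'] at h; exact (cell_eq_zero hN).1 h
    · rw [← hw'] at h; exact (cell_eq_zero hN).1 h
    · obtain ⟨x, hx⟩ := hκ.2
      rw [← hw'] at hx; exact ⟨x, (cell_eq_two_mul hN).1 hx⟩
  have hmem : ∀ j, ∀ κ ∈ Grid1 X N, κj j κ ∈ cells N '' K := fun j κ hκ => by
    obtain ⟨w, hw⟩ := hlift j κ hκ
    exact ⟨w.1, w.2, hw⟩
  let G : ℕ → Grid1 X N →o X := fun j => ⟨fun κ => g (κj j κ.1), fun κ κ' h =>
    hg (hmem j _ κ.2) (hmem j _ κ'.2) fun o => by cases o <;> simp [κj, h _]⟩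
  have hG : ∀ n, Fence (G 0) (G n) := by
    intro n
    induction n with
    | zero => exact Fence.refl _
    | succ n ih =>
      refine ih.trans ?_
      rcases Nat.mod_two_eq_zero_or_one n with hn | hn
      · refine Fence.of_ge fun κ => hg (hmem _ _ κ.2) (hmem _ _ κ.2) fun o => ?_
        cases o
        · simp only [κj, Option.elim, Fen.le_def, Fen.mk'_val]; omega
        · exact le_rfl
      · refine Fence.of_le fun κ => hg (hmem _ _ κ.2) (hmem _ _ κ.2) fun o => ?_
        cases o
        · simp only [κj, Option.elim, Fen.le_def, Fen.mk'_val]; omega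
        · exact le_rfl
  refine ⟨Grid1 X N, inferInstance, inferInstance, Grid1.top hN, fun x => ?_, F fun _ => 0, ?_⟩
  · obtain ⟨c, r, hc, hr, hrc⟩ := Grid1.fiber hN x
    refine Fence.of_iso (subSubIso (Grid1 X N) (fun s => x ≤ Grid1.top hN s)
      {κ | κ ∈ Grid1 X N ∧ ∃ y, x ≤ y ∧ (κ y).val = 2 * N} fun κ => ⟨fun h => ?_, fun h => ?_⟩)
      (hr.fence ⟨c, hc⟩ hrc)
    · exact ⟨h.1, h.2.elim fun y hy => hy.1.trans ((Grid1.isGreatest hN h.1).2 hy.2)⟩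
    · exact ⟨h.1, _, h.2, (Grid1.isGreatest hN h.1).1⟩
  · have h1 : Fence (Grid1.top hN) (G (2 * N)) := by
      refine Fence.of_le fun κ => ?_
      obtain ⟨w, hw⟩ := hlift (2 * N) κ.1 κ.2
      have h0 := hg' w
      rw [hw] at h0
      have hn : w.1 none = 1 := by
        rw [← cell_eq_two_mul hN]
        rw [show cell N (w.1 none) = _ from congrFun hw none]; simp [κj]
      have e : ∀ x, cell N (w.1 (some x)) = κ.1 x := fun x => congrFun hw (some x)
      simp only [ContinuousMap.coe_mk, hn, one_mul] at h0
      rw [hFf _ w.2] at h0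
      refine le_trans (le_of_eq ?_) h0
      show greatest {x | (κ.1 x).val = 2 * N} = greatest {x | w.1 (some x) = 1}
      simp only [← e, cell_eq_two_mul hN]
    have h2 : Fence (G 0) (OrderHom.const _ (F fun _ => 0)) := by
      refine Fence.of_ge fun κ => ?_
      obtain ⟨w, hw⟩ := hlift 0 κ.1 κ.2
      have h0 := hg' w
      rw [hw] at h0
      have hn : w.1 none = 0 := by
        rw [← cell_eq_zero hN]
        rw [show cell N (w.1 none) = _ from congrFun hw none]; simp [κj]
      simp only [ContinuousMap.coe_mk, hn, zero_mul] at h0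
      exact h0
    exact h1.trans ((hG _).symm.trans h2)
end

end

theorem Triv.two_tops {E : Type} [PartialOrder E] [Finite E] {A : Set E} {t t' : E} (ht : t ∈ A)
    (ht' : t' ∈ A) (hne : t' ≠ t) (h : Triv {y | y ∈ A ∧ y < t}) (h' : ∀ a ∈ A, a ≠ t → a ≤ t') :
    Triv A :=
  (EqS.removeUp ht h).triv (Triv.top (m := t') ⟨ht', hne⟩ fun a ha => h' a ha.1 ha.2)

/-- The (non-Hausdorff) suspension, with two additional maximal points. -/
inductive Susp (P : Type) : Type
  | base (p : P) : Susp P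
  | top (b : Bool) : Susp P

namespace Susp
variable {P Q : Type} [PartialOrder P] [PartialOrder Q]

/-- The order of the suspension. -/
def le : Susp P → Susp P → Prop
  | base p, base q => p ≤ q
  | base _, top _ => True
  | top b, top b' => b = b'
  | top _, base _ => False

instance : PartialOrder (Susp P) where
  le := le
  le_refl a := by cases a <;> simp [le]
  le_trans a b c h h' := by
    cases a <;> cases b <;> cases c <;> simp only [le] at h h' ⊢
    · exact h.trans h'
    · exact h.trans h'
  le_antisymm a b h h' := by
    cases a <;> cases b <;> simp only [le] at h h'
    · exact congrArg _ (le_antisymm h h')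
    · rw [h]

@[simp] theorem base_le_base {p q : P} : (base p : Susp P) ≤ base q ↔ p ≤ q := Iff.rfl
@[simp] theorem base_le_top {p : P} {b : Bool} : base p ≤ top b := trivial
@[simp] theorem top_le_top {b b' : Bool} : (top b : Susp P) ≤ top b' ↔ b = b' := Iff.rfl
@[simp] theorem not_top_le_base {p : P} {b : Bool} : ¬ top b ≤ base p := id

instance [Finite P] : Finite (Susp P) :=
  Finite.of_surjective (fun x : P ⊕ Bool => match x with
    | .inl p => base p | .inr b => top b) fun x => by
    cases x with
    | base p => exact ⟨.inl p, rfl⟩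
    | top b => exact ⟨.inr b, rfl⟩

/-- The suspension of a monotone map. -/
def map (f : P →o Q) : Susp P →o Susp Q where
  toFun x := match x with
    | base p => base (f p)
    | top b => top b
  monotone' := by
    rintro (a | a) (b | b) h
    · exact f.monotone h
    · trivial
    · exact h.elim
    · exact h

@[simp] theorem map_base (f : P →o Q) (p : P) : map f (base p) = base (f p) := rfl
@[simp] theorem map_top (f : P →o Q) (b : Bool) : map f (top b) = top b := rfl

theorem map_fence {f g : P →o Q} (h : Fence f g) : Fence (map f) (map g) := by
  induction h with
  | rel f g h =>
    refine Fence.of_le ?_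
    rintro (p | b)
    · exact h p
    · exact le_rfl
  | refl f => exact Fence.refl _
  | symm f g _ ih => exact ih.symm
  | trans f g k _ _ ih ih' => exact ih.trans ih'

theorem fence_const {S : Type} [PartialOrder S] {f : S →o P} {c : P}
    (h : Fence f (OrderHom.const S c)) :
    Fence (map f) (OrderHom.const (Susp S) (base c)) := by
  refine (map_fence h).trans (Fence.of_ge ?_)
  rintro (p | b)
  · exact le_rfl
  · exact base_le_top

theorem eqv_of_fibers {S : Type} [PartialOrder S] [Finite S] [Finite P] (φ : S →o P)
    (h : ∀ x, Triv {s | x ≤ φ s}) : Eqv ⟨Susp S⟩ ⟨Susp P⟩ := by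
  refine Eqv.ofUniv.trans (Eqv.trans (EqS.of_upper_fibers (A := univ) (B := univ) (map φ)
    (fun a _ b _ h => (map φ).monotone h) (fun _ _ => trivial) ?_) Eqv.ofUniv.symm)
  rintro (x | b) -
  · refine Triv.two_tops (t := top true) (t' := top false) ⟨trivial, base_le_top⟩
      ⟨trivial, base_le_top⟩ (by simp) (EqS.triv (EqS.symm ?_) (h x)) ?_
    · refine EqS.image base (fun _ _ _ _ => Iff.rfl) ?_
      ext (s | b)
      · simp [lt_iff_le_and_ne]
      · simp [lt_iff_le_and_ne]
    · rintro (s | b) - h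
      · exact base_le_top
      · cases b
        · exact le_rfl
        · exact absurd rfl h
  · convert Triv.singleton (top b : Susp S) using 1
    ext (s | b')
    · simp
    · simp [eq_comm]

end Susp

theorem Null.susp {X : Type} [PartialOrder X] (h : Null X) : Null (Susp X) := by
  obtain ⟨S, _, _, φ, hφ, c, hc⟩ := h
  refine ⟨Susp S, inferInstance, inferInstance, Susp.map φ, ?_, _, Susp.fence_const hc⟩
  rintro (x | b)
  · obtain ⟨c, hc⟩ := hφ x
    have := Susp.fence_const hc
    refine Fence.of_iso (B := Susp {s // x ≤ φ s}) ⟨⟨fun y => match y with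
      | ⟨.base s, h⟩ => .base ⟨s, h⟩
      | ⟨.top b, _⟩ => .top b, fun y => match y with
      | .base s => ⟨.base s.1, s.2⟩
      | .top b => ⟨.top b, trivial⟩, ?_, ?_⟩, ?_⟩ (c := .base c) ?_
    · rintro ⟨_ | _, _⟩ <;> rfl
    · rintro (_ | _) <;> rfl
    · rintro ⟨_ | _, _⟩ ⟨_ | _, _⟩ <;> rfl
    · convert this using 1
      ext (s | b) <;> rfl
  · refine ⟨⟨.top b, le_rfl⟩, Fence.of_le ?_⟩
    rintro ⟨s | b', h⟩
    · exact h.elim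
    · cases (show b = b' from h); exact le_rfl

theorem eqv_att_const {X S : Type} [PartialOrder X] [Finite X] [PartialOrder S] [Finite S]
    (hS : Eqv ⟨Susp S⟩ ⟨PUnit⟩) {x₀ : X} (ψ : Unit → S →o X) (hψ : ∀ l s, ψ l s = x₀) :
    Eqv ⟨X⟩ ⟨Att ψ⟩ := by
  let D : Set (Att ψ) := {e | ∀ q, e = .base q → q ≤ x₀}
  have hD : IsLowerSet D := by
    rintro a b hba ha q rfl
    obtain ⟨p, rfl⟩ | ⟨l, s, rfl⟩ | ⟨l, rfl⟩ : (∃ p, a = .base p) ∨ (∃ l s, a = .cyl l s) ∨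
        ∃ l, a = .apex l := by cases a <;> simp
    · exact le_trans hba (ha p rfl)
    · exact absurd hba Att.not_base_le_cyl
    · exact absurd hba Att.not_base_le_apex
  let R : LRel (Att ψ) PUnit.{1} := ⟨fun e _ => e ∈ D, fun _ _ _ h _ => h, fun _ _ _ h h' => hD h h'⟩
  have hDT : Triv D := by
    refine (EqS.removeBeats (A := D) {e | ∃ q, e = .base q ∧ q ≠ x₀ ∧ q ≤ x₀} ?_ ?_).triv
      (EqS.triv (EqS.symm (EqS.image (A := univ) (fun x : Susp S => match x with
        | .base s => .cyl () s | .top true => .base x₀ | .top false => .apex ()) ?_ ?_))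
        (Eqv.ofUniv.symm.trans hS))
    · rintro _ ⟨q, rfl, -, h⟩ _ ⟨⟩; exact h
    · rintro _ ⟨q, rfl, hq, hq'⟩
      refine ⟨.base x₀, ?_, by simp, by simp [Att.lt_iff, hq, hq'], ?_⟩
      · rintro _ ⟨⟩; exact le_rfl
      · rintro (p | _ | _) h h' h''
        · by_cases hp : p = x₀
          · rw [hp]
          · exact absurd ⟨p, rfl, hp, h p rfl⟩ h'
        · exact absurd h''.le Att.not_base_le_cyl
        · exact absurd h''.le Att.not_base_le_apex
    · rintro (a | _ | _) - (b | _ | _) - <;> simp [hψ]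
    · ext (p | ⟨l, s⟩ | l)
      · simp only [image_univ, mem_range, mem_diff, D, mem_setOf_eq]
        constructor
        · rintro ⟨_ | _ | _, h⟩ <;> cases h
          exact ⟨by rintro _ ⟨⟩; exact le_rfl, by simp⟩
        · rintro ⟨h, h'⟩
          by_cases hp : p = x₀
          · exact ⟨.top true, by simp [hp]⟩
          · exact absurd ⟨p, rfl, hp, h p rfl⟩ h'
      · simp only [image_univ, mem_range, mem_diff, D, mem_setOf_eq]
        exact ⟨fun _ => by simp, fun _ => ⟨.base s, rfl⟩⟩
      · simp only [image_univ, mem_range, mem_diff, D, mem_setOf_eq]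
        exact ⟨fun _ => by simp, fun _ => ⟨.top false, rfl⟩⟩
  have hb : ∀ q, (.base q : Att ψ) ∈ D ↔ q ≤ x₀ := fun q =>
    ⟨fun h => h q rfl, by rintro h _ ⟨⟩; exact h⟩
  have hcD : ∀ l s, (.cyl l s : Att ψ) ∈ D := fun l s => by rintro _ ⟨⟩
  have haD : ∀ l, (.apex l : Att ψ) ∈ D := fun l => by rintro _ ⟨⟩
  have hw : EqS (univ : Set (Cyl R)) (univ \ {Cyl.hi PUnit.unit}) := EqS.removeUp trivial (by
    refine EqS.triv (EqS.symm (EqS.image (A := D) Cyl.lo (by simp) ?_)) hDT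
    ext (e | e) <;> simp [R])
  have h1 : EqS (univ : Set (Att ψ)) (univ \ {Cyl.hi PUnit.unit} : Set (Cyl R)) :=
    EqS.image Cyl.lo (by simp) (by ext (e | e) <;> simp)
  have h2 := EqS.removeUpper (A := (univ : Set (Cyl R))) {w | ∃ l s, w = .lo (.cyl l s)}
    (subset_univ _) (by
      rintro _ ⟨l, s, rfl⟩
      refine (EqS.removeBeat (x := .lo (.apex ())) (m := .hi ⟨⟩) ?_ ?_ (by simp [R, haD])
        ?_).triv (Triv.bot (m := .lo (.base x₀)) ?_ ?_)
      · simp [Att.lt_iff, hψ]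
      · simp [R, hcD]
      · rintro ((p | _ | _) | _) ⟨-, h, -⟩ h' <;> simp_all [Att.lt_iff]
      · simp [Att.lt_iff, hψ]
      · rintro ((p | _ | _) | _) ⟨⟨-, h, h'⟩, h''⟩
        · simpa [Att.lt_iff, hψ] using h'
        · exact absurd ⟨_, _, rfl⟩ h
        · exact absurd rfl h''
        · simp [R, hb])
  have h3 := EqS.removeBeat (A := univ \ {w : Cyl R | ∃ l s, w = .lo (.cyl l s)})
    (x := .lo (.apex ())) (m := .hi ⟨⟩) (by simp) (by simp) (by simp [R, haD]) (by
      rintro ((p | _ | _) | _) ⟨-, h⟩ h' <;> simp_all [Att.lt_iff])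
  have h4 := EqS.removeUp (A := (univ \ {w : Cyl R | ∃ l s, w = .lo (.cyl l s)}) \
    {.lo (.apex ())}) (x := .hi ⟨⟩) (by simp) (by
      refine Triv.top (m := .lo (.base x₀)) (by simp [R, hb]) ?_
      rintro ((p | _ | _) | _) ⟨⟨⟨-, h⟩, h''⟩, h'⟩
      · simpa [R, hb] using h'
      · exact absurd ⟨_, _, rfl⟩ h
      · exact absurd rfl h''
      · simp at h')
  refine Eqv.trans (Eqv.trans Eqv.ofUniv ?_) (Eqv.trans ((h4.symm.trans (h3.symm.trans
    (h2.symm.trans hw))).trans h1.symm) Eqv.ofUniv.symm)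
  refine EqS.image (A := univ) (fun p => .lo (.base p)) (by simp) ?_
  ext ((p | _ | _) | _) <;> simp

/-- If the suspension of a null poset is trivial then so is the poset itself. -/
theorem Null.triv_of_susp {X : Type} [PartialOrder X] [Finite X] (h : Null X)
    (hs : Eqv ⟨Susp X⟩ ⟨PUnit⟩) : Eqv ⟨X⟩ ⟨PUnit⟩ := by
  obtain ⟨S, _, _, φ, hφ, x₀, hx₀⟩ := h
  have hT : ∀ x, Triv {s | x ≤ φ s} := fun x => by
    obtain ⟨c, hc⟩ := hφ x
    exact Eqv.of_fence c hc
  have hS : Eqv ⟨Susp S⟩ ⟨PUnit⟩ := (Susp.eqv_of_fibers φ hT).trans hs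
  have e1 : Eqv ⟨Att fun _ : Unit => (OrderHom.id : X →o X)⟩ ⟨Att fun _ : Unit => φ⟩ :=
    Att.reindex φ hT _ _ fun _ _ => le_rfl
  have e2 : Eqv ⟨Att fun _ : Unit => φ⟩ ⟨Att fun _ : Unit => OrderHom.const S x₀⟩ := by
    clear hφ hT hS e1 hs
    generalize OrderHom.const S x₀ = ψ at hx₀
    induction hx₀ with
    | rel f g h => exact Att.of_le fun _ => h
    | refl f => exact Eqv.refl _
    | symm f g _ ih => exact ih.symm
    | trans f g k _ _ ih ih' => exact ih.trans ih'
  have e0 : Eqv ⟨Att fun _ : Unit => (OrderHom.id : X →o X)⟩ ⟨PUnit⟩ := by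
    refine Eqv.ofUniv.trans (EqS.triv (EqS.removeLower {w | ∃ p, w = .base p} (subset_univ _) ?_)
      (Triv.top (m := .apex ()) ⟨trivial, by simp⟩ ?_))
    · rintro _ ⟨p, rfl⟩
      refine Triv.top (m := .cyl () p) ⟨trivial, by simp, by simp [Att.lt_iff]⟩ ?_
      rintro (q | _ | _) ⟨-, h, h'⟩
      · exact absurd ⟨q, rfl⟩ h
      · simpa [Att.lt_iff] using h'
      · simp [Att.lt_iff] at h'
    · rintro (q | _ | _) ⟨-, h⟩
      · exact absurd ⟨q, rfl⟩ h
      · simp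
      · simp
  exact (eqv_att_const hS (fun _ => OrderHom.const S x₀) fun _ _ => rfl).trans
    (e2.symm.trans (e1.symm.trans e0))

/-- Integral combinations of lists. -/
abbrev LC (X : Type) : Type := List X →₀ ℤ

namespace LC
variable {X Y P Q : Type}

/-- Linear extension of a function on lists. -/
noncomputable def lin {M : Type} [AddCommGroup M] (f : List X → M) : LC X →ₗ[ℤ] M :=
  Finsupp.linearCombination ℤ f

@[simp] theorem lin_single {M : Type} [AddCommGroup M] (f : List X → M) (l : List X) :
    lin f (Finsupp.single l 1) = f l := by simp [lin]

theorem lin_ext {M : Type} [AddCommGroup M] {f g : LC X →ₗ[ℤ] M}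
    (h : ∀ l, f (Finsupp.single l 1) = g (Finsupp.single l 1)) : f = g :=
  Finsupp.lhom_ext' fun l => LinearMap.ext_ring (h l)

/-- Adjoining a first entry. -/
noncomputable def cons (x : X) : LC X →ₗ[ℤ] LC X := lin fun l => Finsupp.single (x :: l) 1

@[simp] theorem cons_single (x : X) (l : List X) :
    cons x (Finsupp.single l 1) = Finsupp.single (x :: l) 1 := by simp [cons]

/-- The chain map induced by a map. -/
noncomputable def map (f : X → Y) : LC X →ₗ[ℤ] LC Y := lin fun l => Finsupp.single (l.map f) 1

@[simp] theorem map_single (f : X → Y) (l : List X) :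
    map f (Finsupp.single l 1) = Finsupp.single (l.map f) 1 := by simp [map]

theorem map_cons (f : X → Y) (x : X) (z : LC X) : map f (cons x z) = cons (f x) (map f z) :=
  LinearMap.congr_fun (lin_ext (f := map f ∘ₗ cons x) (g := cons (f x) ∘ₗ map f) (by simp)) z

/-- The boundary of a list. -/
noncomputable def bdList : List X → LC X
  | [] => 0
  | x :: s => Finsupp.single s 1 - cons x (bdList s)

/-- The boundary operator. -/
noncomputable def bd : LC X →ₗ[ℤ] LC X := lin bdList

@[simp] theorem bd_nil : bd (Finsupp.single ([] : List X) 1) = 0 := by simp [bd, bdList]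

@[simp] theorem bd_single_cons (x : X) (s : List X) : bd (Finsupp.single (x :: s) 1) =
    Finsupp.single s 1 - cons x (bd (Finsupp.single s 1)) := by simp [bd, bdList]

theorem bd_cons (x : X) (z : LC X) : bd (cons x z) = z - cons x (bd z) :=
  LinearMap.congr_fun (lin_ext (f := bd ∘ₗ cons x) (g := LinearMap.id - cons x ∘ₗ bd)
    (by simp)) z

theorem bd_bd (z : LC X) : bd (bd z) = 0 := by
  refine LinearMap.congr_fun (lin_ext (f := bd ∘ₗ bd) (g := 0) fun l => ?_) z
  induction l with
  | nil => simp
  | cons x s ih =>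
    simp only [LinearMap.comp_apply, LinearMap.zero_apply] at ih ⊢
    simp [bd_cons, ih]

theorem bd_map (f : X → Y) (z : LC X) : bd (map f z) = map f (bd z) := by
  refine LinearMap.congr_fun (lin_ext (f := bd ∘ₗ map f) (g := map f ∘ₗ bd) fun l => ?_) z
  induction l with
  | nil => simp
  | cons x s ih =>
    simp only [LinearMap.comp_apply, map_single] at ih
    simp [map_cons, ih]

/-- Combinations of lists in `A`. -/
abbrev on (A : Set (List X)) : Submodule ℤ (LC X) := Finsupp.supported ℤ ℤ A

theorem single_mem {A : Set (List X)} {l : List X} (h : l ∈ A) : Finsupp.single l 1 ∈ on A :=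
  Finsupp.single_mem_supported ℤ _ h

theorem on_le {A : Set (List X)} {N : Submodule ℤ (LC X)}
    (h : ∀ l ∈ A, Finsupp.single l 1 ∈ N) : on A ≤ N := by
  rw [on, Finsupp.supported_eq_span_single, Submodule.span_le]
  rintro _ ⟨l, hl, rfl⟩
  exact h l hl

theorem apply_mem {M : Type} [AddCommGroup M] {A : Set (List X)} {N : Submodule ℤ M}
    {f : LC X →ₗ[ℤ] M} (h : ∀ l ∈ A, f (Finsupp.single l 1) ∈ N) {z : LC X} (hz : z ∈ on A) :
    f z ∈ N :=
  on_le (N := N.comap f) h hz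

theorem congr_on {M : Type} [AddCommGroup M] {A : Set (List X)} {f g : LC X →ₗ[ℤ] M}
    (h : ∀ l ∈ A, f (Finsupp.single l 1) = g (Finsupp.single l 1)) {z : LC X} (hz : z ∈ on A) :
    f z = g z := by
  have := apply_mem (N := ⊥) (f := f - g) (A := A) (fun l hl => by simp [h l hl]) hz
  simpa [sub_eq_zero] using this

theorem bd_mem (l : List X) : bd (Finsupp.single l 1) ∈ on {l' | l'.Sublist l ∧
    l'.length < l.length} := by
  induction l with
  | nil => simp
  | cons x s ih =>
    rw [bd_single_cons]
    refine sub_mem (single_mem ⟨List.sublist_cons_self _ _, by simp⟩) (apply_mem ?_ ih)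
    rintro l' ⟨h, h'⟩
    rw [cons_single]
    exact single_mem ⟨h.cons₂ x, by simpa using h'⟩

variable [PartialOrder X] [PartialOrder Y] [PartialOrder P] [PartialOrder Q]

/-- Weakly increasing lists. -/
def Srt (X : Type) [PartialOrder X] : Set (List X) := {l | l.Pairwise (· ≤ ·)}

theorem bd_mem_srt {l : List X} (h : l ∈ Srt X) : bd (Finsupp.single l 1) ∈ on (Srt X) :=
  Finsupp.supported_mono (fun _ h' => List.Pairwise.sublist h'.1 h) (bd_mem l)

theorem bd_mem_on_srt {z : LC X} (hz : z ∈ on (Srt X)) : bd z ∈ on (Srt X) :=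
  apply_mem (fun _ h => bd_mem_srt h) hz

theorem map_mem {f : X →o Y} {z : LC X} (hz : z ∈ on (Srt X)) : map f z ∈ on (Srt Y) :=
  apply_mem (fun l h => by
    rw [map_single]
    exact single_mem (List.pairwise_map.2 (List.Pairwise.imp (fun h => f.monotone h) h))) hz

/-- The prism operator. -/
noncomputable def prismList (f g : P → Q) : List P → LC Q
  | [] => 0
  | x :: s => Finsupp.single (f x :: g x :: s.map g) 1 - cons (f x) (prismList f g s)

theorem prism_cons (f g : P → Q) (x : P) (z : LC P) : lin (prismList f g) (cons x z) =
    cons (f x) (cons (g x) (map g z)) - cons (f x) (lin (prismList f g) z) :=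
  LinearMap.congr_fun (lin_ext (f := lin (prismList f g) ∘ₗ cons x)
    (g := cons (f x) ∘ₗ cons (g x) ∘ₗ map g - cons (f x) ∘ₗ lin (prismList f g))
    (by simp [prismList])) z

theorem bd_prism (f g : P → Q) (z : LC P) : bd (lin (prismList f g) z) +
    lin (prismList f g) (bd z) = map g z - map f z := by
  refine LinearMap.congr_fun (lin_ext (f := bd ∘ₗ lin (prismList f g) + lin (prismList f g) ∘ₗ bd)
    (g := map g - map f) fun l => ?_) z
  induction l with
  | nil => simp [prismList]
  | cons x s ih =>
    have h1 : cons x (Finsupp.single s 1) = Finsupp.single (x :: s) 1 := by simp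
    simp only [LinearMap.add_apply, LinearMap.comp_apply, LinearMap.sub_apply] at ih ⊢
    rw [← h1]
    have h2 := congrArg (cons (f x)) ih
    simp only [map_add, map_sub, bd_cons, prism_cons, map_cons, bd_map] at h2 ⊢
    rw [← sub_eq_zero] at h2 ⊢
    rw [← h2]
    abel

theorem prism_mem {f g : P →o Q} (hfg : f ≤ g) {l : List P} (h : l ∈ Srt P) :
    lin (prismList f g) (Finsupp.single l 1) ∈
      on {l' | l' ∈ Srt Q ∧ ∀ z ∈ l', ∃ y ∈ l, f y ≤ z} := by
  rw [lin_single]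
  induction l with
  | nil => simp [prismList]
  | cons x s ih =>
    have hx := List.pairwise_cons.1 h
    refine sub_mem (single_mem ⟨?_, ?_⟩) (apply_mem ?_ (ih hx.2))
    · refine List.pairwise_cons.2 ⟨?_, List.pairwise_cons.2 ⟨?_, List.pairwise_map.2
        (hx.2.imp fun h => g.monotone h)⟩⟩
      · intro a ha
        rcases List.mem_cons.1 ha with rfl | ha
        · exact hfg x
        · obtain ⟨y, hy, rfl⟩ := List.mem_map.1 ha
          exact (hfg x).trans (g.monotone (hx.1 y hy))
      · intro a ha
        obtain ⟨y, hy, rfl⟩ := List.mem_map.1 ha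
        exact g.monotone (hx.1 y hy)
    · intro z hz
      simp only [List.mem_cons, List.mem_map] at hz
      rcases hz with rfl | rfl | ⟨y, hy, rfl⟩
      · exact ⟨x, by simp, le_rfl⟩
      · exact ⟨x, by simp, hfg x⟩
      · exact ⟨y, by simp [hy], hfg y⟩
    · rintro l' ⟨h1, h2⟩
      rw [cons_single]
      refine single_mem ⟨List.pairwise_cons.2 ⟨fun z hz => ?_, h1⟩, fun z hz => ?_⟩
      · obtain ⟨y, hy, hy'⟩ := h2 z hz
        exact (f.monotone (hx.1 y hy)).trans hy'
      · rcases List.mem_cons.1 hz with rfl | hz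
        · exact ⟨x, by simp, le_rfl⟩
        · obtain ⟨y, hy, hy'⟩ := h2 z hz
          exact ⟨y, by simp [hy], hy'⟩

theorem fence_homologous {f g : P →o Q} (h : Fence f g) {z : LC P} (hz : z ∈ on (Srt P))
    (hz0 : bd z = 0) : ∃ w ∈ on (Srt Q), bd w = map g z - map f z := by
  induction h with
  | rel f g h =>
    refine ⟨lin (prismList f g) z, apply_mem (fun l hl => ?_) hz, ?_⟩
    · exact Finsupp.supported_mono (fun _ h => h.1) (prism_mem h hl)
    · simpa [hz0] using bd_prism f g z
  | refl f => exact ⟨0, zero_mem _, by simp⟩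
  | symm f g _ ih =>
    obtain ⟨w, hw, e⟩ := ih
    exact ⟨-w, neg_mem hw, by rw [map_neg, e]; abel⟩
  | trans f g k _ _ ih ih' =>
    obtain ⟨w, hw, e⟩ := ih
    obtain ⟨w', hw', e'⟩ := ih'
    exact ⟨w + w', add_mem hw hw', by rw [map_add, e, e']; abel⟩

/-- Cycles in the submodule are boundaries in the submodule. -/
def Exact (N : Submodule ℤ (LC X)) : Prop := ∀ z ∈ N, bd z = 0 → ∃ w ∈ N, bd w = z

theorem exact_above (x : X) : Exact (on {l | l ∈ Srt X ∧ ∀ y ∈ l, x ≤ y}) := by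
  refine fun z hz hz0 => ⟨cons x z, apply_mem ?_ hz, by rw [bd_cons, hz0, map_zero, sub_zero]⟩
  rintro l ⟨h1, h2⟩
  rw [cons_single]
  exact single_mem ⟨List.pairwise_cons.2 ⟨h2, h1⟩, by simpa using h2⟩

theorem bounds_of_fence_const {f : P →o Q} {c : Q} (h : Fence f (OrderHom.const P c)) {z : LC P}
    (hz : z ∈ on (Srt P)) (hz0 : bd z = 0) : ∃ w ∈ on (Srt Q), bd w = map f z := by
  obtain ⟨w, hw, e⟩ := fence_homologous h.symm hz hz0
  have hm : map (OrderHom.const P c) z ∈ on (Srt Q) := map_mem hz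
  obtain ⟨w', hw', e'⟩ : ∃ w' ∈ on (Srt Q), bd w' = map (OrderHom.const P c) z := by
    have : map (OrderHom.const P c) z ∈ on {l | l ∈ Srt Q ∧ ∀ y ∈ l, c ≤ y} := by
      refine apply_mem (fun l hl => ?_) hz
      rw [map_single]
      exact single_mem ⟨List.pairwise_map.2 (List.Pairwise.imp (fun _ => le_rfl) hl), by simp⟩
    obtain ⟨w, hw, e⟩ := exact_above c _ this (by rw [bd_map, hz0, map_zero])
    exact ⟨w, Finsupp.supported_mono (fun _ h => h.1) hw, e⟩
  exact ⟨w + w', add_mem hw hw', by rw [map_add, e, e']; abel⟩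

/-- Acyclic carriers. -/
theorem exists_carried (N : X → Submodule ℤ (LC Y)) (hN : ∀ x, Exact (N x))
    (hanti : ∀ x y, x ≤ y → N y ≤ N x) (r : LC X →ₗ[ℤ] LC Y) (ε : ℤ) (h₀ : LC Y)
    (hh₀ : ∀ x, h₀ ∈ N x) (hb₀ : bd h₀ = r (Finsupp.single [] 1)) (n : ℕ)
    (hr : ∀ x, ∀ s, x :: s ∈ Srt X → (x :: s).length ≤ n →
      r (Finsupp.single (x :: s) 1) ∈ N x ∧ bd (r (Finsupp.single (x :: s) 1)) =
        ε • r (bd (Finsupp.single (x :: s) 1))) (hε : ε * ε = 1) :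
    ∃ h : List X → LC Y, h [] = h₀ ∧ ∀ l ∈ Srt X, l.length ≤ n →
      (∀ x, (∀ y ∈ l, x ≤ y) → h l ∈ N x) ∧
        bd (h l) = r (Finsupp.single l 1) - ε • lin h (bd (Finsupp.single l 1)) := by
  classical
  induction n with
  | zero =>
    refine ⟨fun _ => h₀, rfl, fun l _ hl => ?_⟩
    obtain rfl : l = [] := by simpa using hl
    exact ⟨fun x _ => hh₀ x, by simp [hb₀]⟩
  | succ n ih =>
    obtain ⟨h, h0, hh⟩ := ih fun x s hs hl => hr x s hs (by omega)
    have key : ∀ x s, x :: s ∈ Srt X → s.length = n → ∃ w ∈ N x,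
        bd w = r (Finsupp.single (x :: s) 1) - ε • lin h (bd (Finsupp.single (x :: s) 1)) := by
      intro x s hs hl
      have hx := List.pairwise_cons.1 hs
      obtain ⟨hr1, hr2⟩ := hr x s hs (by simp [hl])
      refine hN x _ (sub_mem hr1 (Submodule.smul_mem _ _ (apply_mem ?_ (bd_mem _)))) ?_
      · rintro l' ⟨h1, h2⟩
        rw [lin_single]
        refine (hh l' (List.Pairwise.sublist h1 hs) (by simp [hl] at h2; omega)).1 x fun y hy => ?_
        rcases List.mem_cons.1 (h1.subset hy) with rfl | hy
        · exact le_rfl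
        · exact hx.1 y hy
      · have : (bd ∘ₗ lin h) (bd (Finsupp.single (x :: s) 1)) =
            (r - ε • (lin h ∘ₗ bd)) (bd (Finsupp.single (x :: s) 1)) := by
          refine congr_on (fun l' hl' => ?_) (bd_mem (x :: s))
          have := (hh l' (List.Pairwise.sublist hl'.1 hs) (by
            have := hl'.2; simp [hl] at this; omega)).2
          simpa using this
        simp only [LinearMap.comp_apply, LinearMap.sub_apply, LinearMap.smul_apply, bd_bd,
          map_zero, smul_zero, sub_zero] at this
        rw [map_sub, map_smul, this, hr2, sub_self]
    let h' : List X → LC Y := fun l => match l with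
      | [] => h₀
      | x :: s => if hs : x :: s ∈ Srt X ∧ s.length = n then (key x s hs.1 hs.2).choose
          else h (x :: s)
    have hlt : ∀ l, l.length ≤ n → h' l = h l := by
      rintro (_ | ⟨x, s⟩) hl
      · exact h0.symm
      · exact dif_neg fun hs => by simp [hs.2] at hl
    have hlin : ∀ l, l.length ≤ n + 1 →
        lin h' (bd (Finsupp.single l 1)) = lin h (bd (Finsupp.single l 1)) := fun l hl =>
      congr_on (fun l' hl' => by
        rw [lin_single, lin_single]; exact hlt _ (by have := hl'.2; omega)) (bd_mem l)
    refine ⟨h', rfl, fun l hl hn => ?_⟩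
    rw [hlin l hn]
    by_cases hl' : l.length ≤ n
    · rw [hlt l hl']; exact hh l hl hl'
    · match l, hl, hn, hl' with
      | [], _, _, hl' => simp at hl'
      | x :: s, hl, hn, hl' =>
        have hs : x :: s ∈ Srt X ∧ s.length = n := ⟨hl, by simp at hn hl'; omega⟩
        have e : h' (x :: s) = (key x s hs.1 hs.2).choose := dif_pos hs
        obtain ⟨hw, hw'⟩ := (key x s hs.1 hs.2).choose_spec
        rw [e]
        exact ⟨fun y hy => hanti y x (hy x (by simp)) hw, hw'⟩

end LC

open LC in
/-- Null posets are acyclic. -/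
theorem Null.exact {X : Type} [PartialOrder X] (h : Null X) : LC.Exact (on (Srt X)) := by
  obtain ⟨S, _, _, φ, hφ, c, hc⟩ := h
  intro z hz hz0
  obtain ⟨n, hn⟩ : ∃ n, ∀ l ∈ z.support, l.length ≤ n :=
    ⟨z.support.sup List.length, fun l hl => Finset.le_sup (f := List.length) hl⟩
  have hz' : z ∈ on {l | l ∈ Srt X ∧ l.length ≤ n} := fun l hl => ⟨hz hl, hn l hl⟩
  let N : X → Submodule ℤ (LC S) := fun x => on {l | l ∈ Srt S ∧ ∀ s ∈ l, x ≤ φ s}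
  have hN : ∀ x, LC.Exact (N x) := by
    intro x w hw hw0
    let v : {s // x ≤ φ s} →o S := ⟨Subtype.val, fun _ _ h => h⟩
    obtain ⟨c, hc⟩ := hφ x
    obtain ⟨w', hw', rfl⟩ : ∃ w' ∈ on (Srt {s // x ≤ φ s}), map v w' = w := by
      refine on_le (N := (on (Srt {s // x ≤ φ s})).map (map v)) ?_ hw
      rintro l ⟨h1, h2⟩
      have e : (l.pmap Subtype.mk h2).map v = l := by
        change (l.pmap Subtype.mk h2).map Subtype.val = l
        rw [List.map_pmap]; simp
      exact ⟨Finsupp.single (l.pmap Subtype.mk h2) 1,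
        single_mem ((List.pairwise_map (f := v)).1 (by rw [e]; exact h1)), by rw [map_single, e]⟩
    have hinj : Function.Injective (map v) := by
      have : (map v : LC _ → LC S) = Finsupp.mapDomain (List.map v) := by
        funext z
        exact LinearMap.congr_fun (lin_ext (f := map v)
          (g := Finsupp.lmapDomain ℤ ℤ (List.map v)) (by simp [Finsupp.lmapDomain])) z
      rw [this]
      exact Finsupp.mapDomain_injective (List.map_injective_iff.2 Subtype.val_injective)
    rw [bd_map] at hw0
    obtain ⟨b, hb, e⟩ := bounds_of_fence_const hc hw' (hinj (by rw [hw0, map_zero]))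
    refine ⟨map v b, apply_mem (fun l hl => ?_) hb, ?_⟩
    · rw [map_single]
      refine single_mem ⟨List.pairwise_map.2 (List.Pairwise.imp (fun h => h) hl), fun s hs => ?_⟩
      obtain ⟨a, -, rfl⟩ := List.mem_map.1 hs
      exact a.2
    · rw [bd_map, e]
      congr 1
      exact LinearMap.congr_fun (lin_ext (f := map _) (g := LinearMap.id) fun l => by
        rw [map_single]; simp) w'
  obtain ⟨s, s0, hs⟩ := exists_carried N hN
    (fun x y hxy => Finsupp.supported_mono fun l hl => ⟨hl.1, fun a ha => hxy.trans (hl.2 a ha)⟩)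
    0 (-1) (Finsupp.single [] 1) (fun x => single_mem ⟨List.Pairwise.nil, by simp⟩) (by simp) n
    (by simp) (by norm_num)
  have hsN : ∀ x t, x :: t ∈ Srt X → (x :: t).length ≤ n → s (x :: t) ∈ N x := fun x t ht hl =>
    (hs _ ht hl).1 x fun y hy => by
      rcases List.mem_cons.1 hy with rfl | hy
      · exact le_rfl
      · exact (List.pairwise_cons.1 ht).1 y hy
  have hsbd : ∀ l ∈ Srt X, l.length ≤ n → bd (s l) = lin s (bd (Finsupp.single l 1)) := by
    intro l hl hl'; simpa using (hs l hl hl').2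
  obtain ⟨T, T0, hT⟩ := exists_carried (fun x : X => on {l | l ∈ Srt X ∧ ∀ y ∈ l, x ≤ y})
    exact_above (fun x y hxy => Finsupp.supported_mono fun l hl =>
      ⟨hl.1, fun a ha => hxy.trans (hl.2 a ha)⟩)
    (map φ ∘ₗ lin s - LinearMap.id) 1 0 (fun _ => zero_mem _) (by simp [s0]) n
    (fun x t ht hl => by
      refine ⟨sub_mem ?_ (single_mem ⟨ht, ?_⟩), ?_⟩
      · rw [LinearMap.comp_apply, lin_single]
        refine apply_mem (fun l hl => ?_) (hsN x t ht hl)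
        rw [map_single]
        exact single_mem ⟨List.pairwise_map.2 (List.Pairwise.imp (fun h => φ.monotone h) hl.1),
          by simpa using hl.2⟩
      · simpa using (List.pairwise_cons.1 ht).1
      · simp only [LinearMap.sub_apply, LinearMap.comp_apply, LinearMap.id_apply, map_sub, bd_map,
          lin_single, one_smul, hsbd _ ht hl]) (by norm_num)
  have hsz : lin s z ∈ on (Srt S) := apply_mem (fun l hl => by
    rw [lin_single]
    match l, hl with
    | [], _ => rw [s0]; exact single_mem List.Pairwise.nil
    | x :: t, hl => exact Finsupp.supported_mono (fun _ h => h.1) (hsN x t hl.1 hl.2)) hz'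
  have hsz0 : bd (lin s z) = 0 := by
    have : (bd ∘ₗ lin s) z = (lin s ∘ₗ bd) z := congr_on (fun l hl => by
      simpa using hsbd l hl.1 hl.2) hz'
    simpa [hz0] using this
  obtain ⟨w, hw, e⟩ := bounds_of_fence_const hc hsz hsz0
  have hTz : lin T z ∈ on (Srt X) := apply_mem (fun l hl => by
    rw [lin_single]
    match l, hl with
    | [], _ => rw [T0]; exact zero_mem _
    | x :: t, hl =>
      refine Finsupp.supported_mono (fun _ h => h.1) ((hT _ hl.1 hl.2).1 x fun y hy => ?_)
      rcases List.mem_cons.1 hy with rfl | hy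
      · exact le_rfl
      · exact (List.pairwise_cons.1 hl.1).1 y hy) hz'
  have hTbd : (bd ∘ₗ lin T) z =
      ((map φ ∘ₗ lin s - LinearMap.id - lin T ∘ₗ bd : LC X →ₗ[ℤ] LC X)) z :=
    congr_on (fun l hl => by simpa using (hT l hl.1 hl.2).2) hz'
  refine ⟨w - lin T z, sub_mem hw hTz, ?_⟩
  simp only [LinearMap.comp_apply, LinearMap.sub_apply, hz0, map_zero, LinearMap.id_apply,
    sub_zero] at hTbd
  rw [map_sub, hTbd, e]; abel

/-- Integral chains on strictly increasing sequences of length `k`. -/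
abbrev Ch (X : Type) [PartialOrder X] (k : ℕ) : Type := (Fin k ↪o X) →₀ ℤ

namespace Ch
variable {X : Type} [PartialOrder X]

/-- The faces of a strictly increasing sequence. -/
def face {k : ℕ} (e : Fin (k + 1) ↪o X) (i : Fin (k + 1)) : Fin k ↪o X :=
  (Fin.succAboveOrderEmb i).trans e

@[simp] theorem face_apply {k : ℕ} (e : Fin (k + 1) ↪o X) (i : Fin (k + 1)) (j : Fin k) :
    face e i j = e (i.succAbove j) := rfl

/-- The boundary operator. -/
noncomputable def bd (X : Type) [PartialOrder X] (k : ℕ) : Ch X (k + 1) →ₗ[ℤ] Ch X k :=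
  Finsupp.linearCombination ℤ fun e => ∑ i : Fin (k + 1), (-1 : ℤ) ^ (i : ℕ) •
    Finsupp.single (face e i) (1 : ℤ)

@[simp] theorem bd_single {k : ℕ} (e : Fin (k + 1) ↪o X) : bd X k (Finsupp.single e 1) =
    ∑ i : Fin (k + 1), (-1 : ℤ) ^ (i : ℕ) • Finsupp.single (face e i) (1 : ℤ) := by
  rw [bd, Finsupp.linearCombination_single, one_smul]

/-- The boundary operator, defined to be zero in the lowest degree. -/
noncomputable def bd' (X : Type) [PartialOrder X] : ∀ k : ℕ, Ch X k →ₗ[ℤ] Ch X (k - 1)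
  | 0 => 0
  | k + 1 => bd X k

theorem bd_ofFn (k : ℕ) (f : Fin (k + 1) → X) : LC.bd (Finsupp.single (List.ofFn f) 1) =
    ∑ i : Fin (k + 1), (-1 : ℤ) ^ (i : ℕ) •
      (Finsupp.single (List.ofFn fun j => f (i.succAbove j)) 1 : LC X) := by
  induction k with
  | zero => simp
  | succ k ih =>
    rw [List.ofFn_succ, LC.bd_single_cons, ih, Fin.sum_univ_succ (n := k + 1)]
    simp only [Fin.val_zero, pow_zero, one_smul, Fin.zero_succAbove, map_sum, map_zsmul,
      LC.cons_single, Fin.val_succ, pow_succ, mul_neg, mul_one, neg_smul, Finset.sum_neg_distrib,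
      ← sub_eq_add_neg]
    exact congrArg _ (Finset.sum_congr rfl fun i _ => by rw [List.ofFn_succ]; simp)

/-- Chains as combinations of lists. -/
noncomputable def toLC (k : ℕ) : Ch X k →ₗ[ℤ] LC X :=
  Finsupp.linearCombination ℤ fun e => Finsupp.single (List.ofFn e) 1

open Classical in
/-- The projection to chains. -/
noncomputable def ofLC (k : ℕ) : LC X →ₗ[ℤ] Ch X k :=
  LC.lin fun l => if h : ∃ e : Fin k ↪o X, List.ofFn e = l then Finsupp.single h.choose 1 else 0

@[simp] theorem toLC_single {k : ℕ} (e : Fin k ↪o X) :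
    toLC k (Finsupp.single e 1) = Finsupp.single (List.ofFn e) 1 := by simp [toLC]

theorem ofLC_ofFn {k : ℕ} (e : Fin k ↪o X) :
    ofLC k (Finsupp.single (List.ofFn e) 1) = Finsupp.single e 1 := by
  have h : ∃ e' : Fin k ↪o X, List.ofFn e' = List.ofFn e := ⟨e, rfl⟩
  rw [ofLC, LC.lin_single, dif_pos h]
  congr 1
  exact DFunLike.coe_injective (List.ofFn_injective h.choose_spec)

theorem ofLC_eq_zero {k : ℕ} {l : List X} (h : ∀ e : Fin k ↪o X, List.ofFn e ≠ l) :
    ofLC k (Finsupp.single l 1) = 0 := by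
  rw [ofLC, LC.lin_single, dif_neg (by simpa using h)]

theorem ofLC_toLC {k : ℕ} (z : Ch X k) : ofLC k (toLC k z) = z :=
  LinearMap.congr_fun (Finsupp.lhom_ext' (φ := ofLC k ∘ₗ toLC k) (ψ := LinearMap.id) fun e =>
    LinearMap.ext_ring (by simp [ofLC_ofFn])) z

theorem toLC_bd {k : ℕ} (z : Ch X (k + 1)) : LC.bd (toLC (k + 1) z) = toLC k (bd X k z) :=
  LinearMap.congr_fun (Finsupp.lhom_ext' (φ := LC.bd ∘ₗ toLC (k + 1)) (ψ := toLC k ∘ₗ bd X k)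
    fun e => LinearMap.ext_ring (by
      simp only [LinearMap.comp_apply, Finsupp.lsingle_apply, toLC_single, bd_ofFn, bd_single,
        map_sum, map_zsmul]; rfl)) z

theorem ofLC_bd {k : ℕ} {l : List X} (hl : l ∈ LC.Srt X) :
    ofLC k (LC.bd (Finsupp.single l 1)) = bd X k (ofLC (k + 1) (Finsupp.single l 1)) := by
  obtain ⟨n, f, rfl⟩ : ∃ n, ∃ f : Fin n → X, List.ofFn f = l := ⟨_, _, List.ofFn_get l⟩
  obtain _ | n := n
  · rw [ofLC_eq_zero (k := k + 1) fun e he => by simpa using congrArg List.length he]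
    simp
  have hlen : ∀ (m : ℕ) (g : Fin m → X) (k : ℕ), m ≠ k →
      ofLC k (Finsupp.single (List.ofFn g) 1) = 0 := fun m g k h =>
    ofLC_eq_zero fun e he => h (by simpa using (congrArg List.length he).symm)
  rw [bd_ofFn, map_sum]
  simp only [map_zsmul]
  by_cases hnk : n = k
  swap
  · rw [hlen _ _ _ (by omega), map_zero]
    exact Finset.sum_eq_zero fun i _ => by rw [hlen _ _ _ hnk, smul_zero]
  subst hnk
  have hm : Monotone f := by
    intro i j hij
    rcases hij.eq_or_lt with rfl | hij
    · exact le_rfl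
    · exact List.pairwise_ofFn.1 hl hij
  by_cases hs : StrictMono f
  · obtain ⟨e, rfl⟩ : ∃ e : Fin (n + 1) ↪o X, (e : Fin (n + 1) → X) = f :=
      ⟨OrderEmbedding.ofStrictMono f hs, rfl⟩
    rw [ofLC_ofFn, bd_single]
    exact Finset.sum_congr rfl fun i _ => congrArg _ (ofLC_ofFn (face e i))
  · rw [ofLC_eq_zero fun e he => hs (by
      rw [← List.ofFn_injective he]; exact e.strictMono), map_zero]
    obtain ⟨n, rfl⟩ : ∃ m, n = m + 1 := by
      refine ⟨n - 1, ?_⟩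
      by_contra h
      obtain rfl : n = 0 := by omega
      exact hs fun i j h => absurd h (by omega)
    obtain ⟨j, hj⟩ : ∃ j : Fin (n + 1), f j.castSucc = f j.succ := by
      by_contra! h
      exact hs (Fin.strictMono_iff_lt_succ.2 fun i =>
        lt_of_le_of_ne (hm (Fin.castSucc_lt_succ).le) (h i))
    have hne : j.castSucc ≠ j.succ := (Fin.castSucc_lt_succ).ne
    rw [← Finset.sum_subset (Finset.subset_univ {j.castSucc, j.succ}), Finset.sum_pair hne]
    · have : (fun i => f (j.castSucc.succAbove i)) = fun i => f (j.succ.succAbove i) := by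
        funext i
        rcases lt_trichotomy i j with h | rfl | h
        · rw [Fin.succAbove_of_castSucc_lt _ _ (by simpa using h),
            Fin.succAbove_of_castSucc_lt _ _ (by simpa [Fin.lt_def] using h.le)]
        · rw [Fin.succAbove_castSucc_self, Fin.succAbove_succ_self, hj]
        · rw [Fin.succAbove_of_le_castSucc _ _ (by simpa using h.le),
            Fin.succAbove_of_le_castSucc _ _ (by simpa [Fin.le_def] using h)]
      rw [this, ← add_smul, Fin.val_castSucc, Fin.val_succ, pow_succ]
      simp
    · intro i _ hi
      rw [Finset.mem_insert, Finset.mem_singleton, not_or] at hi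
      obtain ⟨a, ha⟩ := Fin.exists_succAbove_eq (Ne.symm hi.1)
      obtain ⟨b, hb⟩ := Fin.exists_succAbove_eq (Ne.symm hi.2)
      rw [ofLC_eq_zero fun e he => ?_, smul_zero]
      have he := List.ofFn_injective he
      have : a = b := e.injective (by rw [he]; simp only [ha, hb, hj])
      exact hne (by rw [← ha, ← hb, this])

theorem ker_bd' (h : LC.Exact (LC.on (LC.Srt X))) (k : ℕ) :
    LinearMap.ker (bd' X k) = LinearMap.range (bd X k) := by
  apply le_antisymm
  · intro z hz
    have hL : toLC k z ∈ LC.on (LC.Srt X) := by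
      rw [toLC, Finsupp.linearCombination_apply]
      refine Submodule.finsuppSum_mem _ _ _ _ fun e _ => Submodule.smul_mem _ _
        (LC.single_mem (List.pairwise_ofFn.2 fun i j hij => e.monotone hij.le))
    have h0 : LC.bd (toLC k z) = 0 := by
      cases k with
      | zero =>
        have : LC.bd ∘ₗ toLC (X := X) 0 = 0 := Finsupp.lhom_ext' fun e =>
          LinearMap.ext_ring (by simp)
        exact LinearMap.congr_fun this z
      | succ k => rw [toLC_bd, show bd X k z = 0 from hz, map_zero]
    obtain ⟨w, hw, e⟩ := h _ hL h0
    refine ⟨ofLC (k + 1) w, ?_⟩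
    rw [← ofLC_toLC z, ← e]
    exact (LC.congr_on (f := ofLC k ∘ₗ LC.bd) (g := bd X k ∘ₗ ofLC (k + 1))
      (fun l hl => ofLC_bd hl) hw).symm
  · rintro _ ⟨w, rfl⟩
    cases k with
    | zero => rfl
    | succ k =>
      have := LC.bd_bd (toLC (k + 2) w)
      rw [toLC_bd, toLC_bd] at this
      change bd X k _ = 0
      rw [← ofLC_toLC (bd X k _), this, map_zero]

end Ch

section
open scoped unitInterval Topology Topology.Homotopy

section
variable {K T : Type*} [TopologicalSpace K] [TopologicalSpace T]

/-- The space of maps subject to pointwise constraints. -/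
abbrev Msp (C : K → Set T) : Type _ := {f : C(K, T) // ∀ x, f x ∈ C x}

/-- A map representing a `2`-dimensional loop of constrained maps, uncurried. -/
structure IsRep (C : K → Set T) (b : T) (g : (Fin 2 → I) → K → T) : Prop where
  cont : Continuous fun p : (Fin 2 → I) × K => g p.1 p.2
  mem : ∀ t x, g t x ∈ C x
  base : ∀ t ∈ Cube.boundary (Fin 2), ∀ x, g t x = b

/-- The second homotopy group of the space of constrained maps, based at a constant map. -/
def Gp (C : K → Set T) (b : T) (hb : ∀ x, b ∈ C x) : Type _ :=
  Additive (HomotopyGroup (Fin 2) (Msp C) ⟨ContinuousMap.const K b, hb⟩)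

noncomputable instance (C : K → Set T) (b : T) (hb : ∀ x, b ∈ C x) : AddCommGroup (Gp C b hb) :=
  inferInstanceAs (AddCommGroup (Additive (HomotopyGroup (Fin 2) (Msp C) _)))

variable {C : K → Set T} {b : T} {hb : ∀ x, b ∈ C x} {f g h : (Fin 2 → I) → K → T}

/-- The generalized loop of a representative. -/
def IsRep.loop (hg : IsRep C b g) (hb : ∀ x, b ∈ C x) :
    Ω^ (Fin 2) (Msp C) ⟨ContinuousMap.const K b, hb⟩ :=
  ⟨⟨fun t => ⟨⟨g t, hg.cont.comp (f := fun x : K => (t, x)) (by fun_prop)⟩, hg.mem t⟩,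
    (ContinuousMap.curry ⟨_, hg.cont⟩).continuous.subtype_mk _⟩,
    fun t ht => Subtype.ext (ContinuousMap.ext fun x => hg.base t ht x)⟩

/-- The class of a representative. -/
def Gp.cls (hb : ∀ x, b ∈ C x) (g : (Fin 2 → I) → K → T) (hg : IsRep C b g) : Gp C b hb :=
  Additive.ofMul (Quotient.mk (GenLoop.Homotopic.setoid _ _) (hg.loop hb))

theorem Gp.cls_eq {hf : IsRep C b f} {hg : IsRep C b g} (H : I → (Fin 2 → I) → K → T)
    (hc : Continuous fun p : (I × (Fin 2 → I)) × K => H p.1.1 p.1.2 p.2)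
    (hm : ∀ s t x, H s t x ∈ C x) (hbd : ∀ s, ∀ t ∈ Cube.boundary (Fin 2), ∀ x, H s t x = b)
    (h0 : ∀ t x, H 0 t x = f t x) (h1 : ∀ t x, H 1 t x = g t x) : cls hb f hf = cls hb g hg := by
  refine congrArg Additive.ofMul (Quotient.sound ⟨⟨⟨⟨fun p => ⟨⟨H p.1 p.2, hc.comp
    (f := fun x : K => (p, x)) (by fun_prop)⟩, hm _ _⟩, ?_⟩, fun t => ?_, fun t => ?_⟩,
    fun s t ht => ?_⟩⟩)
  · exact (ContinuousMap.curry ⟨fun p : (I × (Fin 2 → I)) × K => H p.1.1 p.1.2 p.2,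
      hc⟩).continuous.subtype_mk _
  · exact Subtype.ext (ContinuousMap.ext fun x => h0 t x)
  · exact Subtype.ext (ContinuousMap.ext fun x => h1 t x)
  · refine Subtype.ext (ContinuousMap.ext fun x => ?_)
    exact (hbd s t ht x).trans (hf.base t ht x).symm

theorem Gp.cls_congr {hf : IsRep C b f} {hg : IsRep C b g} (hfg : ∀ t x, f t x = g t x) :
    cls hb f hf = cls hb g hg := by
  obtain rfl : f = g := funext fun t => funext (hfg t)
  rfl

theorem Gp.exists_rep [LocallyCompactSpace K] (x : Gp C b hb) : ∃ g hg, x = cls hb g hg := by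
  obtain ⟨γ, hγ⟩ := Quotient.exists_rep (s := GenLoop.Homotopic.setoid _ _) x.toMul
  refine ⟨fun t x => (γ t).1 x, ⟨?_, fun t => (γ t).2, fun t ht x => ?_⟩, ?_⟩
  · exact ContinuousMap.continuous_uncurry_of_continuous
      (⟨fun t => (γ t).1, continuous_subtype_val.comp γ.1.continuous⟩ : C(Fin 2 → I, C(K, T)))
  · rw [show γ t = _ from γ.2 t ht]; rfl
  · exact hγ.symm

theorem Gp.exists_homotopy [LocallyCompactSpace K] {hf : IsRep C b f} {hg : IsRep C b g}
    (h : cls hb f hf = cls hb g hg) : ∃ H : I → (Fin 2 → I) → K → T,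
      (Continuous fun p : (I × (Fin 2 → I)) × K => H p.1.1 p.1.2 p.2) ∧
      (∀ s t x, H s t x ∈ C x) ∧ (∀ s, ∀ t ∈ Cube.boundary (Fin 2), ∀ x, H s t x = b) ∧
      (∀ t x, H 0 t x = f t x) ∧ ∀ t x, H 1 t x = g t x := by
  obtain ⟨H⟩ : GenLoop.Homotopic (hf.loop hb) (hg.loop hb) := Quotient.exact h
  refine ⟨fun s t x => (H (s, t)).1 x, ?_, fun s t => (H (s, t)).2, fun s t ht x => ?_,
    fun t x => ?_, fun t x => ?_⟩
  · exact ContinuousMap.continuous_uncurry_of_continuous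
      (⟨fun p => (H p).1, continuous_subtype_val.comp H.continuous⟩ : C(I × (Fin 2 → I), C(K, T)))
  · exact (congrArg (fun z : Msp C => z.1 x) (H.eq_fst s ht)).trans (hf.base t ht x)
  · exact congrArg (fun z : Msp C => z.1 x) (H.apply_zero t)
  · exact congrArg (fun z : Msp C => z.1 x) (H.apply_one t)

/-- The sliding reparametrization compressing to the first half. -/
noncomputable def slideL (s t : I) : I := projIcc 0 1 zero_le_one ((1 + s) * t)
/-- The sliding reparametrization compressing to the second half. -/
noncomputable def slideR (s t : I) : I := projIcc 0 1 zero_le_one ((1 + s) * t - s)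

@[fun_prop] theorem continuous_slideL {Z : Type*} [TopologicalSpace Z] {p q : Z → I}
    (hp : Continuous p) (hq : Continuous q) : Continuous fun z => slideL (p z) (q z) :=
  continuous_projIcc.comp (by fun_prop)
@[fun_prop] theorem continuous_slideR {Z : Type*} [TopologicalSpace Z] {p q : Z → I}
    (hp : Continuous p) (hq : Continuous q) : Continuous fun z => slideR (p z) (q z) :=
  continuous_projIcc.comp (by fun_prop)

@[simp] theorem slideL_zero (t : I) : slideL 0 t = t := by simp [slideL]
@[simp] theorem slideR_zero (t : I) : slideR 0 t = t := by simp [slideR]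
@[simp] theorem slideL_right_zero (s : I) : slideL s 0 = 0 := by simp [slideL]
@[simp] theorem slideL_right_one (s : I) : slideL s 1 = 1 := by
  simpa [slideL] using s.2.1
@[simp] theorem slideR_right_zero (s : I) : slideR s 0 = 0 := by
  simpa [slideR] using s.2.1
@[simp] theorem slideR_right_one (s : I) : slideR s 1 = 1 := by simp [slideR]
theorem slideL_one {t : I} (h : 1 / 2 ≤ (t : ℝ)) : slideL 1 t = 1 := by
  refine projIcc_of_right_le _ ?_
  norm_num; linarith
theorem slideR_one {t : I} (h : (t : ℝ) ≤ 1 / 2) : slideR 1 t = 0 := by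
  refine projIcc_of_le_left _ ?_
  norm_num; linarith

theorem update_mem_boundary {ι : Type*} [DecidableEq ι] {t : ι → I} {i : ι} {r : I}
    (h0 : t i = 0 → r = 0) (h1 : t i = 1 → r = 1) (h : t ∈ Cube.boundary ι) :
    Function.update t i r ∈ Cube.boundary ι := by
  obtain ⟨j, hj⟩ := h
  refine ⟨j, ?_⟩
  by_cases hji : j = i
  · subst hji
    rcases hj with hj | hj
    · simp [h0 hj]
    · simp [h1 hj]
  · simpa [hji] using hj

theorem update_mem_boundary' {ι : Type*} [DecidableEq ι] {t : ι → I} {i : ι} {r : I}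
    (h : r = 0 ∨ r = 1) : Function.update t i r ∈ Cube.boundary ι :=
  ⟨i, by simpa using h⟩

open Classical in
/-- Juxtaposition of two loops. -/
noncomputable def Gp.juxt (f g : (Fin 2 → I) → K → T) (t : Fin 2 → I) (x : K) : T :=
  if (t 0 : ℝ) ≤ 1 / 2 then f (Function.update t 0 (slideL 1 (t 0))) x
  else g (Function.update t 0 (slideR 1 (t 0))) x

theorem IsRep.juxt (hf : IsRep C b f) (hg : IsRep C b g) : IsRep C b (Gp.juxt f g) := by
  refine ⟨?_, fun t x => ?_, fun t ht x => ?_⟩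
  · refine Continuous.if_le (hf.cont.comp (g := fun p : (Fin 2 → I) × K => f p.1 p.2)
      (f := fun p : (Fin 2 → I) × K => (Function.update p.1 0 (slideL 1 (p.1 0)), p.2))
      (by fun_prop)) (hg.cont.comp (g := fun p : (Fin 2 → I) × K => g p.1 p.2)
      (f := fun p : (Fin 2 → I) × K => (Function.update p.1 0 (slideR 1 (p.1 0)), p.2))
      (by fun_prop)) (by fun_prop) (by fun_prop) fun p hp => ?_
    rw [hf.base, hg.base]
    · exact update_mem_boundary' (Or.inl (slideR_one hp.le))
    · exact update_mem_boundary' (Or.inr (slideL_one hp.ge))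
  · unfold Gp.juxt; split_ifs
    exacts [hf.mem _ _, hg.mem _ _]
  · unfold Gp.juxt; split_ifs
    · exact hf.base _ (update_mem_boundary (fun h => by simp [h]) (fun h => by simp [h]) ht) _
    · exact hg.base _ (update_mem_boundary (fun h => by simp [h]) (fun h => by simp [h]) ht) _

theorem Gp.cls_juxt (hf : IsRep C b f) (hg : IsRep C b g) :
    cls hb _ (hf.juxt hg) = cls hb f hf + cls hb g hg := by
  rw [add_comm]
  refine (congrArg Additive.ofMul (Eq.trans ?_ (HomotopyGroup.mul_spec (i := (0 : Fin 2))
    (p := hg.loop hb) (q := hf.loop hb)).symm) :)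
  refine congrArg _ (GenLoop.ext _ _ fun t => Subtype.ext (ContinuousMap.ext fun x => ?_))
  change Gp.juxt f g t x = ((if (t 0 : ℝ) ≤ 1 / 2 then _ else _ : Msp C)).1 x
  unfold Gp.juxt
  split_ifs <;> simp [slideL, slideR, one_add_one_eq_two] <;> rfl

theorem IsRep.flip (hf : IsRep C b f) :
    IsRep C b fun t => f fun j => if j = 0 then unitInterval.symm (t j) else t j := by
  refine ⟨hf.cont.comp (f := fun p : (Fin 2 → I) × K => ((fun j => if j = 0 then
    unitInterval.symm (p.1 j) else p.1 j), p.2)) ?_, fun t => hf.mem _, fun t ⟨j, ht⟩ => hf.base _ ⟨j, ?_⟩⟩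
  · refine .prodMk (continuous_pi fun j => ?_) continuous_snd
    split_ifs <;> fun_prop
  · dsimp only
    split_ifs
    · rcases ht with ht | ht <;> simp [ht]
    · exact ht

theorem Gp.cls_flip (hf : IsRep C b f) : cls hb _ hf.flip = -cls hb f hf := by
  refine (congrArg Additive.ofMul (Eq.trans ?_ (HomotopyGroup.inv_spec (i := (0 : Fin 2))
    (p := hf.loop hb)).symm) :)
  refine congrArg _ (GenLoop.ext _ _ fun t => Subtype.ext (ContinuousMap.ext fun x => ?_))
  change f _ x = f _ x
  congr 1
  funext j
  by_cases hj : j = 0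
  · subst hj; rfl
  · simp [hj]

theorem IsRep.const (hb : ∀ x, b ∈ C x) : IsRep C b fun _ _ => b :=
  ⟨continuous_const, fun _ => hb, fun _ _ _ => rfl⟩

theorem Gp.cls_const : cls hb _ (IsRep.const hb) = 0 := by
  refine congrArg Additive.ofMul (Eq.trans ?_ HomotopyGroup.one_def.symm)
  rfl

open Classical in
theorem Gp.cls_eq_add {L M : Set K} (hL : IsClosed L) (hM : IsClosed M) (hLM : ∀ x, x ∉ L → x ∈ M)
    {hf : IsRep C b f} {hg : IsRep C b g} {hh : IsRep C b h} (hfM : ∀ t, ∀ x ∈ M, f t x = b)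
    (hgL : ∀ t, ∀ x ∈ L, g t x = b) (hL' : ∀ t, ∀ x ∈ L, h t x = f t x)
    (hM' : ∀ t, ∀ x ∈ M, h t x = g t x) : cls hb h hh = cls hb f hf + cls hb g hg := by
  rw [← cls_juxt]
  refine cls_eq (fun s t x => if x ∈ L then f (Function.update t 0 (slideL s (t 0))) x
      else g (Function.update t 0 (slideR s (t 0))) x) ?_ ?_ ?_ ?_ ?_
  · refine continuous_glue (A := {p : (I × (Fin 2 → I)) × K | p.2 ∈ L})
      (B := {p : (I × (Fin 2 → I)) × K | p.2 ∈ M}) (hL.preimage continuous_snd)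
      (hM.preimage continuous_snd) (fun x => hLM x.2) (Continuous.continuousOn ?_)
      (Continuous.continuousOn ?_) fun p hp hp' => ?_
    · exact hf.cont.comp (f := fun p : (I × (Fin 2 → I)) × K =>
        (Function.update p.1.2 0 (slideL p.1.1 (p.1.2 0)), p.2)) (by fun_prop)
    · exact hg.cont.comp (f := fun p : (I × (Fin 2 → I)) × K =>
        (Function.update p.1.2 0 (slideR p.1.1 (p.1.2 0)), p.2)) (by fun_prop)
    · rw [hfM _ _ hp', hgL _ _ hp]
  · intro s t x; split_ifs
    exacts [hf.mem _ _, hg.mem _ _]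
  · intro s t ht x; split_ifs
    · exact hf.base _ (update_mem_boundary (fun h => by simp [h]) (fun h => by simp [h]) ht) _
    · exact hg.base _ (update_mem_boundary (fun h => by simp [h]) (fun h => by simp [h]) ht) _
  · intro t x; split_ifs with hx
    · simp [hL' _ _ hx]
    · simp [hM' _ _ (hLM _ hx)]
  · intro t x; dsimp only [juxt]
    split_ifs with hx ht ht
    · rfl
    · rw [hgL _ _ hx, hf.base _ (update_mem_boundary' (Or.inr (slideL_one (not_le.1 ht).le)))]
    · rw [hfM _ _ (hLM _ hx), hg.base _ (update_mem_boundary' (Or.inl (slideR_one ht)))]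
    · rfl

end

section
variable {K T K' T' : Type*} [TopologicalSpace K] [TopologicalSpace T] [TopologicalSpace K']
  [TopologicalSpace T'] [LocallyCompactSpace K] {C : K → Set T} {b : T} {hb : ∀ x, b ∈ C x}
  {C' : K' → Set T'} {b' : T'} {hb' : ∀ x, b' ∈ C' x}

/-- An operation on functions inducing a map of spaces of constrained maps. -/
structure IsOp (C : K → Set T) (b : T) (C' : K' → Set T') (b' : T')
    (F : (K → T) → K' → T') : Prop where
  cont : ∀ g : I × (Fin 2 → I) → K → T,
    (Continuous fun p : (I × (Fin 2 → I)) × K => g p.1 p.2) → (∀ z x, g z x ∈ C x) →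
    Continuous fun p : (I × (Fin 2 → I)) × K' => F (g p.1) p.2
  mem : ∀ f, (∀ x, f x ∈ C x) → ∀ x, F f x ∈ C' x
  base : ∀ x, F (fun _ => b) x = b'

variable {F : (K → T) → K' → T'}

theorem IsRep.op {g : (Fin 2 → I) → K → T} (hg : IsRep C b g) (hF : IsOp C b C' b' F) :
    IsRep C' b' fun t => F (g t) := by
  refine ⟨?_, fun t => hF.mem _ (hg.mem t), fun t ht x => ?_⟩
  · exact (hF.cont (fun z => g z.2) (hg.cont.comp (f := fun p : (I × (Fin 2 → I)) × K =>
      (p.1.2, p.2)) (by fun_prop)) fun z => hg.mem _).comp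
      (f := fun p : (Fin 2 → I) × K' => (((0 : I), p.1), p.2)) (by fun_prop)
  · rw [show g t = fun _ => b from funext (hg.base t ht), hF.base]

theorem Gp.cls_op_eq (hF : IsOp C b C' b' F) {f g : (Fin 2 → I) → K → T} {hf : IsRep C b f}
    {hg : IsRep C b g} (h : cls hb f hf = cls hb g hg) :
    cls hb' _ (hf.op hF) = cls hb' _ (hg.op hF) := by
  obtain ⟨H, hc, hm, hbd, h0, h1⟩ := exists_homotopy h
  refine cls_eq (fun s t => F (H s t)) (hF.cont (fun z => H z.1 z.2) hc fun z => hm _ _)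
    (fun s t => hF.mem _ (hm s t)) (fun s t ht x => ?_) (fun t x => ?_) fun t x => ?_
  · rw [show H s t = fun _ => b from funext (hbd s t ht), hF.base]
  · rw [show H 0 t = f t from funext (h0 t)]
  · rw [show H 1 t = g t from funext (h1 t)]

/-- The homomorphism induced by an operation. -/
noncomputable def Gp.map (hF : IsOp C b C' b' F) : Gp C b hb →+ Gp C' b' hb' :=
  AddMonoidHom.mk' (fun x => cls hb' _ ((exists_rep x).choose_spec.choose.op hF)) fun x y => by
    obtain ⟨f, hf, rfl⟩ := exists_rep x
    obtain ⟨g, hg, rfl⟩ := exists_rep y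
    have key : ∀ (f) (hf : IsRep C b f), cls hb' _ ((exists_rep (cls hb f hf)).choose_spec.choose.op hF)
        = cls hb' _ (hf.op hF) := fun f hf =>
      cls_op_eq hF (exists_rep (cls hb f hf)).choose_spec.choose_spec.symm
    rw [← cls_juxt, key, key, key, ← cls_juxt]
    refine cls_congr fun t x => ?_
    unfold juxt
    split_ifs <;> simp [*]

theorem Gp.map_cls (hF : IsOp C b C' b' F) {f : (Fin 2 → I) → K → T} (hf : IsRep C b f) :
    map hF (cls hb f hf) = cls hb' _ (hf.op hF) :=
  cls_op_eq hF (exists_rep (cls hb f hf)).choose_spec.choose_spec.symm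

end

end

section
open scoped unitInterval Topology Topology.Homotopy

section
variable {K T K' T' : Type*} [TopologicalSpace K] [TopologicalSpace T] [TopologicalSpace K']
  [TopologicalSpace T'] {C : K → Set T} {b : T} {C' : K' → Set T'} {b' : T'}

open Classical in
theorem IsOp.ite {A B : Set K'} (hA : IsClosed A) (hB : IsClosed B) (hAB : ∀ x, x ∉ A → x ∈ B)
    {p : K' → K} (hp : Continuous p) {q : T → T'} (hq : Continuous q) (hqb : q b = b')
    (h : ∀ x ∈ A, x ∈ B → ∀ f : K → T, (∀ x, f x ∈ C x) → q (f (p x)) = b')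
    (hm : ∀ x ∈ A, ∀ f : K → T, (∀ x, f x ∈ C x) → q (f (p x)) ∈ C' x) (hb' : ∀ x, b' ∈ C' x)
    {F : (K → T) → K' → T'} (hF : ∀ f, ∀ x ∈ A, F f x = q (f (p x)))
    (hF' : ∀ f, ∀ x, x ∉ A → F f x = b') : IsOp C b C' b' F := by
  obtain rfl : F = fun f x => if x ∈ A then q (f (p x)) else b' := by
    funext f x
    split_ifs with hx
    exacts [hF f x hx, hF' f x hx]
  refine ⟨fun g hg hgC => ?_, fun f hf x => ?_, fun x => ?_⟩
  · refine continuous_glue (A := {p : (I × (Fin 2 → I)) × K' | p.2 ∈ A})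
      (B := {p : (I × (Fin 2 → I)) × K' | p.2 ∈ B}) (hA.preimage continuous_snd)
      (hB.preimage continuous_snd) (fun x => hAB x.2) (Continuous.continuousOn ?_)
      continuousOn_const fun x hx hx' => h _ hx hx' _ (hgC x.1)
    exact hq.comp (hg.comp (f := fun x : (I × (Fin 2 → I)) × K' => (x.1, p x.2)) (by fun_prop))
  · split_ifs with hx
    exacts [hm x hx f hf, hb' x]
  · simp [hqb]

theorem IsOp.comp_right {p : K' → K} (hp : Continuous p) {q : T → T'} (hq : Continuous q)
    (hqb : q b = b') (hm : ∀ x, ∀ f : K → T, (∀ x, f x ∈ C x) → q (f (p x)) ∈ C' x) :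
    IsOp C b C' b' fun f x => q (f (p x)) :=
  ⟨fun g hg _ => hq.comp (hg.comp (f := fun x : (I × (Fin 2 → I)) × K' => (x.1, p x.2))
    (by fun_prop)), fun f hf x => hm x f hf, fun _ => hqb⟩
end

theorem isClosed_zero {ι : Type*} (l : ι) : IsClosed {x : ι → I | x l = 0} :=
  isClosed_eq (continuous_apply l) continuous_const

theorem isClosed_one {ι : Type*} (l : ι) : IsClosed {x : ι → I | x l = 1} :=
  isClosed_eq (continuous_apply l) continuous_const

section
variable {T : Type*} [TopologicalSpace T] {b : T}

/-- The constraint of being constant on the boundary of the cube. -/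
def CL (k : ℕ) (b : T) (y : Fin k → I) : Set T := {v | y ∈ Cube.boundary (Fin k) → v = b}

/-- The constraint of being based at a corner on the boundary of the cube. -/
def CG (m : ℕ) (b : T) (y : Cube.boundary (Fin m)) : Set T := {v | (∀ i, y.1 i = 1) → v = b}

theorem CL.base {k : ℕ} (y : Fin k → I) : b ∈ CL k b y := fun _ => rfl
theorem CG.base {m : ℕ} (y : Cube.boundary (Fin m)) : b ∈ CG m b y := fun _ => rfl

variable (b) in
/-- Two-parameter families of loops of dimension `k`. -/
abbrev LL (k : ℕ) : Type _ := Gp (CL k b) b CL.base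

variable (b) in
/-- Two-parameter families of maps on the boundary of a cube. -/
abbrev GG (m : ℕ) : Type _ := Gp (CG m b) b CG.base

instance {ι : Type} [Finite ι] : CompactSpace (Cube.boundary ι) :=
  isCompact_iff_compactSpace.1 isClosed_boundary.isCompact

open Classical in
theorem isOp_face {k : ℕ} (l : Fin (k + 1)) :
    IsOp (CL k b) b (CG (k + 1) b) b fun f x =>
      if x.1 l = 0 then f (l.removeNth x.1) else b := by
  have hr : Continuous fun x : Cube.boundary (Fin (k + 1)) => l.removeNth x.1 := by
    exact continuous_pi fun j => (continuous_apply _).comp continuous_subtype_val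
  refine IsOp.ite (T' := T) (q := id) (A := {x : Cube.boundary (Fin (k + 1)) | x.1 l = 0})
    ((isClosed_zero l).preimage continuous_subtype_val)
    (B := {x : Cube.boundary (Fin (k + 1)) | x.1 l = 1 ∨ l.removeNth x.1 ∈ Cube.boundary (Fin k)})
    ?_ (fun x hx => ?_) (p := fun x => l.removeNth x.1) hr
    continuous_id rfl (fun x hx hx' f hf => ?_) (fun x hx f hf => fun hx' => ?_) CG.base
    (fun f x hx => if_pos hx) (fun f x hx => if_neg hx)
  · exact ((isClosed_one l).preimage continuous_subtype_val).union
      (isClosed_boundary.preimage hr)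
  · obtain ⟨j, hj⟩ := x.2
    rcases Fin.eq_self_or_eq_succAbove l j with rfl | ⟨j, rfl⟩
    · exact Or.inl (hj.resolve_left hx)
    · exact Or.inr ⟨j, hj⟩
  · rcases hx' with hx' | hx'
    · exact (zero_ne_one (hx.symm.trans hx')).elim
    · exact hf _ hx'
  · exact (zero_ne_one (hx.symm.trans (hx' l))).elim

/-- Placing a family of loops on a face of the cube through the origin. -/
noncomputable def face {k : ℕ} (l : Fin (k + 1)) : LL b k →+ GG b (k + 1) := Gp.map (isOp_face l)

theorem cls_boundary_eq_zero {m : ℕ} {U : (Fin 2 → I) → (Fin m → I) → T}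
    (hU : Continuous fun p : (Fin 2 → I) × (Fin m → I) => U p.1 p.2)
    (hb : ∀ t ∈ Cube.boundary (Fin 2), ∀ y, U t y = b) (h1 : ∀ t y, (∀ i, y i = 1) → U t y = b)
    (h : IsRep (CG m b) b fun t (y : Cube.boundary (Fin m)) => U t y.1) :
    Gp.cls CG.base _ h = 0 := by
  rw [← Gp.cls_const]
  refine Gp.cls_eq (fun s t y => U t fun i => max (y.1 i) s) ?_ (fun s t y hy => ?_)
    (fun s t ht y => hb t ht _) (fun t y => ?_) fun t y => h1 _ _ fun i => ?_
  · exact hU.comp (f := fun p : (I × (Fin 2 → I)) × Cube.boundary (Fin m) =>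
      (p.1.2, fun i => max (p.2.1 i) p.1.1)) (.prodMk (by fun_prop) (continuous_pi fun i =>
      .max ((continuous_apply i).comp (continuous_subtype_val.comp continuous_snd)) (by fun_prop)))
  · refine h1 _ _ fun i => ?_
    rw [hy i]; exact max_eq_left unitInterval.le_one'
  · congr 1; funext i; exact max_eq_left unitInterval.nonneg'
  · exact max_eq_right unitInterval.le_one'

theorem IsRep.restrict {m : ℕ} {U : (Fin 2 → I) → (Fin m → I) → T}
    (hU : Continuous fun p : (Fin 2 → I) × (Fin m → I) => U p.1 p.2)
    (hb : ∀ t ∈ Cube.boundary (Fin 2), ∀ y, U t y = b) (h1 : ∀ t y, (∀ i, y i = 1) → U t y = b) :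
    IsRep (CG m b) b fun t (y : Cube.boundary (Fin m)) => U t y.1 :=
  ⟨hU.comp (f := fun p : (Fin 2 → I) × Cube.boundary (Fin m) => (p.1, p.2.1)) (by fun_prop),
    fun t _ hy => h1 t _ hy, fun t ht _ => hb t ht _⟩

theorem insertNth_mem_boundary {k : ℕ} {l : Fin (k + 1)} {y : Fin k → I} :
    l.insertNth (α := fun _ => I) 0 y ∈ Cube.boundary (Fin (k + 1)) := ⟨l, by simp⟩

/-- A constraint for maps trivial on outer faces and on intersections of inner faces. -/
structure Concentrated {k : ℕ} (b : T) (g : Cube.boundary (Fin (k + 1)) → T) : Prop where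
  one : ∀ y l, y.1 l = 1 → g y = b
  zero : ∀ y l m, l ≠ m → y.1 l = 0 → y.1 m = 0 → g y = b

theorem Concentrated.isRep {k : ℕ} {g : (Fin 2 → I) → Cube.boundary (Fin (k + 1)) → T}
    (hg : IsRep (CG (k + 1) b) b g) (hc : ∀ t, Concentrated b (g t)) (l : Fin (k + 1)) :
    IsRep (CL k b) b fun t y => g t ⟨l.insertNth (α := fun _ => I) 0 y, insertNth_mem_boundary⟩ := by
  refine ⟨hg.cont.comp (f := fun p : (Fin 2 → I) × (Fin k → I) => (p.1,
    (⟨l.insertNth (α := fun _ => I) 0 p.2, insertNth_mem_boundary⟩ : Cube.boundary (Fin (k + 1)))))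
    (continuous_fst.prodMk (Continuous.subtype_mk
      (Continuous.finInsertNth (A := fun _ => I) l continuous_const continuous_snd) _)), ?_, fun t ht y => hg.base t ht _⟩
  rintro t y ⟨j, hj | hj⟩
  · exact (hc t).zero _ l (l.succAbove j) (Fin.succAbove_ne l j).symm (by simp) (by simpa using hj)
  · exact (hc t).one _ (l.succAbove j) (by simpa using hj)

open Classical in
theorem Concentrated.cls_eq {k : ℕ} {g : (Fin 2 → I) → Cube.boundary (Fin (k + 1)) → T}
    (hg : IsRep (CG (k + 1) b) b g) (hc : ∀ t, Concentrated b (g t)) :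
    Gp.cls CG.base g hg = ∑ l, face l (Gp.cls CL.base _ (Concentrated.isRep hg hc l)) := by
  set G : Finset (Fin (k + 1)) → (Fin 2 → I) → Cube.boundary (Fin (k + 1)) → T := fun S t x =>
    if ∃ l ∈ S, x.1 l = 0 then g t x else b with hG
  have hLc : ∀ S : Finset (Fin (k + 1)),
      IsClosed {x : Cube.boundary (Fin (k + 1)) | ∃ l ∈ S, x.1 l = 0} := fun S => by
    simp only [ofPred_exists]
    convert S.finite_toSet.isClosed_biUnion (f := fun l => {x : Cube.boundary (Fin (k + 1)) |
      x.1 l = 0}) (fun l _ => (isClosed_zero l).preimage continuous_subtype_val) using 1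
    ext; simp
  have hone : IsClosed {x : Cube.boundary (Fin (k + 1)) | ∃ l, x.1 l = 1} := by
    convert isClosed_iUnion_of_finite (s := fun l => {x : Cube.boundary (Fin (k + 1)) |
      x.1 l = 1}) (fun l => (isClosed_one l).preimage continuous_subtype_val) using 1
    ext; simp
  have hcov : ∀ S : Finset (Fin (k + 1)), ∀ x : Cube.boundary (Fin (k + 1)),
      (¬ ∃ l ∈ S, x.1 l = 0) → (∃ l ∈ Sᶜ, x.1 l = 0) ∨ ∃ l, x.1 l = 1 := by
    rintro S ⟨x, j, hj | hj⟩ h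
    · exact Or.inl ⟨j, by simpa using fun hS => h ⟨j, hS, hj⟩, hj⟩
    · exact Or.inr ⟨j, hj⟩
  have hb : ∀ S : Finset (Fin (k + 1)), ∀ t x, (∃ l ∈ S, x.1 l = 0) →
      ((∃ l ∈ Sᶜ, x.1 l = 0) ∨ ∃ l, x.1 l = 1) → g t x = b := by
    rintro S t x ⟨l, hl, hl0⟩ (⟨m, hm, hm0⟩ | ⟨m, hm⟩)
    · exact (hc t).zero x l m (fun h => Finset.mem_compl.1 hm (h ▸ hl)) hl0 hm0
    · exact (hc t).one x m hm
  have hGr : ∀ S, IsRep (CG (k + 1) b) b (G S) := by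
    intro S
    refine ⟨?_, fun t x hx => ?_, fun t ht x => ?_⟩
    · refine (continuous_glue
        (A := {p : (Fin 2 → I) × Cube.boundary (Fin (k + 1)) | ∃ l ∈ S, p.2.1 l = 0})
        (B := {p | (∃ l ∈ Sᶜ, p.2.1 l = 0) ∨ ∃ l, p.2.1 l = 1})
        ((hLc S).preimage continuous_snd) (((hLc _).union hone).preimage continuous_snd)
        (fun p => hcov S p.2) hg.cont.continuousOn continuousOn_const
        fun p hp hp' => hb S p.1 p.2 hp hp').congr fun p => ?_
      by_cases h : ∃ l ∈ S, p.2.1 l = 0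
      · exact (if_pos h).trans (if_pos h).symm
      · exact (if_neg h).trans (if_neg h).symm
    · simp only [hG]; split_ifs
      exacts [hg.mem t x hx, rfl]
    · simp only [hG]; split_ifs
      exacts [hg.base t ht x, rfl]
  have h1 : ∀ l, Gp.cls CG.base _ (hGr {l}) =
      face l (Gp.cls CL.base _ (Concentrated.isRep hg hc l)) := by
    intro l
    rw [face, Gp.map_cls]
    refine Gp.cls_congr fun t x => ?_
    simp only [hG, Finset.mem_singleton, exists_eq_left, mem_ofPred_eq, id]
    split_ifs with h
    · congr 1
      exact Subtype.ext (((congrArg (fun z => l.insertNth (α := fun _ => I) z _) h.symm)).trans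
        (Fin.insertNth_self_removeNth l x.1)).symm
    · rfl
  have key : ∀ S : Finset (Fin (k + 1)), Gp.cls CG.base _ (hGr S) =
      ∑ l ∈ S, face l (Gp.cls CL.base _ (Concentrated.isRep hg hc l)) := by
    intro S
    induction S using Finset.induction_on with
    | empty =>
      rw [Finset.sum_empty, ← Gp.cls_const]
      exact Gp.cls_congr fun t x => by simp [hG]
    | insert a S ha ih =>
      rw [Finset.sum_insert ha, add_comm (face a _), ← ih, ← h1]
      refine Gp.cls_eq_add (hLc S) ((hLc _).union hone) (fun x => hcov S x) (fun t x hx => ?_)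
        (fun t x hx => ?_) (fun t x hx => ?_) fun t x hx => ?_
      · simp only [hG]; split_ifs with h
        exacts [hb S t x h hx, rfl]
      · simp only [hG]; split_ifs with h
        · obtain ⟨l, hl, hl0⟩ := hx
          refine (hc t).zero x l a (fun h => ha (h ▸ hl)) hl0 (by simpa using h)
        · rfl
      · simp only [hG]
        rw [if_pos (show ∃ l ∈ S, x.1 l = 0 from hx), if_pos]
        obtain ⟨l, hl, hl0⟩ := hx
        exact ⟨l, Finset.mem_insert_of_mem hl, hl0⟩
      · simp only [hG, Finset.mem_singleton, exists_eq_left, Finset.exists_mem_insert]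
        by_cases h : x.1 a = 0
        · simp [h]
        · simp only [h, false_or, if_false]
          split_ifs with h'
          exacts [hb S t x h' hx, rfl]
  rw [← key]
  refine Gp.cls_congr fun t x => ?_
  simp only [hG]; split_ifs with h
  · rfl
  · obtain h' | ⟨l, hl⟩ := hcov _ x h
    · simp at h'
    · exact (hc t).one x l hl

/-- Merging two consecutive coordinates. -/
def merge {k : ℕ} (l : Fin k) (y : Fin (k + 1) → I) (j : Fin k) : I :=
  if j < l then y j.castSucc else if j = l then max (y j.castSucc) (y j.succ) else y j.succ

theorem continuous_merge {k : ℕ} (l : Fin k) : Continuous (merge l) := by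
  refine continuous_pi fun j => ?_
  unfold merge
  split_ifs <;> fun_prop

theorem merge_one {k : ℕ} {l : Fin k} {y : Fin (k + 1) → I} {m : Fin (k + 1)} (h : y m = 1) :
    merge l y ∈ Cube.boundary (Fin k) := by
  rcases le_or_gt m l.castSucc with hm | hm
  · obtain ⟨j, rfl⟩ : ∃ j : Fin k, m = j.castSucc := ⟨⟨m, by have := l.2; simp [Fin.le_def] at hm; omega⟩, rfl⟩
    refine ⟨j, Or.inr ?_⟩
    rcases (Fin.castSucc_le_castSucc_iff.1 hm).lt_or_eq with hm | rfl
    · simp [merge, hm, h]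
    · simp [merge, h, unitInterval.le_one']
  · obtain ⟨j, rfl⟩ : ∃ j : Fin k, m = j.succ := ⟨m.pred (Fin.ne_zero_of_lt hm), by simp⟩
    refine ⟨j, Or.inr ?_⟩
    rcases (Fin.le_castSucc_iff.2 hm |>.trans' le_rfl : _) with _
    have hm' : l ≤ j := by simp [Fin.lt_def] at hm; exact Fin.le_def.2 (by omega)
    rcases hm'.lt_or_eq with hm' | rfl
    · simp [merge, h, hm'.not_gt, hm'.ne']
    · simp [merge, h, unitInterval.le_one']

theorem merge_zero {k : ℕ} {l : Fin k} {y : Fin (k + 1) → I} {m : Fin (k + 1)} (h : y m = 0)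
    (h1 : m ≠ l.castSucc) (h2 : m ≠ l.succ) : merge l y ∈ Cube.boundary (Fin k) := by
  rcases lt_or_gt_of_ne h1 with hm | hm
  · obtain ⟨j, rfl⟩ : ∃ j : Fin k, m = j.castSucc := ⟨⟨m, by have := l.2; simp [Fin.lt_def] at hm; omega⟩, rfl⟩
    exact ⟨j, Or.inl (by simp [merge, Fin.castSucc_lt_castSucc_iff.1 hm, h])⟩
  · obtain ⟨j, rfl⟩ : ∃ j : Fin k, m = j.succ := ⟨m.pred (Fin.ne_zero_of_lt hm), by simp⟩
    have hm' : l ≤ j := by simp [Fin.lt_def] at hm; exact Fin.le_def.2 (by omega)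
    have hm'' := hm'.lt_of_ne (fun h => h2 (by rw [h]))
    exact ⟨j, Or.inl (by simp [merge, h, hm''.not_gt, hm''.ne'])⟩

theorem merge_zero_zero {k : ℕ} {l : Fin k} {y : Fin (k + 1) → I} (h1 : y l.castSucc = 0)
    (h2 : y l.succ = 0) : merge l y ∈ Cube.boundary (Fin k) :=
  ⟨l, Or.inl (by simp [merge, h1, h2])⟩

theorem merge_castSucc {k : ℕ} (l : Fin k) (y : Fin k → I) :
    merge l (l.castSucc.insertNth (α := fun _ => I) 0 y) = y := by
  funext j
  rcases lt_trichotomy j l with h | rfl | h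
  · simp only [merge, h, if_true]
    have := Fin.insertNth_apply_succAbove (α := fun _ => I) l.castSucc 0 y j
    rwa [Fin.succAbove_of_castSucc_lt _ _ (by simpa using h)] at this
  · have := Fin.insertNth_apply_succAbove (α := fun _ => I) j.castSucc 0 y j
    rw [Fin.succAbove_castSucc_self] at this
    simp [merge, this]
  · simp only [merge, h.not_gt, h.ne', if_false]
    have := Fin.insertNth_apply_succAbove (α := fun _ => I) l.castSucc 0 y j
    rwa [Fin.succAbove_of_le_castSucc _ _ (by simpa using h.le)] at this

theorem merge_succ {k : ℕ} (l : Fin k) (y : Fin k → I) :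
    merge l (l.succ.insertNth (α := fun _ => I) 0 y) = y := by
  funext j
  have key := Fin.insertNth_apply_succAbove (α := fun _ => I) l.succ 0 y j
  rcases lt_trichotomy j l with h | rfl | h
  · simp only [merge, h, if_true]
    rwa [Fin.succAbove_of_castSucc_lt _ _ (by simpa using h.le)] at key
  · rw [Fin.succAbove_of_castSucc_lt _ _ (by simp)] at key
    simp [merge, key]
  · simp only [merge, h.not_gt, h.ne', if_false]
    rwa [Fin.succAbove_of_le_castSucc _ _ (by simpa [Fin.le_def] using h)] at key

theorem face_succ {k : ℕ} (l : Fin k) (u : LL b k) : face l.succ u = -face l.castSucc u := by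
  obtain ⟨f, hf, rfl⟩ := Gp.exists_rep u
  have hc : Continuous fun p : (Fin 2 → I) × (Fin (k + 1) → I) => f p.1 (merge l p.2) :=
    hf.cont.comp (f := fun p : (Fin 2 → I) × (Fin (k + 1) → I) => (p.1, merge l p.2))
      (continuous_fst.prodMk ((continuous_merge l).comp continuous_snd))
  have hb : ∀ t ∈ Cube.boundary (Fin 2), ∀ y : Fin (k + 1) → I, f t (merge l y) = b :=
    fun t ht y => hf.base t ht _
  have h1 : ∀ t, ∀ y : Fin (k + 1) → I, ∀ m, y m = 1 → f t (merge l y) = b :=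
    fun t y m hm => hf.mem t _ (merge_one hm)
  have hr := IsRep.restrict hc hb fun t y h => h1 t y 0 (h 0)
  have hC : ∀ t, Concentrated b fun y : Cube.boundary (Fin (k + 1)) => f t (merge l y.1) := by
    refine fun t => ⟨fun y m => h1 t y.1 m, fun y i j hij hi hj => hf.mem t _ ?_⟩
    by_cases hi' : i ≠ l.castSucc ∧ i ≠ l.succ
    · exact merge_zero hi hi'.1 hi'.2
    by_cases hj' : j ≠ l.castSucc ∧ j ≠ l.succ
    · exact merge_zero hj hj'.1 hj'.2
    · grind [merge_zero_zero]
  have hne : l.castSucc ≠ l.succ := l.castSucc_lt_succ.ne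
  have h0 := cls_boundary_eq_zero hc hb (fun t y h => h1 t y 0 (h 0)) hr
  rw [Concentrated.cls_eq hr hC, Finset.sum_eq_add_of_mem l.castSucc l.succ (Finset.mem_univ _)
    (Finset.mem_univ _) hne] at h0
  · rw [eq_neg_iff_add_eq_zero, add_comm (face l.succ _), ← h0]
    congr 2
    · exact Gp.cls_congr fun t y => by rw [merge_castSucc]
    · exact Gp.cls_congr fun t y => by rw [merge_succ]
  · rintro m - ⟨hm1, hm2⟩
    refine (congrArg (face m) ?_).trans (map_zero _)
    rw [← Gp.cls_const]
    exact Gp.cls_congr fun t y => hf.mem t _ (merge_zero (m := m) (by simp) hm1 hm2)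

theorem face_eq {k : ℕ} (l : Fin (k + 1)) (u : LL b k) :
    face l u = (-1 : ℤ) ^ (l : ℕ) • face 0 u := by
  induction l using Fin.induction with
  | zero => simp
  | succ l ih => rw [face_succ, ih, ← neg_smul, Fin.val_succ, pow_succ, mul_neg_one]; rfl

theorem Concentrated.cls_eq_face_zero {k : ℕ} {g : (Fin 2 → I) → Cube.boundary (Fin (k + 1)) → T}
    (hg : IsRep (CG (k + 1) b) b g) (hc : ∀ t, Concentrated b (g t)) :
    Gp.cls CG.base g hg =
      face 0 (∑ l : Fin (k + 1), (-1 : ℤ) ^ (l : ℕ) • Gp.cls CL.base _ (Concentrated.isRep hg hc l)) := by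
  rw [Concentrated.cls_eq hg hc, map_sum]
  exact Finset.sum_congr rfl fun l _ => by rw [face_eq, map_zsmul]

end

end

section
open scoped unitInterval Topology Topology.Homotopy

section
variable {T : Type*} [TopologicalSpace T] {b : T} {m : ℕ}

open Classical in
/-- A function on the boundary of a product of cubes extended by a constant value. -/
noncomputable def sphFun (b : T) (g : (Fin 2 → I) → Cube.boundary (Fin m) → T)
    (x : Fin 2 ⊕ Fin m → I) : T :=
  if h : x ∘ Sum.inr ∈ Cube.boundary (Fin m) then g (x ∘ Sum.inl) ⟨x ∘ Sum.inr, h⟩ else b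

theorem sphFun_pos (g : (Fin 2 → I) → Cube.boundary (Fin m) → T) {x : Fin 2 ⊕ Fin m → I}
    (h : x ∘ Sum.inr ∈ Cube.boundary (Fin m)) : sphFun b g x = g (x ∘ Sum.inl) ⟨x ∘ Sum.inr, h⟩ :=
  dif_pos h

theorem sphFun_neg (g : (Fin 2 → I) → Cube.boundary (Fin m) → T) {x : Fin 2 ⊕ Fin m → I}
    (h : x ∘ Sum.inr ∉ Cube.boundary (Fin m)) : sphFun b g x = b := dif_neg h

theorem sphFun_inl {g : (Fin 2 → I) → Cube.boundary (Fin m) → T}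
    (hg : ∀ t ∈ Cube.boundary (Fin 2), ∀ y, g t y = b) {x : Fin 2 ⊕ Fin m → I}
    (hx : x ∘ Sum.inl ∈ Cube.boundary (Fin 2)) : sphFun b g x = b := by
  unfold sphFun; split_ifs
  exacts [hg _ hx _, rfl]

theorem continuous_sphFun {Z : Type*} [TopologicalSpace Z]
    {g : Z → (Fin 2 → I) → Cube.boundary (Fin m) → T}
    (hc : Continuous fun p : (Z × (Fin 2 → I)) × Cube.boundary (Fin m) => g p.1.1 p.1.2 p.2)
    (hg : ∀ z, ∀ t ∈ Cube.boundary (Fin 2), ∀ y, g z t y = b) :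
    Continuous fun p : Z × Cube.boundary (Fin 2 ⊕ Fin m) => sphFun b (g p.1) p.2 := by
  classical
  have hp : ∀ {κ : Type} (f : κ → Fin 2 ⊕ Fin m), Continuous fun p : Z × Cube.boundary
      (Fin 2 ⊕ Fin m) => p.2.1 ∘ f := fun f => continuous_pi fun j =>
    (continuous_apply _).comp (continuous_subtype_val.comp continuous_snd)
  have key := continuous_glue (f := fun p : Z × Cube.boundary (Fin 2 ⊕ Fin m) =>
    sphFun b (g p.1) p.2) (g := fun _ => b) (isClosed_boundary.preimage (hp Sum.inr))
    (isClosed_boundary.preimage (hp Sum.inl)) (fun p hx => ((Cube.boundary_sum_iff.1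
    p.2.2).resolve_right hx)) ?_ continuousOn_const fun p hp hp' => sphFun_inl (hg _) hp'
  · refine key.congr fun p => ?_
    split_ifs with h
    · rfl
    · exact (sphFun_neg _ h).symm
  · rw [continuousOn_iff_continuous_restrict]
    refine (hc.comp (f := fun p : {p : Z × Cube.boundary (Fin 2 ⊕ Fin m) |
      p.2.1 ∘ Sum.inr ∈ Cube.boundary (Fin m)} => ((p.1.1, p.1.2.1 ∘ Sum.inl),
      ⟨p.1.2.1 ∘ Sum.inr, p.2⟩)) ?_).congr fun p => (sphFun_pos _ p.2).symm
    refine .prodMk (.prodMk (by fun_prop) ((hp _).comp continuous_subtype_val)) ?_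
    exact ((hp _).comp continuous_subtype_val).subtype_mk _

/-- The map on a sphere defined by a representative of a class. -/
noncomputable def IsRep.sph {g : (Fin 2 → I) → Cube.boundary (Fin m) → T}
    (hg : IsRep (CG m b) b g) : C(Cube.boundary (Fin 2 ⊕ Fin m), T) :=
  ⟨fun x => sphFun b g x, (continuous_sphFun (Z := Unit) (g := fun _ => g) (hg.cont.comp
    (f := fun p : (Unit × (Fin 2 → I)) × Cube.boundary (Fin m) => (p.1.2, p.2))
    (by fun_prop)) fun _ => hg.base).comp (f := fun x => ((), x)) (by fun_prop)⟩

theorem IsRep.sph_homotopic {f g : (Fin 2 → I) → Cube.boundary (Fin m) → T}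
    {hf : IsRep (CG m b) b f} {hg : IsRep (CG m b) b g}
    (h : Gp.cls CG.base f hf = Gp.cls CG.base g hg) : hf.sph.Homotopic hg.sph := by
  obtain ⟨H, hc, hm, hbd, h0, h1⟩ := Gp.exists_homotopy h
  refine ⟨⟨⟨fun p => sphFun b (H p.1) p.2, continuous_sphFun hc hbd⟩, fun x => ?_, fun x => ?_⟩⟩
  · change sphFun b (H 0) x = sphFun b f x
    rw [show H 0 = f from funext fun t => funext (h0 t)]
  · change sphFun b (H 1) x = sphFun b g x
    rw [show H 1 = g from funext fun t => funext (h1 t)]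

theorem Gp.cls_eq_zero_of_nullhomotopic {g : (Fin 2 → I) → Cube.boundary (Fin m) → T}
    (hg : IsRep (CG m b) b g) (h : hg.sph.Nullhomotopic) : Gp.cls CG.base g hg = 0 := by
  rcases isEmpty_or_nonempty (Cube.boundary (Fin m)) with hm | hm
  · rw [← Gp.cls_const]; exact Gp.cls_congr fun t y => hm.elim y
  obtain ⟨F, hF⟩ := exists_extend hg.sph h
  have e : ∀ t (y : Cube.boundary (Fin m)), F (Sum.elim t y.1) = g t y := fun t y => by
    exact (hF ⟨Sum.elim t y.1, Cube.boundary_sum_iff.2 (Or.inr y.2)⟩).trans (sphFun_pos g (x := Sum.elim t y.1) y.2)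
  have hU : Continuous fun p : (Fin 2 → I) × (Fin m → I) => F (Sum.elim p.1 p.2) := by
    refine F.continuous.comp (continuous_pi ?_)
    rintro (i | i) <;> simp only [Sum.elim_inl, Sum.elim_inr] <;> fun_prop
  have hb : ∀ t ∈ Cube.boundary (Fin 2), ∀ y : Fin m → I, F (Sum.elim t y) = b := fun t ht y => by
    exact (hF ⟨Sum.elim t y, Cube.boundary_sum_iff.2 (Or.inl ht)⟩).trans (sphFun_inl hg.base ht)
  have h1 : ∀ t (y : Fin m → I), (∀ i, y i = 1) → F (Sum.elim t y) = b := fun t y hy => by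
    obtain ⟨-, i, -⟩ := hm
    rw [e t ⟨y, i, Or.inr (hy i)⟩]; exact hg.mem _ _ hy
  exact (Gp.cls_congr fun t y => (e t y).symm).trans (cls_boundary_eq_zero hU hb h1
    (IsRep.restrict hU hb h1))
end

section
variable {Λ Λ' V W S : Type} [PartialOrder V] [PartialOrder W] [PartialOrder S] {m : ℕ}

/-- The map of Alexandrov spaces defined by a monotone map. -/
def Al.map (q : V →o W) (x : Al V) : Al W := q x

theorem Al.continuous_map (q : V →o W) : Continuous (Al.map q) :=
  Al.continuous_of_monotone q.monotone

/-- Postcomposition with a monotone map. -/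
noncomputable def Gp.post (q : V →o W) (b : Al V) : GG b m →+ GG (Al.map q b) m :=
  Gp.map (IsOp.comp_right (C := CG m b) (C' := CG m (Al.map q b)) (p := id)
    continuous_id (Al.continuous_map q) rfl fun x f hf hx => congrArg (Al.map q) (hf x hx))

/-- A monotone map on the cells of a sphere approximating a homotopy class. -/
def IsAppr {b : Al V} {N : ℕ} (ψ : Sph (Fin 2 ⊕ Fin m) N →o V) (u : GG b m) : Prop :=
  ∃ g, ∃ hg : IsRep (CG m b) b g, u = Gp.cls CG.base g hg ∧ (realize ψ).Homotopic hg.sph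

theorem IsAppr.homotopic {b : Al V} {N N' : ℕ} {ψ : Sph (Fin 2 ⊕ Fin m) N →o V}
    {ψ' : Sph (Fin 2 ⊕ Fin m) N' →o V} {u : GG b m} (h : IsAppr ψ u) (h' : IsAppr ψ' u) :
    (realize ψ).Homotopic (realize ψ') := by
  obtain ⟨g, hg, e, h⟩ := h
  obtain ⟨g', hg', e', h'⟩ := h'
  exact h.trans ((IsRep.sph_homotopic (e.symm.trans e')).trans h'.symm)

theorem IsAppr.post {b : Al V} {N : ℕ} {ψ : Sph (Fin 2 ⊕ Fin m) N →o V} {u : GG b m}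
    (h : IsAppr ψ u) (q : V →o W) : IsAppr (q.comp ψ) (Gp.post q b u) := by
  obtain ⟨g, hg, rfl, h⟩ := h
  refine ⟨_, _, Gp.map_cls _ hg, ?_⟩
  let q' : C(Al V, Al W) := ⟨Al.map q, Al.continuous_map q⟩
  have := (ContinuousMap.Homotopic.refl q').comp h
  convert this using 1
  · rfl
  refine ContinuousMap.ext fun x => ?_
  change sphFun (Al.map q b) (fun t y => Al.map q (g t y)) x.1 = Al.map q (sphFun b g x.1)
  by_cases hx : x.1 ∘ Sum.inr ∈ Cube.boundary (Fin m)
  · rw [sphFun_pos _ hx, sphFun_pos _ hx]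
  · rw [sphFun_neg _ hx, sphFun_neg _ hx]

variable [Finite Λ] [Finite Λ'] [Finite V] [Finite W] [Finite S]

theorem exists_isAppr {b : Al V} (u : Λ → GG b m) :
    ∃ N > 0, ∃ ψ : Λ → Sph (Fin 2 ⊕ Fin m) N →o V, ∀ l, IsAppr (ψ l) (u l) := by
  choose g hg e using fun l => Gp.exists_rep (u l)
  have : Nonempty V := ⟨b⟩
  obtain ⟨N, hN, ψ, h⟩ := exists_realize (P := V) fun l => (hg l).sph
  exact ⟨N, hN, ψ, fun l => ⟨g l, hg l, e l, h l⟩⟩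

theorem IsAppr.eqv {b : Al V} {N N' : ℕ} (hN : 0 < N) (hN' : 0 < N')
    {ψ : Λ → Sph (Fin 2 ⊕ Fin m) N →o V} {ψ' : Λ → Sph (Fin 2 ⊕ Fin m) N' →o V} {u : Λ → GG b m}
    (h : ∀ l, IsAppr (ψ l) (u l)) (h' : ∀ l, IsAppr (ψ' l) (u l)) : Eqv ⟨Att ψ⟩ ⟨Att ψ'⟩ :=
  Att.of_homotopic hN hN' fun l => (h l).homotopic (h' l)

/-- The inclusion of the base of an attachment. -/
def Att.baseHom (ψ : Λ → S →o V) : V →o Att ψ := ⟨.base, fun _ _ h => h⟩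

@[simp] theorem Att.baseHom_apply (ψ : Λ → S →o V) (p : V) : Att.baseHom ψ p = .base p := rfl

theorem Att.nest {Λ₀ : Type} [Finite Λ₀] (ψ : Λ → S →o V) (a : Λ₀ → Λ) (c : Λ' → Λ)
    (ha : Function.Injective a) (hc : Function.Injective c) (hac : ∀ x y, a x ≠ c y)
    (h : ∀ l, (∃ x, a x = l) ∨ ∃ y, c y = l) :
    Eqv ⟨Att fun y => (Att.baseHom fun x => ψ (a x)).comp (ψ (c y))⟩ ⟨Att ψ⟩ := by
  let f : Att (fun y => (Att.baseHom fun x => ψ (a x)).comp (ψ (c y))) → Att ψ := fun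
    | .base (.base p) => .base p
    | .base (.cyl x s) => .cyl (a x) s
    | .base (.apex x) => .apex (a x)
    | .cyl y s => .cyl (c y) s
    | .apex y => .apex (c y)
  have hf : ∀ x y, f x ≤ f y ↔ x ≤ y := by
    rintro ((p | ⟨x, s⟩ | x) | ⟨y, s⟩ | y) ((p' | ⟨x', s'⟩ | x') | ⟨y', s'⟩ | y') <;>
      simp [f, ha.eq_iff, hc.eq_iff, hac, (hac _ _).symm]
  have hs : Function.Surjective f := by
    rintro (p | ⟨l, s⟩ | l)
    · exact ⟨.base (.base p), rfl⟩
    · rcases h l with ⟨x, rfl⟩ | ⟨y, rfl⟩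
      exacts [⟨.base (.cyl x s), rfl⟩, ⟨.cyl y s, rfl⟩]
    · rcases h l with ⟨x, rfl⟩ | ⟨y, rfl⟩
      exacts [⟨.base (.apex x), rfl⟩, ⟨.apex y, rfl⟩]
  exact Eqv.iso (OrderIso.ofSurjective (OrderEmbedding.ofMapLEIff f hf) hs)

theorem Att.reindexLabels (e : Λ' ≃ Λ) (ψ : Λ → S →o V) :
    Eqv ⟨Att fun l => ψ (e l)⟩ ⟨Att ψ⟩ := by
  let f : Att (fun l => ψ (e l)) → Att ψ := fun
    | .base p => .base p
    | .cyl x s => .cyl (e x) s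
    | .apex x => .apex (e x)
  have hf : ∀ x y, f x ≤ f y ↔ x ≤ y := by
    rintro (p | ⟨x, s⟩ | x) (p' | ⟨x', s'⟩ | x') <;> simp [f]
  have hs : Function.Surjective f := by
    rintro (p | ⟨l, s⟩ | l)
    · exact ⟨.base p, rfl⟩
    · exact ⟨.cyl (e.symm l) s, by simp [f]⟩
    · exact ⟨.apex (e.symm l), by simp [f]⟩
  exact Eqv.iso (OrderIso.ofSurjective (OrderEmbedding.ofMapLEIff f hf) hs)

theorem Att.post_eq_zero {b : Al V} {N : ℕ} (ψ : Λ → Sph (Fin 2 ⊕ Fin m) N →o V) (l : Λ)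
    {u : GG b m} (h : IsAppr (ψ l) u) : Gp.post (Att.baseHom ψ) b u = 0 := by
  obtain ⟨g, hg, e, h⟩ := h.post (Att.baseHom ψ)
  rw [e]
  refine Gp.cls_eq_zero_of_nullhomotopic hg ⟨.apex l, h.symm.trans ?_⟩
  let χ : Sph (Fin 2 ⊕ Fin m) N →o Att ψ := ⟨fun s => .cyl l s, fun _ _ h => ⟨rfl, h⟩⟩
  have h1 : (realize χ).Homotopic (realize ((Att.baseHom ψ).comp (ψ l))) :=
    Al.homotopic_of_le fun t => le_refl (ψ l _)
  exact h1.symm.trans (Al.homotopic_of_le fun t => rfl)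

/-- The attachment of cones along a family of classes is trivial. -/
def TrivAtt {b : Al V} (u : Λ → GG b m) : Prop :=
  ∃ N > 0, ∃ ψ : Λ → Sph (Fin 2 ⊕ Fin m) N →o V, (∀ l, IsAppr (ψ l) (u l)) ∧
    Eqv ⟨Att ψ⟩ ⟨PUnit⟩

theorem TrivAtt.eqv {b : Al V} {u : Λ → GG b m} (h : TrivAtt u) {N : ℕ} (hN : 0 < N)
    {ψ : Λ → Sph (Fin 2 ⊕ Fin m) N →o V} (hψ : ∀ l, IsAppr (ψ l) (u l)) :
    Eqv ⟨Att ψ⟩ ⟨PUnit⟩ := by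
  obtain ⟨N', hN', ψ', hψ', h⟩ := h
  exact (IsAppr.eqv hN hN' hψ hψ').trans h

theorem TrivAtt.reindex {b : Al V} {u : Λ → GG b m} (h : TrivAtt u) (e : Λ' ≃ Λ) :
    TrivAtt fun l => u (e l) := by
  obtain ⟨N, hN, ψ, hψ, h⟩ := h
  exact ⟨N, hN, fun l => ψ (e l), fun l => hψ _, (Att.reindexLabels e ψ).trans h⟩

theorem Att.change {ψ ψ' : Λ → S →o V} (i : Λ) (hu : ∀ l, l ≠ i → ψ' l = ψ l)
    (h : Eqv ⟨Att fun _ : Unit => (Att.baseHom fun x : {l // l ≠ i} => ψ x).comp (ψ' i)⟩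
      ⟨Att fun _ : Unit => (Att.baseHom fun x : {l // l ≠ i} => ψ x).comp (ψ i)⟩) :
    Eqv ⟨Att ψ'⟩ ⟨Att ψ⟩ := by
  let a : {l : Λ // l ≠ i} → Λ := Subtype.val
  have hn : ∀ ξ : Λ → S →o V, Eqv ⟨Att fun _ : Unit =>
      (Att.baseHom fun x => ξ (a x)).comp (ξ i)⟩ ⟨Att ξ⟩ := fun ξ =>
    Att.nest ξ a (fun _ : Unit => i) Subtype.val_injective (fun _ _ _ => rfl) (fun x _ => x.2)
      fun l => (em (l = i)).symm.imp (fun hl => ⟨⟨l, hl⟩, rfl⟩) fun hl => ⟨(), hl.symm⟩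
  have e : (fun x => ψ' (a x)) = fun x => ψ (a x) := funext fun x => hu _ x.2
  have h3 := hn ψ'
  rw [e] at h3
  exact h3.symm.trans (Eqv.trans h (hn ψ))

/-- Sliding one cone over another one. -/
theorem TrivAtt.slide {b : Al V} {u u' : Λ → GG b m} {i j : Λ} (hij : i ≠ j)
    (hi : u' i = u i + u j ∨ u i = u' i + u j) (hu : ∀ l, l ≠ i → u' l = u l)
    (h : TrivAtt u) : TrivAtt u' := by
  obtain ⟨N, hN, χ, hχ⟩ := exists_isAppr (fun l : Bool × Λ => if l.1 then u l.2 else u' l.2)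
  have h1 : ∀ l, IsAppr (χ (true, l)) (u l) := fun l => hχ (true, l)
  have h2 : ∀ l, IsAppr (χ (false, l)) (u' l) := fun l => hχ (false, l)
  classical
  let ψ' := fun l => if l = i then χ (false, l) else χ (true, l)
  have hψ' : ∀ l, IsAppr (ψ' l) (u' l) := fun l => by
    by_cases hl : l = i
    · simpa [ψ', hl] using h2 i
    · simpa [ψ', hl, hu l hl] using h1 l
  refine ⟨N, hN, ψ', hψ', Eqv.trans (Att.change i (fun l hl => if_neg hl) ?_) (h.eqv hN h1)⟩
  have h0 := Att.post_eq_zero (fun x : {l // l ≠ i} => χ (true, x)) ⟨j, hij.symm⟩ (h1 j)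
  refine IsAppr.eqv hN hN (u := fun _ => Gp.post (Att.baseHom fun x : {l // l ≠ i} =>
    χ (true, x)) b (u i)) (fun _ => ?_) fun _ => (h1 i).post _
  convert (hψ' i).post (Att.baseHom fun x : {l // l ≠ i} => χ (true, x)) using 1
  rcases hi with hi | hi <;> simp [hi, h0]

/-- Reversal of a subdivided interval. -/
def Fen.flip {N : ℕ} (a : Fen N) : Fen N := ⟨2 * N - a.val, Nat.sub_le _ _⟩

@[simp] theorem Fen.flip_val {N : ℕ} (a : Fen N) : a.flip.val = 2 * N - a.val := rfl

theorem cell_symm (N : ℕ) (t : I) : cell N (unitInterval.symm t) = (cell N t).flip := by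
  refine Fen.ext ?_
  have h := (cell N t).2
  rcases cell_cases N t with ⟨n, h1, h2⟩ | ⟨n, h1, h2, h3⟩
  · rw [cell_eq_even (n := N - n), Fen.flip_val, h2]
    · omega
    · rw [Nat.cast_sub (by omega), ← h1, unitInterval.coe_symm_eq]; ring
  · rw [cell_eq_odd (n := N - n - 1), Fen.flip_val, h3]
    · omega
    all_goals
      rw [unitInterval.coe_symm_eq, Nat.cast_sub (by omega), Nat.cast_sub (by omega), mul_sub]
      push_cast; linarith

/-- Reversal of one coordinate on the boundary of a subdivided cube. -/
def Sph.flip {ι : Type} [DecidableEq ι] {N : ℕ} (i : ι) : Sph ι N →o Sph ι N where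
  toFun κ := ⟨fun j => if j = i then (κ.1 j).flip else κ.1 j, by
    obtain ⟨κ, j, h⟩ := κ
    refine ⟨j, ?_⟩
    dsimp only
    split_ifs
    · rw [Fen.flip_val]; omega
    · exact h⟩
  monotone' := fun κ κ' h j => by
    have := h j
    have h1 := (κ.1 j).2
    have h2 := (κ'.1 j).2
    dsimp only
    split_ifs
    · rw [Fen.le_def] at this ⊢; simp only [Fen.flip_val]; omega
    · exact this

theorem Sph.flip_val {ι : Type} [DecidableEq ι] {N : ℕ} (i j : ι) (κ : Sph ι N) :
    (Sph.flip i κ).1 j = if j = i then (κ.1 j).flip else κ.1 j := rfl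

theorem Sph.flip_flip {ι : Type} [DecidableEq ι] {N : ℕ} (i : ι) (κ : Sph ι N) :
    Sph.flip i (Sph.flip i κ) = κ := by
  refine Subtype.ext (funext fun j => Fen.ext ?_)
  have h := (κ.1 j).2
  by_cases hj : j = i
  · simp only [flip_val, hj, if_true, Fen.flip_val]; rw [hj] at h; omega
  · simp [flip_val, hj]

theorem IsAppr.flip {b : Al V} {N : ℕ} {ψ : Sph (Fin 2 ⊕ Fin m) N →o V} {u : GG b m}
    (h : IsAppr ψ u) : IsAppr (ψ.comp (Sph.flip (Sum.inl 0))) (-u) := by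
  obtain ⟨g, hg, rfl, h⟩ := h
  refine ⟨_, hg.flip, (Gp.cls_flip hg).symm, ?_⟩
  let p : C(Cube.boundary (Fin 2 ⊕ Fin m), Cube.boundary (Fin 2 ⊕ Fin m)) :=
    ⟨fun x => ⟨fun j => if j = Sum.inl 0 then unitInterval.symm (x.1 j) else x.1 j, by
      obtain ⟨x, j, h⟩ := x
      refine ⟨j, ?_⟩
      dsimp only
      split_ifs
      · rcases h with h | h <;> simp [h]
      · exact h⟩, by
      refine Continuous.subtype_mk (continuous_pi fun j => ?_) _
      have := (continuous_apply j).comp (continuous_subtype_val (p := (· ∈ Cube.boundary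
        (Fin 2 ⊕ Fin m))))
      split_ifs
      exacts [unitInterval.continuous_symm.comp this, this]⟩
  have := h.comp (ContinuousMap.Homotopic.refl p)
  convert this using 1
  · refine ContinuousMap.ext fun x => ?_
    change ψ _ = ψ (cellS N (p x))
    congr 1
    refine Subtype.ext (funext fun j => ?_)
    change (if j = _ then (cell N (x.1 j)).flip else cell N (x.1 j)) = cell N (if _ then _ else _)
    split_ifs
    exacts [(cell_symm _ _).symm, rfl]
  · refine ContinuousMap.ext fun x => ?_
    change sphFun b (fun t => g fun j => if j = 0 then unitInterval.symm (t j) else t j) x.1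
      = sphFun b g (p x).1
    have hr : (p x).1 ∘ Sum.inr = x.1 ∘ Sum.inr := funext fun j => by simp [p]
    have hl : (p x).1 ∘ Sum.inl = fun j => if j = 0 then unitInterval.symm (x.1 (Sum.inl j))
        else x.1 (Sum.inl j) := funext fun j => by simp [p]
    by_cases hx : x.1 ∘ Sum.inr ∈ Cube.boundary (Fin m)
    · rw [sphFun_pos _ hx, sphFun_pos g (hr ▸ hx)]
      simp only [hl, hr]; rfl
    · rw [sphFun_neg _ hx, sphFun_neg g (hr ▸ hx)]

/-- Changing the sign of a class. -/
theorem TrivAtt.neg {b : Al V} {u u' : Λ → GG b m} {i : Λ} (hi : u' i = -u i)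
    (hu : ∀ l, l ≠ i → u' l = u l) (h : TrivAtt u) : TrivAtt u' := by
  obtain ⟨N, hN, ψ, hψ, h⟩ := h
  classical
  let ψ' := fun l => if l = i then (ψ l).comp (Sph.flip (Sum.inl 0)) else ψ l
  refine ⟨N, hN, ψ', fun l => ?_, Eqv.trans (Att.change i (fun l hl => if_neg hl) ?_) h⟩
  · by_cases hl : l = i
    · simpa [ψ', hl, hi] using (hψ i).flip
    · simpa [ψ', hl, hu l hl] using hψ l
  · refine Att.reindex (Sph.flip (Sum.inl 0)) (fun s => Triv.bot (m := Sph.flip (Sum.inl 0) s)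
      ?_ fun s' hs => ?_) _ _ fun l s => ?_
    · simp only [mem_setOf_eq, Sph.flip_flip]; exact le_rfl
    · simpa only [Sph.flip_flip] using (Sph.flip (Sum.inl 0)).monotone hs
    · simp only [ψ', if_true, OrderHom.comp_coe, Function.comp_apply, Att.baseHom_apply,
        Sph.flip_flip, le_refl]
end

end

section Moves
variable {K M M' : Type} [AddCommGroup M] [AddCommGroup M']

/-- The elementary moves on families of elements of an abelian group. -/
inductive Move (v v' : K → M) : Prop
  | slide (i j : K) (hij : i ≠ j) (h : v' i = v i + v j ∨ v i = v' i + v j)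
      (hv : ∀ l, l ≠ i → v' l = v l) : Move v v'
  | neg (i : K) (h : v' i = -v i) (hv : ∀ l, l ≠ i → v' l = v l) : Move v v'

/-- Families related by a sequence of elementary moves. -/
abbrev Moves : (K → M) → (K → M) → Prop := Relation.ReflTransGen Move

theorem Moves.map (f : M →+ M') {v v' : K → M} (h : Moves v v') :
    Moves (fun i => f (v i)) fun i => f (v' i) := by
  induction h with
  | refl => exact .refl
  | tail _ h ih =>
    refine ih.tail ?_
    rcases h with ⟨i, j, hij, h, hv⟩ | ⟨i, h, hv⟩
    · refine .slide i j hij (h.imp (fun h => ?_) fun h => ?_) fun l hl => by rw [hv l hl]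
      all_goals rw [h, map_add]
    · exact .neg i (by rw [h, map_neg]) fun l hl => by rw [hv l hl]

theorem Move.symm {v v' : K → M} (h : Move v v') : Move v' v := by
  rcases h with ⟨i, j, hij, h, hv⟩ | ⟨i, h, hv⟩
  · exact .slide i j hij (by rw [hv j hij.symm]; exact h.symm) fun l hl => (hv l hl).symm
  · exact .neg i (by rw [h, neg_neg]) fun l hl => (hv l hl).symm

theorem Moves.symm {v v' : K → M} (h : Moves v v') : Moves v' v := by
  induction h with
  | refl => exact .refl
  | tail _ h ih => exact .head h.symm ih

theorem Move.closure_le {v v' : K → M} (h : Move v v') :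
    AddSubgroup.closure (range v) ≤ AddSubgroup.closure (range v') := by
  rw [AddSubgroup.closure_le]
  rintro _ ⟨l, rfl⟩
  have hm : ∀ l, v' l ∈ AddSubgroup.closure (range v') := fun l =>
    AddSubgroup.subset_closure ⟨l, rfl⟩
  rcases h with ⟨i, j, hij, h, hv⟩ | ⟨i, h, hv⟩
  · by_cases hl : l = i
    · subst hl
      rw [← hv j hij.symm] at h
      rcases h with h | h
      · rw [eq_sub_of_add_eq h.symm]; exact sub_mem (hm _) (hm _)
      · rw [h]; exact add_mem (hm _) (hm _)
    · rw [← hv l hl]; exact hm _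
  · by_cases hl : l = i
    · subst hl; rw [← neg_neg (v l), ← h]; exact neg_mem (hm _)
    · rw [← hv l hl]; exact hm _

theorem Moves.closure_eq_top {v v' : K → M} (h : Moves v v')
    (hv : AddSubgroup.closure (range v) = ⊤) : AddSubgroup.closure (range v') = ⊤ := by
  induction h with
  | refl => exact hv
  | tail _ h ih => exact top_unique (ih ▸ h.closure_le)

open Classical in
theorem Moves.add_of_mem (t : K) {v : K → M} {x : M}
    (hx : x ∈ AddSubgroup.closure (v '' {t}ᶜ)) : Moves v (Function.update v t (v t + x)) := by
  suffices h : ∀ w : K → M, (∀ i, i ≠ t → w i = v i) → Moves w (Function.update w t (w t + x)) from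
    h v fun _ _ => rfl
  induction hx using AddSubgroup.closure_induction with
  | mem x hx =>
    obtain ⟨j, hj, rfl⟩ := hx
    intro w hw
    refine .single (.slide t j (Ne.symm hj) (Or.inl ?_) fun l hl => by simp [hl])
    simp [hw j hj]
  | zero => intro w _; simpa using Relation.ReflTransGen.refl
  | add x y _ _ hx hy =>
    intro w hw
    have h1 := hy (Function.update w t (w t + x)) fun i hi => by simp [hi, hw i hi]
    simp only [Function.update_self, Function.update_idem, add_assoc] at h1
    exact (hx w hw).trans h1
  | neg x _ hx =>
    intro w hw
    have h1 := hx (Function.update w t (w t + -x)) fun i hi => by simp [hi, hw i hi]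
    simp only [Function.update_self, Function.update_idem, neg_add_cancel_right,
      Function.update_eq_self] at h1
    exact h1.symm

variable [Finite K]

open Classical in
/-- The Euclidean algorithm by elementary moves. -/
theorem Moves.exists_unique_ne_zero (φ : M →+ ℤ) (v : K → M) :
    ∃ w, Moves v w ∧ (∀ i, φ (v i) = 0 → w i = v i) ∧
      ∀ i j, φ (w i) ≠ 0 → φ (w j) ≠ 0 → i = j := by
  have := Fintype.ofFinite K
  induction hn : ∑ i, (φ (v i)).natAbs using Nat.strong_induction_on generalizing v with
  | _ n ih =>
  subst hn
  by_cases h : ∀ i j, φ (v i) ≠ 0 → φ (v j) ≠ 0 → i = j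
  · exact ⟨v, .refl, fun _ _ => rfl, h⟩
  push Not at h
  obtain ⟨i, j, hi, hj, hij⟩ : ∃ i j, φ (v i) ≠ 0 ∧ φ (v j) ≠ 0 ∧ i ≠ j ∧
      (φ (v j)).natAbs ≤ (φ (v i)).natAbs := by
    obtain ⟨i, j, hi, hj, hij⟩ := h
    rcases le_total (φ (v j)).natAbs (φ (v i)).natAbs with h | h
    exacts [⟨i, j, hi, hj, hij, h⟩, ⟨j, i, hj, hi, hij.symm, h⟩]
  obtain ⟨x, hx, hlt⟩ : ∃ x, (x = v i + v j ∨ v i = x + v j) ∧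
      (φ x).natAbs < (φ (v i)).natAbs := by
    by_cases hs : (φ (v i) + φ (v j)).natAbs < (φ (v i)).natAbs
    · exact ⟨_, Or.inl rfl, by rwa [map_add]⟩
    · exact ⟨v i - v j, Or.inr (by simp), by rw [map_sub]; omega⟩
  have hu : ∀ l, l ≠ i → Function.update v i x l = v l := fun l hl => by simp [hl]
  have hsum : ∑ l, (φ (Function.update v i x l)).natAbs < ∑ l, (φ (v l)).natAbs := by
    refine Finset.sum_lt_sum (fun l _ => ?_) ⟨i, Finset.mem_univ _, by simpa using hlt⟩
    by_cases hl : l = i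
    · subst hl; simpa using hlt.le
    · rw [hu l hl]
  obtain ⟨w, h1, h2, h3⟩ := ih _ hsum (Function.update v i x) rfl
  refine ⟨w, .head (.slide i j hij.1 (by simpa using hx) hu) h1, fun l hl => ?_, h3⟩
  have hli : l ≠ i := by rintro rfl; exact hi hl
  rw [h2 l (by rw [hu l hli]; exact hl), hu l hli]

open Classical in
theorem Moves.exists_pivot (φ : M →+ ℤ) (v : K → M) (hv : AddSubgroup.closure (range v) = ⊤)
    {x : M} (hx : φ x = 1) (t : K) : ∃ w, Moves v w ∧
      (∀ i, i ≠ t → φ (v i) = 0 → w i = v i) ∧ φ (w t) = 1 ∧ ∀ i, i ≠ t → φ (w i) = 0 := by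
  obtain ⟨w, h1, h2, h3⟩ := Moves.exists_unique_ne_zero φ v
  have hw := h1.closure_eq_top hv
  obtain ⟨i, hi⟩ : ∃ i, φ (w i) ≠ 0 := by
    by_contra! h
    have : AddSubgroup.closure (range w) ≤ φ.ker := by
      rw [AddSubgroup.closure_le]; rintro _ ⟨i, rfl⟩; exact h i
    rw [hw] at this
    have := this (AddSubgroup.mem_top x)
    rw [AddMonoidHom.mem_ker, hx] at this
    exact one_ne_zero this
  have h0 : ∀ j, j ≠ i → φ (w j) = 0 := fun j hj => by_contra fun h => hj (h3 _ _ h hi)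
  have hd : φ (w i) ∣ 1 := by
    have : AddSubgroup.closure (range w) ≤ (AddSubgroup.zmultiples (φ (w i))).comap φ := by
      rw [AddSubgroup.closure_le]; rintro _ ⟨j, rfl⟩
      by_cases hj : j = i
      · subst hj; exact AddSubgroup.mem_zmultiples _
      · change φ (w j) ∈ AddSubgroup.zmultiples (φ (w i)); rw [h0 j hj]; exact zero_mem _
    rw [hw] at this
    have := this (AddSubgroup.mem_top x)
    rw [AddSubgroup.mem_comap, hx, Int.mem_zmultiples_iff] at this
    exact this
  have key : ∀ u : K → M, Moves v u → (∀ i, i ≠ t → φ (v i) = 0 → u i = v i) → IsUnit (φ (u t)) →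
      (∀ i, i ≠ t → φ (u i) = 0) → ∃ w, Moves v w ∧
      (∀ i, i ≠ t → φ (v i) = 0 → w i = v i) ∧ φ (w t) = 1 ∧ ∀ i, i ≠ t → φ (w i) = 0 := by
    intro u h1 h2 h3 h4
    rcases Int.isUnit_iff.1 h3 with h | h
    · exact ⟨u, h1, h2, h, h4⟩
    · refine ⟨Function.update u t (-u t), h1.tail (.neg t (by simp) fun l hl => by simp [hl]),
        fun i hi h => by simpa [hi] using h2 i hi h, by simp [h], fun i hi => by simp [hi, h4 i hi]⟩
  by_cases hit : i = t
  · subst hit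
    exact key w h1 (fun i _ => h2 i) (isUnit_of_dvd_one hd) h0
  · refine key (Function.update (Function.update w t (w t + w i)) i (-w t)) ?_ ?_ ?_ ?_
    · refine (h1.tail (.slide t i (Ne.symm hit) (v' := Function.update w t (w t + w i))
        (Or.inl (by simp)) fun l hl => by simp [hl])).tail (.slide i t hit (Or.inr ?_)
        fun l hl => by simp [hl])
      simp [hit, Ne.symm hit]
    · intro l hl h
      have hli : l ≠ i := by rintro rfl; rw [h2 l h] at hi; exact hi h
      simp [hl, hli, h2 l h]
    · simpa [Ne.symm hit, h0 t (Ne.symm hit)] using isUnit_of_dvd_one hd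
    · intro l hl
      by_cases hli : l = i
      · subst hli; simp [h0 t (Ne.symm hit)]
      · simp [hl, hli, h0 l hli]

/-- Every generating family indexed by the basis of a free abelian group is obtained from the basis
by elementary moves. -/
theorem Moves.to_basis (v : K → K →₀ ℤ) (hv : AddSubgroup.closure (range v) = ⊤) :
    Moves v fun i => Finsupp.single i 1 := by
  classical
  have := Fintype.ofFinite K
  suffices h : ∀ T : Finset K, ∀ v : K → K →₀ ℤ, AddSubgroup.closure (range v) = ⊤ →
      (∀ i, i ∉ T → v i = Finsupp.single i 1) → Moves v fun i => Finsupp.single i 1 from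
    h Finset.univ v hv fun i hi => absurd (Finset.mem_univ i) hi
  intro T
  induction T using Finset.induction_on with
  | empty =>
    intro v _ h
    rw [show v = _ from funext fun i => h i (Finset.notMem_empty i)]
  | insert t T ht ih =>
    intro v hv h
    obtain ⟨w, h1, h2, h3, h4⟩ := Moves.exists_pivot (Finsupp.applyAddHom t) v hv
      (x := Finsupp.single t 1) (by simp) t
    have hw := h1.closure_eq_top hv
    have hmem : Finsupp.single t 1 - w t ∈ AddSubgroup.closure (w '' {t}ᶜ) := by
      have hr : range w = insert (w t) (w '' {t}ᶜ) := by
        rw [← image_univ, ← image_insert_eq, insert_eq, union_compl_self]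
      have hx : Finsupp.single t 1 - w t ∈ AddSubgroup.closure (range w) := hw ▸ AddSubgroup.mem_top _
      rw [hr, insert_eq, AddSubgroup.closure_union, AddSubgroup.mem_sup] at hx
      obtain ⟨a, ha, c, hc, e⟩ := hx
      rw [AddSubgroup.mem_closure_singleton] at ha
      obtain ⟨n, rfl⟩ := ha
      have hc0 : Finsupp.applyAddHom t c = 0 := by
        have : AddSubgroup.closure (w '' {t}ᶜ) ≤ (Finsupp.applyAddHom (M := ℤ) t).ker := by
          rw [AddSubgroup.closure_le]; rintro _ ⟨j, hj, rfl⟩; exact h4 j hj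
        exact this hc
      have := congrArg (Finsupp.applyAddHom t) e
      rw [map_add, hc0, map_zsmul, map_sub, h3] at this
      simp at this
      rw [← e, this]; simpa using hc
    refine (h1.trans (Moves.add_of_mem t hmem)).trans (ih _ ?_ fun i hi => ?_)
    · exact (Moves.add_of_mem t hmem).closure_eq_top hw
    · by_cases hit : i = t
      · subst hit; simp
      · have := h i (by simp [hit, hi])
        rw [Function.update_of_ne hit, h2 i hit (by simp [this, hit]), this]

theorem TrivAtt.of_moves {Λ V : Type} [PartialOrder V] [Finite Λ] [Finite V] {m : ℕ} {b : Al V}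
    {u u' : Λ → GG b m} (h : Moves u u') (hu : TrivAtt u) : TrivAtt u' := by
  induction h with
  | refl => exact hu
  | tail _ h ih =>
    rcases h with ⟨i, j, hij, h, hv⟩ | ⟨i, h, hv⟩
    exacts [ih.slide hij h hv, ih.neg h hv]

end Moves

/-- A quotient map collapsing a trivial subset to a maximal point. -/
theorem Eqv.of_collapse {P P' : Type} [PartialOrder P] [PartialOrder P'] [Finite P] [Finite P']
    (f : P →o P') (hf : Function.Surjective f) (b : P') (hb : ∀ x, b ≤ x → x = b)
    (hA : Triv {a | f a = b}) (hF : ∀ s, f s < b → Triv {a | f a = b ∧ s ≤ a})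
    (he : ∀ s t, f s ≠ b → f t ≠ b → f s ≤ f t → s ≤ t) : Eqv ⟨P⟩ ⟨P'⟩ := by
  have up : ∀ s t, s ≤ t → f s = b → f t = b := fun s t h hs => hb _ (hs ▸ f.monotone h)
  refine Eqv.ofUniv.trans (Eqv.trans (EqS.of_upper_fibers (A := univ) (B := univ) f
    (fun _ _ _ _ h => f.monotone h) (fun _ _ => trivial) fun p _ => ?_) Eqv.ofUniv.symm)
  obtain ⟨s, rfl⟩ := hf p
  by_cases hs : f s = b
  · convert hA using 1
    ext a
    exact ⟨fun h => hb _ (hs ▸ h.2), fun h => ⟨trivial, by rw [hs, h]⟩⟩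
  by_cases hsb : f s ≤ b
  · have h1 := EqS.removeLower (A := {a | a ∈ univ ∧ f s ≤ f a}) {a | f s ≤ f a ∧ f a ≠ b ∧ a ≠ s}
      (fun a h => ⟨trivial, h.1⟩) ?_
    have h2 := EqS.removeUpper (A := {a | a ∈ univ ∧ f s ≤ f a} \
      {a | f s ≤ f a ∧ f a ≠ b ∧ a ≠ s}) {s} (by simp) ?_
    · refine (h1.trans h2).triv ?_
      convert hA using 1
      ext a
      simp only [mem_sdiff, mem_setOf_eq, mem_univ, true_and, mem_singleton_iff]
      exact ⟨fun ⟨⟨h, h'⟩, h3⟩ => by tauto, fun h => ⟨⟨by rwa [h], by tauto⟩, fun h' => hs (h' ▸ h)⟩⟩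
    · intro s' hs'
      rw [mem_singleton_iff.1 hs']
      convert hF s (lt_of_le_of_ne hsb hs) using 1
      ext a
      simp only [mem_sdiff, mem_setOf_eq, mem_univ, true_and, mem_singleton_iff]
      constructor
      · rintro ⟨⟨h, h'⟩, h3, h4⟩; exact ⟨by tauto, h4.le⟩
      · rintro ⟨h, h'⟩
        have : a ≠ s := by rintro rfl; exact hs h
        exact ⟨⟨f.monotone h', by tauto⟩, this, lt_of_le_of_ne h' this.symm⟩
    · rintro d ⟨h, h', h3⟩
      convert Triv.singleton s using 1
      ext a
      simp only [mem_setOf_eq, mem_univ, true_and, mem_singleton_iff]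
      constructor
      · rintro ⟨h4, h5, h6⟩
        by_contra has
        exact h' (up _ _ h6.le (by tauto))
      · rintro rfl
        exact ⟨le_rfl, by tauto, lt_of_le_of_ne (he _ _ hs h' h) h3.symm⟩
  · refine Triv.bot (m := s) ⟨trivial, le_rfl⟩ ?_
    rintro a ⟨-, h⟩
    exact he _ _ hs (fun h' => hsb (h' ▸ h)) h

theorem Att.cyl_triv {Λ S P : Type} [PartialOrder S] [PartialOrder P] [Finite Λ] [Finite S]
    [Finite P] {ψ : Λ → S →o P} (l : Λ) {T : Set S} (h : Triv T) :
    Triv {x : Att ψ | ∃ s ∈ T, x = .cyl l s} := by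
  refine EqS.triv (EqS.symm (EqS.image (A := T) (fun s => .cyl l s) (by simp) ?_)) h
  ext x
  simp only [mem_image, mem_setOf_eq]
  exact ⟨fun ⟨a, h, e⟩ => ⟨a, h, e.symm⟩, fun ⟨a, h, e⟩ => ⟨a, h, e.symm⟩⟩

theorem Sph.triv {ι : Type} [Finite ι] {N : ℕ} {T : Set (ι → Fen N)} (h : T ⊆ Sph ι N) (hT : Triv T) :
    Triv {s : Sph ι N | s.1 ∈ T} :=
  EqS.triv (EqS.image (fun s => s.1) (fun _ _ _ _ => Iff.rfl) (by
    ext x; simp only [mem_image, mem_setOf_eq]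
    exact ⟨fun ⟨a, h, e⟩ => e ▸ h, fun hx => ⟨⟨x, h hx⟩, hx, rfl⟩⟩)) hT

section Cancel
variable {ι ι' Λ P : Type} [Finite ι] [Finite ι'] [Finite Λ] [PartialOrder P] [Finite P] {N : ℕ}

theorem Sph.triv_segment (hN : 0 < N) (e : Option ι ≃ ι') (s : Sph ι N) :
    Triv {κ : Sph ι' N | (0 < (κ.1 (e none)).val ∧ (κ.1 (e none)).val < 2 * N) ∧
      (fun i => κ.1 (e (some i))) ≤ s.1} := by
  have h0 := EqS.removeUpper (A := {κ : Sph ι' N | (0 < (κ.1 (e none)).val ∧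
    (κ.1 (e none)).val < 2 * N) ∧ (fun i => κ.1 (e (some i))) ≤ s.1})
    {κ | ((0 < (κ.1 (e none)).val ∧ (κ.1 (e none)).val < 2 * N) ∧
    (fun i => κ.1 (e (some i))) ≤ s.1) ∧ (fun i => κ.1 (e (some i))) ≠ s.1} (fun κ h => h.1) ?_
  · refine h0.triv ?_
    have hs := s.2
    convert Sph.triv (ι := ι') (N := N) (T := {κ | ∀ i,
      (e.symm i).elim 1 (fun j => (s.1 j).val) ≤ (κ i).val ∧
      (κ i).val ≤ (e.symm i).elim (2 * N - 1) fun j => (s.1 j).val}) ?_ (Triv.box _ _ ?_ ?_) using 1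
    · ext κ
      simp only [mem_sdiff, mem_setOf_eq, e.surjective.forall, Option.forall,
        Equiv.symm_apply_apply, Option.elim]
      constructor
      · rintro ⟨⟨h, h1⟩, h2⟩
        have h3 : (fun i => κ.1 (e (some i))) = s.1 := by tauto
        refine ⟨by omega, fun i => ?_⟩
        rw [← h3]; exact ⟨le_rfl, le_rfl⟩
      · rintro ⟨h, h1⟩
        have h3 : (fun i => κ.1 (e (some i))) = s.1 := funext fun i =>
          Fen.ext (le_antisymm (h1 i).2 (h1 i).1)
        exact ⟨⟨by omega, h3.le⟩, fun h => h.2 h3⟩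
    · intro κ h
      obtain ⟨i, hi⟩ := hs
      refine ⟨e (some i), ?_⟩
      have := h (e (some i))
      simp only [Equiv.symm_apply_apply, Option.elim] at this
      omega
    · simp only [e.surjective.forall, Option.forall, Equiv.symm_apply_apply, Option.elim]
      exact ⟨by omega, fun _ => le_rfl⟩
    · simp only [e.surjective.forall, Option.forall, Equiv.symm_apply_apply, Option.elim]
      exact ⟨by omega, fun i => (s.1 i).2⟩
  · rintro κ ⟨⟨h, h1⟩, h2⟩
    have hS : (fun i => (e.symm i).elim (κ.1 (e none)) s.1) ∈ Sph ι' N := by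
      obtain ⟨i, hi⟩ := s.2
      exact ⟨e (some i), by simpa using hi⟩
    refine Triv.bot (m := ⟨_, hS⟩) ⟨?_, ?_, ?_⟩ ?_
    · simpa using h
    · simp
    · refine lt_of_le_of_ne ?_ ?_
      · change ∀ i, κ.1 i ≤ _
        simp only [e.surjective.forall, Option.forall, Equiv.symm_apply_apply, Option.elim,
          le_refl, true_and]
        exact h1
      · intro heq
        refine h2 (funext fun i => ?_)
        rw [heq]; simp
    · rintro a ⟨ha, ha', hlt⟩
      have h3 : (fun i => a.1 (e (some i))) = s.1 := by
        by_contra h; exact ha' ⟨ha, h⟩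
      change ∀ i, _ ≤ a.1 i
      simp only [e.surjective.forall, Option.forall, Equiv.symm_apply_apply, Option.elim]
      exact ⟨hlt.le (e none), fun i => (congrFun h3 i).ge⟩

omit [Finite ι] in
theorem Sph.triv_lower (hN : 0 < N) (c : ι') : Triv {κ : Sph ι' N | (κ.1 c).val < 2 * N} := by
  classical
  convert Sph.triv (T := {κ : ι' → Fen N | κ ∈ Sph ι' N ∧ (κ c).val < 2 * N}) (fun _ h => h.1) ?_
    using 1
  · ext κ; exact ⟨fun h => ⟨κ.2, h⟩, fun h => h.2⟩
  refine Slides.triv (((Slides.id _).lower {c} 0 ?_).lower univ 0 ?_)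
    (c := fun _ => ⟨0, by omega⟩) ⟨⟨c, Or.inl rfl⟩, by simpa using hN⟩ fun a _ => ?_
  · rintro j hj κ ⟨⟨i, hi⟩, h⟩
    refine ⟨⟨i, ?_⟩, (lower_val_le _ _ _).trans_lt h⟩
    simp only [_root_.id, lower_val, mem_singleton_iff]
    split_ifs with h'
    · subst h'; omega
    · exact hi
  · rintro j hj κ ⟨⟨i, hi⟩, h⟩
    have : (lower univ j (lower {c} 0 κ) c).val = 0 := by simp [lower_val]
    exact ⟨⟨c, Or.inl this⟩, by simp only [Function.comp, _root_.id, this]; omega⟩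
  · funext i; ext; simp [lower_val]

omit [Finite ι] in
theorem Sph.triv_raise (hN : 0 < N) (c : ι') : Triv {κ : Sph ι' N | 0 < (κ.1 c).val} := by
  classical
  convert Sph.triv (T := {κ : ι' → Fen N | κ ∈ Sph ι' N ∧ 0 < (κ c).val}) (fun _ h => h.1) ?_
    using 1
  · ext κ; exact ⟨fun h => ⟨κ.2, h⟩, fun h => h.2⟩
  refine Slides.triv (((Slides.id _).raise {c} (2 * N) ?_).raise univ (2 * N) ?_)
    (c := fun _ => ⟨2 * N, le_rfl⟩) ⟨⟨c, Or.inr rfl⟩, by simpa using hN⟩ fun a _ => ?_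
  · rintro j hj κ ⟨⟨i, hi⟩, h⟩
    refine ⟨⟨i, ?_⟩, ?_⟩
    · simp only [_root_.id, raise_val hj, mem_singleton_iff]
      split_ifs with h'
      · subst h'; omega
      · exact hi
    · simp [raise_val hj, h]
  · rintro j hj κ ⟨⟨i, hi⟩, h⟩
    have h1 := (κ c).2
    have : (raise univ j (raise {c} (2 * N) κ) c).val = 2 * N := by
      simp [raise_val hj, raise_val le_rfl]; omega
    exact ⟨⟨c, Or.inr this⟩, by simp only [Function.comp, _root_.id, this]; omega⟩
  · funext i; ext
    have := (a i).2
    have := (a c).2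
    by_cases hi : i = c <;> simp [raise_val, hi] <;> omega

/-- Attaching cancelling pairs of cones. -/
theorem Att.cancel (hN : 0 < N) (e : Option ι ≃ ι') (ψ : Λ → (ι → Fen N) →o P)
    (dψ : Λ → Sph ι N →o P) (hd : ∀ l s, dψ l s = ψ l s.1) (σ : Λ → Sph ι' N →o Att dψ)
    (h0 : ∀ l κ, (κ.1 (e none)).val = 0 → σ l κ = .base (ψ l fun i => κ.1 (e (some i))))
    (h1 : ∀ l κ, 0 < (κ.1 (e none)).val → (κ.1 (e none)).val < 2 * N →
      ∃ hs, σ l κ = .cyl l ⟨fun i => κ.1 (e (some i)), hs⟩)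
    (h2 : ∀ l κ, (κ.1 (e none)).val = 2 * N → σ l κ = .apex l) : Eqv ⟨Att σ⟩ ⟨P⟩ := by
  have cases : ∀ κ : Sph ι' N, (κ.1 (e none)).val = 0 ∨
      (0 < (κ.1 (e none)).val ∧ (κ.1 (e none)).val < 2 * N) ∨ (κ.1 (e none)).val = 2 * N := by
    intro κ; have := (κ.1 (e none)).2; omega
  have k0 : ∀ l κ p, σ l κ ≤ .base p ↔
      (κ.1 (e none)).val < 2 * N ∧ ψ l (fun i => κ.1 (e (some i))) ≤ p := by
    intro l κ p
    rcases cases κ with h | ⟨h, h'⟩ | h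
    · rw [h0 l κ h, base_le_base, h]; simp [hN]
    · obtain ⟨hs, e⟩ := h1 l κ h h'
      rw [e, cyl_le_base, hd]; simp [h']
    · rw [h2 l κ h]; simp [h]
  have k1 : ∀ l l' κ s, σ l κ ≤ .cyl l' s ↔ l = l' ∧ (0 < (κ.1 (e none)).val ∧
      (κ.1 (e none)).val < 2 * N) ∧ (fun i => κ.1 (e (some i))) ≤ s.1 := by
    intro l l' κ s
    rcases cases κ with h | ⟨h, h'⟩ | h
    · rw [h0 l κ h]; simp [h]
    · obtain ⟨hs, e⟩ := h1 l κ h h'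
      rw [e, cyl_le_cyl]; simp [h, h', ← Subtype.coe_le_coe]
    · rw [h2 l κ h]; simp [h]
  have k2 : ∀ l l' κ, σ l κ ≤ .apex l' ↔ l = l' ∧ 0 < (κ.1 (e none)).val := by
    intro l l' κ
    rcases cases κ with h | ⟨h, h'⟩ | h
    · rw [h0 l κ h]; simp [h]
    · obtain ⟨hs, e⟩ := h1 l κ h h'
      rw [e, cyl_le_apex]; simp [h]
    · rw [h2 l κ h]; simp [h, hN]
  have r1 := EqS.removeLower (A := (univ : Set (Att σ))) {x | ∃ y, x = .base y ∧ ∀ p, y ≠ .base p}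
    (subset_univ _) ?_
  have r2 := EqS.removeUpper (A := (univ : Set (Att σ)) \ {x | ∃ y, x = .base y ∧ ∀ p, y ≠ .base p})
    {x | ∃ l κ, x = .cyl l κ ∧ (κ.1 (e none)).val = 2 * N} ?_ ?_
  have r3 := EqS.removeLower (A := ((univ : Set (Att σ)) \
    {x | ∃ y, x = .base y ∧ ∀ p, y ≠ .base p}) \
    {x | ∃ l κ, x = .cyl l κ ∧ (κ.1 (e none)).val = 2 * N}) {x | ∃ l, x = .apex l} ?_ ?_
  have r4 := EqS.removeUpper (A := (((univ : Set (Att σ)) \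
    {x | ∃ y, x = .base y ∧ ∀ p, y ≠ .base p}) \
    {x | ∃ l κ, x = .cyl l κ ∧ (κ.1 (e none)).val = 2 * N}) \ {x | ∃ l, x = .apex l})
    {x | ∃ l κ, x = .cyl l κ ∧ (κ.1 (e none)).val < 2 * N} ?_ ?_
  · refine Eqv.ofUniv.trans (Eqv.trans (r1.trans (r2.trans (r3.trans r4))) ?_)
    refine Eqv.trans (EqS.symm (EqS.image (A := (univ : Set P)) (fun p => .base (.base p))
      (by simp) ?_)) Eqv.ofUniv.symm
    ext x
    rcases x with (p | ⟨l, s⟩ | l) | ⟨l, κ⟩ | l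
    · simp
    · simp
    · simp
    · have := (κ.1 (e none)).2
      simp
      intro; omega
    · simp
  · rintro _ ⟨l, κ, rfl, h⟩
    simp; omega
  · rintro _ ⟨l, κ, rfl, h⟩
    refine Triv.bot (m := .base (.base (ψ l fun i => κ.1 (e (some i))))) ?_ ?_
    · simp [lt_iff, k0, h]
    · rintro ((p | ⟨l, s⟩ | l) | ⟨l', κ'⟩ | l') ⟨ha, hb, hc⟩
      · rw [lt_iff, cyl_le_base, k0] at hc
        exact hc.1.2
      · simp at ha
      · simp at ha
      · have := (κ'.1 (e none)).2
        simp at ha hb; omega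
      · simp at ha
  · rintro _ ⟨l, rfl⟩; simp
  · rintro _ ⟨l, rfl⟩
    convert Att.cyl_triv (ψ := σ) l (T := {κ | (κ.1 (e none)).val < 2 * N}) ?_ using 1
    · ext ((p | ⟨l', s⟩ | l') | ⟨l', κ'⟩ | l')
      · simp [lt_iff]
      · simp [lt_iff]
      · simp [lt_iff]
      · have := (κ'.1 (e none)).2
        simp [lt_iff]
        rintro rfl
        constructor
        · intro h
          have := h _ _ κ'.2 rfl rfl
          omega
        · rintro h _ x hx rfl rfl; simp at h; omega
      · simp [lt_iff]
    · exact Sph.triv_lower hN _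
  · rintro _ ⟨l, κ, rfl, h⟩
    simp
  · rintro _ ⟨l, κ, rfl, h⟩
    refine Triv.bot (m := .apex l) (by simp [lt_iff]) ?_
    rintro ((p | ⟨l, s⟩ | l) | ⟨l', κ'⟩ | l') ⟨ha, hb, hc⟩
    · rw [lt_iff, cyl_le_base, k0] at hc; omega
    · simp at ha
    · simp at ha
    · rw [lt_iff, cyl_le_cyl] at hc
      refine absurd ⟨l', κ', rfl, ?_⟩ hb
      have := hc.1.2 (e none)
      rw [Fen.le_def] at this; omega
    · rw [lt_iff, cyl_le_apex] at hc; simp [hc.1]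
  · rintro _ ⟨y, rfl, hy⟩
    rcases y with p | ⟨l, s⟩ | l
    · exact absurd rfl (hy p)
    · convert Att.cyl_triv (ψ := σ) l (Sph.triv_segment hN e s) using 1
      ext ((p | ⟨l', s'⟩ | l') | ⟨l', κ'⟩ | l')
      · simp [lt_iff]
      · simp
      · simp
      · simp [lt_iff, k1]; tauto
      · simp [lt_iff]
    · convert Att.cyl_triv (ψ := σ) l (T := {κ | 0 < (κ.1 (e none)).val}) ?_ using 1
      · ext ((p | ⟨l', s'⟩ | l') | ⟨l', κ'⟩ | l')
        · simp [lt_iff]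
        · simp
        · simp
        · simp [lt_iff, k2]; tauto
        · simp [lt_iff]
      · exact Sph.triv_raise hN _
end Cancel

section Step
variable {Λ J ι ι' : Type} {N : ℕ}

theorem Sph.rest_mem (e : Option ι ≃ ι') (κ : Sph ι' N) (h : 0 < (κ.1 (e none)).val)
    (h' : (κ.1 (e none)).val < 2 * N) : (fun i => κ.1 (e (some i))) ∈ Sph ι N := by
  obtain ⟨κ, i, hi⟩ := κ
  obtain ⟨o, rfl⟩ := e.surjective i
  cases o with
  | none => simp only at h h'; omega
  | some i => exact ⟨i, hi⟩

theorem Att.exists_cancel {P : Type} [PartialOrder P] (e : Option ι ≃ ι')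
    (ψ : J → (ι → Fen N) →o P) (dψ : J → Sph ι N →o P) (hd : ∀ l s, dψ l s = ψ l s.1) :
    ∃ σ : J → Sph ι' N →o Att dψ,
      (∀ l κ, (κ.1 (e none)).val = 0 → σ l κ = .base (ψ l fun i => κ.1 (e (some i)))) ∧
      (∀ l κ, 0 < (κ.1 (e none)).val → (κ.1 (e none)).val < 2 * N →
        ∃ hs, σ l κ = .cyl l ⟨fun i => κ.1 (e (some i)), hs⟩) ∧
      ∀ l κ, 0 < (κ.1 (e none)).val → (κ.1 (e none)).val = 2 * N → σ l κ = .apex l := by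
  classical
  let f : J → Sph ι' N → Att dψ := fun l κ =>
    if h : (κ.1 (e none)).val = 0 then .base (ψ l fun i => κ.1 (e (some i)))
    else if h' : (κ.1 (e none)).val < 2 * N then
      .cyl l ⟨_, Sph.rest_mem e κ (Nat.pos_of_ne_zero h) h'⟩
    else .apex l
  refine ⟨fun l => ⟨f l, fun κ κ' hκ => ?_⟩, fun l κ h => dif_pos h, fun l κ h h' =>
    ⟨Sph.rest_mem e κ h h', (dif_neg h.ne').trans (dif_pos h')⟩,
    fun l κ h0 h => (dif_neg h0.ne').trans (dif_neg h.not_lt)⟩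
  have h1 := hκ (e none)
  have h2 : (fun i => κ.1 (e (some i))) ≤ fun i => κ'.1 (e (some i)) := fun i => hκ _
  have h3 := (κ.1 (e none)).2
  have h4 := (κ'.1 (e none)).2
  rw [Fen.le_def] at h1
  simp only [f]
  split_ifs <;> simp only [Att.base_le_base, Att.cyl_le_base, Att.cyl_le_cyl, Att.cyl_le_apex,
    Att.apex_le_apex, hd, true_and, Att.not_base_le_cyl, Att.not_base_le_apex,
    Att.not_apex_le_cyl, Att.not_apex_le_base]
  any_goals omega
  · exact (ψ l).monotone h2
  · exact (ψ l).monotone h2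

open Classical in
/-- The map from a sphere which is `h` on a face and constant on the complementary disc. -/
noncomputable def faceMap {V : Type} [PartialOrder V] (e : Option ι ≃ ι') {b : V}
    (h : (ι → Fen N) →o V) (hb : ∀ s ∈ Sph ι N, h s = b) : Sph ι' N →o V where
  toFun κ := if (κ.1 (e none)).val = 0 then h fun i => κ.1 (e (some i)) else b
  monotone' κ κ' hκ := by
    have h1 := hκ (e none)
    have h2 : (fun i => κ.1 (e (some i))) ≤ fun i => κ'.1 (e (some i)) := fun i => hκ _
    have h3 := (κ.1 (e none)).2
    rw [Fen.le_def] at h1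
    dsimp only
    split_ifs with h4 h5 h6
    · exact h.monotone h2
    · omega
    · rw [← hb _ (Sph.rest_mem e κ (by omega) (by omega))]
      exact h.monotone h2
    · exact le_rfl

variable [Finite Λ] [Finite J] [Finite ι] [Finite ι'] {V V' : Type} [PartialOrder V] [Finite V]
  [PartialOrder V'] [Finite V']

/-- Triviality of an attachment can be tested after collapsing a subset of the base,
provided that enough further cones attached to this subset make it trivial. -/
theorem Att.step (hN : 0 < N) (e : Option ι ≃ ι') (p : V →o V') (hp : Function.Surjective p)
    (b : V') (hb : ∀ x, b ≤ x → x = b)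
    (hF : ∀ s, p s < b → Triv {a | p a = b ∧ s ≤ a})
    (he : ∀ s t, p s ≠ b → p t ≠ b → p s ≤ p t → s ≤ t)
    (χ : Λ → Sph ι N →o {v // p v = b}) (ψ : J → (ι → Fen N) →o V)
    (dψ : J → Sph ι N →o {v // p v = b}) (hd : ∀ j s, (dψ j s).1 = ψ j s.1)
    (hB : Eqv ⟨Att (Sum.elim χ dψ)⟩ ⟨PUnit⟩)
    (hp0 : ∀ j, ∀ s ∈ Sph ι N, (p.comp (ψ j)) s = b)
    (hQ : Eqv ⟨Att fun j => faceMap e (p.comp (ψ j)) (hp0 j)⟩ ⟨PUnit⟩) :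
    Eqv ⟨Att fun l => (OrderHom.Subtype.val _).comp (χ l)⟩ ⟨PUnit⟩ := by
  generalize hα : (fun l => (OrderHom.Subtype.val _).comp (χ l)) = α
  let dψ' : J → Sph ι N →o Att α := fun j =>
    (Att.baseHom α).comp ((OrderHom.Subtype.val _).comp (dψ j))
  obtain ⟨σ, h0, h1, h2⟩ := Att.exists_cancel e (fun j => (Att.baseHom α).comp (ψ j)) dψ'
    fun j s => by simp [dψ', hd]
  refine Eqv.trans (Eqv.symm (Att.cancel hN e _ dψ' (fun j s => by simp [dψ', hd]) σ h0 h1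
    fun l κ h => h2 l κ (by omega) h)) (Eqv.trans ?_ hQ)
  have hχ : ∀ l s, p (α l s) = b := fun l s => by subst hα; exact (χ l s).2
  have hdψ : ∀ j s, p (dψ j s).1 = b := fun j s => (dψ j s).2
  let q : Att dψ' → V' := fun
    | .base (.base v) => p v
    | _ => b
  have hq : Monotone q := by
    rintro ((v | ⟨l, s⟩ | l) | ⟨y, s⟩ | y) ((v' | ⟨l', s'⟩ | l') | ⟨y', s'⟩ | y') h
    all_goals first | exact le_rfl | exact absurd h not_false | skip
    · exact p.monotone h
    · exact (hχ l s).ge.trans (p.monotone h)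
    · exact (hdψ y s).ge.trans (p.monotone h)
  have hqσ : ∀ j κ, faceMap e (p.comp (ψ j)) (hp0 j) κ = q (σ j κ) := fun j κ => by
    have := (κ.1 (e none)).2
    change (if _ then _ else _) = _
    split_ifs with h
    · rw [h0 j κ h]; rfl
    · by_cases h' : (κ.1 (e none)).val = 2 * N
      · rw [h2 j κ (by omega) h']
      · obtain ⟨hs, e⟩ := h1 j κ (by omega) (by omega)
        rw [e]
  have hqF : ∀ x, q x ≤ b → Triv {y | q y = b ∧ x ≤ y} := by
    intro x hx
    by_cases hx' : q x = b
    · exact Triv.bot (m := x) ⟨hx', le_rfl⟩ fun _ h => h.2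
    · match x, hx, hx' with
      | .base (.base v), hx, hx' =>
        refine (EqS.image (fun w => Att.base (Att.base w)) (fun _ _ _ _ => Iff.rfl) ?_).symm.triv
          (hF v (lt_of_le_of_ne hx hx'))
        ext ((w | ⟨l, s⟩ | l) | ⟨y, s⟩ | y) <;> simp [q]
  have hqe : ∀ x y, q x ≠ b → q y ≠ b → q x ≤ q y → x ≤ y := by
    rintro ((v | ⟨l, s⟩ | l) | ⟨y, s⟩ | y) ((v' | ⟨l', s'⟩ | l') | ⟨y', s'⟩ | y') h h' hl
    all_goals first | exact he v v' h h' hl | exact absurd rfl h | exact absurd rfl h'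
  have hqA : Triv {x | q x = b} := by
    let G : Att (Sum.elim χ dψ) → Att dψ' := fun
      | .base v => .base (.base v.1)
      | .cyl (.inl l) s => .base (.cyl l s)
      | .cyl (.inr j) s => .cyl j s
      | .apex (.inl l) => .base (.apex l)
      | .apex (.inr j) => .apex j
    refine (EqS.image (A := univ) G ?_ ?_).symm.triv (Eqv.ofUniv.symm.trans hB)
    · subst hα
      rintro (v | ⟨l | j, s⟩ | l | j) - (v' | ⟨l' | j', s'⟩ | l' | j') - <;>
        simp [G, dψ', ← Subtype.coe_le_coe]
    · ext ((v | ⟨l, s⟩ | l) | ⟨y, s⟩ | y)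
      · refine ⟨?_, fun h => ⟨.base ⟨v, h⟩, trivial, rfl⟩⟩
        rintro ⟨(v | ⟨l | j, s⟩ | l | j), -, h⟩ <;> simp only [G, reduceCtorEq, Att.base.injEq] at h
        exact h ▸ v.2
      exacts [⟨fun _ => rfl, fun _ => ⟨.cyl (.inl l) s, trivial, rfl⟩⟩,
        ⟨fun _ => rfl, fun _ => ⟨.apex (.inl l), trivial, rfl⟩⟩,
        ⟨fun _ => rfl, fun _ => ⟨.cyl (.inr y) s, trivial, rfl⟩⟩,
        ⟨fun _ => rfl, fun _ => ⟨.apex (.inr y), trivial, rfl⟩⟩]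
  have hqs : ∀ w, ∃ x, q x = w := fun w => (hp w).imp' (fun v => .base (.base v)) fun _ h => h
  clear_value q
  let F : Att σ → Att fun j => faceMap e (p.comp (ψ j)) (hp0 j) := fun
    | .base x => .base (q x)
    | .cyl j κ => .cyl j κ
    | .apex j => .apex j
  have hFm : Monotone F := by
    rintro (x | ⟨j, κ⟩ | j) (x' | ⟨j', κ'⟩ | j') h
    all_goals first | exact h | skip
    · exact hq h
    · exact (hqσ j κ).le.trans (hq h)
  have hbase : ∀ T : Set (Att dψ'), Triv T → Triv {a : Att σ | ∃ x ∈ T, a = .base x} :=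
    fun T hT => (EqS.image (fun x => Att.base x) (fun _ _ _ _ => Iff.rfl)
      (by ext; simp [eq_comm])).symm.triv hT
  refine Eqv.of_collapse ⟨F, hFm⟩ ?_ (.base b) ?_ ?_ ?_ ?_
  · rintro (w | ⟨j, κ⟩ | j)
    exacts [(hqs w).imp' .base fun _ h => congrArg _ h, ⟨.cyl j κ, rfl⟩, ⟨.apex j, rfl⟩]
  · rintro (x | ⟨j, κ⟩ | j) h
    exacts [congrArg _ (hb x h), h.elim, h.elim]
  · convert hbase _ hqA using 1
    ext (x | ⟨j, κ⟩ | j) <;> simp [F]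
  · rintro (x | ⟨j, κ⟩ | j) h
    · convert hbase _ (hqF x h.le) using 1
      ext (x | ⟨j, κ⟩ | j) <;> simp [F]
    · convert hbase _ (hqF (σ j κ) ((hqσ j κ).ge.trans h.le)) using 1
      ext (x | ⟨j, κ⟩ | j) <;> simp [F]
    · exact h.le.elim
  · rintro (x | ⟨j, κ⟩ | j) (x' | ⟨j', κ'⟩ | j') h h' hl
    all_goals first | exact hl | skip
    · exact hqe _ _ (fun e => h (congrArg _ e)) (fun e => h' (congrArg _ e)) hl
    · refine hqe _ _ (fun e => ?_) (fun e => h' (congrArg _ e)) ((hqσ j κ).ge.trans hl)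
      exact h' (congrArg _ (hb _ (e.ge.trans ((hqσ j κ).ge.trans hl))))

end Step

section Coll
variable {M : Type} [PartialOrder M]

/-- The points of `M`, preordered so that the elements of `A` become equivalent. -/
def CollPre (_ : UpperSet M) : Type := M

instance (A : UpperSet M) : Preorder (CollPre A) where
  le s t := @LE.le M _ s t ∨ (@Membership.mem M _ _ A t ∧ ∃ a ∈ A, @LE.le M _ s a)
  le_refl _ := Or.inl (le_refl (α := M) _)
  le_trans s t u := by
    rintro (h | ⟨ht, a, ha, h⟩) (h' | ⟨hu, a', ha', h'⟩)
    exacts [.inl (le_trans (α := M) h h'), .inr ⟨hu, a', ha', le_trans (α := M) h h'⟩,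
      .inr ⟨A.upper h' ht, a, ha, h⟩, .inr ⟨hu, a, ha, h⟩]

/-- The poset obtained from `M` by collapsing an upper set to a point. -/
abbrev Coll (A : UpperSet M) : Type := Antisymmetrization (CollPre A) (· ≤ ·)

namespace Coll
variable {A A' : UpperSet M}

instance [Finite M] : Finite (Coll A) := Quotient.finite (α := M) _

/-- The quotient map. -/
def mk (A : UpperSet M) : M →o Coll A := ⟨toAntisymmetrization (α := CollPre A) _,
  fun _ _ h => Or.inl h⟩

theorem mk_le {s t : M} : mk A s ≤ mk A t ↔ s ≤ t ∨ (t ∈ A ∧ ∃ a ∈ A, s ≤ a) := Iff.rfl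

theorem mk_surjective : Function.Surjective (mk A) := Quotient.mk_surjective

theorem mk_le_mem {s t : M} (ht : t ∈ A) : mk A s ≤ mk A t ↔ ∃ a ∈ A, s ≤ a :=
  ⟨fun h => h.elim (fun h => ⟨t, ht, h⟩) fun h => h.2, fun h => Or.inr ⟨ht, h⟩⟩

theorem mk_le_not_mem {s t : M} (ht : t ∉ A) : mk A s ≤ mk A t ↔ s ≤ t :=
  ⟨fun h => h.elim id fun h => absurd h.1 ht, Or.inl⟩

theorem mem_of_le {s t : M} (h : mk A s ≤ mk A t) (hs : s ∈ A) : t ∈ A :=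
  h.elim (fun h => A.upper h hs) fun h => h.1

theorem mk_eq {s t : M} (hs : s ∈ A) : mk A t = mk A s ↔ t ∈ A :=
  ⟨fun h => mem_of_le h.ge hs, fun ht => le_antisymm ((mk_le_mem hs).2 ⟨t, ht, le_rfl⟩)
    ((mk_le_mem ht).2 ⟨s, hs, le_rfl⟩)⟩

theorem eq_of_le {s : M} (hs : s ∈ A) (x : Coll A) (h : mk A s ≤ x) : x = mk A s := by
  obtain ⟨t, rfl⟩ := mk_surjective x
  exact (mk_eq hs).2 (mem_of_le h hs)

/-- The map induced by an inclusion of upper sets. -/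
def map (h : ∀ x ∈ A, x ∈ A') : Coll A →o Coll A' where
  toFun := Quotient.map' (s₁ := AntisymmRel.setoid (CollPre A) _)
    (s₂ := AntisymmRel.setoid (CollPre A') _) (fun x => x) fun _ _ h' =>
    ⟨h'.1.imp_right fun h1 => ⟨h _ h1.1, h1.2.imp fun _ h2 => ⟨h _ h2.1, h2.2⟩⟩,
      h'.2.imp_right fun h1 => ⟨h _ h1.1, h1.2.imp fun _ h2 => ⟨h _ h2.1, h2.2⟩⟩⟩
  monotone' := by
    rintro ⟨s⟩ ⟨t⟩ h'
    exact Or.imp_right (fun h1 => ⟨h _ h1.1, h1.2.imp fun _ h2 => ⟨h _ h2.1, h2.2⟩⟩) h'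

theorem map_mk (h : ∀ x ∈ A, x ∈ A') (s : M) : map h (mk A s) = mk A' s := rfl

theorem map_surjective (h : ∀ x ∈ A, x ∈ A') : Function.Surjective (map h) := fun y => by
  obtain ⟨t, rfl⟩ := mk_surjective y
  exact ⟨mk A t, rfl⟩

theorem le_of_map_le (h : ∀ x ∈ A, x ∈ A') {a : M} (ha : a ∈ A') (s t : Coll A)
    (ht : map h t ≠ mk A' a) (hst : map h s ≤ map h t) : s ≤ t := by
  obtain ⟨s, rfl⟩ := mk_surjective s
  obtain ⟨t, rfl⟩ := mk_surjective t
  rw [map_mk, Ne, mk_eq ha] at ht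
  exact Or.inl ((mk_le_not_mem ht).1 hst)

end Coll
end Coll

/-- The cells of a grid on the simplicial cone of chains of `X`, times a square. -/
abbrev MM (X : Type) [PartialOrder X] : Type :=
  {κ : X ⊕ Fin 2 → Fen 2 // IsChain (· ≤ ·) {x | (κ (.inl x)).val ≠ 0}}

namespace MM
variable {X : Type} [PartialOrder X]

/-- The number of nonzero coordinates in `X`. -/
noncomputable def rank (κ : MM X) : ℕ := {x | (κ.1 (.inl x)).val ≠ 0}.ncard

instance : Zero (MM X) := ⟨⟨fun _ => ⟨0, by omega⟩, fun _ h => absurd rfl h⟩⟩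

open Classical in
/-- Replace the coordinates outside `W` by zero. -/
noncomputable def keep (W : Set (X ⊕ Fin 2)) (κ : MM X) : MM X :=
  ⟨fun i => if i ∈ W then κ.1 i else ⟨0, by omega⟩, κ.2.mono fun x hx => by
    simp only [mem_setOf_eq] at hx ⊢
    split_ifs at hx
    exacts [hx, absurd rfl hx]⟩

theorem keep_mem {W : Set (X ⊕ Fin 2)} {κ : MM X} {i} (h : i ∈ W) : (keep W κ).1 i = κ.1 i :=
  if_pos h

theorem keep_not_mem {W : Set (X ⊕ Fin 2)} {κ : MM X} {i} (h : i ∉ W) :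
    (keep W κ).1 i = ⟨0, by omega⟩ := if_neg h

theorem rank_mono [Finite X] {κ κ' : MM X}
    (h : ∀ x, (κ.1 (.inl x)).val = 0 → (κ'.1 (.inl x)).val = 0) : rank κ' ≤ rank κ :=
  ncard_le_ncard (fun x hx h' => hx (h x h')) (toFinite _)

theorem zero_of_le {κ κ' : MM X} (h : κ ≤ κ') {i} (hi : (κ.1 i).val = 0) : (κ'.1 i).val = 0 := by
  have := h i
  rw [Fen.le_def] at this
  omega

variable [Finite X]

/-- The union of the boundary of the grid and its `k`-skeleton. -/
def skel (X : Type) [PartialOrder X] [Finite X] (k : ℕ) : UpperSet (MM X) where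
  carrier := {κ | (∃ i, (κ.1 i).val = 4) ∨ (∃ j, (κ.1 (.inr j)).val = 0) ∨ rank κ < k}
  upper' := by
    rintro κ κ' h (⟨i, hi⟩ | ⟨j, hj⟩ | hk)
    · refine .inl ⟨i, ?_⟩
      have := h i
      rw [Fen.le_def] at this
      omega
    · exact .inr (.inl ⟨j, zero_of_le h hj⟩)
    · exact .inr (.inr ((rank_mono fun x => zero_of_le h).trans_lt hk))

theorem mem_skel {k : ℕ} {κ : MM X} : κ ∈ skel X k ↔
  (∃ i, (κ.1 i).val = 4) ∨ (∃ j, (κ.1 (.inr j)).val = 0) ∨ rank κ < k := Iff.rfl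

theorem zero_mem {k : ℕ} : (0 : MM X) ∈ skel X k := .inr (.inl ⟨0, rfl⟩)

theorem skel_succ {k : ℕ} (κ : MM X) (h : κ ∈ skel X k) : κ ∈ skel X (k + 1) :=
  h.imp_right fun h => h.imp_right fun h => h.trans (Nat.lt_succ_self k)

/-- The upper links of the skeleton in the quotient are trivial. -/
theorem triv_link {k : ℕ} (s : Coll (skel X k))
    (hs : Coll.map skel_succ s < Coll.mk (skel X (k + 1)) 0) :
    Triv {a | Coll.map skel_succ a = Coll.mk (skel X (k + 1)) 0 ∧ s ≤ a} := by
  classical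
  obtain ⟨s, rfl⟩ := Coll.mk_surjective s
  have hsn : s ∉ skel X (k + 1) := fun h => hs.ne ((Coll.mk_eq zero_mem).2 h)
  obtain ⟨t₀, ht₀, hst₀⟩ := (Coll.mk_le_mem zero_mem).1 hs.le
  have hs4 : ∀ i, (s.1 i).val ≠ 4 := fun i h => hsn (.inl ⟨i, h⟩)
  have hs0 : ∀ j, (s.1 (.inr j)).val ≠ 0 := fun j h => hsn (.inr (.inl ⟨j, h⟩))
  let W : MM X → Set (X ⊕ Fin 2) := fun t => {i | (t.1 i).val ≠ 0}
  have hW : ∀ t a : MM X, s ≤ t → s ≤ a → keep (W t) s ≤ keep (W t) a := fun t a _ ha i => by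
    by_cases hi : i ∈ W t
    · rw [keep_mem hi, keep_mem hi]; exact ha i
    · rw [keep_not_mem hi, keep_not_mem hi]
  have k1 : ∀ t, s ≤ t → keep (W t) s ≤ t := fun t ht i => by
    by_cases hi : i ∈ W t
    · rw [keep_mem hi]; exact ht i
    · rw [keep_not_mem hi]; exact Or.inl (not_not.1 hi).symm
  have k2 : ∀ t u, s ≤ t → t ≤ u → keep (W t) s ≤ keep (W u) s := fun t u ht hu i => by
    by_cases hi : i ∈ W u
    · rw [keep_mem hi, keep_mem (show i ∈ W t from fun h => hi (zero_of_le hu h))]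
    · have h1 := (ht.trans hu) i
      have hi' : (u.1 i).val = 0 := not_not.1 hi
      rw [keep_not_mem hi]
      by_cases hi' : i ∈ W t
      · rw [keep_mem hi']; rw [Fen.le_def] at h1 ⊢; simp only; omega
      · rw [keep_not_mem hi']
  have k3 : ∀ t, s ≤ t → s ≤ keep (W t) s := fun t ht i => by
    by_cases hi : i ∈ W t
    · rw [keep_mem hi]
    · have h1 := ht i
      have hi' : (t.1 i).val = 0 := not_not.1 hi
      rw [keep_not_mem hi]; rw [Fen.le_def] at h1 ⊢; simp only; omega
  have k4 : ∀ t ∈ skel X (k + 1), t ∉ skel X k → rank t = k := by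
    rintro t (h | h | h) h'
    exacts [absurd (.inl h) h', absurd (.inr (.inl h)) h',
      le_antisymm (Nat.lt_succ_iff.1 h) (not_lt.1 fun h => h' (.inr (.inr h)))]
  have k5 : ∀ t u : MM X, rank (keep (W t) u) ≤ rank t := fun t u => rank_mono fun x hx => by
    rw [keep_not_mem (not_not.2 hx)]
  let r : Coll (skel X k) → MM X := Function.surjInv Coll.mk_surjective
  have hr : ∀ x, Coll.mk (skel X k) (r x) = x := Function.surjInv_eq _
  let f : Coll (skel X k) → Coll (skel X k) := fun x =>
    if r x ∈ skel X k then x else Coll.mk _ (keep (W (r x)) s)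
  have hS : ∀ x, Coll.map skel_succ x = Coll.mk (skel X (k + 1)) 0 ∧ Coll.mk _ s ≤ x →
      r x ∈ skel X (k + 1) ∧ (r x ∉ skel X k → s ≤ r x) := fun x hx => by
    rw [← hr x, Coll.map_mk, Coll.mk_eq zero_mem] at hx
    exact ⟨hx.1, fun h => (Coll.mk_le_not_mem h).1 hx.2⟩
  have hmem : ∀ t ∈ skel X (k + 1), t ∉ skel X k → s ≤ t →
      Coll.map skel_succ (Coll.mk (skel X k) (keep (W t) s)) = Coll.mk (skel X (k + 1)) 0 ∧
      Coll.mk _ s ≤ Coll.mk (skel X k) (keep (W t) s) := fun t h h' hst =>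
    ⟨(Coll.mk_eq zero_mem).2 (.inr (.inr ((k5 t s).trans_lt (by rw [k4 t h h']; omega)))),
      Or.inl (k3 t hst)⟩
  have hfm : ∀ x, Coll.map skel_succ x = Coll.mk (skel X (k + 1)) 0 ∧ Coll.mk _ s ≤ x →
      f x ≤ x := fun x hx => by
    by_cases h : r x ∈ skel X k
    · simp only [f, if_pos h, le_refl]
    · simp only [f, if_neg h]
      conv_rhs => rw [← hr x]
      exact Or.inl (k1 _ ((hS x hx).2 h))
  have hcone : ∃ c ∈ {a | Coll.map skel_succ a = Coll.mk (skel X (k + 1)) 0 ∧ Coll.mk _ s ≤ a},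
      ∀ x ∈ {a | Coll.map skel_succ a = Coll.mk (skel X (k + 1)) 0 ∧ Coll.mk _ s ≤ a},
        f x ≤ c := by
    by_cases hc : ∃ a ∈ skel X k, s ≤ a
    · refine ⟨Coll.mk _ 0, ⟨rfl, (Coll.mk_le_mem zero_mem).2 hc⟩, fun x hx => ?_⟩
      by_cases h : r x ∈ skel X k
      · rw [← (Coll.mk_eq zero_mem).2 h, hr]; exact hfm x hx
      simp only [f, if_neg h]
      obtain ⟨a, ha, hsa⟩ := hc
      have hsx := (hS x hx).2 h
      refine (Coll.mk_le_mem zero_mem).2 ⟨keep (W (r x)) a, ?_, hW _ a hsx hsa⟩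
      rcases ha with ⟨i, hi⟩ | ⟨j, hj⟩ | ha
      · refine .inl ⟨i, ?_⟩
        rw [keep_mem, hi]
        have h1 := hsx i
        have h2 := hsa i
        rw [Fen.le_def] at h1 h2
        have := hs4 i
        change (_ : ℕ) ≠ 0
        omega
      · refine .inr (.inl ⟨j, ?_⟩)
        rw [keep_mem, hj]
        exact fun h' => h (.inr (.inl ⟨j, h'⟩))
      · refine .inr (.inr ((rank_mono fun y hy => ?_).trans_lt ha))
        by_cases hi : .inl y ∈ W (r x)
        · rw [keep_mem hi, hy]
        · rw [keep_not_mem hi]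
    · push Not at hc
      let U : Set (X ⊕ Fin 2) := {i | ∀ x, i = .inl x → 2 ≤ (s.1 i).val}
      let u : MM X := keep U s
      have hsu : s ≤ u := fun i => by
        by_cases hi : i ∈ U
        · simp only [u]; rw [keep_mem hi]
        · simp only [u]; rw [keep_not_mem hi]; simp only [U, mem_setOf_eq] at hi; push Not at hi; rw [Fen.le_def]; simp only; omega
      have hu : k ≤ rank u := not_lt.1 fun h => hc u (.inr (.inr h)) hsu
      have key : ∀ t ∈ skel X (k + 1), s ≤ t → keep (W t) s = u := fun t ht hst => by
        have htn : t ∉ skel X k := fun h => hc t h hst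
        have hsub : {x | (u.1 (.inl x)).val ≠ 0} = {x | (t.1 (.inl x)).val ≠ 0} := by
          refine eq_of_subset_of_ncard_le (fun x hx => ?_) ((k4 t ht htn).le.trans hu) (toFinite _)
          have h1 := hst (.inl x)
          simp only [mem_setOf_eq] at hx ⊢
          by_cases hi : .inl x ∈ U
          · have := hi x rfl
            rw [Fen.le_def] at h1; omega
          · simp only [u] at hx; rw [keep_not_mem hi] at hx; exact absurd rfl hx
        refine Subtype.ext (funext ?_)
        rintro (x | j)
        · have hx := Set.ext_iff.1 hsub x
          simp only [mem_setOf_eq] at hx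
          by_cases hi : .inl x ∈ W t
          · rw [keep_mem hi]
            by_cases hi' : .inl x ∈ U
            · exact (keep_mem hi').symm
            · exact absurd (congrArg Fen.val (keep_not_mem hi')) (hx.2 hi)
          · rw [keep_not_mem hi]
            exact Fen.ext (not_not.1 (mt hx.1 hi)).symm
        · rw [keep_mem (show .inr j ∈ W t from fun h => htn (.inr (.inl ⟨j, h⟩)))]
          exact (keep_mem (show .inr j ∈ U from fun _ h => nomatch h)).symm
      refine ⟨_, hmem t₀ ht₀ (fun h => hc _ h hst₀) hst₀, fun x hx => ?_⟩
      have h : r x ∉ skel X k := fun h => by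
        have hx := hx.2
        rw [← hr x, Coll.mk_le_mem h] at hx
        obtain ⟨a, ha, h'⟩ := hx
        exact hc a ha h'
      simp only [f, if_neg h]
      rw [key _ (hS x hx).1 ((hS x hx).2 h), key t₀ ht₀ hst₀]
  obtain ⟨c, hc, hfc⟩ := hcone
  refine Triv.of_cone f (fun x hx y hy hxy => ?_) (fun x hx => ?_) c hc (.inl hfm) (.inl hfc)
  · by_cases h : r y ∈ skel X k
    · exact (hfm x hx).trans (hxy.trans_eq (if_pos h).symm)
    · rw [← hr x, ← hr y, Coll.mk_le_not_mem h] at hxy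
      have h' : r x ∉ skel X k := fun h' => h ((skel X k).upper hxy h')
      simp only [f, if_neg h, if_neg h']
      exact Or.inl (k2 _ _ ((hS x hx).2 h') hxy)
  · by_cases h : r x ∈ skel X k
    · simp only [f, if_pos h]; exact hx
    · simp only [f, if_neg h]; exact hmem _ (hS x hx).1 h ((hS x hx).2 h)

end MM

/-- The proper cells lying over a non-maximal interior cell. -/
theorem Sph.triv_link {ι : Type} [Finite ι] {r : ι → Fen 2} (hr : r ∉ Sph ι 2)
    (h : ∃ i, (r i).val % 2 = 1) : Triv {p | p ∈ Sph ι 2 ∧ r ≤ p} := by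
  classical
  have hr' : ∀ i, (r i).val ≠ 0 ∧ (r i).val ≠ 4 := fun i =>
    ⟨fun h => hr ⟨i, .inl h⟩, fun h => hr ⟨i, .inr h⟩⟩
  have hb : ∀ i, (r i).val ≤ 4 := fun i => (r i).2
  let x : (ι → Fen 2) → ι → Prop := fun p i => (p i).val = 0 ∨ (p i).val = 4
  let c : ι → Fen 2 := fun i => if (r i).val = 1 then ⟨0, by omega⟩ else
    if (r i).val = 3 then ⟨4, by omega⟩ else r i
  have hrc : ∀ i, r i ≤ c i := fun i => by
    rw [Fen.le_def]; simp only [c]; split_ifs with h1 h2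
    exacts [.inr ⟨by omega, .inr h1.symm⟩, .inr ⟨by omega, .inl (by simp only; omega)⟩, .inl rfl]
  refine Triv.of_cone (fun p i => if x p i then p i else r i) ?_ ?_ c
    ⟨?_, hrc⟩ (.inl ?_) (.inl ?_)
  · intro p hp q hq hpq i
    have h1 := hpq i
    have h2 := hq.2 i
    by_cases hx : x p i
    · have : p i = q i := Fen.ext (by rw [Fen.le_def] at h1; simp only [x] at hx; omega)
      simp only [x, this, le_refl]
    · simp only [if_neg hx]; split_ifs; exacts [h2, le_rfl]
  · rintro p ⟨⟨i, hi⟩, hp⟩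
    refine ⟨⟨i, by simpa only [if_pos (show x p i from hi)] using hi⟩, fun j => ?_⟩
    dsimp only; split_ifs; exacts [hp j, le_rfl]
  · obtain ⟨i, hi⟩ := h
    have := (r i).2
    refine ⟨i, ?_⟩
    rcases (by omega : (r i).val = 1 ∨ (r i).val = 3) with h | h
    · left; simp [c, h]
    · right; simp [c, h]
  · rintro p ⟨-, hp⟩ i
    dsimp only; split_ifs; exacts [le_rfl, hp i]
  · rintro p ⟨-, hp⟩ i
    have h1 := hp i
    have h2 := hr' i
    dsimp only
    by_cases hx : x p i
    · simp only [if_pos hx, c]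
      rw [Fen.le_def] at h1
      refine le_of_eq (Fen.ext ?_)
      simp only [x] at hx
      have h3 := hb i
      split_ifs <;> (try simp only) <;> omega
    · rw [if_neg hx]; exact hrc i

namespace MM
variable {X : Type} [PartialOrder X] {k : ℕ}

/-- The cell of the grid spanned by a chain. -/
noncomputable def fill (l : Fin k ↪o X) (v : Fin 2 ⊕ Fin k → Fen 2) : MM X :=
  ⟨Sum.elim (Function.extend l (fun i => v (.inr i)) fun _ => ⟨0, by omega⟩) fun j => v (.inl j), by
    have : ∀ x, (Function.extend l (fun i => v (.inr i)) (fun _ => ⟨0, by omega⟩) x : Fen 2).val ≠ 0 →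
        ∃ i, l i = x := fun x hx => by
      by_contra h
      exact hx (by rw [Function.extend_apply' _ _ _ h])
    intro x hx y hy _
    obtain ⟨i, rfl⟩ := this x hx
    obtain ⟨j, rfl⟩ := this y hy
    exact (le_total i j).imp l.monotone.imp l.monotone.imp⟩

theorem fill_inl (l : Fin k ↪o X) (v : Fin 2 ⊕ Fin k → Fen 2) (i : Fin k) :
    (fill l v).1 (.inl (l i)) = v (.inr i) := by
  simp only [fill, Sum.elim_inl]; exact l.injective.extend_apply _ _ _

theorem fill_inr (l : Fin k ↪o X) (v : Fin 2 ⊕ Fin k → Fen 2) (j : Fin 2) :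
    (fill l v).1 (.inr j) = v (.inl j) := rfl

theorem fill_not_mem (l : Fin k ↪o X) (v : Fin 2 ⊕ Fin k → Fen 2) {x : X} (hx : ¬ ∃ i, l i = x) :
    (fill l v).1 (.inl x) = ⟨0, by omega⟩ := by
  simp only [fill, Sum.elim_inl]; exact Function.extend_apply' _ _ _ hx

theorem fill_le_fill {l : Fin k ↪o X} {v w : Fin 2 ⊕ Fin k → Fen 2} :
    fill l v ≤ fill l w ↔ v ≤ w := by
  constructor
  · rintro h (j | i)
    · exact h (.inr j)
    · simpa only [fill_inl] using h (.inl (l i))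
  · rintro h (x | j)
    · by_cases hx : ∃ i, l i = x
      · obtain ⟨i, rfl⟩ := hx
        rw [fill_inl, fill_inl]; exact h _
      · rw [fill_not_mem l v hx, fill_not_mem l w hx]
    · exact h (.inl j)

theorem support_fill (l : Fin k ↪o X) (v : Fin 2 ⊕ Fin k → Fen 2) :
    {x | ((fill l v).1 (.inl x)).val ≠ 0} = l '' {i | (v (.inr i)).val ≠ 0} := by
  ext x
  by_cases hx : ∃ i, l i = x
  · obtain ⟨i, rfl⟩ := hx
    simp [fill_inl]
  · simp only [mem_setOf_eq, fill_not_mem l v hx, ne_eq, not_true_eq_false, false_iff]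
    exact fun ⟨i, _, h⟩ => hx ⟨i, h⟩

theorem rank_fill (l : Fin k ↪o X) (v : Fin 2 ⊕ Fin k → Fen 2) :
    rank (fill l v) = {i | (v (.inr i)).val ≠ 0}.ncard := by
  rw [rank, support_fill, ncard_image_of_injective _ l.injective]

theorem rank_fill_le (l : Fin k ↪o X) (v : Fin 2 ⊕ Fin k → Fen 2) : rank (fill l v) ≤ k := by
  rw [rank_fill]
  exact (ncard_le_ncard (subset_univ _)).trans (by rw [ncard_univ, Nat.card_fin])

variable [Finite X]

theorem fill_mem (l : Fin k ↪o X) (v : Fin 2 ⊕ Fin k → Fen 2) :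
    fill l v ∈ skel X k ↔ v ∈ Sph _ 2 := by
  constructor
  · rintro (⟨x | j, h⟩ | ⟨j, h⟩ | h)
    · by_cases hx : ∃ i, l i = x
      · obtain ⟨i, rfl⟩ := hx
        exact ⟨.inr i, .inr (by rw [← fill_inl l v]; exact h)⟩
      · rw [fill_not_mem l v hx] at h; simp at h
    · exact ⟨.inl j, .inr h⟩
    · exact ⟨.inl j, .inl h⟩
    · rw [rank_fill] at h
      by_contra h'
      refine h.ne ((congrArg ncard (eq_univ_of_forall fun i => ?_)).trans
        ((ncard_univ _).trans (Nat.card_fin k)))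
      exact fun hi => h' ⟨.inr i, .inl hi⟩
  · rintro ⟨j | i, h | h⟩
    · exact .inr (.inl ⟨j, h⟩)
    · exact .inl ⟨.inr j, h⟩
    · refine .inr (.inr ?_)
      rw [rank_fill]
      have := ncard_lt_ncard (s := {i | (v (.inr i)).val ≠ 0}) (t := univ)
        ⟨subset_univ _, fun h' => h' (mem_univ i) h⟩
      rwa [ncard_univ, Nat.card_fin] at this
    · exact .inl ⟨.inl (l i), by rw [fill_inl]; exact h⟩

theorem exists_fill {t : MM X} (ht : rank t = k) : ∃ (l : Fin k ↪o X) (v : _), fill l v = t := by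
  classical
  let s := {x | (t.1 (.inl x)).val ≠ 0}
  letI : LinearOrder s := { (inferInstance : PartialOrder s) with
    le_total := fun a b => t.2.total a.2 b.2
    toDecidableLE := Classical.decRel _ }
  letI := Fintype.ofFinite s
  let o := Fintype.orderIsoFinOfCardEq s ((Nat.card_eq_fintype_card (α := s)).symm.trans ht)
  let l : Fin k ↪o X := o.toOrderEmbedding.trans (OrderEmbedding.subtype _)
  refine ⟨l, Sum.elim (fun j => t.1 (.inr j)) fun i => t.1 (.inl (l i)), Subtype.ext (funext ?_)⟩
  rintro (x | j)
  · by_cases hx : ∃ i, l i = x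
    · obtain ⟨i, rfl⟩ := hx
      exact fill_inl _ _ i
    · rw [fill_not_mem _ _ hx]
      refine Fen.ext (Eq.symm (not_not.1 fun h => hx ⟨o.symm ⟨x, h⟩, ?_⟩))
      exact congrArg Subtype.val (o.apply_symm_apply ⟨x, h⟩)
  · rfl

theorem fill_unique {l l' : Fin k ↪o X} {v v' : Fin 2 ⊕ Fin k → Fen 2}
    (h : fill l' v' ∉ skel X k) (hle : fill l v ≤ fill l' v') : l = l' ∧ v ≤ v' := by
  have h1 : ∀ i, (v' (.inr i)).val ≠ 0 := fun i hi => h ((fill_mem _ _).2 ⟨.inr i, .inl hi⟩)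
  have h2 : ∀ i, (v (.inr i)).val ≠ 0 := fun i hi =>
    h ((skel X k).upper hle ((fill_mem _ _).2 ⟨.inr i, .inl hi⟩))
  have hs : ∀ x, x ∈ range l' → x ∈ range l := by
    rintro _ ⟨i, rfl⟩
    by_contra hx
    have := hle (.inl (l' i))
    rw [fill_inl, fill_not_mem _ _ hx, Fen.le_def] at this
    have := h1 i
    simp only at *
    omega
  have hl : l' = l := by
    refine DFunLike.coe_injective ((l'.strictMono.range_inj l.strictMono).1
      (eq_of_subset_of_ncard_le hs ?_ (toFinite _)))
    rw [← image_univ, ← image_univ, ncard_image_of_injective _ l.injective,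
      ncard_image_of_injective _ l'.injective]
  subst hl
  exact ⟨rfl, fill_le_fill.1 hle⟩

/-- The image of the next skeleton in the quotient by the skeleton. -/
abbrev Bd (X : Type) [PartialOrder X] [Finite X] (k : ℕ) : Type :=
  {v : Coll (skel X k) // Coll.map skel_succ v = Coll.mk (skel X (k + 1)) 0}

/-- The collapsed skeleton. -/
def bd0 (X : Type) [PartialOrder X] [Finite X] (k : ℕ) : Bd X k := ⟨Coll.mk _ 0, rfl⟩

/-- The characteristic map of a cell. -/
noncomputable def cellB (l : Fin k ↪o X) : (Fin 2 ⊕ Fin k → Fen 2) →o Bd X k where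
  toFun v := ⟨Coll.mk _ (fill l v), (Coll.mk_eq zero_mem).2
    (.inr (.inr (Nat.lt_succ_of_le (rank_fill_le l v))))⟩
  monotone' _ _ h := Or.inl (fill_le_fill.2 h)

theorem cellB_eq (l : Fin k ↪o X) (v : Fin 2 ⊕ Fin k → Fen 2) :
    cellB l v = bd0 X k ↔ v ∈ Sph _ 2 := by
  rw [← fill_mem l, ← Coll.mk_eq (zero_mem (X := X)), Subtype.ext_iff]; rfl

theorem le_bd0 {x : Bd X k} (h : bd0 X k ≤ x) : x = bd0 X k :=
  Subtype.ext (Coll.eq_of_le zero_mem _ h)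

theorem exists_cellB (x : Bd X k) (hx : x ≠ bd0 X k) : ∃ l v, v ∉ Sph _ 2 ∧ cellB l v = x := by
  obtain ⟨x, hx'⟩ := x
  obtain ⟨t, rfl⟩ := Coll.mk_surjective x
  have ht : t ∉ skel X k := fun h => hx (Subtype.ext ((Coll.mk_eq zero_mem).2 h))
  obtain ⟨l, v, rfl⟩ : ∃ (l : Fin k ↪o X) (v : _), fill l v = t := by
    refine exists_fill ?_
    rcases (Coll.mk_eq zero_mem).1 hx' with h | h | h
    exacts [absurd (.inl h) ht, absurd (.inr (.inl h)) ht,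
      le_antisymm (Nat.lt_succ_iff.1 h) (not_lt.1 fun h => ht (.inr (.inr h)))]
  exact ⟨l, v, fun h => ht ((fill_mem _ _).2 h), rfl⟩

theorem cellB_le {l l' : Fin k ↪o X} {v v' : Fin 2 ⊕ Fin k → Fen 2} (h : v' ∉ Sph _ 2)
    (hle : cellB l v ≤ cellB l' v') : l = l' ∧ v ≤ v' :=
  have h := mt (fill_mem l' v').1 h
  fill_unique h ((Coll.mk_le_not_mem h).1 hle)

end MM

section Cells
variable {ι ι' Λ V : Type} [Finite ι] [Finite ι'] [Finite Λ] [PartialOrder V] [Finite V]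

/-- The cell of the face `e none = 0` with the given remaining coordinates. -/
def Sph.zcons (e : Option ι ≃ ι') (r : ι → Fen 2) : Sph ι' 2 :=
  ⟨fun i => (e.symm i).elim ⟨0, by omega⟩ r, e none, .inl (by simp)⟩

omit [Finite ι] [Finite ι'] in
theorem Sph.le_zcons {e : Option ι ≃ ι'} {s : Sph ι' 2} {r : ι → Fen 2}
    (h : (s.1 (e none)).val = 0) : s ≤ Sph.zcons e r ↔ (fun i => s.1 (e (some i))) ≤ r := by
  constructor
  · intro h' i
    simpa [Sph.zcons] using h' (e (some i))
  · intro h' i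
    obtain ⟨_ | i, rfl⟩ := e.surjective i
    · rw [Fen.le_def]; simp [Sph.zcons, h]
    · simpa [Sph.zcons] using h' i

omit [Finite ι] in
theorem Sph.triv_corner (e : Option ι ≃ ι') : Triv {s : Sph ι' 2 | (s.1 (e none)).val ≠ 0 ∨
    (fun i => s.1 (e (some i))) ∈ Sph ι 2} := by
  classical
  convert Sph.triv (T := {s : ι' → Fen 2 | s ∈ Sph ι' 2 ∧ ((s (e none)).val ≠ 0 ∨
    (fun i => s (e (some i))) ∈ Sph ι 2)}) (fun _ h => h.1) ?_ using 1
  · ext κ; exact ⟨fun h => ⟨κ.2, h⟩, fun h => h.2⟩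
  refine Slides.triv (((Slides.id _).raise {e none} (2 * 2) ?_).raise univ (2 * 2) ?_)
    (c := fun _ => ⟨2 * 2, le_rfl⟩) ⟨⟨e none, .inr rfl⟩, .inl (by simp)⟩ fun a _ => ?_
  · rintro j hj s ⟨hs, h⟩
    have h1 : ∀ i, raise {e none} j s (e (some i)) = s (e (some i)) := fun i =>
      if_neg (by simp)
    have h2 : (raise {e none} j s (e none)).val = max (s (e none)).val j := by
      rw [raise_val hj, if_pos (mem_singleton _)]
    simp only [_root_.id]
    have h3 : (s (e none)).val = 2 * 2 ∨ (fun i => s (e (some i))) ∈ Sph ι 2 := by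
      refine h.elim (fun h => ?_) .inr
      obtain ⟨i, hi⟩ := hs
      obtain ⟨_ | i, rfl⟩ := e.surjective i
      exacts [.inl (hi.resolve_left h), .inr ⟨i, hi⟩]
    rcases h3 with h3 | h3
    · have h4 : (raise {e none} j s (e none)).val = 2 * 2 := by omega
      exact ⟨⟨e none, .inr h4⟩, .inl (by omega)⟩
    · refine ⟨?_, .inr (by simpa only [h1] using h3)⟩
      obtain ⟨i, hi⟩ := h3
      exact ⟨e (some i), by rwa [h1]⟩
  · rintro j hj s -
    have h1 := (s (e none)).2
    have : (raise univ j (raise {e none} (2 * 2) s) (e none)).val = 2 * 2 := by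
      simp [raise_val hj, raise_val le_rfl]; omega
    exact ⟨⟨e none, .inr this⟩, .inl (by simp only [Function.comp, _root_.id, this]; omega)⟩
  · funext i; ext
    have := (a i).2
    simp [raise_val le_rfl]
    split_ifs <;> omega

/-- Attaching cones along all cells of a bouquet of spheres gives a trivial space. -/
theorem Att.cells (e : Option ι ≃ ι') {b : V} (hb : ∀ x, b ≤ x → x = b)
    (h : Λ → (ι → Fen 2) →o V) (hS : ∀ l s, h l s = b ↔ s ∈ Sph ι 2)
    (h1 : ∀ x, x ≠ b → ∃ l v, v ∉ Sph ι 2 ∧ h l v = x)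
    (h2 : ∀ l l' v v', v' ∉ Sph ι 2 → h l v ≤ h l' v' → l = l' ∧ v ≤ v')
    (h3 : ∀ l v, h l v ≤ b → ∃ p ∈ Sph ι 2, v ≤ p) :
    Eqv ⟨Att fun l => faceMap e (h l) fun s => (hS l s).2⟩ ⟨PUnit⟩ := by
  generalize hψ : (fun l => faceMap e (h l) fun s => (hS l s).2) = ψ
  have p0 : ∀ l (s : Sph ι' 2), (s.1 (e none)).val = 0 → ψ l s = h l fun i => s.1 (e (some i)) :=
    fun l s hs => by rw [← hψ]; exact if_pos hs
  have p1 : ∀ l (s : Sph ι' 2), (s.1 (e none)).val ≠ 0 → ψ l s = b :=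
    fun l s hs => by rw [← hψ]; exact if_neg hs
  have z0 : ∀ s s' : Sph ι' 2, s ≤ s' → (s.1 (e none)).val = 0 → (s'.1 (e none)).val = 0 :=
    fun s s' hs h0 => by have := hs (e none); rw [Fen.le_def] at this; omega
  have zz : ∀ r : ι → Fen 2, ((Sph.zcons e r).1 (e none)).val = 0 := fun r => by simp [Sph.zcons]
  have zr : ∀ r : ι → Fen 2, (fun i => (Sph.zcons e r).1 (e (some i))) = r := fun r => by
    simp [Sph.zcons]
  let D1 : Set (Att ψ) := {x | ∃ v, v ≠ b ∧ x = base v}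
  let D2 : Set (Att ψ) := {x | ∃ l s, ((s.1 (e none)).val = 0 ∧
    (fun i => s.1 (e (some i))) ∉ Sph ι 2) ∧ x = cyl l s}
  let D3 : Set (Att ψ) := {x | ∃ l, x = apex l}
  have s1 := EqS.removeLower (A := (univ : Set (Att ψ))) D1 (subset_univ _) ?_
  have s2 := EqS.removeUpper (A := (univ \ D1 : Set (Att ψ))) D2 ?_ ?_
  have s3 := EqS.removeLower (A := ((univ \ D1) \ D2 : Set (Att ψ))) D3 ?_ ?_
  refine (Eqv.ofUniv.trans ((s1.trans s2).trans s3)).trans (Triv.top (m := base b) ?_ ?_)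
  · simp [D1, D2, D3]
  · rintro (v | ⟨l, s⟩ | l) ⟨⟨⟨-, ha⟩, ha2⟩, ha3⟩
    · refine le_of_eq (congrArg _ (not_not.1 fun hv => ha ⟨v, hv, rfl⟩))
    · rw [cyl_le_base]
      by_cases hs : (s.1 (e none)).val = 0
      · rw [p0 l s hs, (hS l _).2 (not_not.1 fun hr => ha2 ⟨l, s, ⟨hs, hr⟩, rfl⟩)]
      · rw [p1 l s hs]
    · exact absurd ⟨l, rfl⟩ ha3
  · rintro _ ⟨l, rfl⟩; simp [D1, D2]
  · rintro _ ⟨l, rfl⟩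
    convert Att.cyl_triv (ψ := ψ) l (Sph.triv_corner e) using 1
    ext (v | ⟨l', s'⟩ | l')
    · simp [lt_iff]
    · constructor
      · rintro ⟨⟨-, ha⟩, -, ha'⟩
        obtain rfl := cyl_le_apex.1 ha'.le
        refine ⟨s', ?_, rfl⟩
        by_contra hc
        simp only [mem_setOf_eq, not_or, not_not] at hc
        exact ha ⟨l', s', hc, rfl⟩
      · rintro ⟨_, ha, he⟩
        cases he
        refine ⟨⟨by simp [D1], ?_⟩, by simp [D3], by simp [lt_iff]⟩
        rintro ⟨_, _, hc, he⟩; cases he; exact ha.elim (fun h => h hc.1) hc.2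
    · simp [lt_iff, D3]
  · rintro _ ⟨l, s, -, rfl⟩; simp [D1]
  · rintro _ ⟨l, s, ⟨hs, hr⟩, rfl⟩
    have k0 : apex l ∈ {y | y ∈ univ \ D1 ∧ y ∉ D2 ∧ cyl l s < y} := by simp [D1, D2, lt_iff]
    by_cases hp : h l (fun i => s.1 (e (some i))) ≤ b
    · refine Triv.two_tops k0 (t' := base b) (by simpa [D1, D2, lt_iff, p0 l s hs, hp] using fun x hx => Ne.symm hx) (by simp)
        ?_ ?_
      · convert Att.cyl_triv (ψ := ψ) l (T := {s' | s ≤ s' ∧ (fun i => s'.1 (e (some i))) ∈ Sph ι 2})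
          ?_ using 1
        · ext (v | ⟨l', s'⟩ | l')
          · simp [lt_iff]
          · constructor
            · rintro ⟨⟨-, ha, ha'⟩, -⟩
              obtain ⟨rfl, hle⟩ := cyl_le_cyl.1 ha'.le
              exact ⟨s', ⟨hle, not_not.1 fun h' => ha ⟨l, s', ⟨z0 _ _ hle hs, h'⟩, rfl⟩⟩, rfl⟩
            · rintro ⟨_, ⟨ha, ha'⟩, he⟩
              cases he
              refine ⟨⟨by simp [D1], ?_, ?_⟩, by simp [lt_iff]⟩
              · rintro ⟨_, _, hc, he⟩; cases he; exact hc.2 ha'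
              · rw [lt_iff]; refine ⟨⟨rfl, ha⟩, fun he => ?_⟩; cases he; exact hr ha'
          · simp [lt_iff]
        · obtain ⟨p, hp, hrp⟩ := h3 _ _ hp
          refine EqS.triv (EqS.symm (EqS.image (Sph.zcons e) (fun r _ r' _ => ?_) ?_))
            (Sph.triv_link hr ?_)
          · rw [Sph.le_zcons (zz r), zr]
          · ext s'
            constructor
            · rintro ⟨r, ⟨hr1, hr2⟩, rfl⟩
              exact ⟨(Sph.le_zcons hs).2 hr2, by rwa [zr]⟩
            · rintro ⟨ha, ha'⟩
              have hs' := z0 _ _ ha hs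
              refine ⟨_, ⟨ha', fun i => ha _⟩, le_antisymm ?_ ((Sph.le_zcons hs').2 le_rfl)⟩
              intro i
              obtain ⟨_ | i, rfl⟩ := e.surjective i
              · rw [Fen.le_def, zz, hs']; exact .inl rfl
              · simp [Sph.zcons]
          · by_contra! hc
            have h6 : (fun i => s.1 (e (some i))) = p := funext fun i => Fen.ext ?_
            · rw [h6] at hr; exact hr hp
            have h4 : s.1 (e (some i)) ≤ p i := hrp i
            have h5 : (s.1 (e (some i))).val % 2 ≠ 1 := hc i
            rw [Fen.le_def] at h4
            omega
      · rintro (v | ⟨l', s'⟩ | l') ⟨⟨-, ha⟩, ha2, ha'⟩ hne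
        · exact le_of_eq (congrArg _ (not_not.1 fun hv => ha ⟨v, hv, rfl⟩))
        · obtain ⟨rfl, hle⟩ := cyl_le_cyl.1 ha'.le
          have hs' := z0 _ _ hle hs
          rw [cyl_le_base, p0 _ _ hs', (hS l _).2 (not_not.1 fun hr => ha2 ⟨l, s', ⟨hs', hr⟩, rfl⟩)]
        · exact absurd (congrArg _ (cyl_le_apex.1 ha'.le).symm) hne
    · refine Triv.top k0 ?_
      rintro (v | ⟨l', s'⟩ | l') ⟨⟨-, ha⟩, ha2, ha'⟩
      · obtain rfl : v = b := not_not.1 fun hv => ha ⟨v, hv, rfl⟩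
        have := ha'.le
        rw [cyl_le_base, p0 _ _ hs] at this
        exact absurd this hp
      · exact (cyl_le_cyl.1 ha'.le).1.symm
      · exact (cyl_le_apex.1 ha'.le).symm
  · rintro _ ⟨v, hv, rfl⟩
    obtain ⟨l, v, hvS, rfl⟩ := h1 v hv
    refine Triv.top (m := cyl l (Sph.zcons e v)) ⟨mem_univ _, by simp [D1], ?_⟩ ?_
    · rw [lt_iff, cyl_le_base, p0 _ _ (zz v), zr]; simp
    · rintro (x | ⟨l', s⟩ | l') ⟨-, ha, ha'⟩
      · rw [lt_iff, base_le_base] at ha'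
        have hx : x = b := not_not.1 fun hv => ha ⟨x, hv, rfl⟩
        exact absurd (hb _ (hx ▸ ha'.1)) hv
      · have ha' := ha'.le
        rw [cyl_le_base] at ha'
        have hs : (s.1 (e none)).val = 0 := by
          by_contra hs; rw [p1 l' s hs] at ha'; exact hv (hb _ ha')
        rw [p0 l' s hs] at ha'
        obtain ⟨rfl, h'⟩ := h2 _ _ _ _ hvS ha'
        exact ⟨rfl, (Sph.le_zcons hs).2 h'⟩
      · exact absurd ha'.le not_apex_le_base
end Cells

section
open scoped unitInterval Topology Topology.Homotopy

/-- The coordinates of a product with one more interval. -/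
def insertZero (k : ℕ) : Option (Fin 2 ⊕ Fin k) ≃ Fin 2 ⊕ Fin (k + 1) where
  toFun o := o.elim (.inr 0) (Sum.map id Fin.succ)
  invFun := Sum.elim (fun j => some (.inl j)) (Fin.cases none fun i => some (.inr i))
  left_inv := by rintro (_ | j | i) <;> rfl
  right_inv := by
    rintro (j | i)
    · rfl
    · cases i using Fin.cases <;> rfl

section Box
variable {V Q : Type} [PartialOrder V] [PartialOrder Q] {b : Al V} {N m : ℕ}

/-- A monotone map on the cells of a box, as a representative. -/
theorem IsRep.box {C : (Fin m → I) → Set (Al V)} (h : (Fin 2 ⊕ Fin m → Fen N) →o V)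
    (hm : ∀ t y, h (cells N (Sum.elim t y)) ∈ C y)
    (hb : ∀ t ∈ Cube.boundary (Fin 2), ∀ y, h (cells N (Sum.elim t y)) = b) :
    IsRep C b fun t y => h (cells N (Sum.elim t y)) := by
  refine ⟨Al.continuous_iff.2 fun z => ?_, hm, hb⟩
  have hc : Continuous fun p : (Fin 2 → I) × (Fin m → I) => Sum.elim p.1 p.2 :=
    continuous_pi fun i => by rcases i with i | i <;> simp only [Sum.elim_inl, Sum.elim_inr] <;> fun_prop
  filter_upwards [hc.continuousAt.eventually (cells_eventually_le N _)] with z' hz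
  exact h.monotone hz

theorem boundary_inl {t : Fin 2 → I} (ht : t ∈ Cube.boundary (Fin 2)) (y : Fin m → I) :
    Sum.elim t y ∈ Cube.boundary (Fin 2 ⊕ Fin m) := ht.elim fun i hi => ⟨.inl i, hi⟩

theorem boundary_inr (t : Fin 2 → I) {y : Fin m → I} (hy : y ∈ Cube.boundary (Fin m)) :
    Sum.elim t y ∈ Cube.boundary (Fin 2 ⊕ Fin m) := hy.elim fun i hi => ⟨.inr i, hi⟩

theorem IsRep.boxL (hN : 0 < N) (h : (Fin 2 ⊕ Fin m → Fen N) →o V)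
    (hb : ∀ s ∈ Sph (Fin 2 ⊕ Fin m) N, h s = b) :
    IsRep (CL m b) b fun t y => h (cells N (Sum.elim t y)) :=
  IsRep.box h (fun t _ hy => hb _ ((cells_mem_Sph hN).2 (boundary_inr t hy)))
    fun _ ht y => hb _ ((cells_mem_Sph hN).2 (boundary_inl ht y))

/-- A face map approximates the image of the class under the face homomorphism. -/
theorem IsAppr.face (hN : 0 < N) {g : (Fin 2 → I) → (Fin m → I) → Al V} (hg : IsRep (CL m b) b g)
    (h : (Fin 2 ⊕ Fin m → Fen N) →o V) (hb : ∀ s ∈ Sph (Fin 2 ⊕ Fin m) N, h s = b)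
    (hgh : ∀ t y, @LE.le V _ (g t y) (h (cells N (Sum.elim t y)))) :
    IsAppr (faceMap (insertZero m) h hb) (face 0 (Gp.cls CL.base g hg)) := by
  refine ⟨_, _, Gp.map_cls _ hg, (Al.homotopic_of_le fun x => ?_).symm⟩
  let G : (Fin 2 → I) → Cube.boundary (Fin (m + 1)) → Al V := fun t y =>
    if y.1 0 = 0 then g t (Fin.removeNth (α := fun _ => I) 0 y.1) else b
  have h0 : (cells N x.1 (.inr 0)).val = 0 ↔ x.1 (.inr 0) = 0 := cell_eq_zero hN
  by_cases hx : x.1 (.inr 0) = 0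
  · refine le_trans (le_of_eq ((sphFun_pos (b := b) G ⟨0, .inl hx⟩).trans (if_pos hx)))
      ((hgh _ _).trans (le_of_eq (Eq.trans (congrArg h (funext ?_)) (if_pos (h0.2 hx)).symm)))
    rintro (j | i) <;> rfl
  · refine le_of_eq (Eq.trans (?_ : sphFun b G x.1 = b) (if_neg (mt h0.1 hx)).symm)
    by_cases hx' : x.1 ∘ Sum.inr ∈ Cube.boundary (Fin (m + 1))
    · exact (sphFun_pos G hx').trans (if_neg hx)
    · exact sphFun_neg G hx'

variable {p : V →o Q} {b' : Al Q} (c : Al {v : V // p v = b'}) (hc : c.1 = b)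

/-- The constraint for maps of a cube carrying the boundary to a fibre. -/
def CM (p : V →o Q) (b : Al V) (b' : Al Q) (m : ℕ) (y : Fin m → I) : Set (Al V) :=
  {v | (y ∈ Cube.boundary (Fin m) → p v = b') ∧ ((∀ i, y i = 1) → v = b)}

include hc in
theorem CM.base (y : Fin m → I) : b ∈ CM p b b' m y := ⟨fun _ => hc ▸ c.2, fun _ => rfl⟩

open Classical in
/-- A retraction to a fibre. -/
noncomputable def toFibre (v : Al V) : Al {v // p v = b'} := if h : p v = b' then ⟨v, h⟩ else c

theorem toFibre_pos {v : Al V} (h : p v = b') : toFibre c v = (⟨v, h⟩ : {v // p v = b'}) :=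
  dif_pos h

include hc in
theorem isOp_res : IsOp (CM p b b' m) b (CG m c) c
    fun f y => toFibre c (f y.1) := by
  refine ⟨fun g hg hm => Al.continuous_iff.2 fun z => ?_, fun f hf y hy => ?_,
    fun _ => (toFibre_pos c (hc ▸ c.2)).trans (Subtype.ext hc.symm)⟩
  · have hc : Continuous fun q : (I × (Fin 2 → I)) × Cube.boundary (Fin m) => (q.1, q.2.1) := by
      fun_prop
    filter_upwards [Al.continuous_iff.1 (hg.comp hc) z] with z' hz
    rw [toFibre_pos c ((hm z.1 z.2.1).1 z.2.2), toFibre_pos c ((hm z'.1 z'.2.1).1 z'.2.2)]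
    exact hz
  · exact (toFibre_pos c ((hf y.1).1 y.2)).trans (Subtype.ext (((hf y.1).2 hy).trans hc.symm))

/-- Restriction to the boundary. -/
noncomputable def Gp.res : Gp (CM p b b' m) b (CM.base c hc) →+ GG c m :=
  Gp.map (isOp_res c hc)

/-- Projection to the quotient. -/
noncomputable def Gp.quot : Gp (CM p b b' m) b (CM.base c hc) →+ LL b' m :=
  Gp.map (IsOp.comp_right (C' := CL m b') (p := id) continuous_id
    (Al.continuous_map p) (hc ▸ c.2) fun x _ hf hx => (hf x).1 hx)

/-- Simultaneous approximation of a map of a box, of its restriction to the boundary and of its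
projection to the quotient. -/
theorem exists_box [Finite V] (hb' : ∀ x, b' ≤ x → x = b')
    (u : Gp (CM p b b' m) b (CM.base c hc)) :
    ∀ᶠ N in Filter.atTop, ∃ (ψ : (Fin 2 ⊕ Fin m → Fen N) →o V)
      (dψ : Sph (Fin 2 ⊕ Fin m) N →o {v // p v = b'}), (∀ s, (dψ s).1 = ψ s.1) ∧
      IsAppr dψ (Gp.res c hc u) ∧ ∃ hp : ∀ s ∈ Sph (Fin 2 ⊕ Fin m) N, (p.comp ψ) s = b',
      IsAppr (faceMap (insertZero m) (p.comp ψ) hp) (face 0 (Gp.quot c hc u)) := by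
  classical
  obtain ⟨g, hg, rfl⟩ := Gp.exists_rep u
  have hG : Continuous fun x : Fin 2 ⊕ Fin m → I => g (x ∘ Sum.inl) (x ∘ Sum.inr) :=
    hg.cont.comp (f := fun x : Fin 2 ⊕ Fin m → I => (x ∘ Sum.inl, x ∘ Sum.inr))
      ((continuous_pi fun _ => continuous_apply _).prodMk (continuous_pi fun _ => continuous_apply _))
  haveI : Nonempty V := ⟨c.1⟩
  filter_upwards [exists_approx_subtype isClosed_univ ⟨fun x : (univ : Set (Fin 2 ⊕ Fin m → I)) =>
    g (x.1 ∘ Sum.inl) (x.1 ∘ Sum.inr), hG.comp continuous_subtype_val⟩,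
    Filter.eventually_gt_atTop 0] with N ⟨ψ, hψ, hψ'⟩ hN
  have hψm : Monotone ψ := fun s s' h => by
    obtain ⟨t, rfl⟩ := cells_surjective hN s
    obtain ⟨t', rfl⟩ := cells_surjective hN s'
    exact hψ ⟨t, trivial, rfl⟩ ⟨t', trivial, rfl⟩ h
  have hg' : ∀ x : Fin 2 ⊕ Fin m → I, @LE.le V _ (g (x ∘ Sum.inl) (x ∘ Sum.inr))
    (ψ (cells N x)) := fun x => hψ' ⟨x, trivial⟩
  have hgb : ∀ x ∈ Cube.boundary (Fin 2 ⊕ Fin m), p (g (x ∘ Sum.inl) (x ∘ Sum.inr)) = b' := by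
    intro x hx
    rcases Cube.boundary_sum_iff.1 hx with hx | hx
    · rw [hg.base _ hx]; exact hc ▸ c.2
    · exact (hg.mem _ _).1 hx
  have hp : ∀ s ∈ Sph (Fin 2 ⊕ Fin m) N, p (ψ s) = b' := fun s hs => by
    obtain ⟨x, rfl⟩ := cells_surjective hN s
    exact hb' _ ((hgb x ((cells_mem_Sph hN).1 hs)).ge.trans (p.monotone (hg' x)))
  refine ⟨⟨ψ, hψm⟩, ⟨fun s => ⟨ψ s.1, hp s.1 s.2⟩, fun s s' h => hψm h⟩, fun _ => rfl, ?_, hp, ?_⟩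
  · refine ⟨_, _, Gp.map_cls _ hg, (Al.homotopic_of_le fun x => ?_).symm⟩
    let G : (Fin 2 → I) → Cube.boundary (Fin m) → Al {v // p v = b'} := fun t y =>
      toFibre c (g t y.1)
    refine le_trans (le_of_eq (?_ : sphFun (T := Al {v // p v = b'}) c G x.1 =
      (⟨g (x.1 ∘ Sum.inl) (x.1 ∘ Sum.inr), hgb x.1 x.2⟩ : {v // p v = b'}))) (hg' x.1)
    by_cases hx : x.1 ∘ Sum.inr ∈ Cube.boundary (Fin m)
    · exact (sphFun_pos G hx).trans (toFibre_pos c (hgb x.1 x.2))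
    · refine (sphFun_neg G hx).trans (Subtype.ext (hc.trans (Eq.symm (a := (g _ _ : Al V)) (hg.base _ ?_ _))))
      exact (Cube.boundary_sum_iff.1 x.2).resolve_right hx
  · unfold Gp.quot
    rw [Gp.map_cls]
    exact IsAppr.face hN _ _ _ fun t y => p.monotone (hg' (Sum.elim t y))
end Box

end

section
open scoped unitInterval Topology Topology.Homotopy

namespace MM
variable {X : Type} [PartialOrder X] [Finite X] {k m : ℕ}

/-- The base point of the quotient by a skeleton. -/
abbrev pt (X : Type) [PartialOrder X] [Finite X] (k : ℕ) : Al (Coll (skel X k)) := Coll.mk _ 0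

/-- The base point of the image of the next skeleton. -/
abbrev ptB (X : Type) [PartialOrder X] [Finite X] (k : ℕ) : Al (Bd X k) := bd0 X k

/-- The image of a cell in the quotient by a skeleton. -/
noncomputable def cellQ (k : ℕ) (l : Fin m ↪o X) :
    (Fin 2 ⊕ Fin m → Fen 2) →o Coll (skel X k) :=
  (Coll.mk _).comp ⟨fill l, fun _ _ h => fill_le_fill.2 h⟩

theorem cellQ_eq {l : Fin m ↪o X} {v : Fin 2 ⊕ Fin m → Fen 2} (h : fill l v ∈ skel X k) :
    cellQ k l v = pt X k := (Coll.mk_eq zero_mem).2 h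

/-- The class of a cell in the image of the next skeleton. -/
noncomputable def clsB (l : Fin k ↪o X) : LL (ptB X k) k :=
  Gp.cls CL.base _ (IsRep.boxL (b := ptB X k) two_pos (cellB l) fun s hs => (cellB_eq l s).2 hs)

/-- The class of a cell in the quotient by a skeleton. -/
noncomputable def clsQ (l : Fin k ↪o X) : LL (pt X k) k :=
  Gp.cls CL.base _ (IsRep.boxL (b := pt X k) two_pos (cellQ k l) fun _ hs =>
    cellQ_eq ((fill_mem _ _).2 hs))

instance : Finite (Fin k ↪o X) := Finite.of_injective _ DFunLike.coe_injective

theorem trivAtt_clsB : TrivAtt fun l : Fin k ↪o X => face 0 (clsB l) := by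
  refine ⟨2, two_pos, fun l => faceMap (insertZero k) (cellB l) fun s hs => (cellB_eq l s).2 hs,
    fun l => IsAppr.face two_pos _ _ _ fun t y => le_rfl, ?_⟩
  refine Att.cells _ (fun _ => le_bd0) _ cellB_eq exists_cellB
    (fun _ _ _ _ => cellB_le) fun l v h => ?_
  obtain ⟨a, ha, hva⟩ := (Coll.mk_le_mem zero_mem).1 h
  have e : fill l (Sum.elim (fun j => a.1 (.inr j)) fun i => a.1 (.inl (l i))) = a := by
    refine Subtype.ext (funext ?_)
    rintro (x | j)
    · by_cases hx : ∃ i, l i = x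
      · obtain ⟨i, rfl⟩ := hx
        exact fill_inl _ _ _
      · rw [fill_not_mem _ _ hx]
        exact Fen.ext (zero_of_le hva (i := .inl x) (by rw [fill_not_mem _ _ hx])).symm
    · rfl
  refine ⟨_, (fill_mem l _).1 (e.symm ▸ ha), ?_⟩
  rwa [← fill_le_fill (l := l), e]

theorem post_clsB (l : Fin k ↪o X) :
    Gp.post (OrderHom.Subtype.val fun v => Coll.map skel_succ v = pt X (k + 1)) (ptB X k)
      (face 0 (clsB l)) = (face 0 (clsQ l) : GG (pt X k) (k + 1)) := by
  refine (congrArg _ (Gp.map_cls _ _)).trans ((Gp.map_cls _ _).trans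
    ((Gp.cls_congr fun t y => ?_).trans (Gp.map_cls _ _).symm))
  by_cases h : y.1 0 = 0
  · exact Eq.trans (congrArg (Al.map _) (if_pos h)) (if_pos h).symm
  · exact Eq.trans (congrArg (Al.map _) (if_neg h)) (if_neg h).symm

theorem fill_face (l : Fin (k + 1) ↪o X) (i : Fin (k + 1)) {v : Fin 2 ⊕ Fin (k + 1) → Fen 2}
    (h : (v (.inr i)).val = 0) : fill l v = fill (Ch.face l i) (v ∘ Sum.map id i.succAbove) := by
  refine Subtype.ext (funext ?_)
  rintro (x | j)
  · by_cases hx : ∃ j, l j = x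
    · obtain ⟨j, rfl⟩ := hx
      rw [fill_inl]
      rcases Fin.eq_self_or_eq_succAbove i j with rfl | ⟨j, rfl⟩
      · rw [fill_not_mem]
        · exact Fen.ext h
        · rintro ⟨j', hj⟩
          exact Fin.succAbove_ne _ _ (l.injective hj)
      · exact (fill_inl (Ch.face l i) (v ∘ Sum.map id i.succAbove) j).symm
    · rw [fill_not_mem _ _ hx, fill_not_mem]
      rintro ⟨j, rfl⟩
      exact hx ⟨_, rfl⟩
  · rfl

theorem isRep_clsF (l : Fin (k + 1) ↪o X) : IsRep (CM (Coll.map skel_succ) (pt X k) (pt X (k + 1))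
    (k + 1)) (pt X k) fun t y => cellQ k l (cells 2 (Sum.elim t y)) := by
  refine IsRep.box (b := pt X k) (cellQ k l) (fun t y => ⟨fun hy => ?_, fun hy => ?_⟩)
    fun t ht y => ?_
  · exact cellQ_eq (k := k + 1) ((fill_mem l _).2 ((cells_mem_Sph two_pos).2 (boundary_inr t hy)))
  · refine cellQ_eq (.inl ⟨.inl (l 0), ?_⟩)
    rw [fill_inl]
    exact (cell_eq_two_mul two_pos).2 (hy 0)
  · refine cellQ_eq ?_
    obtain ⟨j, h | h⟩ := ht
    · exact .inr (.inl ⟨j, (cell_eq_zero two_pos).2 h⟩)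
    · exact .inl ⟨.inr j, (cell_eq_two_mul two_pos).2 h⟩

/-- The class of a cell in the quotient by the skeleton two dimensions lower. -/
noncomputable def clsF (l : Fin (k + 1) ↪o X) : Gp (CM (Coll.map skel_succ) (pt X k) (pt X (k + 1))
    (k + 1)) (pt X k) (CM.base (ptB X k) rfl) :=
  Gp.cls _ _ (isRep_clsF l)

/-- Projection of boxes to the next quotient. -/
noncomputable abbrev quot (k : ℕ) : Gp (CM (Coll.map skel_succ) (pt X k) (pt X (k + 1)) (k + 1))
    (pt X k) (CM.base (ptB X k) rfl) →+ LL (pt X (k + 1)) (k + 1) := Gp.quot (ptB X k) rfl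

/-- Restriction of boxes to the boundary. -/
noncomputable abbrev res (k : ℕ) : Gp (CM (Coll.map skel_succ) (pt X k) (pt X (k + 1)) (k + 1))
    (pt X k) (CM.base (ptB X k) rfl) →+ GG (ptB X k) (k + 1) := Gp.res (ptB X k) rfl

theorem quot_clsF (l : Fin (k + 1) ↪o X) : quot k (clsF l) = clsQ l :=
  (Gp.map_cls _ _).trans (Gp.cls_congr fun _ _ => rfl)

theorem res_clsF (l : Fin (k + 1) ↪o X) : res k (clsF l) =
    face 0 (∑ i : Fin (k + 1), (-1 : ℤ) ^ (i : ℕ) • clsB (Ch.face l i)) := by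
  have hv : ∀ t (y : Cube.boundary (Fin (k + 1))), fill l (cells 2 (Sum.elim t y.1)) ∈ skel X k →
      toFibre (ptB X k) (cellQ k l (cells 2 (Sum.elim t y.1))) = ptB X k := fun t y h => by
    rw [cellQ_eq h]
    exact toFibre_pos _ rfl
  refine (Gp.map_cls _ _).trans ((Concentrated.cls_eq_face_zero _ fun t => ⟨fun y i hi => hv t y ?_, fun y i j hij hi hj =>
    hv t y ?_⟩).trans (congrArg _ (Finset.sum_congr rfl fun i _ => congrArg _ ?_)))
  · refine .inl ⟨.inl (l i), ?_⟩
    rw [fill_inl]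
    exact (cell_eq_two_mul two_pos).2 hi
  · rw [fill_face l i ((cell_eq_zero two_pos).2 hi)]
    obtain ⟨j, rfl⟩ := Fin.exists_succAbove_eq hij.symm
    exact (fill_mem _ _).2 ⟨.inr j, .inl ((cell_eq_zero two_pos).2 hj)⟩
  · refine Gp.cls_congr fun t y => ?_
    have e : fill l (cells 2 (Sum.elim t (i.insertNth (α := fun _ => I) 0 y))) =
        fill (Ch.face l i) (cells 2 (Sum.elim t y)) := by
      rw [fill_face l i ((cell_eq_zero two_pos).2 (by simp))]
      congr 1
      funext j
      rcases j with j | j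
      · rfl
      · simp [cells]
    refine (toFibre_pos _ ?_).trans (Subtype.ext (congrArg (Coll.mk _) e))
    exact (congrArg (Coll.mk _) e).trans (cellB (Ch.face l i) (cells 2 (Sum.elim t y))).2
end MM

end

section
open scoped unitInterval Topology Topology.Homotopy

theorem IsAppr.eventually {V : Type} [PartialOrder V] [Finite V] {b : Al V} {m : ℕ} (u : GG b m) :
    ∀ᶠ N in Filter.atTop, ∃ ψ : Sph (Fin 2 ⊕ Fin m) N →o V, IsAppr ψ u := by
  obtain ⟨g, hg, rfl⟩ := Gp.exists_rep u
  have : Nonempty V := ⟨b⟩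
  filter_upwards [exists_realize_le hg.sph] with N ⟨ψ, h⟩
  exact ⟨ψ, g, hg, rfl, (Al.homotopic_of_le h).symm⟩

theorem finrank_range_add_ker {M N : Type} [AddCommGroup M] [Module.Finite ℤ M] [AddCommGroup N]
    (f : M →ₗ[ℤ] N) : Module.finrank ℤ (LinearMap.range f) +
      Module.finrank ℤ (LinearMap.ker f) = Module.finrank ℤ M := by
  rw [← Submodule.finrank_quotient_add_finrank (LinearMap.ker f), f.quotKerEquivRange.finrank_eq]

namespace MM
variable {X : Type} [PartialOrder X] [Finite X] {k m : ℕ}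

theorem ext_single {G : Type*} [AddCommGroup G] (f g : Ch X k →+ G)
    (h : ∀ e, f (Finsupp.single e 1) = g (Finsupp.single e 1)) (x : Ch X k) : f x = g x := by
  refine DFunLike.congr_fun (Finsupp.addHom_ext fun e n => ?_) x
  rw [← Finsupp.smul_single_one, map_zsmul, map_zsmul, h]

/-- The class of a chain in the image of the next skeleton. -/
noncomputable def chB (k : ℕ) : Ch X k →+ LL (ptB X k) k :=
  (Finsupp.linearCombination ℤ clsB).toAddMonoidHom

/-- The class of a chain in the quotient by a skeleton. -/
noncomputable def chQ (k : ℕ) : Ch X k →+ LL (pt X k) k :=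
  (Finsupp.linearCombination ℤ clsQ).toAddMonoidHom

/-- The class of a chain in the quotient by the skeleton two dimensions lower. -/
noncomputable def chF (k : ℕ) : Ch X (k + 1) →+ Gp (CM (Coll.map skel_succ) (pt X k) (pt X (k + 1))
    (k + 1)) (pt X k) (CM.base (ptB X k) rfl) := (Finsupp.linearCombination ℤ clsF).toAddMonoidHom

theorem chB_single (e : Fin k ↪o X) : chB k (Finsupp.single e 1) = clsB e := by simp [chB]
theorem chQ_single (e : Fin k ↪o X) : chQ k (Finsupp.single e 1) = clsQ e := by simp [chQ]
theorem chF_single (e : Fin (k + 1) ↪o X) : chF k (Finsupp.single e 1) = clsF e := by simp [chF]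

theorem post_chB (x : Ch X k) :
    Gp.post (OrderHom.Subtype.val fun v => Coll.map skel_succ v = pt X (k + 1)) (ptB X k)
      (face 0 (chB k x)) = (face 0 (chQ k x) : GG (pt X k) (k + 1)) :=
  ext_single (((Gp.post (OrderHom.Subtype.val fun v => Coll.map skel_succ v = pt X (k + 1))
    (ptB X k)).comp (face 0)).comp (chB k)) ((face 0).comp (chQ k)) (fun e =>
    (congrArg _ (congrArg _ (chB_single e))).trans ((post_clsB e).trans
      (congrArg _ (chQ_single e).symm))) x

theorem quot_chF (x : Ch X (k + 1)) : quot k (chF k x) = chQ (k + 1) x :=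
  ext_single ((quot k).comp (chF k)) (chQ (k + 1)) (fun e =>
    (congrArg _ (chF_single e)).trans ((quot_clsF e).trans (chQ_single e).symm)) x

theorem res_chF (x : Ch X (k + 1)) :
    res k (chF k x) = face 0 (chB k (Ch.bd X k x)) :=
  ext_single ((res k).comp (chF k))
    (((face 0).comp (chB k)).comp (Ch.bd X k).toAddMonoidHom) (fun e =>
    (congrArg _ (chF_single e)).trans ((res_clsF e).trans (congrArg (face 0) (by
      change _ = chB k (Ch.bd X k (Finsupp.single e 1))
      rw [Ch.bd_single, map_sum]
      exact Finset.sum_congr rfl fun i _ => by rw [map_zsmul, chB_single])))) x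

variable (X) in
/-- Attaching cones along suitable cells trivializes the quotient by a skeleton. -/
def Filled (k : ℕ) : Prop :=
  ∃ δ : Fin (Module.finrank ℤ (LinearMap.range (Ch.bd' X k))) → Ch X k,
    Submodule.span ℤ (range fun j => Ch.bd' X k (δ j)) = LinearMap.range (Ch.bd' X k) ∧
    TrivAtt fun j => face 0 (chQ k (δ j))

theorem exists_moves (h : LC.Exact (LC.on (LC.Srt X))) {n : ℕ} (k : ℕ) (z : Fin n → Ch X k)
    (hn : n = Module.finrank ℤ (LinearMap.range (Ch.bd X k)))
    (hz : Submodule.span ℤ (range z) = LinearMap.range (Ch.bd X k)) :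
    ∃ δ : Fin (Module.finrank ℤ (LinearMap.range (Ch.bd' X k))) → Ch X k,
    Submodule.span ℤ (range fun j => Ch.bd' X k (δ j)) = LinearMap.range (Ch.bd' X k) ∧
    ∃ e : (_ ⊕ _) ≃ (Fin k ↪o X), Moves (fun i => Finsupp.single i 1) fun i =>
      (Sum.elim δ z (e.symm i) : Ch X k) := by
  haveI : Fintype (Fin k ↪o X) := Fintype.ofFinite _
  let B := Module.finBasis ℤ (LinearMap.range (Ch.bd' X k))
  choose δ hδ using fun j => (B j).2
  have hs : Submodule.span ℤ (range fun j => Ch.bd' X k (δ j)) = LinearMap.range (Ch.bd' X k) := by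
    have := congrArg (Submodule.map (LinearMap.range (Ch.bd' X k)).subtype) B.span_eq
    rw [Submodule.map_span, ← range_comp, Submodule.map_top, Submodule.range_subtype] at this
    exact (congrArg _ (congrArg _ (funext hδ))).trans this
  refine ⟨δ, hs, ?_⟩
  have hc : Fintype.card (Fin (Module.finrank ℤ (LinearMap.range (Ch.bd' X k))) ⊕ Fin n) =
      Fintype.card (Fin k ↪o X) := by
    rw [Fintype.card_sum, Fintype.card_fin, Fintype.card_fin, hn, ← Ch.ker_bd' h]
    have h1 := finrank_range_add_ker (Ch.bd' X k)
    have h2 : Module.finrank ℤ (Ch X k) = _ := Module.finrank_finsupp_self ℤ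
    trans
    · exact h1
    · exact h2
  let e := Fintype.equivOfCardEq hc
  refine ⟨e, (Moves.to_basis _ ?_).symm⟩
  have hr : range (fun i => (Sum.elim δ z (e.symm i) : Ch X k)) = range δ ∪ range z := by
    rw [← Sum.elim_range]
    exact e.symm.surjective.range_comp _
  rw [hr, ← Submodule.span_int_eq_addSubgroupClosure, Submodule.span_union, hz, ← Ch.ker_bd' h]
  have : Submodule.span ℤ (range δ) ⊔ LinearMap.ker (Ch.bd' X k) = ⊤ := by
    rw [← Submodule.comap_map_eq, Submodule.map_span, ← range_comp]
    erw [hs]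
    exact eq_top_iff.2 fun x _ => ⟨x, rfl⟩
  rw [this]; rfl

theorem Filled.step (h : LC.Exact (LC.on (LC.Srt X))) (hk : Filled X (k + 1)) : Filled X k := by
  obtain ⟨δ', hδ', hT⟩ := hk
  obtain ⟨δ, hδ, e, hm⟩ := exists_moves h k (fun j => Ch.bd X k (δ' j)) rfl hδ'
  refine ⟨δ, hδ, ?_⟩
  have hB : TrivAtt (Sum.elim (fun j => face 0 (chB k (δ j)))
      fun j => face 0 (chB k (Ch.bd X k (δ' j)))) := by
    have := (TrivAtt.of_moves (hm.map ((face 0).comp (chB k))) (by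
      simpa only [AddMonoidHom.comp_apply, chB_single] using trivAtt_clsB)).reindex e
    convert this using 2 with i
    rcases i with i | i <;> simp
  obtain ⟨N, hχ, hψ, hN⟩ := ((Filter.eventually_all.2 fun j =>
    IsAppr.eventually (face 0 (chB k (δ j)))).and ((Filter.eventually_all.2 fun j =>
    exists_box (ptB X k) rfl (Coll.eq_of_le zero_mem) (chF k (δ' j))).and
      (Filter.eventually_gt_atTop 0))).exists
  choose χ hχ using hχ
  choose ψ dψ hd hr hp0 hq using hψ
  refine ⟨N, hN, fun j => (OrderHom.Subtype.val _).comp (χ j), fun j => ?_, ?_⟩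
  · have := (hχ j).post (OrderHom.Subtype.val fun v => Coll.map skel_succ v = pt X (k + 1))
    rwa [post_chB] at this
  · refine Att.step hN (insertZero (k + 1)) (Coll.map skel_succ) (Coll.map_surjective _)
      (Coll.mk _ 0) (Coll.eq_of_le zero_mem) triv_link
      (fun s t _ ht => Coll.le_of_map_le _ zero_mem s t ht) χ ψ dψ hd (hB.eqv hN ?_) hp0
      (hT.eqv hN fun j => ?_)
    · rintro (j | j)
      · exact hχ j
      · exact (congrArg (IsAppr (dψ j)) (res_chF (δ' j))).mp (hr j)
    · exact (congrArg (fun u => IsAppr _ (face 0 u)) (quot_chF (δ' j))).mp (hq j)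
end MM

end

/-- Collapsing an upper set with conical links in a trivial poset gives its suspension. -/
theorem Coll.eqv_susp {M : Type} [PartialOrder M] [Finite M] {A : UpperSet M} {b : M} (hb : b ∈ A)
    (hM : Eqv ⟨M⟩ ⟨PUnit⟩)
    (h : ∀ s ∉ A, (∃ a ∈ A, s ≤ a) → Triv {a | a ∈ A ∧ s ≤ a}) :
    Eqv ⟨Coll A⟩ ⟨Susp A⟩ := by
  let R : LRel M PUnit.{1} := ⟨fun s _ => ∃ a ∈ A, s ≤ a, fun _ _ _ h _ => h,
    fun _ _ _ h ⟨a, ha, h'⟩ => ⟨a, ha, h.trans h'⟩⟩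
  let R' : LRel (Cyl R) PUnit.{1} := ⟨fun z _ => ∃ m, z = .lo m, fun _ _ _ h _ => h, by
    rintro (l | l) _ _ h ⟨m, rfl⟩
    exacts [⟨l, rfl⟩, h.elim]⟩
  have hA : ∀ z, (∀ x ∉ A, ¬ z = x) ↔ z ∈ A := fun z =>
    ⟨fun h => by_contra fun h' => h z h' rfl, fun h x hx e => hx (e ▸ h)⟩
  have hA' : ∀ z, (∀ x ∈ A, ¬ z = x) ↔ z ∉ A := fun z =>
    ⟨fun h h' => h z h' rfl, fun h x hx e => h (e ▸ hx)⟩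
  have h1 := EqS.removeUp (A := (univ : Set (Cyl R'))) (x := .hi ⟨⟩) trivial (EqS.triv (EqS.symm
    (EqS.image (A := univ) (fun m => .lo (.lo m)) (fun _ _ _ _ => Iff.rfl) ?_))
      (Eqv.ofUniv.symm.trans hM))
  have h2 := EqS.removeUpper (A := (univ : Set (Cyl R')) \ {.hi ⟨⟩}) {z | ∃ a ∈ A, z = .lo (.lo a)}
    (by rintro _ ⟨a, -, rfl⟩; simp) ?_
  have h3 := EqS.removeUpper (A := (univ : Set (Cyl R'))) {z | ∃ a ∉ A, z = .lo (.lo a)}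
    (subset_univ _) ?_
  have h4 := EqS.image (A := ((univ : Set (Cyl R')) \ {.hi ⟨⟩}) \ {z | ∃ a ∈ A, z = .lo (.lo a)})
    (B := univ) (fun z => match z with
      | .lo (.lo m) => Coll.mk A m | _ => Coll.mk A b) ?_ ?_
  have h5 := EqS.image (A := univ) (B := (univ : Set (Cyl R')) \ {z | ∃ a ∉ A, z = .lo (.lo a)})
    (fun z : Susp A => match z with
      | .base a => .lo (.lo a) | .top true => .hi ⟨⟩ | .top false => .lo (.hi ⟨⟩)) ?_ ?_
  · exact Eqv.trans (Eqv.trans Eqv.ofUniv (((h1.trans h2).trans h4).symm.trans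
      (h3.trans h5.symm))) Eqv.ofUniv.symm
  · rintro (⟨x, hx⟩ | _ | _) - (⟨y, hy⟩ | _ | _) - <;> simp [R, R', -Cyl.lo_lt_lo]
    exact ⟨x, hx, le_rfl⟩
  · ext ((z | z) | z)
    · refine ⟨?_, fun hz => ⟨.base ⟨z, by simpa using hz⟩, trivial, rfl⟩⟩
      rintro ⟨(⟨x, hx⟩ | _ | _), -, ⟨⟩⟩
      simpa using hx
    · simpa using ⟨.top false, rfl⟩
    · simpa using ⟨.top true, rfl⟩
  · rintro ((s | s) | s) hs ((t | t) | t) ht <;> simp at hs ht ⊢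
    · exact Coll.mk_le_not_mem ht
    · exact Coll.mk_le_mem hb
    · exact fun h => ht (Coll.mem_of_le h hb)
  · refine eq_univ_of_forall fun z => ?_
    obtain ⟨t, rfl⟩ := Coll.mk_surjective z
    by_cases ht : t ∈ A
    · exact ⟨.lo (.hi ⟨⟩), by simp, ((Coll.mk_eq hb).2 ht).symm⟩
    · exact ⟨.lo (.lo t), by simpa using ht, rfl⟩
  · rintro _ ⟨s, hs, rfl⟩
    by_cases hs' : ∃ a ∈ A, s ≤ a
    · refine Triv.two_tops (t := .hi ⟨⟩) (t' := .lo (.hi ⟨⟩)) (by simp [R'])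
        (by simpa [R] using hs') (by simp) (EqS.triv (EqS.symm (EqS.image (fun a => .lo (.lo a))
          (fun _ _ _ _ => Iff.rfl) ?_)) (h s hs hs')) ?_
      · ext ((z | z) | z)
        · simp [R', hA]
          exact fun hz => ⟨fun h => lt_of_le_of_ne h fun h => hs (h ▸ hz), le_of_lt⟩
        · simp [R']
        · simp
      · rintro ((z | z) | z) <;> simp [R, hA]
        exact fun hz _ => ⟨z, hz, le_rfl⟩
    · convert Triv.singleton (Cyl.hi ⟨⟩ : Cyl R') using 1
      ext ((z | z) | z)
      · simp [hA]
        exact fun hz h => hs' ⟨z, hz, h.le⟩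
      · simpa [R] using hs'
      · simp [R']
  · rintro _ ⟨a, ha, rfl⟩
    convert Triv.singleton (Cyl.lo (Cyl.hi ⟨⟩) : Cyl R') using 1
    ext ((z | z) | z)
    · simp [hA']
      exact fun hz h => hz (A.upper h.le ha)
    · simpa [R] using ⟨a, ha, le_rfl⟩
    · simp
  · ext ((z | z) | z) <;> simp [R']

namespace MM
variable {X : Type} [PartialOrder X]

/-- The grid of chains times a square. -/
def Gr (X : Type) [PartialOrder X] : Set (X ⊕ Fin 2 → Fen 2) :=
  {κ | ∀ z w, (κ (.inl z)).val = 0 ∨ (κ (.inl w)).val = 0 ∨ z ≤ w ∨ w ≤ z}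

variable [Finite X]

theorem triv_grid : Triv (Gr X) := by
  classical
  refine ((Slides.id (Gr X)).lower univ 0 fun j _ a ha z w => ?_).triv (c := fun _ => ⟨0, by omega⟩)
    (fun _ _ => .inl rfl) fun a _ => funext fun i => Fen.ext ?_
  · have := ha z w
    simp only [lower_val, mem_univ, if_true, id]
    grind
  · simp [lower_val]

theorem triv_top (c : Fen 2) : Triv {κ | κ ∈ Gr X ∧ κ (.inr 0) = c} := by
  classical
  refine ((Slides.id {κ | κ ∈ Gr X ∧ κ (.inr 0) = c}).lower {.inr 0}ᶜ 0 fun j _ a ha =>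
    ⟨fun z w => ?_, ?_⟩).triv
    (c := fun i => if i = .inr 0 then c else ⟨0, by omega⟩)
    ⟨fun _ _ => by simp, by simp⟩ fun a ha => funext fun i => Fen.ext ?_
  · have := ha.1 z w
    simp only [lower_val, id]
    grind
  · refine Fen.ext ?_
    simp [lower_val, ha.2]
  · by_cases hi : i = .inr 0
    · simp [lower_val, hi, ha.2]
    · simp [lower_val, hi]

theorem triv_mid (c : Fen 2) (hc : c.val = 0 ∨ c.val = 4) :
    Triv {κ | κ ∈ Gr X ∧ ((κ (.inr 0)).val = 0 ∨ (κ (.inr 0)).val = 4 ∨ κ (.inr 1) = c)} := by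
  classical
  generalize hA : {κ | κ ∈ Gr X ∧ ((κ (.inr 0)).val = 0 ∨ (κ (.inr 0)).val = 4 ∨ κ (.inr 1) = c)} = A
  have hA' : ∀ κ, κ ∈ A ↔ κ ∈ Gr X ∧ ((κ (.inr 0)).val = 0 ∨ (κ (.inr 0)).val = 4 ∨
    (κ (.inr 1)).val = c.val) := fun κ => by
    rw [← hA, ← Fen.ext_iff]; rfl
  clear hA
  have h1 : ∃ f, Slides A f ∧ ∀ a ∈ A, (f a (.inr 1)).val = c.val := by
    rcases hc with h | h
    · refine ⟨_, (Slides.id A).lower {.inr 1} 0 fun j _ a ha => ?_, fun a _ => ?_⟩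
      · rw [hA'] at ha ⊢
        refine ⟨fun z w => ?_, ?_⟩
        · have := ha.1 z w
          simp only [lower_val, id]
          grind
        · have := ha.2
          simp [lower_val]
          grind
      · simp [lower_val, h]
    · refine ⟨_, (Slides.id A).raise {.inr 1} 4 fun j hj a ha => ?_, fun a _ => ?_⟩
      · rw [hA'] at ha ⊢
        refine ⟨fun z w => ?_, ?_⟩
        · have := ha.1 z w
          simp only [raise_val hj, id]
          grind
        · have := ha.2
          simp [raise_val hj]
          grind
      · have := (a (.inr 1)).2
        simp [raise_val, h]
        omega
  obtain ⟨f, hf, h1⟩ := h1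
  refine (hf.lower {.inr 1}ᶜ 0 fun j _ a ha => ?_).triv
    (c := fun i => if i = .inr 1 then c else ⟨0, by omega⟩)
    ((hA' _).2 ⟨fun _ _ => by simp, by simp⟩) fun a ha => funext fun i => Fen.ext ?_
  · have := ((hA' _).1 (hf.2.1 a ha)).1
    refine (hA' _).2 ⟨fun z w => ?_, ?_⟩
    · have := this z w
      simp only [lower_val]
      grind
    · simp [lower_val, h1 a ha]
  · by_cases hi : i = .inr 1
    · simp [lower_val, hi, h1 a ha]
    · simp [lower_val, hi]

theorem triv_low (x : X) : Triv {κ | κ ∈ Gr X ∧ ((∃ j, (κ (.inr j)).val = 0 ∨ (κ (.inr j)).val = 4) ∨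
    ∃ y, x ≤ y ∧ (κ (.inl y)).val = 4)} := by
  classical
  generalize hA : {κ | κ ∈ Gr X ∧ ((∃ j, (κ (.inr j)).val = 0 ∨ (κ (.inr j)).val = 4) ∨
    ∃ y, x ≤ y ∧ (κ (.inl y)).val = 4)} = A
  have hA' : ∀ κ, κ ∈ A ↔ κ ∈ Gr X ∧ ((∃ j, (κ (.inr j)).val = 0 ∨ (κ (.inr j)).val = 4) ∨
    ∃ y, x ≤ y ∧ (κ (.inl y)).val = 4) := fun κ => by rw [← hA]; rfl
  clear hA
  have s1 := (Slides.id A).lower {i : X ⊕ Fin 2 | ∃ y, i = .inl y ∧ ¬ x ≤ y} 0 fun j _ a ha => ?_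
  have s2 := s1.raise {Sum.inl x} 4 fun j hj a ha => ?_
  have h2 : ∀ a : X ⊕ Fin 2 → Fen 2, ((raise {Sum.inl x} 4 ∘ lower {i : X ⊕ Fin 2 | ∃ y, i = .inl y ∧ ¬ x ≤ y} 0 ∘ id)
      a (Sum.inl x)).val = 4 := fun a => ?_
  · refine (s2.lower {Sum.inl x}ᶜ 0 fun j _ a ha => ?_).triv
      (c := fun i => if i = .inl x then ⟨4, by omega⟩ else ⟨0, by omega⟩)
      ((hA' _).2 ⟨fun z w => ?_, .inr ⟨x, le_rfl, by simp⟩⟩) fun a ha => funext fun i => Fen.ext ?_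
    · have := ((hA' _).1 (s2.2.1 a ha)).1
      refine (hA' _).2 ⟨fun z w => ?_, .inr ⟨x, le_rfl, ?_⟩⟩
      · have := this z w
        simp only [lower_val]
        grind
      · simpa [lower_val] using h2 a
    · grind
    · have := h2 a
      by_cases hi : i = .inl x
      · subst hi; simpa [lower_val] using this
      · simp [lower_val, hi]
  · have := (a (Sum.inl x)).2
    simp [raise_val, lower_val]
    omega
  · have h := (hA' _).1 (s1.2.1 a ha)
    refine (hA' _).2 ⟨fun z w => ?_, h.2.imp (fun ⟨l, h⟩ => ⟨l, ?_⟩) fun ⟨y, hy, h⟩ => ⟨y, hy, ?_⟩⟩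
    · have h1 := h.1 z w
      have h3 : ∀ z, x ≤ z ∨ ((lower {i : X ⊕ Fin 2 | ∃ y, i = .inl y ∧ ¬ x ≤ y} 0 ∘ id) a (Sum.inl z)).val = 0 :=
        fun z => by simp [lower_val]; grind
      have := h3 z
      have := h3 w
      simp only [raise_val hj]
      grind
    · simpa [raise_val hj] using h
    · rw [raise_val hj, h]; grind
  · rw [hA'] at ha ⊢
    refine ⟨fun z w => ?_, ha.2.imp (fun ⟨l, h⟩ => ⟨l, ?_⟩) fun ⟨y, hy, h⟩ => ⟨y, hy, ?_⟩⟩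
    · have := ha.1 z w
      simp only [lower_val, id]
      grind
    · simpa [lower_val] using h
    · simp [lower_val, hy, h]
end MM

theorem Att.eqv_of_isEmpty {Λ S P : Type} [PartialOrder S] [PartialOrder P] [IsEmpty Λ] [Finite S]
    [Finite P] (ψ : Λ → S →o P) : Eqv ⟨Att ψ⟩ ⟨P⟩ := by
  refine Eqv.symm (Eqv.iso (P := P) (Q := Att ψ) ⟨Equiv.ofBijective (Att.base : P → Att ψ)
    ⟨fun a b h => by simpa using h, ?_⟩, Iff.rfl⟩)
  rintro (p | ⟨l, _⟩ | l)
  exacts [⟨p, rfl⟩, isEmptyElim l, isEmptyElim l]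

namespace MM
variable {X : Type} [PartialOrder X]

theorem mem_gr {κ : X ⊕ Fin 2 → Fen 2} :
    κ ∈ Gr X ↔ IsChain (· ≤ ·) {x | (κ (.inl x)).val ≠ 0} := by
  refine ⟨fun h z hz w hw _ => ?_, fun h z w => ?_⟩
  · have := h z w
    simp only [mem_setOf_eq] at hz hw
    tauto
  · by_cases hz : (κ (.inl z)).val = 0
    · exact .inl hz
    · by_cases hw : (κ (.inl w)).val = 0
      · exact .inr (.inl hw)
      · exact .inr (.inr (h.total hz hw))

theorem four_of_le {κ κ' : MM X} (h : κ ≤ κ') {i} (hi : (κ.1 i).val = 4) : (κ'.1 i).val = 4 := by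
  have := h i
  rw [Fen.le_def] at this
  omega

/-- The conditions cutting out the fibres of the projection of the boundary of the grid to the
double suspension. -/
def Fib (κ : MM X) : Susp (Susp X) → Prop
  | .top b => (κ.1 (.inr 0)).val = if b then 0 else 4
  | .base (.top b) => (κ.1 (.inr 0)).val = 0 ∨ (κ.1 (.inr 0)).val = 4 ∨
      (κ.1 (.inr 1)).val = if b then 0 else 4
  | .base (.base x) => (∃ j, (κ.1 (.inr j)).val = 0 ∨ (κ.1 (.inr j)).val = 4) ∨
      ∃ y, x ≤ y ∧ (κ.1 (.inl y)).val = 4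

theorem Fib.mono {κ κ' : MM X} (h : κ ≤ κ') {q} (hq : Fib κ q) : Fib κ' q := by
  have h0 := fun i => zero_of_le h (i := i)
  have h4 := fun i => four_of_le h (i := i)
  rcases q with (x | b) | b
  · exact hq.imp (fun ⟨j, hj⟩ => ⟨j, hj.imp (h0 _) (h4 _)⟩) fun ⟨y, hy, h⟩ => ⟨y, hy, h4 _ h⟩
  · cases b <;> exact hq.imp (h0 _) fun h => h.imp (h4 _) (by simpa [Fib] using by grind)
  · cases b <;> simp only [Fib] at hq ⊢ <;> grind

variable [Finite X]

theorem mem_skel_zero {κ : MM X} :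
    κ ∈ skel X 0 ↔ (∃ i, (κ.1 i).val = 4) ∨ ∃ j, (κ.1 (.inr j)).val = 0 := by
  simp [mem_skel]

theorem exists_fib (κ : MM X) (hκ : κ ∈ skel X 0) : ∃ p, ∀ q, q ≤ p ↔ Fib κ q := by
  by_cases h0 : (κ.1 (.inr 0)).val = 0 ∨ (κ.1 (.inr 0)).val = 4
  · refine ⟨.top (decide ((κ.1 (.inr 0)).val = 0)), ?_⟩
    rintro ((x | b) | b)
    · exact ⟨fun _ => .inl ⟨0, h0⟩, fun _ => trivial⟩
    · exact ⟨fun _ => h0.imp_right .inl, fun _ => trivial⟩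
    · cases b <;> simp [Fib] <;> omega
  by_cases h1 : (κ.1 (.inr 1)).val = 0 ∨ (κ.1 (.inr 1)).val = 4
  · refine ⟨.base (.top (decide ((κ.1 (.inr 1)).val = 0))), ?_⟩
    rintro ((x | b) | b)
    · exact ⟨fun _ => .inl ⟨1, h1⟩, fun _ => trivial⟩
    · cases b <;> simp [Fib] <;> omega
    · cases b <;> simp [Fib] <;> omega
  rw [mem_skel_zero] at hκ
  have hne : {x | (κ.1 (.inl x)).val = 4}.Nonempty := by
    rcases hκ with ⟨i | i, hi⟩ | ⟨j, hj⟩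
    · exact ⟨i, hi⟩
    · fin_cases i <;> simp_all
    · fin_cases j <;> simp_all
  obtain ⟨y, hy⟩ := (toFinite {x | (κ.1 (.inl x)).val = 4}).exists_maximal hne
  have hm : ∀ z, (κ.1 (.inl z)).val = 4 → z ≤ y := fun z hz => by
    rcases κ.2.total (x := z) (y := y) (by simp [hz]) (by
      have : (κ.1 (.inl y)).val = 4 := hy.1
      simp [this]) with h | h
    exacts [h, hy.2 hz h]
  refine ⟨.base (.base y), ?_⟩
  rintro ((x | b) | b)
  · refine ⟨fun h => .inr ⟨y, h, hy.1⟩, ?_⟩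
    rintro (⟨j, hj⟩ | ⟨z, hz, h⟩)
    · fin_cases j <;> simp_all
    · exact hz.trans (hm z h)
  · cases b <;> simp [Fib] <;> omega
  · cases b <;> simp [Fib] <;> omega

theorem triv_of_gr {B : Set (X ⊕ Fin 2 → Fen 2)} (h : Triv B) {A : Set (skel X 0)}
    (hA : ∀ s : skel X 0, s ∈ A ↔ s.1.1 ∈ B) (hB : ∀ κ ∈ B, κ ∈ Gr X ∧
      ((∃ i, (κ i).val = 4) ∨ ∃ j, (κ (.inr j)).val = 0)) : Triv A := by
  refine (EqS.image (fun s => s.1.1) (fun _ _ _ _ => Iff.rfl) (Subset.antisymm ?_ ?_)).triv h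
  · rintro _ ⟨s, hs, rfl⟩
    exact (hA s).1 hs
  · intro κ hκ
    have := hB κ hκ
    exact ⟨⟨⟨κ, mem_gr.1 this.1⟩, mem_skel_zero.2 this.2⟩, (hA _).2 hκ, rfl⟩

theorem eqv_susp : Eqv ⟨Susp (skel X 0)⟩ ⟨Susp (Susp (Susp X))⟩ := by
  choose f hf using fun s : skel X 0 => exists_fib s.1 s.2
  refine Susp.eqv_of_fibers ⟨f, fun s t h => (hf t _).2 (((hf s _).1 le_rfl).mono h)⟩ fun x => ?_
  change Triv {s | x ≤ f s}
  simp only [hf]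
  rcases x with (x | b) | b
  · refine triv_of_gr (triv_low x) (fun s => ?_) fun κ hκ => ⟨hκ.1, ?_⟩
    · exact ⟨fun h => ⟨mem_gr.2 s.1.2, h⟩, fun h => h.2⟩
    · rcases hκ.2 with ⟨j, h | h⟩ | ⟨y, -, h⟩
      exacts [.inr ⟨j, h⟩, .inl ⟨_, h⟩, .inl ⟨_, h⟩]
  · refine triv_of_gr (triv_mid ⟨if b then 0 else 4, by cases b <;> simp⟩ (by cases b <;> simp))
      (fun s => ?_) fun κ hκ => ⟨hκ.1, ?_⟩
    · simp only [mem_setOf_eq, Fen.ext_iff]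
      exact ⟨fun h => ⟨mem_gr.2 s.1.2, h⟩, fun h => h.2⟩
    · rcases hκ.2 with h | h | h
      · exact .inr ⟨_, h⟩
      · exact .inl ⟨_, h⟩
      · cases b
        exacts [.inl ⟨_, by rw [h]; rfl⟩, .inr ⟨_, by rw [h]; rfl⟩]
  · refine triv_of_gr (triv_top ⟨if b then 0 else 4, by cases b <;> simp⟩)
      (fun s => ?_) fun κ hκ => ⟨hκ.1, ?_⟩
    · simp only [mem_setOf_eq, Fen.ext_iff]
      exact ⟨fun h => ⟨mem_gr.2 s.1.2, h⟩, fun h => h.2⟩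
    · have h := hκ.2
      cases b
      exacts [.inl ⟨_, by rw [h]; rfl⟩, .inr ⟨_, by rw [h]; rfl⟩]

theorem triv_skel_link {s : MM X} (hs : s ∉ skel X 0) (h : ∃ a ∈ skel X 0, s ≤ a) :
    Triv {a | a ∈ skel X 0 ∧ s ≤ a} := by
  classical
  simp only [mem_skel_zero, not_or, not_exists] at hs h ⊢
  have hb := fun i => (s.1 i).2
  let f : MM X → X ⊕ Fin 2 → Fen 2 := fun t i =>
    if (t.1 i).val = 4 ∨ (i.isRight ∧ (t.1 i).val = 0) then t.1 i else s.1 i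
  let c : X ⊕ Fin 2 → Fen 2 := fun i => if (s.1 i).val = 3 then ⟨4, by omega⟩ else
    if i.isRight ∧ (s.1 i).val = 1 then ⟨0, by omega⟩ else s.1 i
  have hc : ∀ g : X ⊕ Fin 2 → Fen 2, s.1 ≤ g → IsChain (· ≤ ·) {x | (g (.inl x)).val ≠ 0} :=
    fun g hg => s.2.mono fun x (hx : (g (.inl x)).val ≠ 0) => by
      have := hg (.inl x)
      rw [Fen.le_def] at this
      simp only [mem_setOf_eq]
      omega
  have hsf : ∀ t : MM X, s ≤ t → s.1 ≤ f t := fun t ht i => by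
    simp only [f]
    split_ifs
    exacts [ht i, le_rfl]
  have hsc : s.1 ≤ c := fun i => by
    have := hb i
    simp only [c]
    split_ifs <;> simp only [Fen.le_def] <;> grind
  let F : MM X → MM X := fun t => if ht : s ≤ t then ⟨f t, hc _ (hsf t ht)⟩ else t
  have hF : ∀ t, s ≤ t → (F t).1 = f t := fun t ht => by simp [F, ht]
  refine Triv.of_cone F (fun a ha b hb hab => ?_) (fun a ha => ?_) ⟨c, hc _ hsc⟩ ?_
    (.inl fun a ha => ?_) (.inl fun a ha => ?_)
  · change (F a).1 ≤ (F b).1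
    rw [hF _ ha.2, hF _ hb.2]
    intro i
    have h1 : a.1 i ≤ b.1 i := hab i
    have h2 : s.1 i ≤ b.1 i := hb.2 i
    simp only [f]
    rw [Fen.le_def] at h1 h2 ⊢
    split_ifs <;> grind
  · refine ⟨?_, show s.1 ≤ (F a).1 by rw [hF _ ha.2]; exact hsf a ha.2⟩
    rw [hF _ ha.2]
    refine ha.1.imp (fun ⟨i, h⟩ => ⟨i, ?_⟩) fun ⟨i, h⟩ => ⟨i, ?_⟩
    · simp [f, h]
    · simp [f, h]
  · obtain ⟨a, ha, hsa⟩ := h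
    refine ⟨ha.imp (fun ⟨i, h⟩ => ⟨i, ?_⟩) fun ⟨i, h⟩ => ⟨i, ?_⟩, hsc⟩
    · have h1 : s.1 i ≤ a.1 i := hsa i
      have h2 := hs.1 i
      rw [Fen.le_def] at h1
      have : (s.1 i).val = 3 := by grind
      simp [c, this]
    · have h1 : s.1 (.inr i) ≤ a.1 (.inr i) := hsa (.inr i)
      have h2 := hs.2 i
      rw [Fen.le_def] at h1
      have : (s.1 (.inr i)).val = 1 := by grind
      simp [c, this]
  · change (F a).1 ≤ a.1
    rw [hF _ ha.2]
    intro i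
    simp only [f]
    split_ifs
    exacts [le_rfl, ha.2 i]
  · change (F a).1 ≤ c
    rw [hF _ ha.2]
    intro i
    have h1 : s.1 i ≤ a.1 i := ha.2 i
    have h2 := hs.1 i
    have h3 := hsc i
    simp only [f]
    split_ifs with h
    · rw [Fen.le_def] at h1
      rcases h with h | ⟨hi, h⟩
      · have : (s.1 i).val = 3 := by grind
        simp [c, this, Fen.le_def, h]
      · obtain ⟨j, rfl⟩ := Sum.isRight_iff.1 hi
        have h2' := hs.2 j
        have : (s.1 (.inr j)).val = 1 := by grind
        simp [c, this, Fen.le_def, h]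
    · exact h3

theorem eqv_coll : Eqv ⟨Coll (skel X 0)⟩ ⟨Susp (skel X 0)⟩ := by
  refine Coll.eqv_susp (A := skel X 0) zero_mem (Eqv.trans Eqv.ofUniv (EqS.triv (EqS.image
    (fun κ : MM X => κ.1) (fun _ _ _ _ => Iff.rfl) (B := Gr X) ?_) triv_grid))
    fun s hs h => triv_skel_link hs h
  ext κ
  simp [mem_gr]

theorem filled_card : Filled X (Nat.card X + 1) := by
  have : IsEmpty (Fin (Nat.card X + 1) ↪o X) := ⟨fun e => by
    have := Nat.card_le_card_of_injective e e.injective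
    simp at this⟩
  have : Subsingleton (Ch X (Nat.card X + 1)) := inferInstanceAs (Subsingleton (_ →₀ ℤ))
  have h0 : Module.finrank ℤ (LinearMap.range (Ch.bd' X (Nat.card X + 1))) = 0 := by
    rw [LinearMap.range_eq_bot.2 (Subsingleton.elim _ _), finrank_bot]
  have hs : ∀ κ : MM X, κ ∈ skel X (Nat.card X + 1) := fun κ =>
    .inr (.inr (Nat.lt_succ_of_le (ncard_le_card _)))
  have : Subsingleton (Coll (skel X (Nat.card X + 1))) := ⟨fun x y => by
    obtain ⟨x, rfl⟩ := Coll.mk_surjective x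
    obtain ⟨y, rfl⟩ := Coll.mk_surjective y
    exact (Coll.mk_eq (hs y)).2 (hs x)⟩
  have : IsEmpty (Fin (Module.finrank ℤ (LinearMap.range (Ch.bd' X (Nat.card X + 1))))) := by
    rw [h0]; infer_instance
  refine ⟨isEmptyElim, ?_, 1, one_pos, isEmptyElim, isEmptyElim, ?_⟩
  · rw [range_eq_empty, Submodule.span_empty, LinearMap.range_eq_bot.2 (Subsingleton.elim _ _)]
  exact (Att.eqv_of_isEmpty _).trans (Eqv.iso (P := Coll (skel X (Nat.card X + 1))) (Q := PUnit)
    ⟨⟨fun _ => ⟨⟩, fun _ => Coll.mk _ 0, fun _ => Subsingleton.elim _ _, fun _ => rfl⟩,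
      ⟨fun _ => (Subsingleton.elim _ _).le, fun _ => trivial⟩⟩)

theorem eqv_of_filled (h : Filled X 0) : Eqv ⟨Coll (skel X 0)⟩ ⟨PUnit⟩ := by
  obtain ⟨δ, -, N, hN, ψ, -, h⟩ := h
  have h0 : Module.finrank ℤ (LinearMap.range (Ch.bd' X 0)) = 0 := by
    rw [Ch.bd', LinearMap.range_zero, finrank_bot]
  have : IsEmpty (Fin (Module.finrank ℤ (LinearMap.range (Ch.bd' X 0)))) := by
    rw [h0]; infer_instance
  exact (Att.eqv_of_isEmpty ψ).symm.trans h
end MM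

theorem Null.triv {X : Type} [PartialOrder X] [Finite X] (h : Null X) : Eqv ⟨X⟩ ⟨PUnit⟩ := by
  have hF : MM.Filled X 0 := Nat.decreasingInduction' (n := Nat.card X + 1)
    (fun k _ _ hk => hk.step h.exact) (Nat.zero_le _) MM.filled_card
  exact h.triv_of_susp (h.susp.triv_of_susp (h.susp.susp.triv_of_susp
    (MM.eqv_susp.symm.trans (MM.eqv_coll.symm.trans (MM.eqv_of_filled hF)))))

theorem HTrivial.of_homeomorph {S : Type u} {T : Type v} [TopologicalSpace S] [TopologicalSpace T]
    (e : S ≃ₜ T) (h : HTrivial S) : HTrivial T := by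
  obtain ⟨⟨s⟩, hp, h⟩ := h
  refine ⟨⟨e s⟩, e.surjective.pathConnectedSpace e.continuous, fun n y => ⟨?_⟩⟩
  rintro ⟨f⟩ ⟨g⟩
  have key : ∀ f : GenLoop (Fin (n + 1)) T y, ∃ f' : GenLoop (Fin (n + 1)) S (e.symm y),
      ∀ t, e (f' t) = f t := fun f => ⟨⟨(e.symm : C(T, S)).comp f.1, fun t ht => by
        simp [f.2 t ht]⟩, fun t => e.apply_symm_apply _⟩
  obtain ⟨f', hf⟩ := key f
  obtain ⟨g', hg⟩ := key g
  have : GenLoop.Homotopic f' g' := Quotient.exact ((h n (e.symm y)).elim ⟦f'⟧ ⟦g'⟧)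
  refine Quotient.sound ?_
  change GenLoop.Homotopic f g
  have h1 := ContinuousMap.HomotopicRel.comp_continuousMap this (e : C(S, T))
  rwa [show (e : C(S, T)).comp f'.1 = f.1 from ContinuousMap.ext hf,
    show (e : C(S, T)).comp g'.1 = g.1 from ContinuousMap.ext hg] at h1

theorem HTrivial.triv {S : Type u} {X : Type} [PartialOrder S] [PartialOrder X] [Finite X]
    (e : S ≃o X) (h : @HTrivial S (alexTop S)) : Eqv ⟨X⟩ ⟨PUnit⟩ := by
  let _ := alexTop S
  refine Null.triv (HTrivial.null (HTrivial.of_homeomorph (T := Al X) ⟨e.toEquiv, ?_, ?_⟩ h))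
  · exact alexTop_continuous e.monotone
  · exact alexTop_continuous e.symm.monotone

theorem HTrivialSet.triv {S : Type u} [PartialOrder S] [Finite S] {A : Set S} (h : HTrivialSet A) :
    Triv {x : Shrink.{0} S | (orderIsoShrink.{0} S).symm x ∈ A} :=
  HTrivial.triv (S := A) ⟨(orderIsoShrink.{0} S).toEquiv.subtypeEquiv fun a => by simp,
    fun {a b} => (orderIsoShrink.{0} S).le_iff_le⟩ h

theorem Eqv.she_of_shrink {X Y : Type u} [PartialOrder X] [Finite X] [PartialOrder Y] [Finite Y]
    (h : Eqv ⟨Shrink.{0} X⟩ ⟨Shrink.{0} Y⟩) : SHE (FinPoset.mk X) (FinPoset.mk Y) :=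
  (SHE.of_orderIso ((orderIsoShrink.{0} X).trans ULift.orderIso.symm)).trans
    (h.she.trans (SHE.of_orderIso ((orderIsoShrink.{0} Y).trans ULift.orderIso.symm)).symm)

/-- Finite posets related by a relation with trivial fibres are equivalent. -/
theorem LRel.eqv {L P : Type} [PartialOrder L] [PartialOrder P] [Finite L] [Finite P]
    (R : LRel L P) (h : ∀ l, Triv {p | R.rel l p}) (h' : ∀ p, Triv {l | R.rel l p}) :
    Eqv ⟨L⟩ ⟨P⟩ := by
  have h1 := EqS.removeUpper (A := (univ : Set (Cyl R))) {w | ∃ l, w = .lo l} (subset_univ _) ?_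
  have h2 := EqS.removeLower (A := (univ : Set (Cyl R))) {w | ∃ l, w = .hi l} (subset_univ _) ?_
  · refine Eqv.trans (Eqv.trans Eqv.ofUniv ?_) (Eqv.trans (h2.symm.trans h1)
      (Eqv.symm (Eqv.trans Eqv.ofUniv ?_)))
    · refine EqS.image (.lo : L → Cyl R) (by simp) ?_
      ext w; rcases w with w | w <;> simp [-Subtype.exists]
    · refine EqS.image (.hi : P → Cyl R) (by simp) ?_
      ext w; rcases w with w | w <;> simp [-Subtype.exists]
  · rintro _ ⟨p, rfl⟩
    refine EqS.triv (EqS.symm (EqS.image .lo (by simp) ?_)) (h' p)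
    ext w; rcases w with w | w <;> simp [-Subtype.exists]
  · rintro _ ⟨l, rfl⟩
    refine EqS.triv (EqS.symm (EqS.image .hi (by simp) ?_)) (h l)
    ext w; rcases w with w | w <;> simp [-Subtype.exists]

theorem stmt_13 {X Y I : Type u} [PartialOrder X] [Finite X] [PartialOrder Y] [Finite Y]
    [Finite I] (R₁ : Set (X × Y)) (U : I → Set X)
    (hopen : ∀ i, IsLowerSet (U i)) (hcover : (⋃ i, U i) = Set.univ)
    (h1 : ∀ x : X,
      HTrivialSet {J : NerveHT U | x ∈ ⋂ i ∈ (J : Finset I), U i})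
    (h2 : ∀ y : Y, HTrivialSet (openHull (relPre R₁ (Set.Iic y))))
    (h3 : ∀ x : X, HTrivialSet (cloHull (relIm R₁ (Set.Ici x)))) :
    SHE (FinPoset.mk X) (FinPoset.mk Y) ∧
    SHE (FinPoset.mk X) (FinPoset.mk (NerveHT U)) ∧
    SHE (FinPoset.mk Y) (FinPoset.mk (NerveHT U)) := by
  have hXY : SHE (FinPoset.mk X) (FinPoset.mk Y) := by
    refine Eqv.she_of_shrink (LRel.eqv ⟨fun x y =>
      (orderIsoShrink.{0} X).symm x ∈ openHull (relPre R₁ (Iic ((orderIsoShrink.{0} Y).symm y))), ?_, ?_⟩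
      (fun x => ?_) fun y => (h2 _).triv)
    · rintro x y y' ⟨a, ⟨b, hb, hab⟩, hxa⟩ h
      exact ⟨a, ⟨b, le_trans hb ((orderIsoShrink.{0} Y).symm.monotone h), hab⟩, hxa⟩
    · rintro x x' y h ⟨a, hab, hxa⟩
      exact ⟨a, hab, ((orderIsoShrink.{0} X).symm.monotone h).trans hxa⟩
    · convert (h3 ((orderIsoShrink.{0} X).symm x)).triv using 4
      exact ⟨fun ⟨a, ⟨b, hb, hab⟩, hxa⟩ => ⟨b, ⟨a, hxa, hab⟩, hb⟩,
        fun ⟨b, ⟨a, hxa, hab⟩, hb⟩ => ⟨a, ⟨b, hb, hab⟩, hxa⟩⟩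
  have hXN : SHE (FinPoset.mk X) (FinPoset.mk (NerveHT U)) := by
    refine Eqv.she_of_shrink (Eqv.trans (LRel.eqv (P := (Shrink.{0} (NerveHT U))ᵒᵈ) ⟨fun x J =>
      (orderIsoShrink.{0} X).symm x ∈ ⋂ i ∈ ((orderIsoShrink.{0} (NerveHT U)).symm
        (OrderDual.ofDual J)).1, U i, ?_, ?_⟩ (fun x => ?_) fun J => ?_) (Eqv.dual _).symm)
    · intro x J J' hx h
      exact biInter_mono ((orderIsoShrink.{0} (NerveHT U)).symm.monotone h) (fun _ _ => Subset.rfl) hx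
    · intro x x' J h hx
      simp only [mem_iInter] at hx ⊢
      exact fun i hi => hopen i ((orderIsoShrink.{0} X).symm.monotone h) (hx i hi)
    · exact (EqS.dual _).symm.triv (h1 _).triv
    · exact HTrivialSet.triv ((orderIsoShrink.{0} (NerveHT U)).symm (OrderDual.ofDual J)).2.2
  exact ⟨hXY, hXN, hXY.symm.trans hXN⟩
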